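/- Let K be one of the following 18 even positive-definite lattices: E_8⊕E_7, E_8⊕D_6, E_8⊕D_4⊕A_1, E_8⊕D_4, D_8⊕D_4, E_8⊕4A_1, E_8⊕3A_1, D_8⊕3A_1, E_8⊕A_3, D_8⊕2A_1, 2D_4⊕2A_1, E_8⊕A_2, E_6⊕A_2, D_4⊕A_3, D_5⊕A_2, D_4⊕A_2, A_4⊕A_2, A_3⊕A_2, and set S = U ⊕ K(−1). Then for every positive integer m, the even lattice U(m) ⊕ S is not 2-reflective (so the hyperbolic 2-reflective lattice S has no automorphic correction). -/

import Mathlib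

open Matrix

namespace Refl

noncomputable section

variable {n : ℕ}

/-- ℂ-bilinear extension of the Gram pairing. -/
def cpair (B : Matrix (Fin n) (Fin n) ℤ) (Z W : Fin n → ℂ) : ℂ :=
  ∑ i, ∑ j, (B i j : ℂ) * Z i * W j

/-- ℚ-bilinear extension of the Gram pairing. -/
def qpair (B : Matrix (Fin n) (Fin n) ℤ) (x y : Fin n → ℚ) : ℚ :=
  ∑ i, ∑ j, (B i j : ℚ) * x i * y j

/-- ℝ-bilinear extension of the Gram pairing. -/
def rpair (B : Matrix (Fin n) (Fin n) ℤ) (x y : Fin n → ℝ) : ℝ :=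
  ∑ i, ∑ j, (B i j : ℝ) * x i * y j

def intQ (v : Fin n → ℤ) : Fin n → ℚ := fun i => (v i : ℚ)

def intR (v : Fin n → ℤ) : Fin n → ℝ := fun i => (v i : ℝ)

def intC (v : Fin n → ℤ) : Fin n → ℂ := fun i => (v i : ℂ)

def ratR (v : Fin n → ℚ) : Fin n → ℝ := fun i => (v i : ℝ)

def ratC (v : Fin n → ℚ) : Fin n → ℂ := fun i => (v i : ℂ)

/-- (v, v) for an integral vector. -/
def qnorm (B : Matrix (Fin n) (Fin n) ℤ) (v : Fin n → ℤ) : ℤ := v ⬝ᵥ B.mulVec v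

/-- Membership in the dual lattice (a vector of ℚ^n pairing integrally with the lattice). -/
def InDual (B : Matrix (Fin n) (Fin n) ℤ) (x : Fin n → ℚ) : Prop :=
  ∀ y : Fin n → ℤ, ∃ m : ℤ, qpair B x (intQ y) = (m : ℚ)

/-- A rational vector lies in the lattice ℤ^n itself. -/
def InLat (x : Fin n → ℚ) : Prop := ∃ w : Fin n → ℤ, x = intQ w

/-- `B` is the Gram matrix of an even nondegenerate lattice of signature (p,q). -/
def IsEvenLatticeOfSignature (B : Matrix (Fin n) (Fin n) ℤ) (p q : ℕ) : Prop :=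
  n = p + q ∧ B.IsSymm ∧ (∀ x : Fin n → ℤ, 2 ∣ qnorm B x) ∧ B.det ≠ 0 ∧
    ∃ P : Matrix (Fin n) (Fin n) ℝ, IsUnit P.det ∧
      Pᵀ * B.map (Int.cast : ℤ → ℝ) * P =
        Matrix.diagonal (fun i : Fin n => if (i : ℕ) < p then (1 : ℝ) else -1)

/-- `B` is the Gram matrix of an even positive-definite lattice. -/
def IsEvenPosDef (B : Matrix (Fin n) (Fin n) ℤ) : Prop :=
  B.IsSymm ∧ (∀ x : Fin n → ℤ, 2 ∣ qnorm B x) ∧ (B.map (Int.cast : ℤ → ℝ)).PosDef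

/-- The cone {Z | (Z,Z) = 0, (Z,conj Z) > 0}. -/
def Cone (B : Matrix (Fin n) (Fin n) ℤ) : Set (Fin n → ℂ) :=
  {Z | cpair B Z Z = 0 ∧ 0 < (cpair B Z (fun i => (starRingEnd ℂ) (Z i))).re}

/-- `D` is one of the connected components of the cone (the affine cone `D•(M)`). -/
def IsComponent (B : Matrix (Fin n) (Fin n) ℤ) (D : Set (Fin n → ℂ)) : Prop :=
  ∃ Z ∈ Cone B, D = connectedComponentIn (Cone B) Z

/-- The action of an integral matrix on ℂ^n. -/
def actC (g : Matrix (Fin n) (Fin n) ℤ) (Z : Fin n → ℂ) : Fin n → ℂ :=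
  (g.map (Int.cast : ℤ → ℂ)).mulVec Z

/-- The group O⁺(M): integral isometries preserving the chosen component. -/
def OPlus (B : Matrix (Fin n) (Fin n) ℤ) (D : Set (Fin n → ℂ)) :
    Set (Matrix (Fin n) (Fin n) ℤ) :=
  {g | gᵀ * B * g = B ∧ actC g '' D = D}

/-- The stable orthogonal group Õ⁺(M): elements of O⁺(M) acting trivially on M^∨/M. -/
def StableOPlus (B : Matrix (Fin n) (Fin n) ℤ) (D : Set (Fin n → ℂ)) :
    Set (Matrix (Fin n) (Fin n) ℤ) :=
  {g | g ∈ OPlus B D ∧ ∀ x : Fin n → ℚ, InDual B x →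
        ∃ w : Fin n → ℤ, (g.map (Int.cast : ℤ → ℚ)).mulVec x - x = intQ w}

/-- `Γ` is a finite-index subgroup of O⁺(M). -/
structure IsFiniteIndexSubgroup (B : Matrix (Fin n) (Fin n) ℤ) (D : Set (Fin n → ℂ))
    (Γ : Set (Matrix (Fin n) (Fin n) ℤ)) : Prop where
  subset : Γ ⊆ OPlus B D
  one_mem : (1 : Matrix (Fin n) (Fin n) ℤ) ∈ Γ
  mul_mem : ∀ g ∈ Γ, ∀ h ∈ Γ, g * h ∈ Γ
  inv_mem : ∀ g ∈ Γ, ∃ h ∈ Γ, g * h = 1 ∧ h * g = 1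
  finite_index : ∃ S : Finset (Matrix (Fin n) (Fin n) ℤ),
    ∀ g ∈ OPlus B D, ∃ s ∈ S, ∃ γ ∈ Γ, g = s * γ

/-- `χ` is a character Γ → ℂ× with finite image (equivalently, of finite order). -/
structure IsCharacter (Γ : Set (Matrix (Fin n) (Fin n) ℤ))
    (χ : Matrix (Fin n) (Fin n) ℤ → ℂ) : Prop where
  ne_zero : ∀ g ∈ Γ, χ g ≠ 0
  map_mul : ∀ g ∈ Γ, ∀ h ∈ Γ, χ (g * h) = χ g * χ h
  finite_image : (χ '' Γ).Finite

/-- `F` is a modular form of weight `k` and character `χ` for `Γ` on the component `D`. -/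
structure IsModularForm (B : Matrix (Fin n) (Fin n) ℤ) (D : Set (Fin n → ℂ))
    (Γ : Set (Matrix (Fin n) (Fin n) ℤ)) (χ : Matrix (Fin n) (Fin n) ℤ → ℂ)
    (k : ℤ) (F : (Fin n → ℂ) → ℂ) : Prop where
  holo : DifferentiableOn ℂ F D
  homogeneous : ∀ t : ℂ, t ≠ 0 → ∀ Z ∈ D, F (t • Z) = t ^ (-k) * F Z
  equivariant : ∀ g ∈ Γ, ∀ Z ∈ D, F (actC g Z) = χ g * F Z

def NonConstantOn (D : Set (Fin n → ℂ)) (F : (Fin n → ℂ) → ℂ) : Prop :=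
  ¬ ∃ c : ℂ, ∀ Z ∈ D, F Z = c

/-- `Z` lies on the rational quadratic divisor of the integral vector `v`. -/
def OrthZ (B : Matrix (Fin n) (Fin n) ℤ) (Z : Fin n → ℂ) (v : Fin n → ℤ) : Prop :=
  cpair B Z (intC v) = 0

/-- `F` is nonconstant and its zero set is contained in hyperplanes of (-2)-vectors. -/
def Is2ReflectiveForm (B : Matrix (Fin n) (Fin n) ℤ) (D : Set (Fin n → ℂ))
    (F : (Fin n → ℂ) → ℂ) : Prop :=
  NonConstantOn D F ∧
    ∀ Z ∈ D, F Z = 0 → ∃ v : Fin n → ℤ, qnorm B v = -2 ∧ OrthZ B Z v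

/-- The lattice is 2-reflective. -/
def Is2Reflective (B : Matrix (Fin n) (Fin n) ℤ) : Prop :=
  ∃ D : Set (Fin n → ℂ), IsComponent B D ∧
    ∃ (Γ : Set (Matrix (Fin n) (Fin n) ℤ)) (χ : Matrix (Fin n) (Fin n) ℤ → ℂ)
      (k : ℤ) (F : (Fin n → ℂ) → ℂ),
      IsFiniteIndexSubgroup B D Γ ∧ IsCharacter Γ χ ∧
      IsModularForm B D Γ χ k F ∧ Is2ReflectiveForm B D F

/-- Primitivity of an integral vector : ℚv ∩ ℤ^n = ℤv. -/
def IsPrimitive (v : Fin n → ℤ) : Prop :=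
  v ≠ 0 ∧ ∀ (a : ℚ) (w : Fin n → ℤ), (∀ i, a * (v i : ℚ) = (w i : ℚ)) →
    ∃ m : ℤ, w = m • v

/-- The reflection σ_v maps the lattice into itself. -/
def ReflPreservesLat (B : Matrix (Fin n) (Fin n) ℤ) (v : Fin n → ℤ) : Prop :=
  ∀ x : Fin n → ℤ, ∃ y : Fin n → ℤ, ∀ i,
    (x i : ℚ) - (2 * ((x ⬝ᵥ B.mulVec v : ℤ) : ℚ) / (qnorm B v : ℚ)) * (v i : ℚ) = (y i : ℚ)

/-- The ℂ-linear extension of the reflection σ_v. -/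
def reflC (B : Matrix (Fin n) (Fin n) ℤ) (v : Fin n → ℤ) (Z : Fin n → ℂ) : Fin n → ℂ :=
  fun i => Z i - (2 * cpair B Z (intC v) / (qnorm B v : ℂ)) * (v i : ℂ)

/-- `v` is a reflective vector of the lattice `M` (w.r.t. the component `D`). -/
def IsReflectiveVector (B : Matrix (Fin n) (Fin n) ℤ) (D : Set (Fin n → ℂ))
    (v : Fin n → ℤ) : Prop :=
  IsPrimitive v ∧ qnorm B v < 0 ∧ ReflPreservesLat B v ∧ reflC B v '' D = D

/-- `F` is nonconstant and its zero set is contained in hyperplanes of reflective vectors. -/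
def IsReflectiveForm (B : Matrix (Fin n) (Fin n) ℤ) (D : Set (Fin n → ℂ))
    (F : (Fin n → ℂ) → ℂ) : Prop :=
  NonConstantOn D F ∧
    ∀ Z ∈ D, F Z = 0 → ∃ v : Fin n → ℤ, IsReflectiveVector B D v ∧ OrthZ B Z v

/-- The lattice is reflective. -/
def IsReflective (B : Matrix (Fin n) (Fin n) ℤ) : Prop :=
  ∃ D : Set (Fin n → ℂ), IsComponent B D ∧
    ∃ (Γ : Set (Matrix (Fin n) (Fin n) ℤ)) (χ : Matrix (Fin n) (Fin n) ℤ → ℂ)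
      (k : ℤ) (F : (Fin n → ℂ) → ℂ),
      IsFiniteIndexSubgroup B D Γ ∧ IsCharacter Γ χ ∧
      IsModularForm B D Γ χ k F ∧ IsReflectiveForm B D F

/-- Isomorphism of lattices given by Gram matrices. -/
def LatIso {m n : ℕ} (A : Matrix (Fin m) (Fin m) ℤ) (B : Matrix (Fin n) (Fin n) ℤ) : Prop :=
  ∃ e : (Fin m → ℤ) ≃ₗ[ℤ] (Fin n → ℤ), ∀ x y : Fin m → ℤ,
    e x ⬝ᵥ B.mulVec (e y) = x ⬝ᵥ A.mulVec y

/-- Orthogonal direct sum of lattices. -/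
def dsum {m n : ℕ} (A : Matrix (Fin m) (Fin m) ℤ) (B : Matrix (Fin n) (Fin n) ℤ) :
    Matrix (Fin (m + n)) (Fin (m + n)) ℤ :=
  Matrix.reindex finSumFinEquiv finSumFinEquiv (Matrix.fromBlocks A 0 0 B)

/-- The hyperbolic plane U. -/
def U : Matrix (Fin 2) (Fin 2) ℤ := !![0, 1; 1, 0]

/-- Gram matrix of the root lattice A_m. -/
def gramA (m : ℕ) : Matrix (Fin m) (Fin m) ℤ :=
  Matrix.of fun i j =>
    if i = j then 2 else if i.val + 1 = j.val ∨ j.val + 1 = i.val then -1 else 0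

/-- Gram matrix of the root lattice D_m. -/
def gramD (m : ℕ) : Matrix (Fin m) (Fin m) ℤ :=
  Matrix.of fun i j =>
    if i = j then 2
    else if (i.val + 1 = j.val ∧ j.val + 1 ≠ m) ∨ (j.val + 1 = i.val ∧ i.val + 1 ≠ m) then -1
    else if (i.val + 3 = m ∧ j.val + 1 = m) ∨ (j.val + 3 = m ∧ i.val + 1 = m) then -1
    else 0

/-- Gram matrix of the root lattice E_6. -/
def gramE6 : Matrix (Fin 6) (Fin 6) ℤ :=
  !![2, -1, 0, 0, 0, 0;
     -1, 2, -1, 0, 0, 0;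
     0, -1, 2, -1, 0, -1;
     0, 0, -1, 2, -1, 0;
     0, 0, 0, -1, 2, 0;
     0, 0, -1, 0, 0, 2]

/-- Gram matrix of the root lattice E_7. -/
def gramE7 : Matrix (Fin 7) (Fin 7) ℤ :=
  !![2, -1, 0, 0, 0, 0, 0;
     -1, 2, -1, 0, 0, 0, 0;
     0, -1, 2, -1, 0, 0, -1;
     0, 0, -1, 2, -1, 0, 0;
     0, 0, 0, -1, 2, -1, 0;
     0, 0, 0, 0, -1, 2, 0;
     0, 0, -1, 0, 0, 0, 2]

/-- Gram matrix of the root lattice E_8. -/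
def gramE8 : Matrix (Fin 8) (Fin 8) ℤ :=
  !![2, -1, 0, 0, 0, 0, 0, 0;
     -1, 2, -1, 0, 0, 0, 0, 0;
     0, -1, 2, -1, 0, 0, 0, -1;
     0, 0, -1, 2, -1, 0, 0, 0;
     0, 0, 0, -1, 2, -1, 0, 0;
     0, 0, 0, 0, -1, 2, -1, 0;
     0, 0, 0, 0, 0, -1, 2, 0;
     0, 0, -1, 0, 0, 0, 0, 2]

/-- Gram matrix of the Nikulin lattice N_8 (basis a_1,…,a_7,h with h=(a_1+⋯+a_8)/2). -/
def gramN8 : Matrix (Fin 8) (Fin 8) ℤ :=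
  Matrix.of fun i j =>
    if i = j then (if i.val = 7 then 4 else 2)
    else if i.val = 7 ∨ j.val = 7 then 1 else 0

/-- The lattice M = 2U ⊕ L(−1). -/
def M2U {r : ℕ} (L : Matrix (Fin r) (Fin r) ℤ) :
    Matrix (Fin (2 + (2 + r))) (Fin (2 + (2 + r))) ℤ :=
  dsum U (dsum U (-L))

/-- div(v) = d : the ideal (v, M) of ℤ is generated by d. -/
def DivEq (B : Matrix (Fin n) (Fin n) ℤ) (v : Fin n → ℤ) (d : ℤ) : Prop :=
  Ideal.span {a : ℤ | ∃ x : Fin n → ℤ, a = v ⬝ᵥ B.mulVec x} = Ideal.span {d}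

/-- Sum-of-divisors function σ₁ (on nonnegative integers). -/
def sigma1 (m : ℤ) : ℤ := ∑ d ∈ m.toNat.divisors, (d : ℤ)

end

end Refl

open Matrix

set_option linter.unusedSectionVars false

namespace Refl

section Bil

variable {n m : ℕ} {R S : Type*} [CommRing R] [CommRing S]

/-- Extension of the Gram pairing to any commutative ring. -/
def bil (B : Matrix (Fin n) (Fin n) ℤ) (x y : Fin n → R) : R :=
  ∑ i, ∑ j, (B i j : R) * x i * y j

variable (B : Matrix (Fin n) (Fin n) ℤ)

theorem cpair_eq_bil (Z W : Fin n → ℂ) : cpair B Z W = bil B Z W := rfl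

theorem qnorm_eq_bil (v : Fin n → ℤ) : qnorm B v = bil B v v := by
  simp only [qnorm, bil, dotProduct, mulVec, Finset.mul_sum, Int.cast_id]
  refine Finset.sum_congr rfl fun i _ => Finset.sum_congr rfl fun j _ => by ring

@[simp] theorem bil_add_left (x y z : Fin n → R) : bil B (x + y) z = bil B x z + bil B y z := by
  simp [bil, mul_add, add_mul, Finset.sum_add_distrib]

@[simp] theorem bil_add_right (x y z : Fin n → R) : bil B z (x + y) = bil B z x + bil B z y := by
  simp [bil, mul_add, Finset.sum_add_distrib]

@[simp] theorem bil_smul_left (c : R) (x z : Fin n → R) : bil B (c • x) z = c * bil B x z := by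
  simp only [bil, Pi.smul_apply, smul_eq_mul, Finset.mul_sum]
  refine Finset.sum_congr rfl fun i _ => Finset.sum_congr rfl fun j _ => by ring

@[simp] theorem bil_smul_right (c : R) (x z : Fin n → R) : bil B z (c • x) = c * bil B z x := by
  simp only [bil, Pi.smul_apply, smul_eq_mul, Finset.mul_sum]
  refine Finset.sum_congr rfl fun i _ => Finset.sum_congr rfl fun j _ => by ring

@[simp] theorem bil_neg_left (x z : Fin n → R) : bil B (-x) z = -bil B x z := by
  simpa using bil_smul_left B (-1) x z

@[simp] theorem bil_neg_right (x z : Fin n → R) : bil B z (-x) = -bil B z x := by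
  simpa using bil_smul_right B (-1) x z

@[simp] theorem bil_sub_left (x y z : Fin n → R) : bil B (x - y) z = bil B x z - bil B y z := by
  simp [sub_eq_add_neg]

@[simp] theorem bil_sub_right (x y z : Fin n → R) : bil B z (x - y) = bil B z x - bil B z y := by
  simp [sub_eq_add_neg]

@[simp] theorem bil_zero_left (z : Fin n → R) : bil B 0 z = 0 := by simp [bil]

@[simp] theorem bil_zero_right (z : Fin n → R) : bil B z 0 = 0 := by simp [bil]

theorem bil_sum_right {ι : Type*} (s : Finset ι) (f : ι → Fin n → R) (z : Fin n → R) :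
    bil B z (∑ i ∈ s, f i) = ∑ i ∈ s, bil B z (f i) := by
  classical
  induction s using Finset.induction_on with
  | empty => simp
  | insert a s ha ih => simp [Finset.sum_insert ha, ih]

theorem bil_sum_left {ι : Type*} (s : Finset ι) (f : ι → Fin n → R) (z : Fin n → R) :
    bil B (∑ i ∈ s, f i) z = ∑ i ∈ s, bil B (f i) z := by
  classical
  induction s using Finset.induction_on with
  | empty => simp
  | insert a s ha ih => simp [Finset.sum_insert ha, ih]

theorem bil_comm {B : Matrix (Fin n) (Fin n) ℤ} (hB : B.IsSymm) (x y : Fin n → R) :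
    bil B x y = bil B y x := by
  unfold bil
  rw [Finset.sum_comm]
  refine Finset.sum_congr rfl fun i _ => Finset.sum_congr rfl fun j _ => ?_
  rw [hB.apply]; ring

theorem map_bil (f : R →+* S) (x y : Fin n → R) :
    f (bil B x y) = bil B (fun i => f (x i)) (fun i => f (y i)) := by
  simp [bil, map_sum]

theorem bil_single_left (i : Fin n) (y : Fin n → R) :
    bil B (Pi.single i 1) y = ∑ j, (B i j : R) * y j := by
  unfold bil
  rw [Finset.sum_eq_single i]
  · simp
  · intro b _ hb; simp [hb]
  · simp

theorem bil_single (i j : Fin n) : bil B (Pi.single i (1 : R)) (Pi.single j 1) = (B i j : R) := by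
  rw [bil_single_left, Finset.sum_eq_single j]
  · simp
  · intro b _ hb; simp [hb]
  · simp

theorem bil_neg_mat (x y : Fin n → R) : bil (-B) x y = -bil B x y := by
  simp [bil]

theorem bil_zsmul_mat (c : ℤ) (x y : Fin n → R) : bil (c • B) x y = c * bil B x y := by
  simp only [bil, Finset.mul_sum, Matrix.smul_apply, smul_eq_mul, Int.cast_mul]
  refine Finset.sum_congr rfl fun i _ => Finset.sum_congr rfl fun j _ => by ring

theorem continuous_bil {X : Type*} [TopologicalSpace X] [TopologicalSpace R] [IsTopologicalRing R]
    {f g : X → Fin n → R} (hf : Continuous f) (hg : Continuous g) :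
    Continuous fun x => bil B (f x) (g x) := by
  unfold bil
  fun_prop

/-- The action of an integral matrix on `R^n`. -/
def actR (g : Matrix (Fin m) (Fin n) ℤ) (x : Fin n → R) : Fin m → R :=
  fun i => ∑ j, (g i j : R) * x j

theorem actC_eq (g : Matrix (Fin n) (Fin n) ℤ) (Z : Fin n → ℂ) : actC g Z = actR g Z := by
  ext i; simp [actC, actR, mulVec, dotProduct]

theorem actR_mul {k : ℕ} (g : Matrix (Fin k) (Fin m) ℤ) (h : Matrix (Fin m) (Fin n) ℤ)
    (x : Fin n → R) : actR (g * h) x = actR g (actR h x) := by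
  ext i
  simp only [actR, Matrix.mul_apply, Finset.mul_sum, Int.cast_sum, Int.cast_mul, Finset.sum_mul]
  rw [Finset.sum_comm]
  refine Finset.sum_congr rfl fun i _ => Finset.sum_congr rfl fun j _ => by ring

@[simp] theorem actR_one (x : Fin n → R) : actR (1 : Matrix (Fin n) (Fin n) ℤ) x = x := by
  ext i
  simp only [actR]
  rw [Finset.sum_eq_single i]
  · simp
  · intro b _ hb; simp [Matrix.one_apply, hb.symm]
  · simp

theorem actR_add (g : Matrix (Fin m) (Fin n) ℤ) (x y : Fin n → R) :
    actR g (x + y) = actR g x + actR g y := by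
  ext i; simp [actR, mul_add, Finset.sum_add_distrib]

theorem actR_smul (g : Matrix (Fin m) (Fin n) ℤ) (c : R) (x : Fin n → R) :
    actR g (c • x) = c • actR g x := by
  ext i
  simp only [actR, Pi.smul_apply, smul_eq_mul, Finset.mul_sum]
  refine Finset.sum_congr rfl fun i _ => by ring

theorem actR_map (f : R →+* S) (g : Matrix (Fin m) (Fin n) ℤ) (x : Fin n → R) :
    (fun i => f (actR g x i)) = actR g fun i => f (x i) := by
  ext i; simp [actR]

theorem bil_act (B : Matrix (Fin m) (Fin m) ℤ) (g : Matrix (Fin m) (Fin n) ℤ) (x y : Fin n → R) :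
    bil B (actR g x) (actR g y) = bil (gᵀ * B * g) x y := by
  have key : ∀ (A : Matrix (Fin m) (Fin m) ℤ) (u v : Fin m → R),
      bil A u v = ∑ i, u i * actR A v i := by
    intro A u v
    simp only [bil, actR, Finset.mul_sum]
    refine Finset.sum_congr rfl fun i _ => Finset.sum_congr rfl fun j _ => by ring
  have key' : bil (gᵀ * B * g) x y = ∑ i, x i * actR (gᵀ * B * g) y i := by
    simp only [bil, actR, Finset.mul_sum]
    refine Finset.sum_congr rfl fun i _ => Finset.sum_congr rfl fun j _ => by ring
  rw [key, key', Matrix.mul_assoc, actR_mul, actR_mul]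
  generalize actR B (actR g y) = w
  simp only [actR, Finset.sum_mul, Finset.mul_sum, Matrix.transpose_apply]
  rw [Finset.sum_comm]
  refine Finset.sum_congr rfl fun i _ => Finset.sum_congr rfl fun j _ => by ring

end Bil

section Dsum

variable {m n : ℕ} {R S : Type*} [CommRing R] [CommRing S]

theorem bil_dsum (A : Matrix (Fin m) (Fin m) ℤ) (B : Matrix (Fin n) (Fin n) ℤ)
    (x x' : Fin m → R) (y y' : Fin n → R) :
    bil (dsum A B) (Fin.append x y) (Fin.append x' y') = bil A x x' + bil B y y' := by
  simp only [bil, dsum, Matrix.reindex_apply, Matrix.submatrix_apply]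
  simp [Fin.sum_univ_add]

theorem isSymm_dsum {A : Matrix (Fin m) (Fin m) ℤ} {B : Matrix (Fin n) (Fin n) ℤ}
    (hA : A.IsSymm) (hB : B.IsSymm) : (dsum A B).IsSymm := by
  unfold dsum
  simp only [Matrix.reindex_apply]
  exact (Matrix.IsSymm.fromBlocks hA (by simp) hB).submatrix _

theorem isSymm_U : U.IsSymm := by
  unfold U Matrix.IsSymm
  ext i j; fin_cases i <;> fin_cases j <;> rfl

/-- The vector with hyperbolic coordinates `a`, `b` and remaining part `x`. -/
def hv (a b : R) (x : Fin n → R) : Fin (2 + n) → R := Fin.append ![a, b] x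

theorem exists_hv (v : Fin (2 + n) → R) : ∃ a b x, v = hv a b x := by
  refine ⟨v (Fin.castAdd n 0), v (Fin.castAdd n 1), fun i => v (Fin.natAdd 2 i), ?_⟩
  ext i
  refine Fin.addCases (fun j => ?_) (fun j => ?_) i
  · fin_cases j <;> simp [hv]
  · simp [hv]

theorem bil_hv (A : Matrix (Fin n) (Fin n) ℤ) (a b a' b' : R) (x x' : Fin n → R) :
    bil (dsum U A) (hv a b x) (hv a' b' x') = a * b' + b * a' + bil A x x' := by
  unfold hv
  rw [bil_dsum]
  simp [bil, U, Fin.sum_univ_two]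

theorem hv_inj {a b a' b' : R} {x x' : Fin n → R} :
    hv a b x = hv a' b' x' ↔ a = a' ∧ b = b' ∧ x = x' := by
  constructor
  · intro h
    refine ⟨?_, ?_, ?_⟩
    · simpa [hv] using congrFun h (Fin.castAdd n 0)
    · simpa [hv] using congrFun h (Fin.castAdd n 1)
    · ext i; simpa [hv] using congrFun h (Fin.natAdd 2 i)
  · rintro ⟨rfl, rfl, rfl⟩; rfl

theorem hv_add (a b a' b' : R) (x x' : Fin n → R) :
    hv a b x + hv a' b' x' = hv (a + a') (b + b') (x + x') := by
  ext i
  refine Fin.addCases (fun j => ?_) (fun j => ?_) i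
  · fin_cases j <;> simp [hv]
  · simp [hv]

theorem hv_smul (c a b : R) (x : Fin n → R) : c • hv a b x = hv (c * a) (c * b) (c • x) := by
  ext i
  refine Fin.addCases (fun j => ?_) (fun j => ?_) i
  · fin_cases j <;> simp [hv]
  · simp [hv]

theorem hv_neg (a b : R) (x : Fin n → R) : -hv a b x = hv (-a) (-b) (-x) := by
  have := hv_smul (-1) a b x
  simpa using this

theorem hv_sub (a b a' b' : R) (x x' : Fin n → R) :
    hv a b x - hv a' b' x' = hv (a - a') (b - b') (x - x') := by
  rw [sub_eq_add_neg, hv_neg, hv_add]; simp [sub_eq_add_neg]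

theorem hv_zsmul (c : ℤ) (a b : R) (x : Fin n → R) : c • hv a b x = hv (c * a) (c * b) (c • x) := by
  have h1 : c • hv a b x = (c : R) • hv a b x := by ext; simp
  have h2 : c • x = (c : R) • x := by ext; simp
  rw [h1, h2, hv_smul]

theorem hv_zero : hv (0 : R) 0 (0 : Fin n → R) = 0 := by
  have := hv_smul (0 : R) 0 0 (0 : Fin n → R)
  simpa using this.symm

theorem map_hv (f : R → S) (a b : R) (x : Fin n → R) :
    (fun i => f (hv a b x i)) = hv (f a) (f b) fun i => f (x i) := by
  ext i
  refine Fin.addCases (fun j => ?_) (fun j => ?_) i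
  · fin_cases j <;> simp [hv]
  · simp [hv]

theorem continuous_hv {X : Type*} [TopologicalSpace X] [TopologicalSpace R]
    {f g : X → R} {h : X → Fin n → R} (hf : Continuous f) (hg : Continuous g) (hh : Continuous h) :
    Continuous fun x => hv (f x) (g x) (h x) := by
  refine continuous_pi fun i => ?_
  refine Fin.addCases (fun j => ?_) (fun j => ?_) i
  · fin_cases j <;> simpa [hv]
  · simpa [hv, Function.comp_def] using (continuous_apply j).comp hh

/-- First hyperbolic coordinate. -/
def hA (v : Fin (2 + n) → R) : R := v (Fin.castAdd n 0)
/-- Second hyperbolic coordinate. -/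
def hB (v : Fin (2 + n) → R) : R := v (Fin.castAdd n 1)
/-- The part orthogonal to the hyperbolic plane. -/
def hX (v : Fin (2 + n) → R) : Fin n → R := fun i => v (Fin.natAdd 2 i)

@[simp] theorem hA_hv (a b : R) (x : Fin n → R) : hA (hv a b x) = a := by simp [hA, hv]
@[simp] theorem hB_hv (a b : R) (x : Fin n → R) : hB (hv a b x) = b := by simp [hB, hv]
@[simp] theorem hX_hv (a b : R) (x : Fin n → R) : hX (hv a b x) = x := by
  ext i; simp [hX, hv]

end Dsum

end Refl

open Matrix

namespace Refl

section Winding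

open Complex

theorem exists_continuous_log {X : Type*} [TopologicalSpace X] [SimplyConnectedSpace X]
    [LocallyPathConnectedSpace X] (u : X → ℂ) (hu : Continuous u) (h0 : ∀ x, u x ≠ 0) :
    ∃ L : X → ℂ, Continuous L ∧ ∀ x, exp (L x) = u x := by
  obtain ⟨x0⟩ : Nonempty X := inferInstance
  obtain ⟨F, ⟨-, hF⟩, -⟩ := Complex.isCoveringMap_exp.existsUnique_continuousMap_lifts
    ⟨fun x => (⟨u x, h0 x⟩ : {z : ℂ // z ≠ 0}), by fun_prop⟩ x0 (Complex.log (u x0))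
    (by ext; simp [Complex.exp_log (h0 x0)])
  refine ⟨F, F.continuous, fun x => ?_⟩
  have := congrArg Subtype.val (congrFun hF x)
  simpa using this

/-- `u` has winding number `n` around `0` along `[0,1]`. -/
def IsWind (u : ℝ → ℂ) (n : ℤ) : Prop :=
  ∃ L : ℝ → ℂ, Continuous L ∧ (∀ t, exp (L t) = u t) ∧ L 1 - L 0 = 2 * Real.pi * I * n

/-- The winding number. -/
noncomputable def wind (u : ℝ → ℂ) : ℤ := by
  classical exact if h : ∃ n, IsWind u n then h.choose else 0

theorem log_diff_const {X : Type*} [TopologicalSpace X] [PreconnectedSpace X] {L M : X → ℂ}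
    (hL : Continuous L) (hM : Continuous M) (h : ∀ x, exp (L x) = exp (M x)) (x y : X) :
    L x - M x = L y - M y := by
  have key : ∀ x, ∃ k : ℤ, L x - M x = k * (2 * Real.pi * I) := by
    intro x
    rw [← Complex.exp_eq_one_iff, Complex.exp_sub, h x, div_self (Complex.exp_ne_zero _)]
  choose k hk using key
  have hpi : (2 * Real.pi * I : ℂ) ≠ 0 := Complex.two_pi_I_ne_zero
  have hc : Continuous fun x => (k x : ℂ) := by
    have : (fun x => (k x : ℂ)) = fun x => (L x - M x) / (2 * Real.pi * I) := by
      ext x; rw [hk, mul_div_cancel_right₀ _ hpi]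
    rw [this]; fun_prop
  have hc' : Continuous k := by
    have hr : Continuous fun x => ((k x : ℤ) : ℝ) := by
      have := Complex.continuous_re.comp hc
      simpa [Function.comp_def] using this
    exact Int.isClosedEmbedding_coe_real.isInducing.continuous_iff.2 hr
  have := PreconnectedSpace.constant (inferInstance : PreconnectedSpace X) hc' (x := x) (y := y)
  rw [hk, hk, this]

theorem IsWind.unique {u : ℝ → ℂ} {n m : ℤ} (hn : IsWind u n) (hm : IsWind u m) : n = m := by
  obtain ⟨L, hL, hLu, hL1⟩ := hn
  obtain ⟨M, hM, hMu, hM1⟩ := hm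
  have := log_diff_const hL hM (fun x => by rw [hLu, hMu]) 1 0
  have h2 : (2 * Real.pi * I : ℂ) * n = 2 * Real.pi * I * m := by
    rw [← hL1, ← hM1]; linear_combination this
  have := mul_left_cancel₀ Complex.two_pi_I_ne_zero h2
  exact_mod_cast this

theorem IsWind.wind_eq {u : ℝ → ℂ} {n : ℤ} (hn : IsWind u n) : wind u = n := by
  unfold wind
  have h : ∃ n, IsWind u n := ⟨n, hn⟩
  rw [dif_pos h]
  exact h.choose_spec.unique hn

theorem isWind_of_log {u L : ℝ → ℂ} (hL : Continuous L) (h : ∀ t, exp (L t) = u t)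
    (h1 : u 1 = u 0) : IsWind u (wind u) ∧ L 1 - L 0 = 2 * Real.pi * I * wind u := by
  have : ∃ k : ℤ, L 1 - L 0 = k * (2 * Real.pi * I) := by
    rw [← Complex.exp_eq_one_iff, Complex.exp_sub, h, h, h1, div_self]
    rw [← h]; exact Complex.exp_ne_zero _
  obtain ⟨k, hk⟩ := this
  have hw : IsWind u k := ⟨L, hL, h, by rw [hk]; ring⟩
  rw [hw.wind_eq]
  exact ⟨hw, by rw [hk]; ring⟩

theorem wind_mul {u v : ℝ → ℂ} (hu : Continuous u) (hv : Continuous v) (hu0 : ∀ t, u t ≠ 0)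
    (hv0 : ∀ t, v t ≠ 0) (hu1 : u 1 = u 0) (hv1 : v 1 = v 0) :
    wind (fun t => u t * v t) = wind u + wind v := by
  obtain ⟨L, hL, hLu⟩ := exists_continuous_log u hu hu0
  obtain ⟨M, hM, hMu⟩ := exists_continuous_log v hv hv0
  refine IsWind.wind_eq ⟨fun t => L t + M t, by fun_prop, fun t => ?_, ?_⟩
  · rw [Complex.exp_add, hLu, hMu]
  · have h1 := (isWind_of_log hL hLu hu1).2
    have h2 := (isWind_of_log hM hMu hv1).2
    push_cast
    linear_combination h1 + h2

theorem wind_of_exp_log {u L : ℝ → ℂ} (hL : Continuous L) (h : ∀ t, exp (L t) = u t) {n : ℤ}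
    (h1 : L 1 - L 0 = 2 * Real.pi * I * n) : wind u = n := IsWind.wind_eq ⟨L, hL, h, h1⟩

theorem wind_const (c : ℂ) (hc : c ≠ 0) : wind (fun _ => c) = 0 :=
  wind_of_exp_log (L := fun _ => Complex.log c) continuous_const
    (fun _ => Complex.exp_log hc) (by simp)

/-- Homotopy invariance. -/
theorem wind_homotopy (H : ℝ → ℝ → ℂ) (hH : ContinuousOn (fun p : ℝ × ℝ => H p.1 p.2)
    (Set.Icc 0 1 ×ˢ Set.univ)) (h0 : ∀ σ ∈ Set.Icc (0:ℝ) 1, ∀ t, H σ t ≠ 0)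
    (h1 : ∀ σ ∈ Set.Icc (0:ℝ) 1, H σ 1 = H σ 0) : wind (H 0) = wind (H 1) := by
  let p : ℝ → ℝ := fun σ => (Set.projIcc (0:ℝ) 1 zero_le_one σ : ℝ)
  have hp : Continuous p := continuous_subtype_val.comp continuous_projIcc
  have hpm : ∀ σ, p σ ∈ Set.Icc (0:ℝ) 1 := fun σ => (Set.projIcc (0:ℝ) 1 zero_le_one σ).2
  have hp0 : p 0 = 0 := by simp [p]
  have hp1 : p 1 = 1 := by simp [p]
  have hc : Continuous fun q : ℝ × ℝ => H (p q.1) q.2 := by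
    have : Continuous fun q : ℝ × ℝ => ((p q.1, q.2) : ℝ × ℝ) := by fun_prop
    exact hH.comp_continuous this fun q => ⟨hpm _, trivial⟩
  obtain ⟨L, hL, hLu⟩ := exists_continuous_log _ hc fun q => h0 _ (hpm _) _
  have hLs : ∀ σ, Continuous fun t => L (σ, t) := fun σ => by fun_prop
  have e0 := (isWind_of_log (u := H 0) (hLs 0) (fun t => by rw [hLu]; simp [hp0])
    (h1 0 (by simp))).2
  have e1 := (isWind_of_log (u := H 1) (hLs 1) (fun t => by rw [hLu]; simp [hp1])
    (h1 1 (by simp))).2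
  have := log_diff_const (L := fun σ => L (σ, 1)) (M := fun σ => L (σ, 0)) (by fun_prop)
    (by fun_prop) (fun σ => by rw [hLu, hLu]; exact h1 _ (hpm _)) 0 1
  have h2 : (2 * Real.pi * I : ℂ) * wind (H 0) = 2 * Real.pi * I * wind (H 1) := by
    rw [← e0, ← e1]; exact this
  have := mul_left_cancel₀ Complex.two_pi_I_ne_zero h2
  exact_mod_cast this

theorem wind_shift {u : ℝ → ℂ} (hu : Continuous u) (hu0 : ∀ t, u t ≠ 0)
    (hu1 : ∀ t, u (t + 1) = u t) (c : ℝ) : wind (fun t => u (t + c)) = wind u := by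
  have := wind_homotopy (fun σ t => u (t + σ * c)) (by fun_prop) (fun _ _ _ => hu0 _)
    (fun σ _ => by beta_reduce; rw [zero_add, add_comm, hu1])
  simpa using this.symm

theorem wind_neg {u : ℝ → ℂ} (hu : Continuous u) (hu0 : ∀ t, u t ≠ 0)
    (hu1 : ∀ t, u (t + 1) = u t) : wind (fun t => u (-t)) = -wind u := by
  obtain ⟨L, hL, hLu⟩ := exists_continuous_log u hu hu0
  have e := (isWind_of_log hL hLu (by simpa using hu1 0)).2
  have h2 : wind (fun t => u (-t)) = wind (fun t => u (-(t-1))) := by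
    have := wind_shift (u := fun t => u (-t)) (by fun_prop) (fun t => hu0 _)
      (fun t => by have := hu1 (-(t+1)); rw [← this]; congr 1; ring) (-1)
    rw [← this]; rfl
  rw [h2]
  refine wind_of_exp_log (L := fun t => L (-(t-1))) (by fun_prop) (fun t => hLu _) ?_
  push_cast
  simp only [sub_self, neg_zero, zero_sub, neg_neg]
  linear_combination -e

theorem wind_diag (K : ℝ → ℝ → ℂ) (hK : Continuous fun p : ℝ × ℝ => K p.1 p.2)
    (h0 : ∀ s t, K s t ≠ 0) (h1 : ∀ s, K s 1 = K s 0) (h2 : K 1 0 = K 0 0) :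
    wind (fun t => K t t) = wind (fun s => K s 0) + wind (fun t => K 0 t) := by
  have hh : wind (K 0) = wind (K 1) :=
    wind_homotopy K hK.continuousOn (fun _ _ _ => h0 _ _) (fun σ _ => h1 σ)
  obtain ⟨L, hL, hLu⟩ := exists_continuous_log _ hK fun q => h0 _ _
  have e0 := (isWind_of_log (u := fun s => K s 0) (L := fun s => L (s, 0)) (by fun_prop)
    (fun t => hLu _) h2).2
  have e1 := (isWind_of_log (u := K 1) (L := fun s => L (1, s)) (by fun_prop)
    (fun t => hLu _) (h1 1)).2
  change _ = _ + wind (K 0)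
  refine wind_of_exp_log (L := fun t => L (t, t)) (by fun_prop) (fun t => hLu _) ?_
  rw [hh]
  push_cast
  linear_combination e0 + e1

theorem wind_disc {h : ℂ → ℂ} {ε : ℝ} (hε : 0 < ε)
    (hc : ContinuousOn h (Metric.closedBall 0 ε))
    (h0 : ∀ s ∈ Metric.closedBall (0:ℂ) ε, h s ≠ 0) :
    wind (fun t => h (ε * exp (2 * Real.pi * I * t))) = 0 := by
  have hmem : ∀ σ ∈ Set.Icc (0:ℝ) 1, ∀ t : ℝ,
      ((σ * ε : ℝ) * exp (2 * Real.pi * I * t) : ℂ) ∈ Metric.closedBall (0:ℂ) ε := by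
    intro σ hσ t
    rw [mem_closedBall_zero_iff, norm_mul, Complex.norm_real, Complex.norm_exp]
    simp only [Real.norm_eq_abs, abs_of_nonneg (mul_nonneg hσ.1 hε.le)]
    have : (2 * Real.pi * I * t : ℂ).re = 0 := by simp
    rw [this, Real.exp_zero, mul_one]
    nlinarith [hσ.2]
  have := wind_homotopy (fun σ t => h ((σ * ε : ℝ) * exp (2 * Real.pi * I * t))) ?_
    (fun σ hσ t => h0 _ (hmem σ hσ t)) (fun σ hσ => ?_)
  · simp only [one_mul, zero_mul, ofReal_zero] at this
    rw [← this]
    exact wind_const _ (h0 _ (by simp [hε.le]))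
  · refine hc.comp (by fun_prop) ?_
    rintro ⟨σ, t⟩ ⟨hσ, -⟩
    exact hmem σ hσ t
  · simp

theorem wind_circle {ε : ℝ} (hε : 0 < ε) (n : ℕ) :
    wind (fun t => (ε * exp (2 * Real.pi * I * t)) ^ n) = n := by
  refine wind_of_exp_log
    (L := fun t => n * (Real.log ε + 2 * Real.pi * I * t)) (by fun_prop) (fun t => ?_) ?_
  · rw [Complex.exp_nat_mul, Complex.exp_add, ← Complex.ofReal_exp, Real.exp_log hε]
  · push_cast; ring

end Winding

end Refl

open Matrix

namespace Refl

section LevelOne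

open Complex UpperHalfPlane ModularGroup MatrixGroups ModularForm CongruenceSubgroup
open scoped Manifold

/-- A bounded level-one modular form, given as a function on the upper half plane. -/
theorem exists_modularForm (k : ℤ) (g : ℂ → ℂ) (hg : DifferentiableOn ℂ g {z | 0 < z.im})
    (h1 : ∀ z : ℂ, 0 < z.im → g (z + 1) = g z)
    (h2 : ∀ z : ℂ, 0 < z.im → g (-1 / z) = z ^ k * g z)
    (hb : ∃ M : ℝ, ∀ z : ℂ, 1 ≤ z.im → ‖g z‖ ≤ M) :
    ∃ f : ModularForm 𝒮ℒ k, ∀ z : ℍ, f z = g z := by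
  have hS : (fun z : ℍ => g z) ∣[k] S = fun z : ℍ => g z := by
    ext z
    rw [SL_slash_apply, modular_S_smul, denom_S]
    have h := h2 z z.im_pos
    have e : (-1 / (z : ℂ)) = (-(z : ℂ))⁻¹ := by rw [inv_neg, ← one_div, neg_div]
    rw [e] at h
    simp only
    rw [h, _root_.zpow_neg, mul_comm, ← mul_assoc, inv_mul_cancel₀, one_mul]
    exact zpow_ne_zero _ (UpperHalfPlane.ne_zero z)
  have hT : (fun z : ℍ => g z) ∣[k] T = fun z : ℍ => g z := by
    ext z
    rw [SL_slash_apply, modular_T_smul]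
    have h := h1 z z.im_pos
    have e : denom (T : GL (Fin 2) ℝ) z = 1 := by
      rw [ModularGroup.denom_apply]; simp [T]
    rw [e, _root_.one_zpow, mul_one, UpperHalfPlane.coe_vadd]
    push_cast
    rw [add_comm, h]
  refine ⟨{ toFun := fun z => g z
            slash_action_eq' := ?_
            holo' := ?_
            bdd_at_cusps' := ?_ }, fun z => rfl⟩
  · rintro A ⟨A, rfl⟩
    exact SlashInvariantForm.slash_action_generators_SL2Z hS hT A
  · change MDiff (fun z : ℍ => g z)
    rw [UpperHalfPlane.mdifferentiable_iff]
    refine hg.congr fun z hz => ?_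
    simp [ofComplex_apply_of_im_pos hz]
  · intro c hc
    rw [Subgroup.IsArithmetic.isCusp_iff_isCusp_SL2Z] at hc
    rw [OnePoint.isBoundedAt_iff_forall_SL2Z hc]
    intro γ _
    rw [SlashInvariantForm.slash_action_generators_SL2Z hS hT]
    obtain ⟨M, hM⟩ := hb
    rw [isBoundedAtImInfty_iff]
    exact ⟨M, 1, fun z hz => hM z hz⟩

theorem levelOne_neg (k : ℤ) (hk : k < 0) (g : ℂ → ℂ) (hg : DifferentiableOn ℂ g {z | 0 < z.im})
    (h1 : ∀ z : ℂ, 0 < z.im → g (z + 1) = g z)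
    (h2 : ∀ z : ℂ, 0 < z.im → g (-1 / z) = z ^ k * g z)
    (hb : ∃ M : ℝ, ∀ z : ℂ, 1 ≤ z.im → ‖g z‖ ≤ M) (z : ℂ) (hz : 0 < z.im) : g z = 0 := by
  obtain ⟨f, hf⟩ := exists_modularForm k g hg h1 h2 hb
  have := ModularFormClass.levelOne_neg_weight_eq_zero hk f
  have h := hf ⟨z, hz⟩
  rw [this] at h
  exact h.symm

theorem levelOne_zero (g : ℂ → ℂ) (hg : DifferentiableOn ℂ g {z | 0 < z.im})
    (h1 : ∀ z : ℂ, 0 < z.im → g (z + 1) = g z)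
    (h2 : ∀ z : ℂ, 0 < z.im → g (-1 / z) = g z)
    (hb : ∃ M : ℝ, ∀ z : ℂ, 1 ≤ z.im → ‖g z‖ ≤ M) : ∃ c, ∀ z : ℂ, 0 < z.im → g z = c := by
  obtain ⟨f, hf⟩ := exists_modularForm 0 g hg h1 (by simpa using h2) hb
  obtain ⟨c, hc⟩ := ModularFormClass.levelOne_weight_zero_const f
  refine ⟨c, fun z hz => ?_⟩
  have h := hf ⟨z, hz⟩
  rw [hc] at h
  exact h.symm

end LevelOne

section Koecher

open Complex

/-- Koecher principle for a function with the periodicity of a Jacobi form of index one. -/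
theorem koecher_bound (t : ℝ) (ht : 0 < t) (φ : ℂ → ℂ → ℂ)
    (hc : ContinuousOn (fun p : ℂ × ℂ => φ p.1 p.2) {p | p.1.im ^ 2 < t * p.2.im})
    (hd : ∀ ω : ℂ, DifferentiableOn ℂ (fun s => φ s ω) {s | s.im ^ 2 < t * ω.im})
    (h1 : ∀ s ω : ℂ, s.im ^ 2 < t * ω.im → φ (s + 1) ω = φ s ω)
    (h2 : ∀ s ω : ℂ, s.im ^ 2 < t * ω.im → φ s (ω + 1) = φ s ω)
    (h3 : ∀ s ω : ℂ, s.im ^ 2 < t * ω.im → φ (s + t * I) (ω + 2 * s + t * I) = φ s ω) :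
    ∃ M : ℝ, ∀ ω : ℂ, 1 ≤ ω.im → ‖φ 0 ω‖ ≤ M := by
  have h1' : ∀ (n : ℤ) (s ω : ℂ), s.im ^ 2 < t * ω.im → φ (s + n) ω = φ s ω := by
    intro n s ω hs
    induction n using Int.induction_on with
    | zero => simp
    | succ n ih =>
      rw [← ih, ← h1 (s + (n : ℤ)) ω (by simpa using hs)]; congr 1; push_cast; ring
    | pred n ih =>
      rw [← ih, ← h1 (s + ((-n - 1 : ℤ) : ℂ)) ω (by simpa using hs)]; congr 1; push_cast; ring
  have h2' : ∀ (n : ℤ) (s ω : ℂ), s.im ^ 2 < t * ω.im → φ s (ω + n) = φ s ω := by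
    intro n s ω hs
    induction n using Int.induction_on with
    | zero => simp
    | succ n ih =>
      rw [← ih, ← h2 s (ω + (n : ℤ)) (by simpa using hs)]; congr 1; push_cast; ring
    | pred n ih =>
      rw [← ih, ← h2 s (ω + ((-n - 1 : ℤ) : ℂ)) (by simpa using hs)]; congr 1; push_cast; ring
  have h3' : ∀ (n : ℤ) (s ω : ℂ), s.im ^ 2 < t * ω.im →
      φ (s + n * (t * I)) (ω + 2 * n * s + n ^ 2 * (t * I)) = φ s ω := by
    intro n s ω hs
    have hdom : ∀ m : ℤ, (s + m * (t * I)).im ^ 2 <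
        t * (ω + 2 * m * s + m ^ 2 * (t * I)).im := by
      intro m
      have e1 : (s + m * (t * I)).im = s.im + m * t := by simp
      have e2 : (ω + 2 * m * s + m ^ 2 * (t * I)).im = ω.im + 2 * m * s.im + m ^ 2 * t := by
        have : ((m : ℂ) ^ 2) = ((m ^ 2 : ℝ) : ℂ) := by push_cast; ring
        rw [this]
        have h' : (2 * (m : ℂ)) = ((2 * m : ℝ) : ℂ) := by push_cast; ring
        rw [h']
        simp only [add_im, im_ofReal_mul]
        simp
      rw [e1, e2]; nlinarith
    induction n using Int.induction_on with
    | zero => simp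
    | succ n ih =>
      rw [← ih, ← h3 _ _ (hdom n)]; congr 1 <;> (push_cast; ring)
    | pred n ih =>
      rw [← ih, ← h3 _ _ (hdom (-n - 1))]; congr 1 <;> (push_cast; ring)
  let K : Set (ℂ × ℂ) := (fun q : ℝ × ℝ × ℝ =>
    ((q.1 + q.2.1 * I : ℂ), (q.2.2 + (1 + q.2.1 ^ 2 / t : ℝ) * I : ℂ))) ''
      (Set.Icc 0 1 ×ˢ (Set.Icc 0 t ×ˢ Set.Icc 0 1))
  have hK : IsCompact K := by
    refine IsCompact.image ?_ (by fun_prop)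
    exact isCompact_Icc.prod (isCompact_Icc.prod isCompact_Icc)
  have hKsub : K ⊆ {p : ℂ × ℂ | p.1.im ^ 2 < t * p.2.im} := by
    rintro _ ⟨⟨x, y, z⟩, -, rfl⟩
    simp only [Set.mem_ofPred_eq, add_im, ofReal_im, mul_im, ofReal_re, I_im, I_re, mul_one,
      mul_zero, add_zero, zero_add]
    have : t * (1 + y ^ 2 / t) = t + y ^ 2 := by field_simp
    rw [this]; linarith
  obtain ⟨M, hM⟩ := hK.exists_bound_of_continuousOn (hc.mono hKsub)
  refine ⟨M, fun ω hω => ?_⟩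
  set T := ω.im with hT
  set R := Real.sqrt (t * (T - 1)) with hR
  have hR2 : R ^ 2 = t * (T - 1) := Real.sq_sqrt (by nlinarith)
  have hR0 : 0 ≤ R := Real.sqrt_nonneg _
  have hdom : ∀ s : ℂ, s.im ∈ Set.Icc (-R) R → s.im ^ 2 < t * ω.im := by
    intro s hs
    have : s.im ^ 2 ≤ R ^ 2 := sq_le_sq' hs.1 hs.2
    nlinarith
  have hbd : ∀ s : ℂ, s.im ^ 2 = R ^ 2 → ‖φ s ω‖ ≤ M := by
    intro s hs
    have hsd : s.im ^ 2 < t * ω.im := by nlinarith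
    let n : ℤ := ⌊s.im / t⌋
    have hn1 : (n : ℝ) * t ≤ s.im := by
      have := Int.floor_le (s.im / t)
      rwa [le_div_iff₀ ht] at this
    have hn2 : s.im < (n + 1 : ℝ) * t := by
      have := Int.lt_floor_add_one (s.im / t)
      rwa [div_lt_iff₀ ht] at this
    rw [← h3' (-n) s ω hsd]
    set s' := s + ((-n : ℤ) : ℂ) * (t * I) with hs'
    set ω' := ω + 2 * ((-n : ℤ) : ℂ) * s + ((-n : ℤ) : ℂ) ^ 2 * (t * I) with hω'
    have es : s'.im = s.im - n * t := by simp [hs']; ring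
    have eω : ω'.im = 1 + s'.im ^ 2 / t := by
      have e2 : ω'.im = ω.im - 2 * n * s.im + n ^ 2 * t := by
        have : (((-n : ℤ) : ℂ) ^ 2) = ((n ^ 2 : ℝ) : ℂ) := by push_cast; ring
        rw [hω', this]
        have h' : (2 * ((-n : ℤ) : ℂ)) = ((-2 * n : ℝ) : ℂ) := by push_cast; ring
        rw [h']
        simp only [add_im, im_ofReal_mul]
        simp; ring
      rw [e2, es]; field_simp; nlinarith
    have hdom' : s'.im ^ 2 < t * ω'.im := by
      rw [eω]
      have : t * (1 + s'.im ^ 2 / t) = t + s'.im ^ 2 := by field_simp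
      rw [this]; linarith
    rw [← h1' (-⌊s'.re⌋) s' ω' hdom', ← h2' (-⌊ω'.re⌋) _ ω' (by simpa using hdom')]
    refine hM (s' + ((-⌊s'.re⌋ : ℤ) : ℂ), ω' + ((-⌊ω'.re⌋ : ℤ) : ℂ))
      ⟨(Int.fract s'.re, s'.im, Int.fract ω'.re), ⟨⟨Int.fract_nonneg _, (Int.fract_lt_one _).le⟩,
        ⟨?_, ?_⟩, ⟨Int.fract_nonneg _, (Int.fract_lt_one _).le⟩⟩, ?_⟩
    · simp only; linarith
    · simp only; linarith
    · simp only [Prod.mk.injEq]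
      constructor
      · apply Complex.ext
        · have := Int.fract_add_floor s'.re
          simp; linarith
        · simp
      · rw [← eω]
        apply Complex.ext
        · have := Int.fract_add_floor ω'.re
          simp; linarith
        · simp
  have hcl : closure (Complex.im ⁻¹' Set.Ioo (-R) R) ⊆ Complex.im ⁻¹' Set.Icc (-R) R :=
    closure_minimal (Set.preimage_mono Set.Ioo_subset_Icc_self)
      (isClosed_Icc.preimage Complex.continuous_im)
  refine PhragmenLindelof.horizontal_strip (f := fun s => φ s ω) (a := -R) (b := R) (C := M)
    (DifferentiableOn.diffContOnCl ((hd ω).mono fun s hs => hdom s (hcl hs))) ?_ ?_ ?_ ?_ ?_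
  · refine ⟨-1, ?_, 0, ?_⟩
    · have : 0 ≤ Real.pi / (R - -R) := div_nonneg Real.pi_pos.le (by linarith)
      linarith
    · let K' : Set ℂ := (fun q : ℝ × ℝ => (q.1 + q.2 * I : ℂ)) '' (Set.Icc 0 1 ×ˢ Set.Icc (-R) R)
      have hK' : IsCompact K' := (isCompact_Icc.prod isCompact_Icc).image (by fun_prop)
      have hK'sub : K' ⊆ {s : ℂ | s.im ^ 2 < t * ω.im} := by
        rintro _ ⟨⟨x, y⟩, ⟨-, hy⟩, rfl⟩
        exact hdom _ (by simpa using hy)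
      obtain ⟨M', hM'⟩ := hK'.exists_bound_of_continuousOn ((hd ω).continuousOn.mono hK'sub)
      refine Asymptotics.IsBigO.of_bound M' ?_
      refine Filter.eventually_inf_principal.2 (Filter.Eventually.of_forall fun s hs => ?_)
      simp only [zero_mul, Real.exp_zero, norm_one, mul_one]
      rw [← h1' (-⌊s.re⌋) s ω (hdom s ⟨hs.1.le, hs.2.le⟩)]
      refine hM' _ ⟨(Int.fract s.re, s.im), ⟨⟨Int.fract_nonneg _, (Int.fract_lt_one _).le⟩,
        hs.1.le, hs.2.le⟩, ?_⟩
      apply Complex.ext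
      · have := Int.fract_add_floor s.re
        simp; linarith
      · simp
  · intro z hz; exact hbd z (by rw [hz]; ring)
  · intro z hz; exact hbd z (by rw [hz])
  · simpa using hR0
  · simpa using hR0

end Koecher

end Refl

open Matrix

namespace Refl

section Lorentz

variable {r : ℕ}

/-- Positive definite even integral form. -/
structure PD (C : Matrix (Fin r) (Fin r) ℤ) : Prop where
  symm : C.IsSymm
  even : ∀ x : Fin r → ℤ, 2 ∣ bil C x x
  pos : ∀ x : Fin r → ℝ, x ≠ 0 → 0 < bil C x x

/-- The hyperbolic lattice `U ⊕ C(-1)`. -/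
abbrev SM (C : Matrix (Fin r) (Fin r) ℤ) : Matrix (Fin (2 + r)) (Fin (2 + r)) ℤ := dsum U (-C)

/-- The open forward cone. -/
def PosCone (C : Matrix (Fin r) (Fin r) ℤ) : Set (Fin (2 + r) → ℝ) :=
  {y | 0 < hA y ∧ 0 < bil (SM C) y y}

variable {C : Matrix (Fin r) (Fin r) ℤ}

theorem PD.symmS (hC : PD C) : (SM C).IsSymm :=
  isSymm_dsum isSymm_U (by
    have := hC.symm
    unfold Matrix.IsSymm at *
    rw [Matrix.transpose_neg, this])

theorem PD.symmM (hC : PD C) : (dsum U (SM C)).IsSymm := isSymm_dsum isSymm_U hC.symmS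

theorem PD.nonneg (hC : PD C) (x : Fin r → ℝ) : 0 ≤ bil C x x := by
  rcases eq_or_ne x 0 with rfl | h
  · simp
  · exact (hC.pos x h).le

theorem PD.eq_zero (hC : PD C) (x : Fin r → ℝ) (h : bil C x x ≤ 0) : x = 0 := by
  by_contra hx
  exact absurd (hC.pos x hx) (not_lt.2 h)

theorem bil_S {R : Type*} [CommRing R] (a b a' b' : R) (x x' : Fin r → R) :
    bil (SM C) (hv a b x) (hv a' b' x') = a * b' + b * a' - bil C x x' := by
  rw [bil_hv, bil_neg_mat]; ring

theorem negdef_orth (hC : PD C) {x y : Fin (2 + r) → ℝ} (hy : 0 < bil (SM C) y y)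
    (hxy : bil (SM C) x y = 0) (hx : 0 ≤ bil (SM C) x x) : x = 0 := by
  obtain ⟨a, b, μ, rfl⟩ := exists_hv y
  obtain ⟨a', b', μ', rfl⟩ := exists_hv x
  rw [bil_S] at hy hxy hx
  have h1 := hC.nonneg (a • μ' - a' • μ)
  have h2 := hC.nonneg μ
  have e : bil C (a • μ' - a' • μ) (a • μ' - a' • μ) =
      a ^ 2 * bil C μ' μ' - 2 * a * a' * bil C μ' μ + a' ^ 2 * bil C μ μ := by
    simp [bil_comm hC.symm μ μ']; ring
  have ha : a ≠ 0 := by rintro rfl; linarith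
  have ha2 : 0 < a ^ 2 := by positivity
  have key : a ^ 2 * (a' * b' + b' * a' - bil C μ' μ') =
      -(bil C (a • μ' - a' • μ) (a • μ' - a' • μ) + a' ^ 2 * (a * b + b * a - bil C μ μ)) := by
    rw [e]; linear_combination 2 * a * a' * hxy
  have h3 : 0 ≤ a ^ 2 * (a' * b' + b' * a' - bil C μ' μ') := mul_nonneg ha2.le hx
  have h4 : 0 ≤ a' ^ 2 * (a * b + b * a - bil C μ μ) := mul_nonneg (sq_nonneg _) hy.le
  have ha' : a' = 0 := by
    have : a' ^ 2 * (a * b + b * a - bil C μ μ) = 0 := by linarith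
    rcases mul_eq_zero.1 this with h | h
    · exact pow_eq_zero_iff (by norm_num) |>.1 h
    · linarith
  subst ha'
  have h5 : a • μ' - (0:ℝ) • μ = 0 := hC.eq_zero _ (by linarith)
  have hμ : μ' = 0 := by
    simp only [zero_smul, sub_zero] at h5
    exact (smul_eq_zero.1 h5).resolve_left ha
  subst hμ
  have hb : b' = 0 := by
    simp only [bil_zero_left] at hxy
    have : b' * a = 0 := by linarith
    exact (mul_eq_zero.1 this).resolve_right ha
  subst hb
  exact hv_zero

/-- Reverse Cauchy-Schwarz inequality. -/
theorem reverse_CS (hC : PD C) (x : Fin (2 + r) → ℝ) {y : Fin (2 + r) → ℝ}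
    (hy : 0 < bil (SM C) y y) : bil (SM C) x x * bil (SM C) y y ≤ bil (SM C) x y ^ 2 := by
  by_contra! h
  set Y := bil (SM C) y y
  set p := bil (SM C) x y
  have hyx : bil (SM C) y x = p := bil_comm hC.symmS _ _
  have e1 : bil (SM C) (Y • x - p • y) y = 0 := by simp; ring
  have e2 : bil (SM C) (Y • x - p • y) (Y • x - p • y) =
      Y * (bil (SM C) x x * Y - p ^ 2) := by
    simp [hyx]; ring
  have h0 := negdef_orth hC hy e1 (by rw [e2]; exact mul_nonneg hy.le (by linarith))
  rw [h0] at e2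
  simp at e2
  rcases e2 with h' | h' <;> nlinarith

theorem posCone_pair (hC : PD C) {y y' : Fin (2 + r) → ℝ} (hy : y ∈ PosCone C)
    (hy' : y' ∈ PosCone C) : 0 < bil (SM C) y y' := by
  obtain ⟨a, b, μ, rfl⟩ := exists_hv y
  obtain ⟨a', b', μ', rfl⟩ := exists_hv y'
  simp only [PosCone, Set.mem_ofPred_eq, hA_hv, bil_S] at hy hy' ⊢
  obtain ⟨ha, h⟩ := hy
  obtain ⟨ha', h'⟩ := hy'
  have h1 := hC.nonneg (a • μ' - a' • μ)
  have e : bil C (a • μ' - a' • μ) (a • μ' - a' • μ) =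
      a ^ 2 * bil C μ' μ' - 2 * a * a' * bil C μ μ' + a' ^ 2 * bil C μ μ := by
    simp [bil_comm hC.symm μ' μ]; ring
  rw [e] at h1
  have h2 : 0 < a ^ 2 * (a' * b' + b' * a' - bil C μ' μ') := by positivity
  have h3 : 0 < a' ^ 2 * (a * b + b * a - bil C μ μ) := by positivity
  have h4 : 0 < (2 * a * a') * (a * b' + b * a' - bil C μ μ') := by nlinarith
  exact pos_of_mul_pos_right h4 (by positivity)

theorem convex_posCone (hC : PD C) : Convex ℝ (PosCone C) := by
  intro x hx y hy s t hs ht hst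
  have hxy := posCone_pair hC hx hy
  have hyx := posCone_pair hC hy hx
  have e : bil (SM C) (s • x + t • y) (s • x + t • y) =
      s * s * bil (SM C) x x + s * t * bil (SM C) x y + t * s * bil (SM C) y x
        + t * t * bil (SM C) y y := by simp; ring
  have e2 : hA (s • x + t • y) = s * hA x + t * hA y := rfl
  have hx1 := hx.1
  have hy1 := hy.1
  have hx2 := hx.2
  have hy2 := hy.2
  rcases hs.eq_or_lt with rfl | hs
  · have : t = 1 := by linarith
    subst this; simpa using hy
  · refine ⟨?_, ?_⟩
    · rw [e2]; nlinarith [mul_pos hs hx1, mul_nonneg ht hy1.le]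
    · rw [e]; positivity

theorem isOpen_posCone : IsOpen (PosCone C) := by
  refine IsOpen.inter ?_ ?_
  · exact isOpen_lt continuous_const (continuous_apply _)
  · exact isOpen_lt continuous_const (continuous_bil _ continuous_id continuous_id)

theorem mem_posCone_of_pair (hC : PD C) {y y' : Fin (2 + r) → ℝ} (hy : y ∈ PosCone C)
    (h1 : 0 < bil (SM C) y' y') (h2 : 0 < bil (SM C) y' y) : y' ∈ PosCone C := by
  refine ⟨?_, h1⟩
  by_contra! h
  rcases h.lt_or_eq with h | h
  · have : -y' ∈ PosCone C := ⟨by change 0 < -(hA y'); linarith, by simpa using h1⟩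
    have := posCone_pair hC this hy
    simp at this; linarith
  · obtain ⟨a', b', μ', rfl⟩ := exists_hv y'
    simp only [hA_hv] at h
    subst h
    rw [bil_S] at h1
    have := hC.nonneg μ'
    linarith

theorem hA_ne_zero (hC : PD C) {y : Fin (2 + r) → ℝ} (h1 : 0 < bil (SM C) y y) : hA y ≠ 0 := by
  obtain ⟨a', b', μ', rfl⟩ := exists_hv y
  intro h
  simp only [hA_hv] at h
  subst h
  rw [bil_S] at h1
  have := hC.nonneg μ'
  linarith

/-- Projection of a point of the cone to the orthogonal complement of a negative vector. -/
theorem proj_mem_posCone (hC : PD C) {y α : Fin (2 + r) → ℝ} (hy : y ∈ PosCone C)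
    (hα : bil (SM C) α α < 0) :
    y - (bil (SM C) α y / bil (SM C) α α) • α ∈ PosCone C := by
  have hsy : bil (SM C) y α = bil (SM C) α y := bil_comm hC.symmS _ _
  have hy2 := hy.2
  have h0 : 0 ≤ -(bil (SM C) α y / bil (SM C) α α * bil (SM C) α y) := by
    rw [div_mul_eq_mul_div, ← sq, ← div_neg]
    exact div_nonneg (sq_nonneg _) (by linarith)
  refine mem_posCone_of_pair hC hy ?_ ?_
  · have : bil (SM C) (y - (bil (SM C) α y / bil (SM C) α α) • α)
        (y - (bil (SM C) α y / bil (SM C) α α) • α) =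
        bil (SM C) y y + -(bil (SM C) α y / bil (SM C) α α * bil (SM C) α y) := by
      simp only [bil_sub_left, bil_sub_right, bil_smul_left, bil_smul_right, smul_eq_mul, hsy]
      have hne : bil (SM C) α α ≠ 0 := hα.ne
      generalize bil (SM C) α α = q at *
      field_simp
      ring
    rw [this]; linarith
  · simp; linarith

theorem refl_mem_posCone (hC : PD C) {y α : Fin (2 + r) → ℝ} (hy : y ∈ PosCone C)
    (hα : bil (SM C) α α < 0) :
    y - (2 * bil (SM C) α y / bil (SM C) α α) • α ∈ PosCone C := by
  have hm := proj_mem_posCone hC hy hα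
  have hsy : bil (SM C) y α = bil (SM C) α y := bil_comm hC.symmS _ _
  have h1 := hy.2
  have h2 := hm.2
  refine mem_posCone_of_pair hC hm ?_ ?_
  · convert h1 using 1
    simp only [bil_sub_left, bil_sub_right, bil_smul_left, bil_smul_right, smul_eq_mul, hsy]
    have hne : bil (SM C) α α ≠ 0 := hα.ne
    generalize bil (SM C) α α = q at *
    field_simp
    ring
  · convert h2 using 1
    simp only [bil_sub_left, bil_sub_right, bil_smul_left, bil_smul_right, smul_eq_mul, hsy]
    have hne : bil (SM C) α α ≠ 0 := hα.ne
    generalize bil (SM C) α α = q at *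
    field_simp
    ring

end Lorentz

end Refl

open Matrix

namespace Refl

section Tube

variable {n r : ℕ}

/-- Real vectors as complex vectors. -/
def cv (x : Fin n → ℝ) : Fin n → ℂ := fun i => (x i : ℂ)

/-- Imaginary part of a vector. -/
def imv (z : Fin n → ℂ) : Fin n → ℝ := fun i => (z i).im

/-- Real part of a vector. -/
def rev (z : Fin n → ℂ) : Fin n → ℝ := fun i => (z i).re

theorem cv_decomp (z : Fin n → ℂ) : z = cv (rev z) + Complex.I • cv (imv z) := by
  ext i; simpa [cv, rev, imv, mul_comm] using (Complex.re_add_im (z i)).symm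

theorem bil_cv (B : Matrix (Fin n) (Fin n) ℤ) (x y : Fin n → ℝ) :
    bil B (cv x) (cv y) = ((bil B x y : ℝ) : ℂ) := (map_bil B Complex.ofRealHom x y).symm

theorem bil_intR (B : Matrix (Fin n) (Fin n) ℤ) (x y : Fin n → ℤ) :
    bil B (intR x) (intR y) = ((bil B x y : ℤ) : ℝ) := (map_bil B (Int.castRingHom ℝ) x y).symm

theorem bil_intC (B : Matrix (Fin n) (Fin n) ℤ) (x y : Fin n → ℤ) :
    bil B (intC x) (intC y) = ((bil B x y : ℤ) : ℂ) := (map_bil B (Int.castRingHom ℂ) x y).symm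

theorem cv_intR (x : Fin n → ℤ) : cv (intR x) = intC x := by ext i; simp [cv, intR, intC]

@[simp] theorem cv_add (x y : Fin n → ℝ) : cv (x + y) = cv x + cv y := by ext i; simp [cv]
@[simp] theorem cv_sub (x y : Fin n → ℝ) : cv (x - y) = cv x - cv y := by ext i; simp [cv]
@[simp] theorem cv_smul (c : ℝ) (y : Fin n → ℝ) : cv (c • y) = (c : ℂ) • cv y := by
  ext i; simp [cv]
@[simp] theorem imv_add (x y : Fin n → ℂ) : imv (x + y) = imv x + imv y := by ext i; simp [imv]
@[simp] theorem imv_cv (x : Fin n → ℝ) : imv (cv x) = 0 := by ext i; simp [imv, cv]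
@[simp] theorem imv_intC (x : Fin n → ℤ) : imv (intC x) = 0 := by ext i; simp [imv, intC]
@[simp] theorem rev_cv (x : Fin n → ℝ) : rev (cv x) = x := by ext i; simp [rev, cv]
@[simp] theorem imv_real_smul (c : ℝ) (z : Fin n → ℂ) : imv ((c : ℂ) • z) = c • imv z := by
  ext i; simp [imv]
@[simp] theorem imv_I_smul (z : Fin n → ℂ) : imv (Complex.I • z) = rev z := by
  ext i; simp [imv, rev]
theorem imv_smul_intC (c : ℂ) (x : Fin n → ℤ) : imv (c • intC x) = c.im • intR x := by
  ext i; simp [imv, intC, intR]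

theorem continuous_imv : Continuous (imv : (Fin n → ℂ) → _) :=
  continuous_pi fun i => Complex.continuous_im.comp (continuous_apply i)

theorem continuous_cv : Continuous (cv : (Fin n → ℝ) → _) :=
  continuous_pi fun i => Complex.continuous_ofReal.comp (continuous_apply i)

theorem im_bil_cv (B : Matrix (Fin n) (Fin n) ℤ) (x : Fin n → ℝ) (z : Fin n → ℂ) :
    (bil B (cv x) z).im = bil B x (imv z) := by
  conv_lhs => rw [cv_decomp z]
  simp only [bil_add_right, bil_smul_right, bil_cv]
  simp

theorem re_bil_cv (B : Matrix (Fin n) (Fin n) ℤ) (x : Fin n → ℝ) (z : Fin n → ℂ) :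
    (bil B (cv x) z).re = bil B x (rev z) := by
  conv_lhs => rw [cv_decomp z]
  simp only [bil_add_right, bil_smul_right, bil_cv]
  simp

theorem bil_self_complex {B : Matrix (Fin n) (Fin n) ℤ} (hB : B.IsSymm) (z : Fin n → ℂ) :
    bil B z z = ((bil B (rev z) (rev z) - bil B (imv z) (imv z) : ℝ) : ℂ) +
      Complex.I * ((2 * bil B (rev z) (imv z) : ℝ) : ℂ) := by
  conv_lhs => rw [cv_decomp z]
  simp only [bil_add_right, bil_add_left, bil_smul_left, bil_smul_right, bil_cv]
  rw [bil_comm hB (imv z) (rev z)]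
  push_cast
  linear_combination ((bil B (imv z) (imv z) : ℝ) : ℂ) * Complex.I_sq

theorem bil_self_conj {B : Matrix (Fin n) (Fin n) ℤ} (hB : B.IsSymm) (z : Fin n → ℂ) :
    bil B z (fun i => (starRingEnd ℂ) (z i)) =
      ((bil B (rev z) (rev z) + bil B (imv z) (imv z) : ℝ) : ℂ) := by
  have h : (fun i => (starRingEnd ℂ) (z i)) = cv (rev z) - Complex.I • cv (imv z) := by
    ext i; apply Complex.ext <;> simp [cv, rev, imv]
  rw [h]
  conv_lhs => enter [2]; rw [cv_decomp z]
  simp only [bil_add_left, bil_sub_right, bil_smul_left, bil_smul_right, bil_cv]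
  rw [bil_comm hB (imv z) (rev z)]
  push_cast
  linear_combination -((bil B (imv z) (imv z) : ℝ) : ℂ) * Complex.I_sq

/-- The lattice `2U ⊕ C(-1)`. -/
abbrev MM (C : Matrix (Fin r) (Fin r) ℤ) : Matrix (Fin (2 + (2 + r))) (Fin (2 + (2 + r))) ℤ :=
  dsum U (SM C)

/-- The tube domain. -/
def Tube (C : Matrix (Fin r) (Fin r) ℤ) : Set (Fin (2 + r) → ℂ) := {z | imv z ∈ PosCone C}

/-- The standard section of the affine cone over the tube domain. -/
noncomputable def psi (C : Matrix (Fin r) (Fin r) ℤ) (z : Fin (2 + r) → ℂ) :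
    Fin (2 + (2 + r)) → ℂ := hv 1 (-(bil (SM C) z z) / 2) z

/-- The affine cone over the tube domain. -/
def D0 (C : Matrix (Fin r) (Fin r) ℤ) : Set (Fin (2 + (2 + r)) → ℂ) :=
  {Z | ∃ c : ℂ, c ≠ 0 ∧ ∃ z ∈ Tube C, Z = c • psi C z}

variable {C : Matrix (Fin r) (Fin r) ℤ}

theorem mem_tube {z : Fin (2 + r) → ℂ} : z ∈ Tube C ↔ imv z ∈ PosCone C := Iff.rfl

theorem isOpen_tube : IsOpen (Tube C) := isOpen_posCone.preimage continuous_imv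

theorem convex_tube (hC : PD C) : Convex ℝ (Tube C) := by
  intro x hx y hy s t hs ht hst
  have := convex_posCone hC hx hy hs ht hst
  have e : imv (s • x + t • y) = s • imv x + t • imv y := by
    ext i; simp [imv]
  change imv _ ∈ PosCone C
  rwa [e]

theorem tube_add_cv {z : Fin (2 + r) → ℂ} (hz : z ∈ Tube C) (x : Fin (2 + r) → ℝ) :
    z + cv x ∈ Tube C := by
  change imv _ ∈ PosCone C
  simpa using mem_tube.1 hz

theorem tube_add_intC {z : Fin (2 + r) → ℂ} (hz : z ∈ Tube C) (x : Fin (2 + r) → ℤ) :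
    z + intC x ∈ Tube C := by
  change imv _ ∈ PosCone C
  simpa using mem_tube.1 hz

theorem conj_hv (a b : ℂ) (z : Fin (2 + r) → ℂ) :
    (fun i => (starRingEnd ℂ) (hv a b z i)) =
      hv ((starRingEnd ℂ) a) ((starRingEnd ℂ) b) fun i => (starRingEnd ℂ) (z i) :=
  map_hv _ _ _ _

theorem bil_psi (z : Fin (2 + r) → ℂ) : bil (MM C) (psi C z) (psi C z) = 0 := by
  unfold psi; rw [bil_hv]; ring

theorem bil_psi_conj (hC : PD C) (z : Fin (2 + r) → ℂ) :
    bil (MM C) (psi C z) (fun i => (starRingEnd ℂ) (psi C z i)) =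
      ((2 * bil (SM C) (imv z) (imv z) : ℝ) : ℂ) := by
  unfold psi; rw [conj_hv, bil_hv, bil_self_conj hC.symmS, bil_self_complex hC.symmS]
  simp only [map_div₀, map_neg, map_add, map_mul, Complex.conj_ofReal, Complex.conj_I, map_one]
  simp only [map_ofNat]
  push_cast
  ring

theorem cone_smul {n : ℕ} {B : Matrix (Fin n) (Fin n) ℤ} {Z : Fin n → ℂ} {c : ℂ} (hc : c ≠ 0) :
    c • Z ∈ Cone B ↔ Z ∈ Cone B := by
  have e : (fun i => (starRingEnd ℂ) ((c • Z) i)) = (starRingEnd ℂ) c • fun i => (starRingEnd ℂ) (Z i) := by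
    ext i; simp
  unfold Cone
  simp only [Set.mem_ofPred_eq, cpair_eq_bil]
  rw [e]
  simp only [bil_smul_left, bil_smul_right]
  rw [← mul_assoc ((starRingEnd ℂ) c) c, mul_comm ((starRingEnd ℂ) c) c, Complex.mul_conj, Complex.re_ofReal_mul]
  have h : 0 < Complex.normSq c := Complex.normSq_pos.2 hc
  constructor
  · rintro ⟨h1, h2⟩
    refine ⟨?_, ?_⟩
    · simpa [hc] using h1
    · exact (mul_pos_iff_of_pos_left h).1 h2
  · rintro ⟨h1, h2⟩
    rw [h1]
    exact ⟨by simp, mul_pos h h2⟩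

theorem psi_mem_cone_iff (hC : PD C) (z : Fin (2 + r) → ℂ) :
    psi C z ∈ Cone (MM C) ↔ 0 < bil (SM C) (imv z) (imv z) := by
  unfold Cone
  simp only [Set.mem_ofPred_eq, cpair_eq_bil, bil_psi, bil_psi_conj hC, Complex.ofReal_re, true_and]
  constructor <;> intro h <;> linarith

theorem D0_subset_cone (hC : PD C) : D0 C ⊆ Cone (MM C) := by
  rintro _ ⟨c, hc, z, hz, rfl⟩
  exact (cone_smul hc).2 ((psi_mem_cone_iff hC z).2 hz.2)

theorem psi_mem_D0 {z : Fin (2 + r) → ℂ} (hz : z ∈ Tube C) : psi C z ∈ D0 C :=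
  ⟨1, one_ne_zero, z, hz, by simp⟩

theorem hA_ne_zero_of_cone (hC : PD C) {Z : Fin (2 + (2 + r)) → ℂ} (hZ : Z ∈ Cone (MM C)) :
    hA Z ≠ 0 := by
  intro h
  obtain ⟨a, b, ζ, rfl⟩ := exists_hv Z
  rw [hA_hv] at h
  subst h
  obtain ⟨h1, h2⟩ := hZ
  rw [cpair_eq_bil, bil_hv, bil_self_complex hC.symmS] at h1
  rw [cpair_eq_bil, conj_hv, bil_hv, bil_self_conj hC.symmS] at h2
  have hre := congrArg Complex.re h1
  have him := congrArg Complex.im h1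
  simp at hre him h2
  have hx : 0 < bil (SM C) (rev ζ) (rev ζ) := by linarith
  have := negdef_orth hC hx (x := imv ζ) (by rw [bil_comm hC.symmS]; exact him) (by linarith)
  rw [this] at hre h2
  simp at hre h2; linarith

theorem cone_decomp (hC : PD C) {Z : Fin (2 + (2 + r)) → ℂ} (hZ : Z ∈ Cone (MM C)) :
    Z = hA Z • psi C ((hA Z)⁻¹ • hX Z) ∧
      0 < bil (SM C) (imv ((hA Z)⁻¹ • hX Z)) (imv ((hA Z)⁻¹ • hX Z)) := by
  have ha := hA_ne_zero_of_cone hC hZ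
  have e : Z = hA Z • psi C ((hA Z)⁻¹ • hX Z) := by
    have h1 := hZ.1
    obtain ⟨a, b, ζ, rfl⟩ := exists_hv Z
    rw [cpair_eq_bil, bil_hv] at h1
    simp only [hA_hv, hX_hv, psi, hv_smul] at *
    rw [hv_inj]
    refine ⟨by ring, ?_, ?_⟩
    · simp only [bil_smul_left, bil_smul_right]
      field_simp
      linear_combination h1
    · rw [smul_smul, mul_inv_cancel₀ ha, one_smul]
  refine ⟨e, ?_⟩
  rw [← psi_mem_cone_iff hC, ← cone_smul ha, ← e]
  exact hZ

theorem mem_D0_iff (hC : PD C) {Z : Fin (2 + (2 + r)) → ℂ} (hZ : Z ∈ Cone (MM C)) :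
    Z ∈ D0 C ↔ 0 < hA (imv ((hA Z)⁻¹ • hX Z)) := by
  obtain ⟨e, h⟩ := cone_decomp hC hZ
  constructor
  · rintro ⟨c, hc, z, hz, rfl⟩
    have : (hA (c • psi C z))⁻¹ • hX (c • psi C z) = z := by
      unfold psi
      rw [hv_smul, hA_hv, hX_hv, smul_smul]
      simp [hc]
    rw [this]; exact hz.1
  · intro h'
    exact ⟨_, hA_ne_zero_of_cone hC hZ, _, ⟨h', h⟩, e⟩

theorem isPreconnected_tube (hC : PD C) : IsPreconnected (Tube C) :=
  (convex_tube hC).isPreconnected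

theorem isPreconnected_D0 (hC : PD C) : IsPreconnected (D0 C) := by
  have h1 : IsPreconnected ({0}ᶜ : Set ℂ) :=
    (isConnected_compl_singleton_of_one_lt_rank (by simp) 0).isPreconnected
  have h2 := (h1.prod (isPreconnected_tube hC)).image (fun p : ℂ × (Fin (2 + r) → ℂ) => p.1 • psi C p.2)
    (by
      refine Continuous.continuousOn (continuous_fst.smul ?_)
      exact continuous_hv continuous_const
        ((continuous_bil _ continuous_snd continuous_snd).neg.div_const 2) continuous_snd)
  convert h2 using 1
  ext Z; constructor
  · rintro ⟨c, hc, z, hz, rfl⟩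
    exact ⟨(c, z), ⟨hc, hz⟩, rfl⟩
  · rintro ⟨⟨c, z⟩, ⟨hc, hz⟩, rfl⟩
    exact ⟨c, hc, z, hz, rfl⟩

theorem subset_D0 (hC : PD C) {A : Set (Fin (2 + (2 + r)) → ℂ)} (hA' : IsPreconnected A)
    (hAC : A ⊆ Cone (MM C)) {Z : Fin (2 + (2 + r)) → ℂ} (hZA : Z ∈ A) (hZ : Z ∈ D0 C) :
    A ⊆ D0 C := by
  intro W hW
  rw [mem_D0_iff hC (hAC hW)]
  rw [mem_D0_iff hC (hAC hZA)] at hZ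
  set σ : (Fin (2 + (2 + r)) → ℂ) → ℝ := fun Z => hA (imv ((hA Z)⁻¹ • hX Z)) with hσ
  have hc : ContinuousOn σ A := by
    have h1 : Continuous fun Z : Fin (2 + (2 + r)) → ℂ => hA Z := continuous_apply _
    have h2 : Continuous fun Z : Fin (2 + (2 + r)) → ℂ => hX Z :=
      continuous_pi fun i => continuous_apply _
    have h3 : ContinuousOn (fun Z : Fin (2 + (2 + r)) → ℂ => (hA Z)⁻¹ • hX Z) A :=
      (h1.continuousOn.inv₀ fun x hx => hA_ne_zero_of_cone hC (hAC hx)).smul h2.continuousOn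
    exact ((continuous_apply _).comp continuous_imv).comp_continuousOn h3
  by_contra! hneg
  have h0 : (0 : ℝ) ∈ σ '' A := (hA'.image σ hc).Icc_subset ⟨W, hW, rfl⟩ ⟨Z, hZA, rfl⟩ ⟨hneg, hZ.le⟩
  obtain ⟨V, hV, hV0⟩ := h0
  exact Refl.hA_ne_zero hC (cone_decomp hC (hAC hV)).2 hV0

theorem component_eq_D0 (hC : PD C) {Z : Fin (2 + (2 + r)) → ℂ} (hZ : Z ∈ D0 C) :
    connectedComponentIn (Cone (MM C)) Z = D0 C := by
  have hZc := D0_subset_cone hC hZ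
  refine (subset_D0 hC isPreconnected_connectedComponentIn (connectedComponentIn_subset _ _)
    (mem_connectedComponentIn hZc) hZ).antisymm ?_
  exact (isPreconnected_D0 hC).subset_connectedComponentIn hZ (D0_subset_cone hC)

end Tube

end Refl

open Matrix

namespace Refl

section Forms

variable {n : ℕ}

theorem actC_eq_actR (g : Matrix (Fin n) (Fin n) ℤ) : actC g = actR g := funext (actC_eq g)

theorem continuous_actR (g : Matrix (Fin n) (Fin n) ℤ) :
    Continuous (actR g : (Fin n → ℂ) → Fin n → ℂ) :=
  continuous_pi fun i => by
    unfold actR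
    exact continuous_finsetSum _ fun j _ => continuous_const.mul (continuous_apply j)

theorem differentiable_actR (g : Matrix (Fin n) (Fin n) ℤ) :
    Differentiable ℂ (actR g : (Fin n → ℂ) → Fin n → ℂ) := by
  rw [differentiable_pi]
  intro i
  unfold actR
  fun_prop

theorem actR_single {g : Matrix (Fin n) (Fin n) ℤ} (i j : Fin n) :
    actR g (Pi.single j (1 : ℤ)) i = g i j := by
  unfold actR
  rw [Finset.sum_eq_single j]
  · simp
  · intro b _ hb; simp [hb]
  · simp

theorem mat_ext_actR {g h : Matrix (Fin n) (Fin n) ℤ} (H : ∀ x : Fin n → ℤ, actR g x = actR h x) :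
    g = h := by
  ext i j
  have h1 := congrFun (H (Pi.single j 1)) i
  rwa [actR_single, actR_single] at h1

theorem isom_of_bil {B g : Matrix (Fin n) (Fin n) ℤ}
    (H : ∀ x y : Fin n → ℤ, bil B (actR g x) (actR g y) = bil B x y) : gᵀ * B * g = B := by
  ext i j
  have := H (Pi.single i 1) (Pi.single j 1)
  rw [bil_act, bil_single, bil_single] at this
  simpa using this

theorem act_mem_cone {B B' P : Matrix (Fin n) (Fin n) ℤ} {t : ℤ} (ht : 0 < t)
    (hP : Pᵀ * B' * P = t • B) {Z : Fin n → ℂ} (hZ : Z ∈ Cone B) : actR P Z ∈ Cone B' := by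
  obtain ⟨h1, h2⟩ := hZ
  refine ⟨?_, ?_⟩
  · rw [cpair_eq_bil, bil_act, hP, bil_zsmul_mat]
    rw [cpair_eq_bil] at h1
    rw [h1, mul_zero]
  · rw [cpair_eq_bil, actR_map, bil_act, hP, bil_zsmul_mat]
    rw [cpair_eq_bil] at h2
    have ht' : (0 : ℝ) < t := by exact_mod_cast ht
    rw [show ((t : ℤ) : ℂ) = ((t : ℝ) : ℂ) by simp, Complex.re_ofReal_mul]
    exact mul_pos ht' h2

theorem isom_mem_cone {B g : Matrix (Fin n) (Fin n) ℤ} (hg : gᵀ * B * g = B) {Z : Fin n → ℂ}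
    (hZ : Z ∈ Cone B) : actR g Z ∈ Cone B :=
  act_mem_cone one_pos (by rw [hg, one_smul]) hZ

theorem OPlus.maps {B : Matrix (Fin n) (Fin n) ℤ} {D : Set (Fin n → ℂ)}
    {g : Matrix (Fin n) (Fin n) ℤ} (hg : g ∈ OPlus B D) {Z : Fin n → ℂ} (hZ : Z ∈ D) :
    actR g Z ∈ D := by
  rw [← hg.2, actC_eq_actR]; exact ⟨Z, hZ, rfl⟩

theorem OPlus.mul {B : Matrix (Fin n) (Fin n) ℤ} {D : Set (Fin n → ℂ)}
    {g h : Matrix (Fin n) (Fin n) ℤ} (hg : g ∈ OPlus B D) (hh : h ∈ OPlus B D) :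
    g * h ∈ OPlus B D := by
  refine ⟨?_, ?_⟩
  · rw [Matrix.transpose_mul]
    calc hᵀ * gᵀ * B * (g * h) = hᵀ * (gᵀ * B * g) * h := by simp only [Matrix.mul_assoc]
      _ = B := by rw [hg.1, hh.1]
  · have : actC (g * h) = actC g ∘ actC h := by
      funext x; simp only [actC_eq_actR, Function.comp, actR_mul]
    rw [this, Set.image_comp, hh.2, hg.2]

theorem OPlus.inv {B : Matrix (Fin n) (Fin n) ℤ} (hB : B.det ≠ 0) {D : Set (Fin n → ℂ)}
    {g : Matrix (Fin n) (Fin n) ℤ} (hg : g ∈ OPlus B D) :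
    ∃ h ∈ OPlus B D, g * h = 1 ∧ h * g = 1 := by
  have hd : g.det * g.det = 1 := by
    have := congrArg Matrix.det hg.1
    rw [Matrix.det_mul, Matrix.det_mul, Matrix.det_transpose] at this
    apply mul_left_cancel₀ hB
    linear_combination this
  have hu : IsUnit g.det := IsUnit.of_mul_eq_one _ hd
  have h1 := Matrix.mul_nonsing_inv g hu
  have h2 := Matrix.nonsing_inv_mul g hu
  refine ⟨g⁻¹, ⟨?_, ?_⟩, h1, h2⟩
  · have h3 : (g⁻¹)ᵀ * gᵀ = 1 := by rw [← Matrix.transpose_mul, h1, Matrix.transpose_one]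
    calc (g⁻¹)ᵀ * B * g⁻¹ = (g⁻¹)ᵀ * (gᵀ * B * g) * g⁻¹ := by rw [hg.1]
      _ = ((g⁻¹)ᵀ * gᵀ) * B * (g * g⁻¹) := by simp only [Matrix.mul_assoc]
      _ = B := by rw [h3, h1, Matrix.one_mul, Matrix.mul_one]
  · conv_lhs => rw [← hg.2]
    rw [← Set.image_comp]
    have : actC g⁻¹ ∘ actC g = id := by
      funext x; simp only [actC_eq_actR, Function.comp, ← actR_mul, h2, actR_one, id]
    rw [this, Set.image_id]

/-- Restrictions of the translates of `F`. -/
def orb (B : Matrix (Fin n) (Fin n) ℤ) (D : Set (Fin n → ℂ)) (F : (Fin n → ℂ) → ℂ) :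
    Set ((Fin n → ℂ) → ℂ) :=
  {φ | ∃ g ∈ OPlus B D, φ = D.indicator fun Z => F (actR g Z)}

/-- Holomorphic, homogeneous functions with finite orbit under `O⁺`. -/
structure AInv (B : Matrix (Fin n) (Fin n) ℤ) (D : Set (Fin n → ℂ)) (k : ℤ)
    (F : (Fin n → ℂ) → ℂ) : Prop where
  holo : DifferentiableOn ℂ F D
  homog : ∀ t : ℂ, t ≠ 0 → ∀ Z ∈ D, F (t • Z) = t ^ (-k) * F Z
  fin : (orb B D F).Finite

/-- Holomorphic, homogeneous functions invariant under `O⁺`. -/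
structure XForm (B : Matrix (Fin n) (Fin n) ℤ) (D : Set (Fin n → ℂ)) (k : ℤ)
    (F : (Fin n → ℂ) → ℂ) : Prop where
  holo : DifferentiableOn ℂ F D
  homog : ∀ t : ℂ, t ≠ 0 → ∀ Z ∈ D, F (t • Z) = t ^ (-k) * F Z
  inv : ∀ g ∈ OPlus B D, ∀ Z ∈ D, F (actR g Z) = F Z

variable {B : Matrix (Fin n) (Fin n) ℤ} {D : Set (Fin n → ℂ)}

theorem AInv.of_modular (hB : B.det ≠ 0) {Γ : Set (Matrix (Fin n) (Fin n) ℤ)}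
    {χ : Matrix (Fin n) (Fin n) ℤ → ℂ} {k : ℤ} {F : (Fin n → ℂ) → ℂ}
    (hΓ : IsFiniteIndexSubgroup B D Γ) (hχ : IsCharacter Γ χ) (hF : IsModularForm B D Γ χ k F) :
    AInv B D k F := by
  refine ⟨hF.holo, hF.homogeneous, ?_⟩
  obtain ⟨S, hS⟩ := hΓ.finite_index
  refine Set.Finite.subset (((hχ.finite_image.prod S.finite_toSet).image
    fun p => D.indicator fun Z => p.1 * F (actR p.2⁻¹ Z))) ?_
  rintro φ ⟨g, hg, rfl⟩
  obtain ⟨g', hg', h1, h2⟩ := OPlus.inv hB hg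
  obtain ⟨s, hs, γ, hγ, he⟩ := hS g' hg'
  obtain ⟨γ', hγ', h3, h4⟩ := hΓ.inv_mem γ hγ
  have hsi : s⁻¹ = γ * g := by
    apply Matrix.inv_eq_right_inv
    rw [← Matrix.mul_assoc, ← he, h2]
  refine ⟨(χ γ', s), ⟨⟨γ', hγ', rfl⟩, hs⟩, ?_⟩
  ext Z
  by_cases hZ : Z ∈ D
  · simp only [Set.indicator_of_mem hZ]
    have hmem : actR s⁻¹ Z ∈ D := by
      rw [hsi]; exact OPlus.maps (OPlus.mul (hΓ.subset hγ) hg) hZ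
    rw [← hF.equivariant γ' hγ' _ hmem, actC_eq, ← actR_mul, hsi, ← Matrix.mul_assoc, h4,
      Matrix.one_mul]
  · simp only [Set.indicator_of_notMem hZ]

theorem AInv.pullback {B' P Q : Matrix (Fin n) (Fin n) ℤ} {D' : Set (Fin n → ℂ)} {k s t : ℤ}
    {F : (Fin n → ℂ) → ℂ} (hB : B.det ≠ 0) (hs : s ≠ 0) (hPQ : P * Q = s • 1)
    (hQP : Q * P = s • 1) (hP : Pᵀ * B' * P = t • B) (hPD : ∀ Z ∈ D, actR P Z ∈ D')
    (hDne : D.Nonempty) (hD'c : D' ⊆ Cone B')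
    (hD' : ∀ W ∈ D', connectedComponentIn (Cone B') W = D') (hF : AInv B' D' k F) :
    AInv B D k fun Z => F (actR P Z) := by
  refine ⟨hF.holo.comp (differentiable_actR P).differentiableOn hPD, ?_, ?_⟩
  · intro c hc Z hZ
    rw [actR_smul, hF.homog c hc _ (hPD Z hZ)]
  have cancel : ∀ {A A' : Matrix (Fin n) (Fin n) ℤ}, A * P = A' * P → A = A' := by
    intro A A' h
    have := congrArg (· * Q) h
    simp only [Matrix.mul_assoc, hPQ, Matrix.mul_smul, Matrix.mul_one] at this
    exact smul_right_injective _ hs this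
  have cancelT : ∀ {A A' : Matrix (Fin n) (Fin n) ℤ}, Pᵀ * A = Pᵀ * A' → A = A' := by
    intro A A' h
    have := congrArg (Qᵀ * ·) h
    simp only [← Matrix.mul_assoc, ← Matrix.transpose_mul, hPQ, Matrix.transpose_smul,
      Matrix.transpose_one, Matrix.smul_mul, Matrix.one_mul] at this
    exact smul_right_injective _ hs this
  have step : ∀ γ ∈ OPlus B D, (∃ X, γ = 1 + s • X) →
      ∃ δ, δᵀ * B' * δ = B' ∧ δ * P = P * γ ∧ actR δ '' D' ⊆ D' := by
    rintro γ hγ ⟨X, hX⟩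
    have hδP : (1 + P * X * Q) * P = P * γ := by
      rw [hX, Matrix.add_mul, Matrix.mul_add, Matrix.mul_assoc (P * X), hQP, Matrix.mul_smul, Matrix.mul_smul, Matrix.one_mul, Matrix.mul_one, Matrix.mul_one]
    have hiso : (1 + P * X * Q)ᵀ * B' * (1 + P * X * Q) = B' := by
      apply cancel; apply cancelT
      calc Pᵀ * ((1 + P * X * Q)ᵀ * B' * (1 + P * X * Q) * P)
          = ((1 + P * X * Q) * P)ᵀ * B' * ((1 + P * X * Q) * P) := by
            rw [Matrix.transpose_mul]; simp only [Matrix.mul_assoc]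
        _ = γᵀ * (Pᵀ * B' * P) * γ := by
            rw [hδP, Matrix.transpose_mul]; simp only [Matrix.mul_assoc]
        _ = Pᵀ * B' * P := by
            rw [hP, Matrix.mul_smul, Matrix.smul_mul, hγ.1]
        _ = Pᵀ * (B' * P) := by rw [Matrix.mul_assoc]
    refine ⟨1 + P * X * Q, hiso, hδP, ?_⟩
    obtain ⟨Z, hZ⟩ := hDne
    have hW : actR (1 + P * X * Q) (actR P Z) ∈ D' := by
      rw [← actR_mul, hδP, actR_mul]; exact hPD _ (OPlus.maps hγ hZ)
    have hpre : IsPreconnected D' := by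
      rw [← hD' _ hW]; exact isPreconnected_connectedComponentIn
    conv_rhs => rw [← hD' _ hW]
    refine (hpre.image _ (continuous_actR _).continuousOn).subset_connectedComponentIn
      ⟨_, hPD Z hZ, rfl⟩ ?_
    rintro _ ⟨V, hV, rfl⟩
    exact isom_mem_cone hiso (hD'c hV)
  have step2 : ∀ γ ∈ OPlus B D, (∃ X, γ = 1 + s • X) → ∃ δ ∈ OPlus B' D', δ * P = P * γ := by
    intro γ hγ hX
    obtain ⟨δ, h1, h2, h3⟩ := step γ hγ hX
    obtain ⟨γ', hγ', e1, e2⟩ := OPlus.inv hB hγ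
    obtain ⟨X, hX⟩ := hX
    obtain ⟨δ', h1', h2', h3'⟩ := step γ' hγ' ⟨-(γ' * X), by
      have : γ' * γ = γ' + s • (γ' * X) := by
        conv_lhs => rw [hX]
        rw [Matrix.mul_add, Matrix.mul_smul, Matrix.mul_one]
      rw [e2] at this
      rw [this, smul_neg]; simp⟩
    refine ⟨δ, ⟨h1, ?_⟩, h2⟩
    rw [actC_eq_actR]
    refine h3.antisymm ?_
    intro V hV
    refine ⟨actR δ' V, h3' ⟨V, hV, rfl⟩, ?_⟩
    rw [← actR_mul]
    have : δ * δ' = 1 := by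
      apply cancel
      rw [Matrix.mul_assoc, h2', ← Matrix.mul_assoc, h2, Matrix.mul_assoc, e1]; simp
    rw [this, actR_one]
  have : NeZero s.natAbs := ⟨by simpa using hs⟩
  let red : Matrix (Fin n) (Fin n) ℤ → Matrix (Fin n) (Fin n) (ZMod s.natAbs) :=
    fun g => g.map (Int.cast)
  classical
  let rep : Matrix (Fin n) (Fin n) (ZMod s.natAbs) → Matrix (Fin n) (Fin n) ℤ := fun c =>
    if h : ∃ g ∈ OPlus B D, red g = c then h.choose else 1
  refine Set.Finite.subset (Set.finite_iUnion fun c => hF.fin.image fun φ =>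
    D.indicator fun Z => φ (actR (P * rep c) Z)) ?_
  rintro _ ⟨g, hg, rfl⟩
  have hex : ∃ g' ∈ OPlus B D, red g' = red g := ⟨g, hg, rfl⟩
  have hrep : rep (red g) ∈ OPlus B D ∧ red (rep (red g)) = red g := by
    simp only [rep, dif_pos hex]; exact hex.choose_spec
  obtain ⟨hr1, hr2⟩ := hrep
  obtain ⟨r', hr', e1, e2⟩ := OPlus.inv hB hr1
  have hdiv : ∃ X, g = rep (red g) + s • X := by
    have : ∀ i j, s ∣ g i j - rep (red g) i j := by
      intro i j
      have h := congrFun (congrFun hr2 i) j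
      simp only [red, Matrix.map_apply] at h
      have := (ZMod.intCast_eq_intCast_iff_dvd_sub _ _ _).1 h
      exact Int.natAbs_dvd.1 this
    choose X hX using this
    refine ⟨Matrix.of X, ?_⟩
    ext i j
    simp [← hX]
  obtain ⟨X, hX⟩ := hdiv
  obtain ⟨δ, hδ, hδP⟩ := step2 (g * r') (OPlus.mul hg hr') ⟨X * r', by
    conv_lhs => rw [hX]
    rw [Matrix.add_mul, e1, Matrix.smul_mul]⟩
  refine Set.mem_iUnion.2 ⟨red g, _, ⟨δ, hδ, rfl⟩, ?_⟩
  ext Z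
  by_cases hZ : Z ∈ D
  · simp only [Set.indicator_of_mem hZ]
    have hm : actR (P * rep (red g)) Z ∈ D' := by
      rw [actR_mul]; exact hPD _ (OPlus.maps hr1 hZ)
    rw [Set.indicator_of_mem hm, ← actR_mul, ← actR_mul, ← Matrix.mul_assoc, hδP,
      Matrix.mul_assoc, Matrix.mul_assoc g, e2, Matrix.mul_one]
  · simp only [Set.indicator_of_notMem hZ]

theorem differentiableOn_prod {ι : Type*} (s : Finset ι) (f : ι → (Fin n → ℂ) → ℂ)
    (h : ∀ i ∈ s, DifferentiableOn ℂ (f i) D) : DifferentiableOn ℂ (fun Z => ∏ i ∈ s, f i Z) D := by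
  classical
  induction s using Finset.induction_on with
  | empty => simp
  | insert a s ha ih =>
    simp only [Finset.prod_insert ha]
    exact (h a (Finset.mem_insert_self _ _)).mul (ih fun i hi => h i (Finset.mem_insert_of_mem hi))

theorem orb_apply_act {F : (Fin n → ℂ) → ℂ} {h : Matrix (Fin n) (Fin n) ℤ} (hh : h ∈ OPlus B D)
    {φ : (Fin n → ℂ) → ℂ} (hφ : φ ∈ orb B D F) :
    (D.indicator fun Z => φ (actR h Z)) ∈ orb B D F := by
  obtain ⟨g, hg, rfl⟩ := hφ
  refine ⟨g * h, OPlus.mul hg hh, ?_⟩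
  ext Z
  by_cases hZ : Z ∈ D
  · simp only [Set.indicator_of_mem hZ, Set.indicator_of_mem (OPlus.maps hh hZ), actR_mul]
  · simp only [Set.indicator_of_notMem hZ]

theorem orb_indicator {F φ : (Fin n → ℂ) → ℂ} (hφ : φ ∈ orb B D F) : D.indicator φ = φ := by
  obtain ⟨g, hg, rfl⟩ := hφ
  rw [Set.indicator_indicator, Set.inter_self]

theorem AInv.orb_holo {k : ℤ} {F φ : (Fin n → ℂ) → ℂ} (hF : AInv B D k F) (hφ : φ ∈ orb B D F) :
    DifferentiableOn ℂ φ D := by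
  obtain ⟨g, hg, rfl⟩ := hφ
  refine (hF.holo.comp (differentiable_actR g).differentiableOn fun Z hZ => OPlus.maps hg hZ).congr ?_
  intro Z hZ
  simp [Set.indicator_of_mem hZ]

theorem OPlus.one : (1 : Matrix (Fin n) (Fin n) ℤ) ∈ OPlus B D := by
  refine ⟨by simp, ?_⟩
  rw [actC_eq_actR]
  ext x; simp

theorem AInv.self_mem_orb {F : (Fin n → ℂ) → ℂ} : D.indicator F ∈ orb B D F :=
  ⟨1, OPlus.one, by simp⟩

/-- Product of the values of a function along the orbit of a form. -/
noncomputable def orbProd {k : ℤ} {F : (Fin n → ℂ) → ℂ} (hF : AInv B D k F) (p : ℂ → ℂ)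
    (Z : Fin n → ℂ) : ℂ := ∏ φ ∈ hF.fin.toFinset, p (φ Z)

theorem orbProd_inv (hB : B.det ≠ 0) {k : ℤ} {F : (Fin n → ℂ) → ℂ} (hF : AInv B D k F)
    (p : ℂ → ℂ) {h : Matrix (Fin n) (Fin n) ℤ} (hh : h ∈ OPlus B D) {Z : Fin n → ℂ} (hZ : Z ∈ D) :
    orbProd hF p (actR h Z) = orbProd hF p Z := by
  obtain ⟨h', hh', e1, e2⟩ := OPlus.inv hB hh
  unfold orbProd
  have key : ∀ {a b : Matrix (Fin n) (Fin n) ℤ}, b ∈ OPlus B D → a * b = 1 →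
      ∀ φ ∈ hF.fin.toFinset,
      (D.indicator fun Z => (D.indicator fun Z => φ (actR a Z)) (actR b Z)) = φ := by
    intro a b hb hab φ hφ
    rw [Set.Finite.mem_toFinset] at hφ
    conv_rhs => rw [← orb_indicator hφ]
    ext V
    by_cases hV : V ∈ D
    · rw [Set.indicator_of_mem hV, Set.indicator_of_mem (OPlus.maps hb hV), Set.indicator_of_mem hV,
        ← actR_mul, hab, actR_one]
    · simp only [Set.indicator_of_notMem hV]
  refine Finset.prod_nbij' (fun φ => D.indicator fun Z => φ (actR h Z))
    (fun φ => D.indicator fun Z => φ (actR h' Z)) ?_ ?_ (key hh' e1) (key hh e2) ?_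
  · intro φ hφ
    rw [Set.Finite.mem_toFinset] at hφ ⊢
    exact orb_apply_act hh hφ
  · intro φ hφ
    rw [Set.Finite.mem_toFinset] at hφ ⊢
    exact orb_apply_act hh' hφ
  · intro φ hφ
    rw [Set.indicator_of_mem hZ]

theorem AInv.prodForm (hB : B.det ≠ 0) {k : ℤ} {F : (Fin n → ℂ) → ℂ} (hF : AInv B D k F)
    (hhom : ∀ t : ℂ, t ≠ 0 → ∀ Z ∈ D, t • Z ∈ D) :
    XForm B D (k * hF.fin.toFinset.card) (orbProd hF id) := by
  refine ⟨?_, ?_, fun g hg Z hZ => orbProd_inv hB hF id hg hZ⟩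
  · unfold orbProd
    refine differentiableOn_prod _ _ ?_
    intro φ hφ
    exact hF.orb_holo ((Set.Finite.mem_toFinset _).1 hφ)
  · intro t ht Z hZ
    unfold orbProd
    have : ∀ φ ∈ hF.fin.toFinset, id (φ (t • Z)) = t ^ (-k) * id (φ Z) := by
      intro φ hφ
      rw [Set.Finite.mem_toFinset] at hφ
      obtain ⟨g, hg, rfl⟩ := hφ
      simp only [id, Set.indicator_of_mem hZ, Set.indicator_of_mem (hhom t ht Z hZ)]
      rw [actR_smul, hF.homog t ht _ (OPlus.maps hg hZ)]
    rw [Finset.prod_congr rfl this, Finset.prod_mul_distrib, Finset.prod_const, ← zpow_natCast,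
      ← _root_.zpow_mul, neg_mul]

theorem AInv.charForm (hB : B.det ≠ 0) {F : (Fin n → ℂ) → ℂ} (hF : AInv B D 0 F)
    (hhom : ∀ t : ℂ, t ≠ 0 → ∀ Z ∈ D, t • Z ∈ D) (x : ℂ) :
    XForm B D 0 (orbProd hF fun y => x - y) := by
  refine ⟨?_, ?_, fun g hg Z hZ => orbProd_inv hB hF _ hg hZ⟩
  · unfold orbProd
    refine differentiableOn_prod _ _ ?_
    intro φ hφ
    exact (differentiableOn_const x).sub (hF.orb_holo ((Set.Finite.mem_toFinset _).1 hφ))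
  · intro t ht Z hZ
    unfold orbProd
    rw [neg_zero, zpow_zero, one_mul]
    refine Finset.prod_congr rfl ?_
    intro φ hφ
    rw [Set.Finite.mem_toFinset] at hφ
    obtain ⟨g, hg, rfl⟩ := hφ
    simp only [Set.indicator_of_mem hZ, Set.indicator_of_mem (hhom t ht Z hZ)]
    rw [actR_smul, hF.homog t ht _ (OPlus.maps hg hZ), neg_zero, zpow_zero, one_mul]

end Forms

end Refl

open Matrix

namespace Refl

section Reflections

variable {n r : ℕ}

theorem bil_eq_sum_right {R : Type*} [CommRing R] (B : Matrix (Fin n) (Fin n) ℤ) (v : Fin n → ℤ)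
    (x : Fin n → R) :
    bil B (fun i => (v i : R)) x = ∑ j, ((bil B v (Pi.single j 1) : ℤ) : R) * x j := by
  unfold bil
  rw [Finset.sum_comm]
  refine Finset.sum_congr rfl fun j _ => ?_
  rw [← Finset.sum_mul]
  congr 1
  push_cast
  refine Finset.sum_congr rfl fun i _ => ?_
  rw [Finset.sum_eq_single j]
  · simp
  · intro b _ hb; simp [hb]
  · simp

/-- Integral reflection in a vector of norm `-2k` whose pairings are divisible by `k`. -/
theorem exists_reflection {B : Matrix (Fin n) (Fin n) ℤ} (hB : B.IsSymm) {v : Fin n → ℤ} {k : ℤ}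
    (hk : k ≠ 0) (hv2 : bil B v v = -2 * k) (hdiv : ∀ x : Fin n → ℤ, k ∣ bil B v x) :
    ∃ g : Matrix (Fin n) (Fin n) ℤ, gᵀ * B * g = B ∧ g * g = 1 ∧
      ∀ x : Fin n → ℂ, actR g x = x + (bil B (intC v) x / k) • intC v := by
  choose w hw using fun j : Fin n => hdiv (Pi.single j 1)
  have key : ∀ {R : Type} [CommRing R] (x : Fin n → R),
      actR (1 + vecMulVec v w) x = x + (∑ j, (w j : R) * x j) • fun i => (v i : R) := by
    intro R _ x
    ext i
    have h1 := congrFun (actR_one x) i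
    simp only [actR] at h1
    simp only [actR, Matrix.add_apply, vecMulVec_apply, Int.cast_add, add_mul,
      Finset.sum_add_distrib, Pi.add_apply, Pi.smul_apply, smul_eq_mul, h1, Finset.sum_mul]
    congr 1
    refine Finset.sum_congr rfl fun j _ => by push_cast; ring
  have hw' : ∀ {R : Type} [CommRing R] (x : Fin n → R),
      bil B (fun i => (v i : R)) x = k * ∑ j, (w j : R) * x j := by
    intro R _ x
    rw [bil_eq_sum_right, Finset.mul_sum]
    refine Finset.sum_congr rfl fun j _ => ?_
    rw [hw j]; push_cast; ring
  have hwv : ∑ j, w j * v j = -2 := by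
    have := hw' (R := ℤ) v
    simp only [Int.cast_id] at this
    rw [hv2] at this
    apply mul_left_cancel₀ hk
    linear_combination -this
  refine ⟨1 + vecMulVec v w, ?_, ?_, ?_⟩
  · apply isom_of_bil
    intro x y
    have hx := hw' (R := ℤ) x
    have hy := hw' (R := ℤ) y
    rw [key, key]
    simp only [Int.cast_id] at hx hy ⊢
    have hx' : bil B x v = k * ∑ j, w j * x j := by rw [bil_comm hB, hx]
    simp only [bil_add_left, bil_add_right, bil_smul_left, bil_smul_right, hx', hy, hv2]
    ring
  · apply mat_ext_actR
    intro x
    rw [actR_mul, key, key, actR_one]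
    ext i
    simp only [Int.cast_id, Pi.add_apply, Pi.smul_apply, smul_eq_mul, mul_add,
      Finset.sum_add_distrib]
    have : ∑ j, w j * ((∑ j, w j * x j) * v j) = (∑ j, w j * x j) * (-2) := by
      rw [← hwv, Finset.mul_sum]
      refine Finset.sum_congr rfl fun j _ => by ring
    rw [this]; ring
  · intro x
    have hk' : (k : ℂ) ≠ 0 := by exact_mod_cast hk
    have h := hw' (R := ℂ) x
    change bil B (intC v) x = _ at h
    rw [key, h, mul_div_cancel_left₀ _ hk']
    rfl

variable {C : Matrix (Fin r) (Fin r) ℤ}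

theorem mem_OPlus_of_involution (hC : PD C) {g : Matrix (Fin (2 + (2 + r))) (Fin (2 + (2 + r))) ℤ}
    (hg : gᵀ * MM C * g = MM C) (hgg : g * g = 1) {Z : Fin (2 + (2 + r)) → ℂ} (hZ : Z ∈ D0 C)
    (hgZ : actR g Z ∈ D0 C) : g ∈ OPlus (MM C) (D0 C) := by
  have hsub : actR g '' D0 C ⊆ D0 C := by
    refine subset_D0 hC ((isPreconnected_D0 hC).image _ (continuous_actR g).continuousOn) ?_
      ⟨Z, hZ, rfl⟩ hgZ
    rintro _ ⟨W, hW, rfl⟩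
    exact isom_mem_cone hg (D0_subset_cone hC hW)
  refine ⟨hg, ?_⟩
  rw [actC_eq_actR]
  refine hsub.antisymm fun W hW => ⟨actR g W, hsub ⟨W, hW, rfl⟩, ?_⟩
  rw [← actR_mul, hgg, actR_one]

theorem exists_OPlus_reflection (hC : PD C) {v : Fin (2 + (2 + r)) → ℤ} {k : ℤ}
    (hk : k ≠ 0) (hv2 : bil (MM C) v v = -2 * k) (hdiv : ∀ x : Fin (2 + (2 + r)) → ℤ, k ∣ bil (MM C) v x)
    {Z : Fin (2 + (2 + r)) → ℂ} (hZ : Z ∈ D0 C) (hvZ : bil (MM C) (intC v) Z = 0) :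
    ∃ g ∈ OPlus (MM C) (D0 C),
      ∀ x, actR g x = x + (bil (MM C) (intC v) x / k) • intC v := by
  obtain ⟨g, h1, h2, h3⟩ := exists_reflection hC.symmM hk hv2 hdiv
  refine ⟨g, mem_OPlus_of_involution hC h1 h2 hZ ?_, h3⟩
  rw [h3, hvZ]; simpa using hZ

theorem D0_smul {t : ℂ} (ht : t ≠ 0) {Z : Fin (2 + (2 + r)) → ℂ} (hZ : Z ∈ D0 C) :
    t • Z ∈ D0 C := by
  obtain ⟨c, hc, z, hz, rfl⟩ := hZ
  exact ⟨t * c, mul_ne_zero ht hc, z, hz, by rw [smul_smul]⟩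

theorem D0_normal (hC : PD C) {Z : Fin (2 + (2 + r)) → ℂ} (hZ : Z ∈ D0 C) :
    Z = hA Z • psi C ((hA Z)⁻¹ • hX Z) ∧ (hA Z)⁻¹ • hX Z ∈ Tube C := by
  have hc := D0_subset_cone hC hZ
  obtain ⟨h1, h2⟩ := cone_decomp hC hc
  exact ⟨h1, (mem_D0_iff hC hc).1 hZ, h2⟩

theorem XForm.tube (hC : PD C) {k : ℤ} {G : (Fin (2 + (2 + r)) → ℂ) → ℂ}
    (hG : XForm (MM C) (D0 C) k G) {g : Matrix (Fin (2 + (2 + r))) (Fin (2 + (2 + r))) ℤ}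
    (hg : g ∈ OPlus (MM C) (D0 C)) {z : Fin (2 + r) → ℂ} (hz : z ∈ Tube C) {a b : ℂ}
    {z' : Fin (2 + r) → ℂ} (ha : a ≠ 0) (h : actR g (psi C z) = hv a b (a • z')) :
    z' ∈ Tube C ∧ G (psi C z') = a ^ k * G (psi C z) := by
  have hW := OPlus.maps hg (psi_mem_D0 hz)
  obtain ⟨e, hm⟩ := D0_normal hC hW
  rw [h, hA_hv, hX_hv, smul_smul, inv_mul_cancel₀ ha, one_smul] at hm
  rw [h, hA_hv, hX_hv, smul_smul, inv_mul_cancel₀ ha, one_smul] at e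
  refine ⟨hm, ?_⟩
  rw [← hG.inv g hg _ (psi_mem_D0 hz), h, e, hG.homog a ha _ (psi_mem_D0 hm), ← mul_assoc,
    ← zpow_add₀ ha]
  simp

/-- Automorphic forms on the tube domain. -/
structure TForm (C : Matrix (Fin r) (Fin r) ℤ) (k : ℤ) (f : (Fin (2 + r) → ℂ) → ℂ) : Prop where
  holo : DifferentiableOn ℂ f (Tube C)
  refl : ∀ α : Fin (2 + r) → ℤ, bil (SM C) α α = -2 → ∀ b : ℤ, ∀ z ∈ Tube C,
    f (z + (bil (SM C) (intC α) z + b) • intC α) = f z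
  refl4 : ∀ u : Fin (2 + r) → ℤ, bil (SM C) u u = -4 → (∀ x, 2 ∣ bil (SM C) u x) → ∀ z ∈ Tube C,
    f (z + (bil (SM C) (intC u) z / 2) • intC u) = f z
  inv : ∀ z ∈ Tube C, f ((-2 / bil (SM C) z z) • z) = (-(bil (SM C) z z) / 2) ^ k * f z

theorem intC_hv (a b : ℤ) (x : Fin n → ℤ) : intC (hv a b x) = hv (a : ℂ) (b : ℂ) (intC x) :=
  map_hv _ _ _ _

theorem intR_hv (a b : ℤ) (x : Fin n → ℤ) : intR (hv a b x) = hv (a : ℝ) (b : ℝ) (intR x) :=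
  map_hv _ _ _ _

theorem cv_hv (a b : ℝ) (x : Fin n → ℝ) : cv (hv a b x) = hv (a : ℂ) (b : ℂ) (cv x) :=
  map_hv _ _ _ _

theorem imv_hv (a b : ℂ) (x : Fin n → ℂ) : imv (hv a b x) = hv a.im b.im (imv x) :=
  map_hv _ _ _ _

theorem base_mem (C : Matrix (Fin r) (Fin r) ℤ) : hv (1 : ℝ) 1 0 ∈ PosCone C := by
  refine ⟨by simp, ?_⟩
  rw [bil_hv]; simp

theorem bil_intC_real (α : Fin (2 + r) → ℤ) (y : Fin (2 + r) → ℝ) :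
    bil (SM C) (intC α) (cv y) = ((bil (SM C) (intR α) y : ℝ) : ℂ) := by
  rw [← cv_intR, bil_cv]

theorem I_smul_mem_tube {y : Fin (2 + r) → ℝ} (hy : y ∈ PosCone C) :
    Complex.I • cv y ∈ Tube C := by
  rw [mem_tube, imv_I_smul, rev_cv]; exact hy

/-- A point of the tube domain on the divisor of a vector with vanishing first coordinate. -/
theorem exists_tube_orth (hC : PD C) {α : Fin (2 + r) → ℤ} (hα : bil (SM C) α α < 0) (b : ℤ) :
    ∃ z ∈ Tube C, bil (SM C) (intC α) z + b = 0 := by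
  have hα' : bil (SM C) (intR α) (intR α) < 0 := by rw [bil_intR]; exact_mod_cast hα
  have hy := proj_mem_posCone hC (base_mem C) hα'
  set q := bil (SM C) (intR α) (intR α) with hq
  set p := bil (SM C) (intR α) (hv (1 : ℝ) 1 0)
  refine ⟨Complex.I • cv (hv (1 : ℝ) 1 0 - (p / q) • intR α) + cv ((-(b / q)) • intR α),
    tube_add_cv (I_smul_mem_tube hy) _, ?_⟩
  simp only [bil_add_right, bil_smul_right, bil_intC_real, bil_sub_right]
  rw [← hq, div_mul_cancel₀ _ hα'.ne, sub_self, neg_mul, div_mul_cancel₀ _ hα'.ne]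
  simp

theorem J_step (hC : PD C) {k : ℤ} {G : (Fin (2 + (2 + r)) → ℂ) → ℂ}
    (hG : XForm (MM C) (D0 C) k G) {z : Fin (2 + r) → ℂ} (hz : z ∈ Tube C)
    (hne : bil (SM C) z z ≠ 0) :
    (-2 / bil (SM C) z z) • z ∈ Tube C ∧
      G (psi C ((-2 / bil (SM C) z z) • z)) = (-(bil (SM C) z z) / 2) ^ k * G (psi C z) := by
  have hv2 : bil (MM C) (hv (1 : ℤ) (-1) (0 : Fin (2 + r) → ℤ)) (hv 1 (-1) 0) = -2 * 1 := by
    rw [bil_hv]; simp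
  have hfix : bil (MM C) (intC (hv (1 : ℤ) (-1) (0 : Fin (2 + r) → ℤ)))
      (psi C (Complex.I • cv (hv (1 : ℝ) 1 (0 : Fin r → ℝ)))) = 0 := by
    have h0 : intC (0 : Fin (2 + r) → ℤ) = 0 := by ext; simp [intC]
    unfold psi
    rw [intC_hv, bil_hv, h0, bil_smul_left, bil_smul_right, bil_cv, bil_hv]
    simp only [bil_zero_left]
    have := Complex.I_sq
    push_cast
    linear_combination -this
  obtain ⟨g, hg, hgx⟩ := exists_OPlus_reflection hC one_ne_zero hv2 (fun x => one_dvd _)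
    (psi_mem_D0 (I_smul_mem_tube (base_mem C))) hfix
  refine hG.tube hC hg hz (b := 1) (by simpa using hne) ?_
  have h0 : intC (0 : Fin (2 + r) → ℤ) = 0 := by ext; simp [intC]
  rw [hgx, intC_hv, h0]
  unfold psi
  rw [bil_hv, hv_smul, hv_add, hv_inj]
  refine ⟨by simp, by simp, ?_⟩
  rw [smul_zero, add_zero, smul_smul]
  have : -(bil (SM C) z z) / 2 * (-2 / bil (SM C) z z) = 1 := by field_simp
  rw [this, one_smul]

theorem bil_self_ne_zero (hC : PD C) {z : Fin (2 + r) → ℂ} (hz : z ∈ Tube C) :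
    bil (SM C) z z ≠ 0 := by
  intro h
  rw [bil_self_complex hC.symmS] at h
  have hre := congrArg Complex.re h
  have him := congrArg Complex.im h
  simp at hre him
  have hy := hz.2
  have := negdef_orth hC hy (x := rev z) him (by linarith)
  rw [this] at hre
  simp at hre; linarith

theorem refl_step (hC : PD C) {k : ℤ} {G : (Fin (2 + (2 + r)) → ℂ) → ℂ}
    (hG : XForm (MM C) (D0 C) k G) {z : Fin (2 + r) → ℂ} (hz : z ∈ Tube C)
    {α : Fin (2 + r) → ℤ} {m b : ℤ} (hm : 0 < m) (hα : bil (SM C) α α = -2 * m)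
    (hdiv : ∀ x, m ∣ bil (SM C) α x) (hb : m ∣ b) :
    G (psi C (z + ((bil (SM C) (intC α) z + b) / m) • intC α)) = G (psi C z) := by
  have hv2 : bil (MM C) (hv (0 : ℤ) b α) (hv 0 b α) = -2 * m := by
    rw [bil_hv, hα]; ring
  obtain ⟨z0, hz0, h0⟩ := exists_tube_orth hC (α := α) (by rw [hα]; linarith) b
  have hpair : ∀ z, bil (MM C) (intC (hv (0 : ℤ) b α)) (psi C z) = bil (SM C) (intC α) z + b := by
    intro z
    unfold psi
    rw [intC_hv, bil_hv]; simp; ring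
  obtain ⟨g, hg, hgx⟩ := exists_OPlus_reflection hC hm.ne' hv2 (by
      intro x
      obtain ⟨a', b', x', rfl⟩ := exists_hv x
      rw [bil_hv]
      have := hdiv x'
      have h2 : m ∣ b * a' := hb.mul_right _
      simpa using dvd_add h2 this)
    (psi_mem_D0 hz0) (by rw [hpair, h0])
  have := (hG.tube hC hg hz (a := 1)
    (b := -(bil (SM C) z z) / 2 + ((bil (SM C) (intC α) z + b) / m) * b)
    (z' := z + ((bil (SM C) (intC α) z + b) / m) • intC α) one_ne_zero (by
      rw [hgx, hpair, intC_hv]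
      unfold psi
      rw [hv_smul, hv_add, hv_inj]
      refine ⟨by simp, by simp, by simp⟩)).2
  rw [this]; simp

theorem differentiable_bil_self (B : Matrix (Fin n) (Fin n) ℤ) :
    Differentiable ℂ fun z : Fin n → ℂ => bil B z z := by
  unfold bil; fun_prop

theorem differentiable_psi : Differentiable ℂ (psi C) := by
  rw [differentiable_pi]
  intro i
  refine Fin.addCases (fun j => ?_) (fun j => ?_) i
  · fin_cases j
    · simp [psi, hv]
    · have h := differentiable_bil_self (SM C)
      have h2 : Differentiable ℂ fun z : Fin (2 + r) → ℂ => -(bil (SM C) z z) / 2 := by fun_prop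
      change Differentiable ℂ fun z => hB (psi C z)
      simpa [psi] using h2
  · simp [psi, hv]
    fun_prop

theorem XForm.toTForm (hC : PD C) {k : ℤ} {G : (Fin (2 + (2 + r)) → ℂ) → ℂ}
    (hG : XForm (MM C) (D0 C) k G) : TForm C k fun z => G (psi C z) := by
  refine ⟨?_, ?_, ?_, ?_⟩
  · exact hG.holo.comp differentiable_psi.differentiableOn fun z hz => psi_mem_D0 hz
  · intro α hα b z hz
    have := refl_step hC hG hz (m := 1) (b := b) one_pos (by rw [hα]; norm_num)
      (fun _ => one_dvd _) (one_dvd _)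
    simpa using this
  · intro u hu hdiv z hz
    have := refl_step hC hG hz (m := 2) (b := 0) two_pos (by rw [hu]; norm_num) hdiv (dvd_zero _)
    simpa using this
  · intro z hz
    exact (J_step hC hG hz (bil_self_ne_zero hC hz)).2

theorem tube_inv (hC : PD C) {z : Fin (2 + r) → ℂ} (hz : z ∈ Tube C) :
    (-2 / bil (SM C) z z) • z ∈ Tube C := by
  have hG : XForm (MM C) (D0 C) 0 fun _ => (0 : ℂ) :=
    ⟨differentiableOn_const _, by intros; simp, by intros; rfl⟩
  exact (J_step hC hG hz (bil_self_ne_zero hC hz)).1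

theorem tube_refl (hC : PD C) {z : Fin (2 + r) → ℂ} (hz : z ∈ Tube C) {α : Fin (2 + r) → ℤ}
    (hα : bil (SM C) α α = -2) (b : ℝ) :
    z + (bil (SM C) (intC α) z + b) • intC α ∈ Tube C := by
  have hα' : bil (SM C) (intR α) (intR α) = -2 := by rw [bil_intR, hα]; norm_num
  have := refl_mem_posCone hC hz (α := intR α) (by rw [hα']; norm_num)
  rw [mem_tube, imv_add, imv_smul_intC]
  convert this using 1
  rw [hα', ← cv_intR, Complex.add_im, im_bil_cv]
  ext i; simp; ring

end Reflections

end Refl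

open Matrix

namespace Refl

section Reduction

variable {n r : ℕ}

theorem bil_eq_dotProduct (B : Matrix (Fin n) (Fin n) ℤ) (x y : Fin n → ℤ) :
    bil B x y = x ⬝ᵥ B.mulVec y := by
  simp only [bil, dotProduct, mulVec, Finset.mul_sum]
  refine Finset.sum_congr rfl fun i _ => Finset.sum_congr rfl fun j _ => by rw [Int.cast_id]; ring

theorem det_ne_zero_of_nondeg {B : Matrix (Fin n) (Fin n) ℤ}
    (h : ∀ v : Fin n → ℤ, (∀ x : Fin n → ℤ, bil B x v = 0) → v = 0) : B.det ≠ 0 := by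
  intro hd
  obtain ⟨v, hv0, hv⟩ := Matrix.exists_mulVec_eq_zero_iff.2 hd
  exact hv0 (h v fun x => by rw [bil_eq_dotProduct, hv, dotProduct_zero])

variable {C : Matrix (Fin r) (Fin r) ℤ}

theorem PD.eq_zero_int (hC : PD C) (x : Fin r → ℤ) (h : bil C x x ≤ 0) : x = 0 := by
  have := hC.eq_zero (intR x) (by rw [bil_intR]; exact_mod_cast h)
  ext i
  have := congrFun this i
  simpa [intR] using this

theorem PD.det_ne_zero (hC : PD C) : (MM C).det ≠ 0 := by
  refine det_ne_zero_of_nondeg fun v h => ?_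
  obtain ⟨a, b, v, rfl⟩ := exists_hv v
  obtain ⟨a', b', x, rfl⟩ := exists_hv v
  have h1 := h (hv 1 0 0)
  have h2 := h (hv 0 1 0)
  have h3 := h (hv 0 0 (hv 1 0 0))
  have h4 := h (hv 0 0 (hv 0 1 0))
  have h5 := h (hv 0 0 (hv 0 0 x))
  simp only [bil_hv, bil_neg_mat, bil_zero_left] at h1 h2 h3 h4 h5
  have hx := hC.eq_zero_int x (by linarith)
  simp at h1 h2 h3 h4
  rw [h1, h2, h3, h4, hx, hv_zero, hv_zero]

/-- The block matrix scaling the two hyperbolic coordinates. -/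
def diagM (a b : ℤ) (g : Matrix (Fin n) (Fin n) ℤ) : Matrix (Fin (2 + n)) (Fin (2 + n)) ℤ :=
  dsum !![a, 0; 0, b] g

theorem actR_diagM {R : Type*} [CommRing R] (a b : ℤ) (g : Matrix (Fin n) (Fin n) ℤ) (x y : R)
    (z : Fin n → R) : actR (diagM a b g) (hv x y z) = hv (a * x) (b * y) (actR g z) := by
  ext i
  refine Fin.addCases (fun j => ?_) (fun j => ?_) i
  · fin_cases j <;> simp [actR, diagM, dsum, hv, Fin.sum_univ_add, Matrix.fromBlocks]
  · simp [actR, diagM, dsum, hv, Fin.sum_univ_add, Matrix.fromBlocks]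

theorem bil_dsum_smul_U {R : Type*} [CommRing R] (m : ℤ) (A : Matrix (Fin n) (Fin n) ℤ)
    (a b a' b' : R) (x x' : Fin n → R) :
    bil (dsum (m • U) A) (hv a b x) (hv a' b' x') = m * (a * b' + b * a') + bil A x x' := by
  unfold hv
  rw [bil_dsum]
  congr 1
  simp [bil, U, Fin.sum_univ_two]
  ring

theorem scaled_isom_of_bil {B B' g : Matrix (Fin n) (Fin n) ℤ} {t : ℤ}
    (H : ∀ x y : Fin n → ℤ, bil B' (actR g x) (actR g y) = t * bil B x y) :
    gᵀ * B' * g = t • B := by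
  ext i j
  have := H (Pi.single i 1) (Pi.single j 1)
  rw [bil_act, bil_single, bil_single] at this
  simpa using this

theorem actR_smul_one' {R : Type*} [CommRing R] (s : ℤ) (x : Fin n → R) :
    actR (s • (1 : Matrix (Fin n) (Fin n) ℤ)) x = (s : R) • x := by
  ext i
  have := congrFun (actR_one x) i
  simp only [actR] at this
  simp only [actR, Matrix.smul_apply, smul_eq_mul, Int.cast_mul, mul_assoc, ← Finset.mul_sum, this,
    Pi.smul_apply]

/-- The statement that forms with zeros only on mirrors of roots have no zeros at all. -/
def ZeroFree (C : Matrix (Fin r) (Fin r) ℤ) : Prop :=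
  ∀ (k : ℤ) (f : (Fin (2 + r) → ℂ) → ℂ), TForm C k f →
    (∀ z ∈ Tube C, f z = 0 → ∃ v : Fin (2 + (2 + r)) → ℤ, bil (MM C) v v = -2 ∧
      bil (MM C) (intC v) (psi C z) = 0) → ∀ z ∈ Tube C, f z ≠ 0

theorem const_of_finite {X : Type*} [TopologicalSpace X] {D : Set X} (hD : IsPreconnected D)
    {F : X → ℂ} (hF : ContinuousOn F D) {T : Set ℂ} (hT : T.Finite) (h : ∀ x ∈ D, F x ∈ T) :
    ∃ c, ∀ x ∈ D, F x = c := by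
  rcases D.eq_empty_or_nonempty with rfl | ⟨x0, hx0⟩
  · exact ⟨0, by simp⟩
  refine ⟨F x0, fun x hx => ?_⟩
  have := hT.countable.isTotallyDisconnected (F '' D) (by rintro _ ⟨y, hy, rfl⟩; exact h y hy)
    (hD.image _ hF)
  exact this ⟨x, hx, rfl⟩ ⟨x0, hx0, rfl⟩

/-- The weight-zero automorphic functions on `D0` are constant. -/
def WeightZeroConst (C : Matrix (Fin r) (Fin r) ℤ) : Prop :=
  ∀ h, XForm (MM C) (D0 C) 0 h → ∃ c, ∀ Z ∈ D0 C, h Z = c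

def NonvanishingWeight (C : Matrix (Fin r) (Fin r) ℤ) : Prop :=
  ∀ (k : ℤ) (f : (Fin (2 + r) → ℂ) → ℂ), TForm C k f → (∀ z ∈ Tube C, f z ≠ 0) → k = 0

theorem AInv.const (hC : PD C) (hW : WeightZeroConst C) {F : (Fin (2 + (2 + r)) → ℂ) → ℂ}
    (hF : AInv (MM C) (D0 C) 0 F) : ∃ c, ∀ Z ∈ D0 C, F Z = c := by
  have hp := isPreconnected_D0 hC
  rcases (D0 C).eq_empty_or_nonempty with he | ⟨Z1, hZ1⟩
  · exact ⟨0, by simp [he]⟩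
  refine const_of_finite hp hF.holo.continuousOn
    (hF.fin.image fun φ => φ Z1) fun Z hZ => ?_
  obtain ⟨c, hc⟩ := hW _ (hF.charForm hC.det_ne_zero (fun t ht Z hZ => D0_smul ht hZ) (F Z))
  have h0 : orbProd hF (fun y => F Z - y) Z = 0 :=
    Finset.prod_eq_zero (hF.fin.mem_toFinset.2 AInv.self_mem_orb) (by simp [hZ])
  have h1 : orbProd hF (fun y => F Z - y) Z1 = 0 := by rw [hc Z1 hZ1, ← hc Z hZ, h0]
  obtain ⟨φ, hφ, h2⟩ := Finset.prod_eq_zero_iff.1 h1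
  exact ⟨φ, hF.fin.mem_toFinset.1 hφ, (sub_eq_zero.1 h2).symm⟩

theorem AInv.const_of_mirrors (hC : PD C) (hZF : ZeroFree C) (hNV : NonvanishingWeight C)
    (hW : WeightZeroConst C) {k : ℤ} {F : (Fin (2 + (2 + r)) → ℂ) → ℂ}
    (hF : AInv (MM C) (D0 C) k F)
    (hz : ∀ Z ∈ D0 C, F Z = 0 → ∃ v : Fin (2 + (2 + r)) → ℤ, bil (MM C) v v = -2 ∧
      bil (MM C) (intC v) Z = 0) : ∃ c, ∀ Z ∈ D0 C, F Z = c := by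
  have hG := hF.prodForm hC.det_ne_zero fun t ht Z hZ => D0_smul ht hZ
  have hT := hG.toTForm hC
  have hnz := hZF _ _ hT (by
    intro z hz' h0
    obtain ⟨φ, hφ, h2⟩ := Finset.prod_eq_zero_iff.1 h0
    obtain ⟨g, hg, rfl⟩ := hF.fin.mem_toFinset.1 hφ
    have hm := psi_mem_D0 hz'
    simp only [Set.indicator_of_mem hm, id] at h2
    obtain ⟨v, hv2, hv0⟩ := hz _ (OPlus.maps hg hm) h2
    obtain ⟨h, -, hgh, -⟩ := OPlus.inv hC.det_ne_zero hg
    have e1 : actR g (actR h v) = v := by rw [← actR_mul, hgh, actR_one]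
    have e2 : actR g (intC (actR h v)) = intC v := by
      have := actR_map (Int.castRingHom ℂ) g (actR h v)
      rw [e1] at this
      exact this.symm
    refine ⟨actR h v, ?_, ?_⟩
    · rw [← hv2]
      conv_rhs => rw [← e1, bil_act, hg.1]
    · rw [← hv0, ← e2, bil_act, hg.1])
  have hk := hNV _ _ hT hnz
  have hcard : (hF.fin.toFinset.card : ℤ) ≠ 0 := by
    rw [Nat.cast_ne_zero, Finset.card_ne_zero]
    exact ⟨_, hF.fin.mem_toFinset.2 AInv.self_mem_orb⟩
  obtain rfl : k = 0 := (mul_eq_zero.1 hk).resolve_right hcard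
  exact hF.const hC hW

theorem not_reflective_of_embedding (hC : PD C) (hZF : ZeroFree C) (hNV : NonvanishingWeight C)
    (hW : WeightZeroConst C) {K E E' : Matrix (Fin r) (Fin r) ℤ} {d : ℤ} (hd : 0 < d)
    (hE : Eᵀ * C * E = K) (h1 : E * E' = d • 1) (h2 : E' * E = d • 1) {m : ℤ} (hm : 0 < m) :
    ¬ Is2Reflective (dsum (m • U) (dsum U (-K))) := by
  rintro ⟨D', ⟨Z', hZ', rfl⟩, Γ, χ, k, F, hΓ, hχ, hF, hnc, hzero⟩
  set B' := dsum (m • U) (dsum U (-K)) with hB'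
  have hEE : ∀ {R : Type} [CommRing R] (x : Fin r → R), actR E (actR E' x) = (d : R) • x := by
    intro R _ x; rw [← actR_mul, h1, actR_smul_one']
  have hEE' : ∀ {R : Type} [CommRing R] (x : Fin r → R), actR E' (actR E x) = (d : R) • x := by
    intro R _ x; rw [← actR_mul, h2, actR_smul_one']
  have hbE : ∀ {R : Type} [CommRing R] (x y : Fin r → R),
      bil C (actR E x) (actR E y) = bil K x y := by
    intro R _ x y; rw [bil_act, hE]
  have hQB' : ∀ ε : ℤ, ε * ε = 1 → (diagM (ε * m) ε (diagM 1 1 E))ᵀ * MM C *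
      (diagM (ε * m) ε (diagM 1 1 E)) = (1 : ℤ) • B' := by
    intro ε hε
    apply scaled_isom_of_bil
    intro x y
    obtain ⟨a, b, x, rfl⟩ := exists_hv x
    obtain ⟨a', b', x, rfl⟩ := exists_hv x
    obtain ⟨c, e, y, rfl⟩ := exists_hv y
    obtain ⟨c', e', y, rfl⟩ := exists_hv y
    simp only [hB', actR_diagM, bil_dsum_smul_U, bil_hv, bil_neg_mat, hbE, Int.cast_id]
    linear_combination (m * a * e + m * b * c) * hε
  obtain ⟨ε, hε, hε2⟩ : ∃ ε : ℤ, ε * ε = 1 ∧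
      actR (diagM (ε * m) ε (diagM 1 1 E)) Z' ∈ D0 C := by
    have hc1 := act_mem_cone one_pos (hQB' 1 (by norm_num)) hZ'
    have hc2 := act_mem_cone one_pos (hQB' (-1) (by norm_num)) hZ'
    have hne := hA_ne_zero hC (cone_decomp hC hc1).2
    obtain ⟨a, b, x, rfl⟩ := exists_hv Z'
    rcases lt_or_gt_of_ne hne with h | h
    · refine ⟨-1, by norm_num, (mem_D0_iff hC hc2).2 ?_⟩
      have e : (hA (actR (diagM (-1 * m) (-1) (diagM 1 1 E)) (hv a b x)))⁻¹ •
          hX (actR (diagM (-1 * m) (-1) (diagM 1 1 E)) (hv a b x)) =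
          (((-1 : ℝ)) : ℂ) • ((hA (actR (diagM (1 * m) 1 (diagM 1 1 E)) (hv a b x)))⁻¹ •
          hX (actR (diagM (1 * m) 1 (diagM 1 1 E)) (hv a b x))) := by
        simp only [actR_diagM, hA_hv, hX_hv, smul_smul]
        congr 1
        push_cast
        rw [show (-1 * (m : ℂ) * a) = -(1 * (m : ℂ) * a) by ring, inv_neg]; ring
      rw [e, imv_real_smul]
      simp only [hA, Pi.smul_apply, smul_eq_mul] at h ⊢
      linarith
    · exact ⟨1, by norm_num, (mem_D0_iff hC hc1).2 h⟩
  set Q := diagM (ε * m) ε (diagM 1 1 E) with hQ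
  set P := diagM (ε * d) (ε * (m * d)) (diagM (m * d) (m * d) (m • E')) with hP
  have hsm : ∀ {R : Type} [CommRing R] (x : Fin r → R), actR (m • E') x = (m : R) • actR E' x := by
    intro R _ x
    ext i
    simp [actR, Finset.mul_sum, mul_assoc]
  have hQB : Qᵀ * MM C * Q = B' := by rw [hQB' ε hε, one_zsmul]
  have hQP : Q * P = (m * d) • 1 := by
    apply mat_ext_actR
    intro x
    obtain ⟨a, b, x, rfl⟩ := exists_hv x
    obtain ⟨a', b', x, rfl⟩ := exists_hv x
    rw [actR_mul, actR_smul_one']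
    simp only [hQ, hP, actR_diagM, hsm, actR_smul, hEE, hv_smul, hv_inj, smul_smul]
    simp only [Int.cast_id]
    refine ⟨?_, ?_, by ring, by ring, ?_⟩
    · linear_combination (m * d * a) * hε
    · linear_combination (m * d * b) * hε
    · trivial
  have hPQ : P * Q = (m * d) • 1 := by
    apply mat_ext_actR
    intro x
    obtain ⟨a, b, x, rfl⟩ := exists_hv x
    obtain ⟨a', b', x, rfl⟩ := exists_hv x
    rw [actR_mul, actR_smul_one']
    simp only [hQ, hP, actR_diagM, hsm, hEE', hv_smul, hv_inj, smul_smul]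
    simp only [Int.cast_id]
    refine ⟨?_, ?_, by ring, by ring, ?_⟩
    · linear_combination (m * d * a) * hε
    · linear_combination (m * d * b) * hε
    · trivial
  have hs : m * d ≠ 0 := (mul_pos hm hd).ne'
  have hPB : Pᵀ * B' * P = ((m * d) ^ 2) • MM C := by
    rw [← hQB]
    apply scaled_isom_of_bil
    intro x y
    rw [← bil_act, ← actR_mul, ← actR_mul, hQP]
    simp only [actR_smul_one', bil_smul_left, bil_smul_right]
    simp; ring
  have hQdet : Q.det ≠ 0 := by
    intro h0
    have := congrArg Matrix.det hPQ
    rw [Matrix.det_mul, h0, mul_zero, Matrix.det_smul, Matrix.det_one, mul_one] at this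
    exact pow_ne_zero _ hs this.symm
  have hB'det : B'.det ≠ 0 := by
    rw [← hQB, Matrix.det_mul, Matrix.det_mul, Matrix.det_transpose]
    exact mul_ne_zero (mul_ne_zero hQdet hC.det_ne_zero) hQdet
  have hsC : ((m * d : ℤ) : ℂ) ≠ 0 := by exact_mod_cast hs
  have hD'c : connectedComponentIn (Cone B') Z' ⊆ Cone B' := connectedComponentIn_subset _ _
  have hcomp : ∀ W ∈ connectedComponentIn (Cone B') Z',
      connectedComponentIn (Cone B') W = connectedComponentIn (Cone B') Z' :=
    fun W hW => (connectedComponentIn_eq hW).symm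
  have hZ'D : Z' ∈ connectedComponentIn (Cone B') Z' := mem_connectedComponentIn hZ'
  have hQPx : ∀ Z : Fin (2 + (2 + r)) → ℂ, actR Q (actR P Z) = ((m * d : ℤ) : ℂ) • Z := by
    intro Z; rw [← actR_mul, hQP, actR_smul_one']
  have hPQx : ∀ Z : Fin (2 + (2 + r)) → ℂ, actR P (actR Q Z) = ((m * d : ℤ) : ℂ) • Z := by
    intro Z; rw [← actR_mul, hPQ, actR_smul_one']
  have hQD : ∀ W ∈ connectedComponentIn (Cone B') Z', actR Q W ∈ D0 C := by
    have hsub := subset_D0 hC ((isPreconnected_connectedComponentIn (x := Z') (F := Cone B')).image _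
      (continuous_actR Q).continuousOn) (by
        rintro _ ⟨W, hW, rfl⟩
        exact act_mem_cone one_pos (by rw [hQB, one_zsmul]) (hD'c hW)) ⟨Z', hZ'D, rfl⟩ hε2
    exact fun W hW => hsub ⟨W, hW, rfl⟩
  have hPD : ∀ Z ∈ D0 C, actR P Z ∈ connectedComponentIn (Cone B') Z' := by
    have hsub := ((isPreconnected_D0 hC).image _
      (continuous_actR P).continuousOn).subset_connectedComponentIn (F := Cone B')
      (x := Z') (by
        refine ⟨((m * d : ℤ) : ℂ)⁻¹ • actR Q Z', D0_smul (inv_ne_zero hsC) hε2, ?_⟩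
        rw [actR_smul, hPQx, smul_smul, inv_mul_cancel₀ hsC, one_smul]) (by
        rintro _ ⟨W, hW, rfl⟩
        exact act_mem_cone (by positivity) hPB (D0_subset_cone hC hW))
    exact fun W hW => hsub ⟨W, hW, rfl⟩
  have hFA := AInv.of_modular hB'det hΓ hχ hF
  have hFP := AInv.pullback hC.det_ne_zero hs hPQ hQP hPB hPD ⟨_, hε2⟩ hD'c hcomp hFA
  obtain ⟨c, hc⟩ := hFP.const_of_mirrors hC hZF hNV hW (by
    intro Z hZ h0
    obtain ⟨v, hv2, hv0⟩ := hzero _ (hPD Z hZ) h0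
    have e : bil B' (actR P Z) (intC v) = ((m * d : ℤ) : ℂ) * bil (MM C) Z (actR Q (intC v)) := by
      rw [← hQB, ← bil_act, hQPx, bil_smul_left]
    refine ⟨actR Q v, ?_, ?_⟩
    · rw [bil_act, hQB, ← qnorm_eq_bil, hv2]
    · have hv0' : bil B' (actR P Z) (intC v) = 0 := hv0
      rw [e] at hv0'
      have := (mul_eq_zero.1 hv0').resolve_left hsC
      rw [bil_comm hC.symmM, ← this]
      congr 1
      exact actR_map (Int.castRingHom ℂ) Q v)
  refine hnc ⟨c, fun W hW => ?_⟩
  have := hc _ (D0_smul (inv_ne_zero hsC) (hQD W hW))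
  simpa only [actR_smul, hPQx, smul_smul, inv_mul_cancel₀ hsC, one_smul] using this

end Reduction

end Refl

open Matrix

namespace Refl

section Koecher

variable {n r : ℕ} {C : Matrix (Fin r) (Fin r) ℤ} {k : ℤ} {f : (Fin (2 + r) → ℂ) → ℂ}

theorem mem_tube_hv {τ ω : ℂ} {z : Fin r → ℂ} :
    hv τ ω z ∈ Tube C ↔ 0 < τ.im ∧ bil C (imv z) (imv z) < 2 * (τ.im * ω.im) := by
  rw [mem_tube, imv_hv]
  unfold PosCone
  simp only [Set.mem_ofPred_eq, hA_hv, bil_S]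
  constructor
  · rintro ⟨h1, h2⟩; exact ⟨h1, by linarith⟩
  · rintro ⟨h1, h2⟩; exact ⟨h1, by linarith⟩

theorem intC_zero : intC (0 : Fin n → ℤ) = 0 := by ext; simp [intC]

theorem intC_add (x y : Fin n → ℤ) : intC (x + y) = intC x + intC y := by ext; simp [intC]

theorem intC_neg (x : Fin n → ℤ) : intC (-x) = -intC x := by ext; simp [intC]

theorem intC_smul (c : ℤ) (x : Fin n → ℤ) : intC (c • x) = (c : ℂ) • intC x := by
  ext; simp [intC]

theorem intR_neg (x : Fin n → ℤ) : intR (-x) = -intR x := by ext; simp [intR]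

theorem intC_single (i : Fin n) : intC (Pi.single i 1) = Pi.single i 1 := by
  ext j; rcases eq_or_ne j i with rfl | h <;> simp [intC, *]

theorem intR_single (i : Fin n) : intR (Pi.single i 1) = Pi.single i 1 := by
  ext j; rcases eq_or_ne j i with rfl | h <;> simp [intR, *]

/-- The lattice vectors along which `f` is periodic. -/
def periods (C : Matrix (Fin r) (Fin r) ℤ) (f : (Fin (2 + r) → ℂ) → ℂ) :
    AddSubgroup (Fin (2 + r) → ℤ) where
  carrier := {l | ∀ z ∈ Tube C, f (z + intC l) = f z}
  zero_mem' := by intro z _; simp [intC_zero]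
  add_mem' := by
    intro a b ha hb z hz
    rw [intC_add, ← add_assoc, hb _ (tube_add_intC hz a), ha z hz]
  neg_mem' := by
    intro a ha z hz
    have := ha _ (tube_add_intC hz (-a))
    rw [add_assoc, ← intC_add, neg_add_cancel, intC_zero, add_zero] at this
    exact this.symm

theorem TForm.root_mem_periods (hC : PD C) (hf : TForm C k f) {α : Fin (2 + r) → ℤ}
    (hα : bil (SM C) α α = -2) : α ∈ periods C f := by
  intro z hz
  have hz' := tube_refl hC hz hα 0
  have h1 := hf.refl α hα 0 z hz
  have h2 := hf.refl α hα 1 _ hz'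
  simp only [Complex.ofReal_zero, Int.cast_zero, Int.cast_one] at h1 h2
  rw [h1] at h2
  rw [← h2]
  congr 1
  have : bil (SM C) (intC α) (intC α) = -2 := by rw [bil_intC, hα]; norm_num
  simp only [bil_add_right, bil_smul_right, this]
  rw [add_assoc, ← add_smul]
  ring_nf
  rw [one_smul]

theorem bil_single_int (i j : Fin r) :
    bil C (Pi.single i (1 : ℤ)) (Pi.single j 1) = C i j := by
  rw [bil_single]; simp

theorem hv_decomp (a b : ℤ) (x : Fin n → ℤ) :
    hv a b x = a • hv 1 0 0 + b • hv 0 1 0 + ∑ i, x i • hv 0 0 (Pi.single i 1) := by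
  have h : ∀ s : Finset (Fin n), ∑ i ∈ s, x i • hv (0 : ℤ) 0 (Pi.single i (1 : ℤ)) =
      hv 0 0 (∑ i ∈ s, x i • Pi.single i (1 : ℤ)) := by
    intro s
    induction s using Finset.induction_on with
    | empty => simp [hv_zero]
    | insert i s hi ih => rw [Finset.sum_insert hi, Finset.sum_insert hi, ih, hv_smul, hv_add]; simp
  rw [h, hv_smul, hv_smul, hv_add, hv_add, hv_inj]
  refine ⟨by simp, by simp, ?_⟩
  ext j
  simp [Finset.sum_apply, Pi.single_apply]

theorem TForm.periods_eq_top (hC : PD C) (hd : ∀ i, C i i = 2) (i0 : Fin r) (hf : TForm C k f) :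
    periods C f = ⊤ := by
  have hs : ∀ a b : ℤ, ∀ i, a * b = 0 → hv a b (Pi.single i 1) ∈ periods C f := by
    intro a b i hab
    refine hf.root_mem_periods hC ?_
    rw [bil_S, bil_single_int, hd]; linarith
  have he : ∀ a b : ℤ, a * b = 0 → hv a b 0 ∈ periods C f := by
    intro a b hab
    have := sub_mem (hs a b i0 hab) (hs 0 0 i0 (by simp))
    rwa [hv_sub, sub_zero, sub_zero, sub_self] at this
  rw [eq_top_iff]
  rintro x -
  obtain ⟨a, b, x, rfl⟩ := exists_hv x
  rw [hv_decomp]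
  exact add_mem (add_mem (zsmul_mem (he _ _ (by simp)) _) (zsmul_mem (he _ _ (by simp)) _))
    (sum_mem fun i _ => zsmul_mem (hs _ _ i (by simp)) _)

theorem TForm.trans (hC : PD C) (hd : ∀ i, C i i = 2) (i0 : Fin r) (hf : TForm C k f)
    (l : Fin (2 + r) → ℤ) {z : Fin (2 + r) → ℂ} (hz : z ∈ Tube C) : f (z + intC l) = f z := by
  have : l ∈ periods C f := by rw [hf.periods_eq_top hC hd i0]; trivial
  exact this z hz

theorem TForm.swap (hf : TForm C k f) {τ ω : ℂ} {z : Fin r → ℂ} (hz : hv τ ω z ∈ Tube C) :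
    f (hv ω τ z) = f (hv τ ω z) := by
  rw [← hf.refl (hv 1 (-1) 0) (by rw [bil_S]; simp) 0 _ hz]
  congr 1
  rw [intC_hv, intC_zero, bil_S, hv_smul, hv_add, hv_inj]
  refine ⟨?_, ?_, ?_⟩ <;> simp

theorem imv_zero : imv (0 : Fin n → ℂ) = 0 := by ext; simp [imv]

theorem mem_tube_slice {τ ω : ℂ} : hv τ ω 0 ∈ Tube C ↔ 0 < τ.im ∧ 0 < ω.im := by
  rw [mem_tube_hv, imv_zero, bil_zero_left]
  constructor
  · rintro ⟨h1, h2⟩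
    exact ⟨h1, by by_contra h; nlinarith⟩
  · rintro ⟨h1, h2⟩; exact ⟨h1, by positivity⟩

theorem im_neg_inv_pos {τ : ℂ} (h : 0 < τ.im) : 0 < (-1 / τ).im := by
  have hτ : τ ≠ 0 := by rintro rfl; simp at h
  rw [neg_div, one_div, Complex.neg_im, Complex.inv_im, neg_div, neg_neg]
  exact div_pos h (Complex.normSq_pos.2 hτ)

theorem TForm.inv_slice (hf : TForm C k f) {τ ω : ℂ} (h1 : 0 < τ.im) (h2 : 0 < ω.im) :
    f (hv (-1 / τ) (-1 / ω) 0) = (-(τ * ω)) ^ k * f (hv τ ω 0) := by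
  have hz := mem_tube_slice (C := C).2 ⟨h1, h2⟩
  have hτ : τ ≠ 0 := by rintro rfl; simp at h1
  have hω : ω ≠ 0 := by rintro rfl; simp at h2
  have := hf.inv _ hz
  rw [hf.swap (mem_tube_slice.2 ⟨im_neg_inv_pos h2, im_neg_inv_pos h1⟩)]
  rw [bil_S, hv_smul, bil_zero_left, smul_zero] at this
  convert this using 2
  · rw [hv_inj]; refine ⟨by field_simp; ring, by field_simp; ring, rfl⟩
  · congr 1; ring

theorem TForm.neg_inv_slice (hC : PD C) (hd : ∀ i, C i i = 2) (i0 : Fin r) (hf : TForm C k f)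
    {τ ω : ℂ} (h1 : 0 < τ.im) (h2 : 0 < ω.im) :
    f (hv (-1 / τ) ω 0) = τ ^ k * f (hv τ ω 0) := by
  have hT : ∀ {τ ω : ℂ}, 0 < τ.im → 0 < ω.im → f (hv (τ + 1) ω 0) = f (hv τ ω 0) := by
    intro τ ω h1 h2
    rw [← hf.trans hC hd i0 (hv 1 0 0) (mem_tube_slice.2 ⟨h1, h2⟩), intC_hv, hv_add, intC_zero]
    simp
  have hI : ∀ {τ : ℂ}, 0 < τ.im → 0 < (-1 / τ).im := im_neg_inv_pos
  have h0 : ∀ {τ : ℂ}, 0 < τ.im → τ ≠ 0 := by rintro τ h1 rfl; simp at h1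
  have hV : ∀ {τ ω : ℂ}, 0 < τ.im → 0 < ω.im →
      f (hv (-1 / (-1 / τ + 1)) ω 0) = (1 - τ) ^ k * f (hv τ ω 0) := by
    intro τ ω h1 h2
    have e := hf.inv_slice (τ := -1 / τ + 1) (ω := -1 / ω) (by simpa using hI h1) (hI h2)
    rw [hT (hI h1) (hI h2), hf.inv_slice h1 h2, ← mul_assoc, ← mul_zpow] at e
    have hτ := h0 h1
    have hω := h0 h2
    convert e using 2
    · rw [hv_inj]; refine ⟨rfl, by field_simp, rfl⟩
    · congr 1; field_simp; ring
  have key : ∀ {τ ω : ℂ}, 0 < τ.im → 0 < ω.im →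
      f (hv (-1 / τ) ω 0) = (-τ) ^ k * f (hv τ ω 0) := by
    intro τ ω h1 h2
    have h1' : 0 < (τ + 1).im := by simpa
    have hτ := h0 h1
    have hτ1 := h0 h1'
    have e : -1 / (-1 / (τ + 1) + 1) = -1 / τ - 1 := by
      have : -1 / (τ + 1) + 1 = τ / (τ + 1) := by field_simp; ring
      rw [this]; field_simp; ring
    have hh := hV h1' h2
    rw [e, hT h1 h2] at hh
    have hi : 0 < (-1 / τ - 1).im := by simpa using hI h1
    have := hT hi h2
    rw [sub_add_cancel] at this
    rw [this, hh]; congr 2; ring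
  have h3 := key h1 h2
  have h4 := key (hI h1) h2
  have hτ := h0 h1
  have e : -1 / (-1 / τ) = τ := by field_simp
  rw [e, h3, ← mul_assoc, ← mul_zpow] at h4
  have e2 : (-(-1 / τ) * -τ) = -1 := by field_simp
  rw [e2] at h4
  rw [h3, neg_eq_neg_one_mul τ, mul_zpow, mul_right_comm, ← h4, mul_comm]

theorem TForm.exists_slice_bound (hC : PD C) (hd : ∀ i, C i i = 2) (i0 : Fin r)
    (hf : TForm C k f) {t : ℝ} (ht : 0 < t) :
    ∃ M : ℝ, ∀ ω : ℂ, 1 ≤ ω.im → ‖f (hv (t * Complex.I) ω 0)‖ ≤ M := by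
  set w : Fin r → ℤ := Pi.single i0 1 with hw
  have hw2 : bil C w w = 2 := by rw [hw, bil_single_int, hd]
  have hw2C : bil C (intC w) (intC w) = 2 := by rw [bil_intC, hw2]; norm_num
  have hmem : ∀ (τ s ω : ℂ), τ.im = t → (hv τ ω (s • intC w) ∈ Tube C ↔ s.im ^ 2 < t * ω.im) := by
    intro τ s ω hτ
    have hw2R : bil C (intR w) (intR w) = 2 := by rw [bil_intR, hw2]; norm_num
    rw [mem_tube_hv, imv_smul_intC, bil_smul_left, bil_smul_right, hw2R, hτ]
    constructor
    · rintro ⟨-, h⟩; linarith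
    · intro h; exact ⟨ht, by linarith⟩
  have ht' : ((t : ℂ) * Complex.I).im = t := by simp
  have hm := fun s ω => hmem (t * Complex.I) s ω ht'
  have := koecher_bound t ht (fun s ω => f (hv (t * Complex.I) ω (s • intC w))) ?_ ?_ ?_ ?_ ?_
  · simpa using this
  · refine hf.holo.continuousOn.comp (Continuous.continuousOn ?_) fun p hp => (hm _ _).2 hp
    exact continuous_hv continuous_const continuous_snd (by fun_prop)
  · intro ω
    refine hf.holo.comp (Differentiable.differentiableOn ?_) fun s hs => (hm _ _).2 hs
    have : (fun s : ℂ => hv (t * Complex.I) ω (s • intC w)) =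
        fun s : ℂ => hv (t * Complex.I) ω 0 + s • hv 0 0 (intC w) := by
      ext1 s; rw [hv_smul, hv_add]; simp
    rw [this]; fun_prop
  · intro s ω hs
    have := hf.trans hC hd i0 (hv 0 0 w) ((hm s ω).2 hs)
    rw [intC_hv, hv_add] at this
    simpa [add_smul] using this
  · intro s ω hs
    have := hf.trans hC hd i0 (hv 0 1 0) ((hm s ω).2 hs)
    rw [intC_hv, hv_add, intC_zero] at this
    simpa using this
  · intro s ω hs
    have hz := (hm s ω).2 hs
    have e1 := hf.refl (hv 0 0 w) (by rw [bil_S, hw2]; simp) 0 _ hz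
    have hz1 := tube_refl hC hz (α := hv 0 0 w) (by rw [bil_S, hw2]; simp) 0
    have e2 := hf.refl (hv 0 1 w) (by rw [bil_S, hw2]; simp) 0 _ hz1
    simp only [intC_hv, bil_S, hv_smul, hv_add, bil_smul_right, hw2C, Int.cast_zero, Int.cast_one,
      Complex.ofReal_zero, ← add_smul] at e1 e2
    rw [← e1, ← e2]
    congr 1
    rw [hv_inj]
    refine ⟨by ring, by ring, ?_⟩
    congr 1; ring

theorem slice_differentiableOn (hf : TForm C k f) {τ : ℂ} (hτ : 0 < τ.im) :
    DifferentiableOn ℂ (fun ω => f (hv τ ω 0)) {z | 0 < z.im} := by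
  refine hf.holo.comp (Differentiable.differentiableOn ?_) fun s hs => mem_tube_slice.2 ⟨hτ, hs⟩
  have : (fun s : ℂ => hv τ s (0 : Fin r → ℂ)) = fun s : ℂ => hv τ 0 0 + s • hv 0 1 0 := by
    ext1 s; rw [hv_smul, hv_add]; simp
  rw [this]; fun_prop

theorem TForm.slice_props (hC : PD C) (hd : ∀ i, C i i = 2) (i0 : Fin r) (hf : TForm C k f)
    {τ : ℂ} (hτ : 0 < τ.im) :
    (∀ ω : ℂ, 0 < ω.im → f (hv τ (ω + 1) 0) = f (hv τ ω 0)) ∧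
    (∀ ω : ℂ, 0 < ω.im → f (hv τ (-1 / ω) 0) = ω ^ k * f (hv τ ω 0)) := by
  constructor
  · intro ω hω
    rw [← hf.trans hC hd i0 (hv 0 1 0) (mem_tube_slice.2 ⟨hτ, hω⟩), intC_hv, hv_add, intC_zero]
    simp
  · intro ω hω
    have h1 := im_neg_inv_pos hω
    rw [hf.swap (mem_tube_slice.2 ⟨h1, hτ⟩), hf.neg_inv_slice hC hd i0 hω hτ,
      hf.swap (mem_tube_slice.2 ⟨hω, hτ⟩)]

theorem nonvanishingWeight (hC : PD C) (hd : ∀ i, C i i = 2) (i0 : Fin r) :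
    NonvanishingWeight C := by
  have key : ∀ (k : ℤ) (f : (Fin (2 + r) → ℂ) → ℂ), TForm C k f → (∀ z ∈ Tube C, f z ≠ 0) →
      ¬ k < 0 := by
    intro k f hf hnz hk
    have hI : 0 < (((1 : ℝ) : ℂ) * Complex.I).im := by simp
    obtain ⟨h1, h2⟩ := hf.slice_props hC hd i0 hI
    exact hnz _ (mem_tube_slice.2 ⟨hI, hI⟩) (levelOne_neg k hk _ (slice_differentiableOn hf hI) h1 h2
      (hf.exists_slice_bound hC hd i0 one_pos) _ hI)
  intro k f hf hnz
  have h1 := key k f hf hnz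
  have h2 := key (-k) (fun z => (f z)⁻¹) ⟨hf.holo.inv hnz, fun α hα b z hz => by rw [hf.refl α hα b z hz],
    fun u hu hu' z hz => by rw [hf.refl4 u hu hu' z hz], fun z hz => by
      rw [hf.inv z hz, mul_inv, _root_.zpow_neg]⟩ fun z hz => inv_ne_zero (hnz z hz)
  omega

theorem TForm.slice_const (hC : PD C) (hd : ∀ i, C i i = 2) (i0 : Fin r) (hf : TForm C 0 f)
    {t : ℝ} (ht : 0 < t) : ∃ c, ∀ ω : ℂ, 0 < ω.im → f (hv (t * Complex.I) ω 0) = c := by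
  have hI : 0 < ((t : ℂ) * Complex.I).im := by simpa using ht
  obtain ⟨h1, h2⟩ := hf.slice_props hC hd i0 hI
  exact levelOne_zero _ (slice_differentiableOn hf hI) h1 (by simpa using h2)
      (hf.exists_slice_bound hC hd i0 ht)

end Koecher

end Refl

open Matrix

namespace Refl

section WeightZero

variable {n r : ℕ} {C : Matrix (Fin r) (Fin r) ℤ} {f : (Fin (2 + r) → ℂ) → ℂ}

/-- The matrix of `x ↦ (v, x) u`. -/
def rankOne (B : Matrix (Fin n) (Fin n) ℤ) (u v : Fin n → ℤ) : Matrix (Fin n) (Fin n) ℤ :=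
  vecMulVec u fun j => bil B v (Pi.single j 1)

theorem actR_rankOne {R : Type*} [CommRing R] (B : Matrix (Fin n) (Fin n) ℤ) (u v : Fin n → ℤ)
    (x : Fin n → R) :
    actR (rankOne B u v) x = bil B (fun i => (v i : R)) x • fun i => (u i : R) := by
  rw [bil_eq_sum_right]
  ext i
  simp only [actR, rankOne, vecMulVec_apply, Pi.smul_apply, smul_eq_mul, Finset.sum_mul]
  refine Finset.sum_congr rfl fun j _ => by push_cast; ring

theorem actR_mat_add {R : Type*} [CommRing R] (g h : Matrix (Fin n) (Fin n) ℤ) (x : Fin n → R) :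
    actR (g + h) x = actR g x + actR h x := by
  ext i; simp [actR, add_mul, Finset.sum_add_distrib]

theorem actR_mat_smul {R : Type*} [CommRing R] (c : ℤ) (g : Matrix (Fin n) (Fin n) ℤ)
    (x : Fin n → R) : actR (c • g) x = (c : R) • actR g x := by
  ext i; simp [actR, Finset.mul_sum, mul_assoc]

/-- Scaled translation by `β / N` on `M`, where `2 c = β²`. -/
def transM (C : Matrix (Fin r) (Fin r) ℤ) (N c : ℤ) (β : Fin (2 + r) → ℤ) :
    Matrix (Fin (2 + (2 + r))) (Fin (2 + (2 + r))) ℤ :=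
  N ^ 2 • (1 : Matrix _ _ ℤ) + N • rankOne (MM C) (hv 0 0 β) (hv 0 1 0) +
    (-N) • rankOne (MM C) (hv 0 1 0) (hv 0 0 β) + (-c) • rankOne (MM C) (hv 0 1 0) (hv 0 1 0)

theorem actR_transM {R : Type*} [CommRing R] (N c : ℤ) (β : Fin (2 + r) → ℤ) (a b : R)
    (x : Fin (2 + r) → R) :
    actR (transM C N c β) (hv a b x) =
      hv (N ^ 2 * a) (N ^ 2 * b - N * bil (SM C) (fun i => (β i : R)) x - c * a)
        ((N : R) ^ 2 • x + (N * a) • fun i => (β i : R)) := by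
  have h0 : (fun i => (((0 : Fin (2 + r) → ℤ) i : ℤ) : R)) = 0 := by ext; simp
  simp only [transM, actR_mat_add, actR_mat_smul, actR_rankOne, actR_one,
    map_hv (Int.cast : ℤ → R), h0, bil_hv, bil_zero_left, hv_smul, hv_add, hv_inj]
  refine ⟨by push_cast; ring, by push_cast; ring, ?_⟩
  ext i
  simp; ring

theorem transM_isom (hC : PD C) (N c : ℤ) {β : Fin (2 + r) → ℤ} (hc : bil (SM C) β β = 2 * c) :
    (transM C N c β)ᵀ * MM C * transM C N c β = N ^ 4 • MM C := by
  apply scaled_isom_of_bil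
  intro x y
  obtain ⟨a, b, x, rfl⟩ := exists_hv x
  obtain ⟨a', b', y, rfl⟩ := exists_hv y
  simp only [actR_transM, bil_hv, bil_add_left, bil_add_right, bil_smul_left, bil_smul_right,
    Int.cast_id, hc]
  rw [bil_comm hC.symmS x β]
  ring

theorem transM_mul (N c : ℤ) {β : Fin (2 + r) → ℤ} (hc : bil (SM C) β β = 2 * c) :
    transM C N c β * transM C N c (-β) = N ^ 4 • 1 := by
  apply mat_ext_actR
  intro x
  obtain ⟨a, b, x, rfl⟩ := exists_hv x
  rw [actR_mul, actR_smul_one', actR_transM, actR_transM, hv_smul, hv_inj]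
  simp only [Int.cast_id, Pi.neg_apply]
  have hn : (fun i => -β i) = -β := rfl
  refine ⟨by ring, ?_, ?_⟩
  · simp only [bil_add_right, bil_smul_right, hn, bil_neg_right, bil_neg_left, hc]; ring
  · ext i; simp; ring

theorem PD.exists_half (hC : PD C) (β : Fin (2 + r) → ℤ) : ∃ c, bil (SM C) β β = 2 * c := by
  obtain ⟨a, b, x, rfl⟩ := exists_hv β
  obtain ⟨c, hc⟩ := hC.even x
  exact ⟨a * b - c, by rw [bil_S, hc]; ring⟩

variable {h : (Fin (2 + (2 + r)) → ℂ) → ℂ}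

theorem ratio_translate_psi (hC : PD C) {N c : ℤ} (hN : N ≠ 0) {β : Fin (2 + r) → ℤ}
    (hc : bil (SM C) β β = 2 * c) (z : Fin (2 + r) → ℂ) :
    actR (transM C N c β) (psi C z) = (N : ℂ) ^ 2 • psi C (z + (1 / N : ℂ) • intC β) := by
  have hN' : (N : ℂ) ≠ 0 := by exact_mod_cast hN
  have hcC : bil (SM C) (intC β) (intC β) = 2 * c := by rw [bil_intC, hc]; push_cast; ring
  unfold psi
  rw [actR_transM, hv_smul, hv_inj]
  refine ⟨by ring, ?_, ?_⟩
  · simp only [bil_add_left, bil_add_right, bil_smul_left, bil_smul_right, hcC]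
    rw [bil_comm hC.symmS z (intC β)]
    change _ - _ * bil (SM C) (intC β) z - _ = _
    field_simp; ring
  · rw [smul_add, smul_smul, mul_one]
    congr 1
    congr 1; field_simp

theorem XForm.rational_slice (hC : PD C) (hd : ∀ i, C i i = 2) (i0 : Fin r)
    (hh : XForm (MM C) (D0 C) 0 h) {N : ℤ} (hN : N ≠ 0) (β : Fin (2 + r) → ℤ) {t : ℝ}
    (ht : 0 < t) : ∃ c, ∀ ω : ℂ, 0 < ω.im →
      h (psi C (hv (t * Complex.I) ω 0 + (1 / N : ℂ) • intC β)) = c := by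
  obtain ⟨c, hc⟩ := hC.exists_half β
  have hc' : bil (SM C) (-β) (-β) = 2 * c := by simpa using hc
  have hN' : (N : ℂ) ≠ 0 := by exact_mod_cast hN
  have hA : AInv (MM C) (D0 C) 0 h := by
    refine ⟨hh.holo, hh.homog, (Set.finite_singleton ((D0 C).indicator h)).subset ?_⟩
    rintro φ ⟨g, hg, rfl⟩
    refine Set.indicator_congr fun Z hZ => hh.inv g hg Z hZ
  have hPsi : ∀ z ∈ Tube C, z + (1 / N : ℂ) • intC β ∈ Tube C := by
    intro z hz
    rw [mem_tube, imv_add, imv_smul_intC]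
    have : (1 / (N : ℂ)).im = 0 := by simp
    rwa [this, zero_smul, add_zero]
  have hF := AInv.pullback (F := h) hC.det_ne_zero (pow_ne_zero 4 hN) (transM_mul N c hc)
    (by have := transM_mul (C := C) N c hc'; rwa [neg_neg] at this) (transM_isom hC N c hc)
    (D' := D0 C) (by
      rintro _ ⟨s, hs, z, hz, rfl⟩
      rw [actR_smul, ratio_translate_psi hC hN hc]
      exact D0_smul hs (D0_smul (pow_ne_zero 2 hN') (psi_mem_D0 (hPsi z hz))))
    ⟨_, psi_mem_D0 (I_smul_mem_tube (base_mem C))⟩ (D0_subset_cone hC)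
    (fun W hW => component_eq_D0 hC hW) hA
  have hI : ∀ ω : ℂ, 0 < ω.im → hv (t * Complex.I) ω 0 ∈ Tube C := fun ω hω =>
    mem_tube_slice.2 ⟨by simpa using ht, hω⟩
  have hIm := psi_mem_D0 (hI Complex.I (by simp))
  have hval : ∀ z ∈ Tube C, h (actR (transM C N c β) (psi C z)) =
      h (psi C (z + (1 / N : ℂ) • intC β)) := by
    intro z hz
    rw [ratio_translate_psi hC hN hc, hh.homog _ (pow_ne_zero 2 hN') _ (psi_mem_D0 (hPsi z hz))]
    simp
  have hcont : ContinuousOn (fun ω : ℂ => h (psi C (hv (t * Complex.I) ω 0 + (1 / N : ℂ) • intC β)))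
      {ω | 0 < ω.im} := by
    refine (hh.toTForm hC).holo.continuousOn.comp (Continuous.continuousOn ?_)
      fun ω hω => hPsi _ (hI ω hω)
    exact (continuous_hv continuous_const continuous_id continuous_const).add continuous_const
  have hpre : IsPreconnected {ω : ℂ | 0 < ω.im} :=
    (convex_halfSpace_im_gt 0).isPreconnected
  refine const_of_finite hpre hcont (hF.fin.image fun φ => φ (psi C (hv (t * Complex.I) Complex.I 0)))
    fun ω hω => ?_
  have hωm := psi_mem_D0 (hI ω hω)
  rw [← hval _ (hI ω hω)]
  set x := h (actR (transM C N c β) (psi C (hv (t * Complex.I) ω 0))) with hx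
  obtain ⟨y, hy⟩ := ((hF.charForm hC.det_ne_zero (fun t ht Z hZ => D0_smul ht hZ) x).toTForm
    hC).slice_const hC hd i0 ht
  have h0 : orbProd hF (fun y => x - y) (psi C (hv (t * Complex.I) ω 0)) = 0 :=
    Finset.prod_eq_zero (hF.fin.mem_toFinset.2 AInv.self_mem_orb) (by simp [hωm, hx])
  have h1 : orbProd hF (fun y => x - y) (psi C (hv (t * Complex.I) Complex.I 0)) = 0 := by
    rw [hy _ (by simp), ← hy ω hω, h0]
  obtain ⟨φ, hφ, h2⟩ := Finset.prod_eq_zero_iff.1 h1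
  exact ⟨φ, hF.fin.mem_toFinset.1 hφ, (sub_eq_zero.1 h2).symm⟩

/-- Real vectors are limits of rational ones. -/
theorem dense_ratio : Dense {x : Fin n → ℝ | ∃ N : ℤ, N ≠ 0 ∧ ∃ β : Fin n → ℤ,
    x = (1 / N : ℝ) • intR β} := by
  have hd : DenseRange (fun q : Fin n → ℚ => fun i => (q i : ℝ)) :=
    DenseRange.piMap fun _ => Rat.denseRange_cast
  refine hd.mono ?_
  rintro _ ⟨q, rfl⟩
  refine ⟨∏ i, ((q i).den : ℤ), ?_, fun i => (q i).num * ∏ j ∈ Finset.univ.erase i, ((q j).den : ℤ), ?_⟩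
  · exact Finset.prod_ne_zero_iff.2 fun i _ => by exact_mod_cast (q i).den_nz
  · ext i
    simp only [Pi.smul_apply, intR, smul_eq_mul]
    rw [← Finset.mul_prod_erase Finset.univ _ (Finset.mem_univ i)]
    have h1 : ((∏ j ∈ Finset.univ.erase i, ((q j).den : ℤ) : ℤ) : ℝ) ≠ 0 := by
      exact_mod_cast Finset.prod_ne_zero_iff.2 fun j _ => by exact_mod_cast (q j).den_nz
    have h2 : ((q i).den : ℝ) ≠ 0 := by exact_mod_cast (q i).den_nz
    push_cast at h1 ⊢
    rw [Rat.cast_def]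
    field_simp

theorem XForm.real_slice (hC : PD C) (hd : ∀ i, C i i = 2) (i0 : Fin r)
    (hh : XForm (MM C) (D0 C) 0 h) (x : Fin (2 + r) → ℝ) {t : ℝ} (ht : 0 < t) {ω ω' : ℂ}
    (hω : 0 < ω.im) (hω' : 0 < ω'.im) :
    h (psi C (hv (t * Complex.I) ω 0 + cv x)) = h (psi C (hv (t * Complex.I) ω' 0 + cv x)) := by
  have hcont : ∀ ω : ℂ, 0 < ω.im → Continuous fun x : Fin (2 + r) → ℝ =>
      h (psi C (hv (t * Complex.I) ω 0 + cv x)) := by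
    intro ω hω
    rw [← continuousOn_univ]
    refine (hh.toTForm hC).holo.continuousOn.comp (Continuous.continuousOn ?_)
      fun x _ => tube_add_cv (mem_tube_slice.2 ⟨by simpa using ht, hω⟩) x
    exact continuous_const.add continuous_cv
  refine congrFun (Continuous.ext_on dense_ratio (hcont ω hω) (hcont ω' hω') ?_) x
  rintro _ ⟨N, hN, β, rfl⟩
  obtain ⟨c, hc⟩ := hh.rational_slice hC hd i0 hN β ht
  have e : cv ((1 / N : ℝ) • intR β) = (1 / N : ℂ) • intC β := by
    rw [cv_smul, cv_intR]; push_cast; rfl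
  simp only [e]
  rw [hc ω hω, hc ω' hω']

theorem XForm.indep_right (hC : PD C) (hd : ∀ i, C i i = 2) (i0 : Fin r)
    (hh : XForm (MM C) (D0 C) 0 h) {τ ω ω' : ℂ} {z : Fin r → ℂ} (h1 : hv τ ω z ∈ Tube C)
    (h2 : hv τ ω' z ∈ Tube C) : h (psi C (hv τ ω z)) = h (psi C (hv τ ω' z)) := by
  set S : Set ℂ := {s | hv τ ω (cv (rev z) + s • cv (imv z)) ∈ Tube C ∧
    hv τ ω' (cv (rev z) + s • cv (imv z)) ∈ Tube C} with hS
  have hτ := (mem_tube_hv.1 h1).1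
  have hpos : ∀ {ω : ℂ}, hv τ ω z ∈ Tube C → 0 < ω.im := by
    intro ω hω
    have h2 := (mem_tube_hv.1 hω).2
    have := hC.nonneg (imv z)
    by_contra hcon
    nlinarith
  have hlin : ∀ ω : ℂ, (fun s : ℂ => hv τ ω (cv (rev z) + s • cv (imv z))) =
      fun s : ℂ => hv τ ω (cv (rev z)) + s • hv 0 0 (cv (imv z)) := by
    intro ω; ext1 s; rw [hv_smul, hv_add]; simp
  have hdiff : ∀ ω : ℂ, Differentiable ℂ fun s : ℂ => hv τ ω (cv (rev z) + s • cv (imv z)) := by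
    intro ω; rw [hlin]; fun_prop
  have hopen : IsOpen S := (isOpen_tube.preimage (hdiff ω).continuous).inter
    (isOpen_tube.preimage (hdiff ω').continuous)
  have hconv : Convex ℝ S := by
    have : ∀ ω : ℂ, Convex ℝ {s : ℂ | hv τ ω (cv (rev z) + s • cv (imv z)) ∈ Tube C} := by
      intro ω s hs t ht a b ha hb hab
      have := convex_tube hC hs ht ha hb hab
      change _ ∈ Tube C
      convert this using 1
      have hab' : (a : ℂ) + b = 1 := by exact_mod_cast hab
      ext i
      have e1 := congrFun (congrFun (hlin ω) (a • s + b • t)) i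
      have e2 := congrFun (congrFun (hlin ω) s) i
      have e3 := congrFun (congrFun (hlin ω) t) i
      simp only [Pi.add_apply, Pi.smul_apply, Complex.real_smul, smul_eq_mul] at e1 e2 e3 ⊢
      rw [e1, e2, e3]
      linear_combination -(hv τ ω (cv (rev z)) i) * hab'
    exact (this ω).inter (this ω')
  set G : ℂ → ℂ := fun s => h (psi C (hv τ ω (cv (rev z) + s • cv (imv z)))) -
    h (psi C (hv τ ω' (cv (rev z) + s • cv (imv z)))) with hG
  have hGd : DifferentiableOn ℂ G S := by
    have hf := (hh.toTForm hC).holo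
    exact (hf.comp (hdiff ω).differentiableOn fun s hs => hs.1).sub
      (hf.comp (hdiff ω').differentiableOn fun s hs => hs.2)
  have hreal : ∀ s : ℝ, (s : ℂ) ∈ S ∧ G s = 0 := by
    intro s
    have ha : ∀ ω : ℂ, hv τ ω (cv (rev z) + (s : ℂ) • cv (imv z)) =
        hv (τ.im * Complex.I) ω 0 + cv (hv τ.re 0 (rev z + s • imv z)) := by
      intro ω
      rw [cv_hv, hv_add, hv_inj]
      refine ⟨?_, by simp, by simp⟩
      rw [add_comm, Complex.re_add_im]
    have hm : ∀ {ω : ℂ}, 0 < ω.im → hv τ ω (cv (rev z) + (s : ℂ) • cv (imv z)) ∈ Tube C := by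
      intro ω hω
      rw [ha]
      exact tube_add_cv (mem_tube_slice.2 ⟨by simpa using hτ, hω⟩) _
    refine ⟨⟨hm (hpos h1), hm (hpos h2)⟩, ?_⟩
    simp only [hG, ha]
    rw [hh.real_slice hC hd i0 _ hτ (hpos h1) (hpos h2), sub_self]
  have hz : G Complex.I = 0 := by
    have han := hGd.analyticOnNhd hopen
    have hev : ∃ᶠ s in nhdsWithin (0 : ℂ) {0}ᶜ, G s = 0 := by
      have ht : Filter.Tendsto (fun n : ℕ => (((1 / ((n : ℝ) + 1) : ℝ)) : ℂ)) Filter.atTop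
          (nhdsWithin (0 : ℂ) {0}ᶜ) := by
        refine tendsto_nhdsWithin_iff.2 ⟨?_, Filter.Eventually.of_forall fun n => ?_⟩
        · rw [← Complex.ofReal_zero]
          exact (Complex.continuous_ofReal.tendsto 0).comp tendsto_one_div_add_atTop_nhds_zero_nat
        · simp only [Set.mem_compl_iff, Set.mem_singleton_iff, Complex.ofReal_eq_zero]
          positivity
      exact ht.frequently (Filter.Frequently.of_forall fun n => (hreal _).2)
    have h0S : (0 : ℂ) ∈ S := by simpa using (hreal 0).1
    have hIS : Complex.I ∈ S := by
      simp only [hS, Set.mem_ofPred_eq, ← cv_decomp]; exact ⟨h1, h2⟩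
    exact han.eqOn_zero_of_preconnected_of_frequently_eq_zero hconv.isPreconnected h0S hev hIS
  simp only [hG, ← cv_decomp] at hz
  exact sub_eq_zero.1 hz

theorem XForm.indep (hC : PD C) (hd : ∀ i, C i i = 2) (i0 : Fin r)
    (hh : XForm (MM C) (D0 C) 0 h) {τ ω τ' ω' : ℂ} {z : Fin r → ℂ} (h1 : hv τ ω z ∈ Tube C)
    (h2 : hv τ' ω' z ∈ Tube C) : h (psi C (hv τ ω z)) = h (psi C (hv τ' ω' z)) := by
  have hf := hh.toTForm hC
  obtain ⟨a1, b1⟩ := mem_tube_hv.1 h1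
  obtain ⟨a2, b2⟩ := mem_tube_hv.1 h2
  have := hC.nonneg (imv z)
  have p1 : 0 < ω.im := by by_contra hcon; nlinarith
  have p2 : 0 < ω'.im := by by_contra hcon; nlinarith
  set w : ℂ := (ω.im + ω'.im : ℝ) * Complex.I with hw
  have hwi : w.im = ω.im + ω'.im := by simp [hw]
  have m1 : hv τ w z ∈ Tube C := mem_tube_hv.2 ⟨a1, by rw [hwi]; nlinarith⟩
  have m2 : hv τ' w z ∈ Tube C := mem_tube_hv.2 ⟨a2, by rw [hwi]; nlinarith⟩
  have hsw : ∀ {τ ω : ℂ}, hv τ ω z ∈ Tube C → 0 < ω.im → hv ω τ z ∈ Tube C := by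
    intro τ ω hm hp
    exact mem_tube_hv.2 ⟨hp, by rw [mul_comm ω.im]; exact (mem_tube_hv.1 hm).2⟩
  have pw : 0 < w.im := by rw [hwi]; linarith
  rw [hh.indep_right hC hd i0 h1 m1, hh.indep_right hC hd i0 h2 m2]
  have s1 := hf.swap m1
  have s2 := hf.swap m2
  rw [← s1, ← s2]
  exact hh.indep_right hC hd i0 (hsw m1 pw) (hsw m2 pw)

theorem weightZeroConst (hC : PD C) (hd : ∀ i, C i i = 2) (i0 : Fin r) : WeightZeroConst C := by
  intro h hh
  have hf := hh.toTForm hC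
  have hbase : hv Complex.I Complex.I (0 : Fin r → ℂ) ∈ Tube C := mem_tube_slice.2 ⟨by simp, by simp⟩
  refine ⟨h (psi C (hv Complex.I Complex.I 0)), ?_⟩
  rintro _ ⟨s, hs, z, hz, rfl⟩
  rw [hh.homog s hs _ (psi_mem_D0 hz)]
  simp only [neg_zero, zpow_zero, one_mul]
  obtain ⟨τ, ω, z, rfl⟩ := exists_hv z
  obtain ⟨a1, b1⟩ := mem_tube_hv.1 hz
  set ζ : ℝ → (Fin r → ℂ) := fun R => (-2 / (2 * τ * (R * Complex.I) - bil C z z)) • z with hζ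
  have hlim : Filter.Tendsto ζ Filter.atTop (nhds 0) := by
    have hτ : τ ≠ 0 := fun h0 => by simp [h0] at a1
    have hinv : Filter.Tendsto (fun R : ℝ => ((R⁻¹ : ℝ) : ℂ)) Filter.atTop (nhds 0) :=
      (Complex.continuous_ofReal.tendsto' 0 0 (by simp)).comp tendsto_inv_atTop_zero
    have hq : Filter.Tendsto (fun R : ℝ => -2 * ((R⁻¹ : ℝ) : ℂ) /
        (2 * τ * Complex.I - bil C z z * ((R⁻¹ : ℝ) : ℂ))) Filter.atTop
        (nhds (-2 * 0 / (2 * τ * Complex.I - bil C z z * 0))) :=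
      (tendsto_const_nhds.mul hinv).div (tendsto_const_nhds.sub (tendsto_const_nhds.mul hinv))
        (by simp [hτ])
    have hq' : Filter.Tendsto (fun R : ℝ => -2 / (2 * τ * (R * Complex.I) - bil C z z))
        Filter.atTop (nhds 0) := by
      rw [mul_zero, zero_div] at hq
      refine hq.congr' ?_
      filter_upwards [Filter.eventually_gt_atTop 0] with R hR
      have hR' : (R : ℂ) ≠ 0 := by exact_mod_cast hR.ne'
      have e : 2 * τ * (R * Complex.I) - bil C z z =
          (2 * τ * Complex.I - bil C z z * ((R⁻¹ : ℝ) : ℂ)) * R := by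
        push_cast; field_simp
      rw [e, div_mul_eq_div_div_swap]
      push_cast
      rw [div_eq_mul_inv (-2 : ℂ)]
    simpa [hζ] using hq'.smul_const z
  have hcont : ContinuousAt (fun x : Fin r → ℂ => h (psi C (hv Complex.I Complex.I x))) 0 := by
    have h1 : ContinuousAt (fun z => h (psi C z)) (hv Complex.I Complex.I (0 : Fin r → ℂ)) :=
      (hf.holo.continuousOn).continuousAt (isOpen_tube.mem_nhds hbase)
    exact ContinuousAt.comp (f := fun x : Fin r → ℂ => hv Complex.I Complex.I x) h1
      (continuous_hv continuous_const continuous_const continuous_id).continuousAt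
  have hmem : ∀ᶠ x in nhds (0 : Fin r → ℂ), hv Complex.I Complex.I x ∈ Tube C :=
    (continuous_hv continuous_const continuous_const continuous_id).continuousAt.eventually
      (isOpen_tube.mem_nhds hbase)
  have hR : ∀ᶠ R : ℝ in Filter.atTop, hv τ (R * Complex.I) z ∈ Tube C := by
    filter_upwards [Filter.eventually_ge_atTop ω.im] with R hR
    refine mem_tube_hv.2 ⟨a1, ?_⟩
    have : ((R : ℂ) * Complex.I).im = R := by simp
    rw [this]; nlinarith
  have hev : ∀ᶠ R : ℝ in Filter.atTop,
      h (psi C (hv Complex.I Complex.I (ζ R))) = h (psi C (hv τ ω z)) := by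
    filter_upwards [hR, hlim.eventually hmem] with R h1 h2
    have h3 := hf.inv _ h1
    have h4 := tube_inv hC h1
    simp only [bil_S, hv_smul, zpow_zero, one_mul] at h3 h4
    have e : τ * (R * Complex.I) + R * Complex.I * τ = 2 * τ * (R * Complex.I) := by ring
    rw [e] at h3 h4
    rw [hh.indep hC hd i0 hz h1, ← h3]
    exact hh.indep hC hd i0 h2 h4
  exact tendsto_nhds_unique (tendsto_const_nhds.congr' (hev.mono fun _ h => h.symm))
    (hcont.tendsto.comp hlim)

end WeightZero

end Refl

open Matrix
namespace Refl

section LocalFiniteness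

variable {n r : ℕ} {C : Matrix (Fin r) (Fin r) ℤ}

/-- The function on the tube domain whose zero locus is the divisor of `v`. -/
noncomputable def wq (C : Matrix (Fin r) (Fin r) ℤ) (v : Fin (2 + (2 + r)) → ℤ)
    (z : Fin (2 + r) → ℂ) : ℂ := bil (MM C) (intC v) (psi C z)

theorem wq_hv (a b : ℤ) (l : Fin (2 + r) → ℤ) (z : Fin (2 + r) → ℂ) :
    wq C (hv a b l) z = b + bil (SM C) (intC l) z - a * bil (SM C) z z / 2 := by
  rw [wq, MM, psi, intC_hv, bil_hv]; ring

theorem bil_MM_hv {R : Type*} [CommRing R] (a b a' b' : R) (l l' : Fin (2 + r) → R) :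
    bil (MM C) (hv a b l) (hv a' b' l') = a * b' + b * a' + bil (SM C) l l' := by
  rw [MM, bil_hv]

theorem continuous_wq (v : Fin (2 + (2 + r)) → ℤ) : Continuous (wq C v) :=
  continuous_bil _ continuous_const differentiable_psi.continuous

theorem PD.exists_dual (hC : PD C) (i : Fin r) :
    ∃ c : Fin r → ℝ, ∀ x : Fin r → ℝ, bil C x c = x i := by
  have hdet : C.det ≠ 0 := det_ne_zero_of_nondeg fun v h => hC.eq_zero_int v (h v).le
  have hu : IsUnit (C.map (Int.cast : ℤ → ℝ)).det := by
    have : (C.map (Int.cast : ℤ → ℝ)).det = ((C.det : ℤ) : ℝ) := by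
      simpa using (RingHom.map_det (Int.castRingHom ℝ) C).symm
    rw [this]; exact isUnit_iff_ne_zero.2 (by exact_mod_cast hdet)
  refine ⟨(C.map (Int.cast : ℤ → ℝ))⁻¹ *ᵥ Pi.single i 1, fun x => ?_⟩
  have h : bil C x ((C.map (Int.cast : ℤ → ℝ))⁻¹ *ᵥ Pi.single i 1) =
      x ⬝ᵥ (C.map (Int.cast : ℤ → ℝ)) *ᵥ ((C.map (Int.cast : ℤ → ℝ))⁻¹ *ᵥ Pi.single i 1) := by
    simp only [bil, dotProduct, mulVec, Finset.mul_sum, Matrix.map_apply]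
    exact Finset.sum_congr rfl fun i _ => Finset.sum_congr rfl fun j _ =>
      Finset.sum_congr rfl fun _ _ => by ring
  rw [h, Matrix.mulVec_mulVec, Matrix.mul_nonsing_inv _ hu, Matrix.one_mulVec]
  simp

theorem PD.exists_dual_S (hC : PD C) (i : Fin (2 + r)) :
    ∃ c : Fin (2 + r) → ℝ, ∀ x : Fin (2 + r) → ℝ, bil (SM C) x c = x i := by
  refine Fin.addCases (fun j => ?_) (fun j => ?_) i
  · fin_cases j
    · refine ⟨hv 0 1 0, fun x => ?_⟩
      obtain ⟨a, b, y, rfl⟩ := exists_hv x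
      rw [bil_S]
      simp [hv, Fin.append_left]
    · refine ⟨hv 1 0 0, fun x => ?_⟩
      obtain ⟨a, b, y, rfl⟩ := exists_hv x
      rw [bil_S]
      simp [hv, Fin.append_left]
  · obtain ⟨c, hc⟩ := hC.exists_dual j
    refine ⟨hv 0 0 (-c), fun x => ?_⟩
    obtain ⟨a, b, y, rfl⟩ := exists_hv x
    rw [bil_S]
    simp [hv, hc]

theorem orth_pair_sq_le (hC : PD C) {y w : Fin (2 + r) → ℝ} (hy : 0 < bil (SM C) y y)
    (hw : bil (SM C) w y = 0) (h2 : -2 ≤ bil (SM C) w w) (x : Fin (2 + r) → ℝ) :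
    bil (SM C) w x ^ 2 ≤ 2 * (bil (SM C) x y ^ 2 / bil (SM C) y y - bil (SM C) x x) := by
  set Q := bil (SM C) y y
  set x' := x - (bil (SM C) x y / Q) • y with hx'
  have e1 : bil (SM C) x' y = 0 := by
    simp only [hx', bil_sub_left, bil_smul_left]
    rw [div_mul_cancel₀ _ hy.ne', sub_self]
  have e2 : bil (SM C) w x = bil (SM C) w x' := by
    simp only [hx', bil_sub_right, bil_smul_right, hw]; ring
  have e3 : bil (SM C) x' x' = bil (SM C) x x - bil (SM C) x y ^ 2 / Q := by
    simp only [hx', bil_sub_left, bil_smul_left, bil_sub_right, bil_smul_right,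
      bil_comm hC.symmS y x]
    change _ - _ * bil (SM C) x y - _ * (_ - _ * Q) = _
    field_simp; ring
  have hneg : ∀ u : Fin (2 + r) → ℝ, bil (SM C) u y = 0 → bil (SM C) u u ≤ 0 := by
    intro u hu
    have := reverse_CS hC u hy
    rw [hu] at this; nlinarith
  have hd := discrim_le_zero (a := -bil (SM C) w w) (b := -2 * bil (SM C) w x')
    (c := -bil (SM C) x' x') (fun t => by
      have := hneg (t • w + x') (by simp [hw, e1])
      simp only [bil_add_left, bil_add_right, bil_smul_left, bil_smul_right,
        bil_comm hC.symmS x' w] at this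
      nlinarith)
  have h3 := hneg w hw
  have h4 := hneg x' e1
  rw [discrim] at hd
  rw [e2]
  have e4 : bil (SM C) x y ^ 2 / Q - bil (SM C) x x = - bil (SM C) x' x' := by rw [e3]; ring
  rw [e4]
  nlinarith

theorem wq_zero_data (hC : PD C) {a b : ℤ} {l : Fin (2 + r) → ℤ}
    (hv2 : bil (MM C) (hv a b l) (hv a b l) = -2) {z : Fin (2 + r) → ℂ}
    (h0 : wq C (hv a b l) z = 0) :
    bil (SM C) (intR l - (a : ℝ) • rev z) (imv z) = 0 ∧
    bil (SM C) (intR l - (a : ℝ) • rev z) (intR l - (a : ℝ) • rev z) =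
      -2 + a ^ 2 * bil (SM C) (imv z) (imv z) ∧
    (b : ℝ) = -bil (SM C) (intR l - (a : ℝ) • rev z) (rev z) -
      a * (bil (SM C) (rev z) (rev z) + bil (SM C) (imv z) (imv z)) / 2 := by
  rw [wq_hv, ← cv_intR, bil_self_complex hC.symmS] at h0
  have hre := congrArg Complex.re h0
  have him := congrArg Complex.im h0
  have r1 := re_bil_cv (SM C) (intR l) z
  have i1 := im_bil_cv (SM C) (intR l) z
  set A := bil (SM C) (rev z) (rev z)
  set D := bil (SM C) (imv z) (imv z)
  set E := bil (SM C) (rev z) (imv z)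
  have hre' : (b : ℝ) + bil (SM C) (intR l) (rev z) - a * (A - D) / 2 = 0 := by
    rw [← r1]
    have : ((a : ℂ) * (((A - D : ℝ) : ℂ) + Complex.I * ((2 * E : ℝ) : ℂ)) / 2).re =
        a * (A - D) / 2 := by
      simp
    simpa [this] using hre
  have him' : bil (SM C) (intR l) (imv z) - a * E = 0 := by
    rw [← i1]
    have : ((a : ℂ) * (((A - D : ℝ) : ℂ) + Complex.I * ((2 * E : ℝ) : ℂ)) / 2).im =
        a * E := by
      simp; ring
    rw [Complex.sub_im, Complex.add_im, this] at him
    simpa using him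
  rw [bil_MM_hv] at hv2
  have hv2' : (2 * a * b : ℝ) + bil (SM C) (intR l) (intR l) = -2 := by
    rw [bil_intR]
    have : ((a * b + b * a + bil (SM C) l l : ℤ) : ℝ) = -2 := by rw [hv2]; norm_num
    push_cast at this; linarith
  simp only [bil_sub_left, bil_smul_left, bil_sub_right, bil_smul_right,
    bil_comm hC.symmS (rev z) (intR l)]
  refine ⟨by linarith, ?_, by linarith⟩
  have : (b : ℝ) = -bil (SM C) (intR l) (rev z) + a * (A - D) / 2 := by linarith
  rw [this] at hv2'
  linarith

theorem locally_finite_roots (hC : PD C) {p : Fin (2 + r) → ℂ} (hp : p ∈ Tube C) :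
    ∃ F : Set (Fin (2 + (2 + r)) → ℤ), F.Finite ∧ ∀ᶠ z in nhds p, ∀ v,
      bil (MM C) v v = -2 → wq C v z = 0 → v ∈ F := by
  have key : ∀ i, ∃ g : (Fin (2 + r) → ℂ) → ℝ, ContinuousAt g p ∧ ∀ z ∈ Tube C, ∀ v,
      bil (MM C) v v = -2 → wq C v z = 0 → (v i : ℝ) ^ 2 ≤ g z := by
    have cI : ContinuousAt (fun z : Fin (2 + r) → ℂ => imv z) p := continuous_imv.continuousAt
    have cR : Continuous (fun z : Fin (2 + r) → ℂ => rev z) :=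
      continuous_pi fun i => Complex.continuous_re.comp (continuous_apply i)
    have cII : Continuous fun z : Fin (2 + r) → ℂ => bil (SM C) (imv z) (imv z) :=
      continuous_bil _ continuous_imv continuous_imv
    have cRR : Continuous fun z : Fin (2 + r) → ℂ => bil (SM C) (rev z) (rev z) :=
      continuous_bil _ cR cR
    have cRI : Continuous fun z : Fin (2 + r) → ℂ => bil (SM C) (rev z) (imv z) :=
      continuous_bil _ cR continuous_imv
    have hp0 : bil (SM C) (imv p) (imv p) ≠ 0 := (mem_tube.1 hp).2.ne'
    have basic : ∀ z ∈ Tube C, ∀ a b l, bil (MM C) (hv a b l) (hv a b l) = -2 →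
        wq C (hv a b l) z = 0 → (a : ℝ) ^ 2 ≤ 2 / bil (SM C) (imv z) (imv z) ∧
        -2 ≤ bil (SM C) (intR l - (a : ℝ) • rev z) (intR l - (a : ℝ) • rev z) := by
      intro z hz a b l h1 h2
      obtain ⟨d1, d2, d3⟩ := wq_zero_data hC h1 h2
      have hy := (mem_tube.1 hz).2
      have := reverse_CS hC (intR l - (a : ℝ) • rev z) hy
      rw [d1] at this
      have h4 : bil (SM C) (intR l - (a : ℝ) • rev z) (intR l - (a : ℝ) • rev z) ≤ 0 := by
        nlinarith
      refine ⟨?_, ?_⟩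
      · rw [le_div_iff₀ hy]; linarith
      · rw [d2]; have := mul_nonneg (sq_nonneg (a : ℝ)) hy.le; linarith
    intro i
    refine Fin.addCases (fun j => ?_) (fun j => ?_) i
    · fin_cases j
      · refine ⟨fun z => 2 / bil (SM C) (imv z) (imv z),
          continuousAt_const.div cII.continuousAt hp0, fun z hz v h1 h2 => ?_⟩
        obtain ⟨a, b, l, rfl⟩ := exists_hv v
        simpa [hv, Fin.append_left] using (basic z hz a b l h1 h2).1
      · refine ⟨fun z => 2 * (2 * (bil (SM C) (rev z) (imv z) ^ 2 / bil (SM C) (imv z) (imv z) -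
            bil (SM C) (rev z) (rev z))) + 2 * (2 / bil (SM C) (imv z) (imv z) *
            ((bil (SM C) (rev z) (rev z) + bil (SM C) (imv z) (imv z)) / 2) ^ 2), ?_,
          fun z hz v h1 h2 => ?_⟩
        · have q1 : ContinuousAt (fun z => bil (SM C) (rev z) (imv z) ^ 2 /
            bil (SM C) (imv z) (imv z)) p := (cRI.pow 2).continuousAt.div cII.continuousAt hp0
          have q2 : ContinuousAt (fun z => 2 / bil (SM C) (imv z) (imv z)) p :=
            continuousAt_const.div cII.continuousAt hp0
          have q3 : Continuous (fun z : Fin (2 + r) → ℂ =>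
            ((bil (SM C) (rev z) (rev z) + bil (SM C) (imv z) (imv z)) / 2) ^ 2) :=
            ((cRR.add cII).div_const 2).pow 2
          exact (continuousAt_const.mul (continuousAt_const.mul (q1.sub cRR.continuousAt))).add
            (continuousAt_const.mul (q2.mul q3.continuousAt))
        · obtain ⟨a, b, l, rfl⟩ := exists_hv v
          obtain ⟨b1, b2⟩ := basic z hz a b l h1 h2
          obtain ⟨d1, d2, d3⟩ := wq_zero_data hC h1 h2
          have b3 := orth_pair_sq_le hC (mem_tube.1 hz).2 d1 b2 (rev z)
          have e : ((hv a b l (Fin.castAdd (2 + r) ⟨1, by norm_num⟩) : ℤ) : ℝ) = b := by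
            simp [hv, Fin.append_left]
          change ((hv a b l (Fin.castAdd (2 + r) ⟨1, by norm_num⟩) : ℤ) : ℝ) ^ 2 ≤ _
          rw [e, d3]
          set m := bil (SM C) (intR l - (a : ℝ) • rev z) (rev z)
          set K := (bil (SM C) (rev z) (rev z) + bil (SM C) (imv z) (imv z)) / 2
          have b4 := mul_le_mul_of_nonneg_right b1 (sq_nonneg K)
          have e2 : -m - a * (bil (SM C) (rev z) (rev z) + bil (SM C) (imv z) (imv z)) / 2 =
            -m - a * K := by ring
          rw [e2]
          change _ ≤ 2 * (2 * _) + 2 * (_ * K ^ 2)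
          nlinarith [sq_nonneg (m - a * K)]
    · obtain ⟨c, hc⟩ := hC.exists_dual_S j
      refine ⟨fun z => 2 * (2 * (bil (SM C) c (imv z) ^ 2 / bil (SM C) (imv z) (imv z) -
            bil (SM C) c c)) + 2 * (2 / bil (SM C) (imv z) (imv z) * rev z j ^ 2), ?_,
          fun z hz v h1 h2 => ?_⟩
      · have cc : Continuous fun z : Fin (2 + r) → ℂ => bil (SM C) c (imv z) :=
          continuous_bil _ continuous_const continuous_imv
        have q1 : ContinuousAt (fun z => bil (SM C) c (imv z) ^ 2 /
          bil (SM C) (imv z) (imv z)) p := (cc.pow 2).continuousAt.div cII.continuousAt hp0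
        have q2 : ContinuousAt (fun z => 2 / bil (SM C) (imv z) (imv z)) p :=
          continuousAt_const.div cII.continuousAt hp0
        have q3 : Continuous (fun z : Fin (2 + r) → ℂ => rev z j ^ 2) :=
          ((continuous_apply j).comp cR).pow 2
        exact (continuousAt_const.mul (continuousAt_const.mul (q1.sub continuousAt_const))).add
            (continuousAt_const.mul (q2.mul q3.continuousAt))
      · obtain ⟨a, b, l, rfl⟩ := exists_hv v
        obtain ⟨b1, b2⟩ := basic z hz a b l h1 h2
        obtain ⟨d1, d2, d3⟩ := wq_zero_data hC h1 h2
        have b3 := orth_pair_sq_le hC (mem_tube.1 hz).2 d1 b2 c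
        rw [hc] at b3
        have e : ((hv a b l (Fin.natAdd 2 j) : ℤ) : ℝ) =
            (intR l - (a : ℝ) • rev z) j + a * rev z j := by
          simp [hv, Fin.append_right, intR]
        rw [e]
        set m := (intR l - (a : ℝ) • rev z) j
        have b4 := mul_le_mul_of_nonneg_right b1 (sq_nonneg (rev z j))
        simp only
        nlinarith [sq_nonneg (m - a * rev z j)]
  choose g hg hg2 using key
  have hU : ∀ᶠ z in nhds p, z ∈ Tube C ∧ ∀ i, g i z < g i p + 1 :=
    Filter.Eventually.and (isOpen_tube.mem_nhds hp) (Filter.eventually_all.2 fun i =>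
      (hg i).eventually (gt_mem_nhds (by linarith)))
  obtain ⟨N, hN⟩ : ∃ N : ℕ, ∀ i, g i p + 1 ≤ N := by
    obtain ⟨N, hN⟩ := (Set.finite_range fun i => g i p + 1).bddAbove
    obtain ⟨M, hM⟩ := exists_nat_ge N
    exact ⟨M, fun i => (hN ⟨i, rfl⟩).trans hM⟩
  refine ⟨Set.Icc (fun _ => -(N : ℤ)) (fun _ => (N : ℤ)), Set.finite_Icc _ _, ?_⟩
  filter_upwards [hU] with z hz v h1 h2
  have : ∀ i, |v i| ≤ N := fun i => by
    have h3 : ((v i ^ 2 : ℤ) : ℝ) ≤ (N : ℤ) := by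
      push_cast
      exact (hg2 i z hz.1 v h1 h2).trans ((hz.2 i).le.trans (hN i))
    have h4 : v i ^ 2 ≤ (N : ℤ) := by exact_mod_cast h3
    rw [← sq_abs] at h4
    nlinarith [abs_nonneg (v i), Int.le_self_sq |v i|]
  exact ⟨fun i => (abs_le.1 (this i)).1, fun i => (abs_le.1 (this i)).2⟩

end LocalFiniteness

end Refl

open Matrix
namespace Refl

section Order

variable {n r : ℕ} {C : Matrix (Fin r) (Fin r) ℤ} {k : ℤ} {f : (Fin (2 + r) → ℂ) → ℂ}

/-- A function whose zeros lie on the divisors of `(-2)`-vectors. -/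
def ReflZeros (C : Matrix (Fin r) (Fin r) ℤ) (f : (Fin (2 + r) → ℂ) → ℂ) : Prop :=
  ∀ z ∈ Tube C, f z = 0 → ∃ v, bil (MM C) v v = -2 ∧ wq C v z = 0

/-- `p` lies on the divisor of `v` and on no other root divisor. -/
structure Gen (C : Matrix (Fin r) (Fin r) ℤ) (v : Fin (2 + (2 + r)) → ℤ) (p : Fin (2 + r) → ℂ) :
    Prop where
  mem : p ∈ Tube C
  zero : wq C v p = 0
  only : ∀ w, bil (MM C) w w = -2 → wq C w p = 0 → w = v ∨ w = -v

/-- Order of vanishing at `p` along the line in direction `α`. -/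
noncomputable def lineOrd (f : (Fin (2 + r) → ℂ) → ℂ) (p : Fin (2 + r) → ℂ)
    (α : Fin (2 + r) → ℤ) : ℕ := analyticOrderNatAt (fun s : ℂ => f (p + s • intC α)) 0

theorem wq_neg (v : Fin (2 + (2 + r)) → ℤ) (z : Fin (2 + r) → ℂ) : wq C (-v) z = -wq C v z := by
  rw [wq, intC_neg, bil_neg_left, wq]

theorem analyticAt_line {f : (Fin n → ℂ) → ℂ} {A : Set (Fin n → ℂ)} (hA : IsOpen A)
    (hf : DifferentiableOn ℂ f A) (p u : Fin n → ℂ) {s : ℂ} (hs : p + s • u ∈ A) :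
    AnalyticAt ℂ (fun s : ℂ => f (p + s • u)) s := by
  have hc : Continuous fun s : ℂ => p + s • u := by fun_prop
  have hd : DifferentiableOn ℂ (fun s : ℂ => f (p + s • u)) ((fun s : ℂ => p + s • u) ⁻¹' A) :=
    hf.comp (Differentiable.differentiableOn (by fun_prop)) fun _ h => h
  exact hd.analyticAt ((hA.preimage hc).mem_nhds hs)

theorem wind_eq_order {g : ℂ → ℂ} {ε : ℝ} (hε : 0 < ε)
    (hg : ∀ s ∈ Metric.closedBall (0 : ℂ) ε, AnalyticAt ℂ g s)
    (h0 : ∀ s ∈ Metric.closedBall (0 : ℂ) ε, g s = 0 → s = 0) :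
    wind (fun t => g (ε * Complex.exp (2 * Real.pi * Complex.I * t))) =
      analyticOrderNatAt g 0 := by
  have hz : (0 : ℂ) ∈ Metric.closedBall (0 : ℂ) ε := by simp [hε.le]
  have hntop : analyticOrderAt g 0 ≠ ⊤ := by
    rw [ne_eq, analyticOrderAt_eq_top]
    intro hev
    rw [Metric.eventually_nhds_iff] at hev
    obtain ⟨δ, hδ, h⟩ := hev
    have hm : 0 < min (δ / 2) ε := lt_min (by linarith) hε
    have e : ‖((min (δ / 2) ε : ℝ) : ℂ)‖ = min (δ / 2) ε := by
      rw [Complex.norm_real, Real.norm_of_nonneg hm.le]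
    have := h0 ((min (δ / 2) ε : ℝ) : ℂ) (by
      rw [mem_closedBall_zero_iff, e]; exact min_le_right _ _) (h (by
      rw [dist_zero_right, e]; exact (min_le_left _ _).trans_lt (by linarith)))
    rw [Complex.ofReal_eq_zero] at this
    exact hm.ne' this
  obtain ⟨u, hu, hu0, hev⟩ := ((hg 0 hz).analyticOrderAt_ne_top).1 hntop
  set m := analyticOrderNatAt g 0
  simp only [sub_zero, smul_eq_mul] at hev
  set h : ℂ → ℂ := fun s => if s = 0 then u 0 else g s / s ^ m with hh
  have hne : ∀ s ∈ Metric.closedBall (0 : ℂ) ε, h s ≠ 0 := by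
    intro s hs
    by_cases hs0 : s = 0
    · simp [hh, hs0, hu0]
    · simp only [hh, hs0, if_false]
      exact div_ne_zero (fun h => hs0 (h0 s hs h)) (pow_ne_zero _ hs0)
  have hcont : ContinuousOn h (Metric.closedBall 0 ε) := by
    intro s hs
    refine ContinuousAt.continuousWithinAt ?_
    by_cases hs0 : s = 0
    · subst hs0
      have : h =ᶠ[nhds 0] u := by
        filter_upwards [hev] with s hs
        by_cases hs0 : s = 0
        · simp [hh, hs0]
        · simp only [hh, hs0, if_false, hs]
          field_simp
      exact hu.continuousAt.congr this.symm
    · have : h =ᶠ[nhds s] fun s => g s / s ^ m := by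
        filter_upwards [isOpen_ne.mem_nhds hs0] with t ht
        simp only [hh, if_neg (show t ≠ 0 from ht)]
      exact ((hg s hs).continuousAt.div (continuousAt_id.pow m) (pow_ne_zero _ hs0)).congr
        this.symm
  have hE : Continuous fun t : ℝ => (ε : ℂ) * Complex.exp (2 * Real.pi * Complex.I * t) := by
    fun_prop
  have hE0 : ∀ t : ℝ, (ε : ℂ) * Complex.exp (2 * Real.pi * Complex.I * t) ≠ 0 := fun t =>
    mul_ne_zero (by exact_mod_cast hε.ne') (Complex.exp_ne_zero _)
  have hEm : ∀ t : ℝ, (ε : ℂ) * Complex.exp (2 * Real.pi * Complex.I * t) ∈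
      Metric.closedBall (0 : ℂ) ε := by
    intro t
    rw [mem_closedBall_zero_iff, norm_mul, Complex.norm_exp, Complex.norm_real,
      Real.norm_of_nonneg hε.le]
    simp
  have hE1 : (ε : ℂ) * Complex.exp (2 * Real.pi * Complex.I * (1 : ℝ)) =
      ε * Complex.exp (2 * Real.pi * Complex.I * (0 : ℝ)) := by simp
  have hfac : (fun t : ℝ => g (ε * Complex.exp (2 * Real.pi * Complex.I * t))) = fun t : ℝ =>
      ((ε : ℂ) * Complex.exp (2 * Real.pi * Complex.I * t)) ^ m *
        h (ε * Complex.exp (2 * Real.pi * Complex.I * t)) := by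
    funext t
    simp only [hh, if_neg (hE0 t)]
    rw [mul_div_cancel₀ _ (pow_ne_zero _ (hE0 t))]
  have hmul := wind_mul (u := fun t : ℝ => ((ε : ℂ) * Complex.exp (2 * Real.pi * Complex.I * t)) ^ m)
    (v := fun t : ℝ => h (ε * Complex.exp (2 * Real.pi * Complex.I * t))) (hE.pow m)
    (hcont.comp_continuous hE hEm) (fun t => pow_ne_zero _ (hE0 t))
    (fun t => hne _ (hEm t)) (by simp only [hE1]) (by simp only [hE1])
  rw [hfac, hmul, wind_circle hε, wind_disc hε hcont hne, add_zero]

theorem wq_line (b : ℤ) {α : Fin (2 + r) → ℤ} (hα : bil (SM C) α α = -2) (z : Fin (2 + r) → ℂ)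
    (s : ℂ) : wq C (hv 0 b α) (z + s • intC α) = wq C (hv 0 b α) z - 2 * s := by
  rw [wq_hv, wq_hv, bil_add_right, bil_smul_right, bil_intC, hα]
  push_cast; ring

theorem Gen.local_zero (hC : PD C) (hz : ReflZeros C f) {v : Fin (2 + (2 + r)) → ℤ}
    {p : Fin (2 + r) → ℂ} (h : Gen C v p) :
    ∀ᶠ z in nhds p, z ∈ Tube C ∧ (f z = 0 → wq C v z = 0) := by
  obtain ⟨F, hF, hev⟩ := locally_finite_roots hC h.mem
  have h1 : ∀ᶠ z in nhds p, ∀ w ∈ F, wq C w p ≠ 0 → wq C w z ≠ 0 := by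
    rw [Filter.eventually_all_finite hF]
    intro w _
    by_cases hw : wq C w p = 0
    · exact Filter.Eventually.of_forall fun z h => absurd hw h
    · exact ((continuous_wq w).continuousAt.eventually_ne hw).mono fun _ h _ => h
  filter_upwards [hev, h1, isOpen_tube.mem_nhds h.mem] with z e1 e2 e3
  refine ⟨e3, fun hf0 => ?_⟩
  obtain ⟨w, hw, hwz⟩ := hz z e3 hf0
  by_cases hwp : wq C w p = 0
  · rcases h.only w hw hwp with rfl | rfl
    · exact hwz
    · rw [wq_neg, neg_eq_zero] at hwz; exact hwz
  · exact absurd hwz (e2 w (e1 w hw hwz) hwp)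

theorem Gen.lineOrd_locally_const (hC : PD C) (hf : DifferentiableOn ℂ f (Tube C))
    (hz : ReflZeros C f) {b : ℤ} {α : Fin (2 + r) → ℤ} (hα : bil (SM C) α α = -2)
    {p : Fin (2 + r) → ℂ} (h : Gen C (hv 0 b α) p) :
    ∀ᶠ q in nhds p, wq C (hv 0 b α) q = 0 → lineOrd f q α = lineOrd f p α := by
  obtain ⟨δ, hδ, hb⟩ := Metric.eventually_nhds_iff_ball.1 (h.local_zero hC hz)
  set N := ‖intC α‖
  have hN : 0 ≤ N := norm_nonneg _
  set ε := δ / 2 / (N + 1) with hε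
  have hε0 : 0 < ε := by positivity
  have hball : ∀ q ∈ Metric.ball p (δ / 2), ∀ s ∈ Metric.closedBall (0 : ℂ) ε,
      q + s • intC α ∈ Metric.ball p δ := by
    intro q hq s hs
    rw [Metric.mem_ball, dist_eq_norm] at hq ⊢
    rw [mem_closedBall_zero_iff] at hs
    have e : q + s • intC α - p = (q - p) + s • intC α := by abel
    rw [e]
    have h2 : ‖s • intC α‖ ≤ δ / 2 := by
      rw [norm_smul]
      calc ‖s‖ * N ≤ ε * (N + 1) := by gcongr; linarith
        _ = δ / 2 := by rw [hε]; field_simp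
    linarith [norm_add_le (q - p) (s • intC α)]
  have hw : ∀ q ∈ Metric.ball p (δ / 2), wq C (hv 0 b α) q = 0 →
      wind (fun t => f (q + (ε * Complex.exp (2 * Real.pi * Complex.I * t) : ℂ) • intC α)) =
        lineOrd f q α := by
    intro q hq hq0
    refine wind_eq_order (g := fun s => f (q + s • intC α)) hε0 (fun s hs => ?_) fun s hs h0 => ?_
    · exact analyticAt_line isOpen_tube hf _ _ (hb _ (hball q hq s hs)).1
    · have := (hb _ (hball q hq s hs)).2 h0
      rw [wq_line b hα, hq0] at this
      simpa using this
  filter_upwards [Metric.ball_mem_nhds p (half_pos hδ)] with q hq hq0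
  have hEm : ∀ t : ℝ, (ε : ℂ) * Complex.exp (2 * Real.pi * Complex.I * t) ∈
      Metric.closedBall (0 : ℂ) ε := by
    intro t
    rw [mem_closedBall_zero_iff, norm_mul, Complex.norm_exp, Complex.norm_real,
      Real.norm_of_nonneg hε0.le]
    simp
  have hp : p ∈ Metric.ball p (δ / 2) := Metric.mem_ball_self (half_pos hδ)
  have hseg : ∀ σ ∈ Set.Icc (0 : ℝ) 1, p + (σ : ℂ) • (q - p) ∈ Metric.ball p (δ / 2) := by
    intro σ hσ
    have := (convex_ball p (δ / 2)).add_smul_sub_mem hp hq hσ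
    simpa using this
  have hzero : ∀ σ : ℝ, wq C (hv 0 b α) (p + (σ : ℂ) • (q - p)) = 0 := by
    intro σ
    have e1 := h.zero
    rw [wq_hv] at e1 hq0 ⊢
    simp only [bil_add_right, bil_smul_right, bil_sub_right, Int.cast_zero, zero_mul, zero_div,
      sub_zero] at e1 hq0 ⊢
    linear_combination (1 - (σ : ℂ)) * e1 + σ * hq0
  have hom := wind_homotopy (fun σ t => f (p + (σ : ℂ) • (q - p) +
    (ε * Complex.exp (2 * Real.pi * Complex.I * t) : ℂ) • intC α)) ?_ ?_ ?_
  · have e0 := hw p hp h.zero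
    have e1 := hw q hq hq0
    simp only [Complex.ofReal_zero, zero_smul, add_zero, Complex.ofReal_one, one_smul,
      add_sub_cancel] at hom
    rw [e0, e1] at hom
    exact_mod_cast hom.symm
  · refine hf.continuousOn.comp (Continuous.continuousOn (by fun_prop)) ?_
    rintro ⟨σ, t⟩ ⟨hσ, -⟩
    exact (hb _ (hball _ (hseg σ hσ) _ (hEm t))).1
  · intro σ hσ t h0
    have := (hb _ (hball _ (hseg σ hσ) _ (hEm t))).2 h0
    rw [wq_line b hα, hzero] at this
    have hne : (ε : ℂ) * Complex.exp (2 * Real.pi * Complex.I * t) ≠ 0 :=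
      mul_ne_zero (by exact_mod_cast hε0.ne') (Complex.exp_ne_zero _)
    simp [hne] at this
  · intro σ _; simp

theorem lineOrd_segment (hC : PD C) (hf : DifferentiableOn ℂ f (Tube C))
    (hz : ReflZeros C f) {b : ℤ} {α : Fin (2 + r) → ℤ} (hα : bil (SM C) α α = -2)
    {p d : Fin (2 + r) → ℂ}
    (h : ∀ t ∈ Set.Icc (0 : ℝ) 1, Gen C (hv 0 b α) (p + (t : ℂ) • d)) :
    lineOrd f (p + d) α = lineOrd f p α := by
  have hc : ContinuousOn (fun t : ℝ => lineOrd f (p + (t : ℂ) • d) α) (Set.Icc 0 1) := by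
    intro t ht
    have h1 := (h t ht).lineOrd_locally_const hC hf hz hα
    have h2 : Filter.Tendsto (fun t : ℝ => p + (t : ℂ) • d) (nhdsWithin t (Set.Icc 0 1))
        (nhds (p + (t : ℂ) • d)) :=
      (Continuous.continuousAt (f := fun t : ℝ => p + (t : ℂ) • d)
        (by fun_prop)).continuousWithinAt
    rw [ContinuousWithinAt, nhds_discrete, Filter.tendsto_pure]
    filter_upwards [h2.eventually h1, self_mem_nhdsWithin] with t' e1 e2
    exact e1 (h t' e2).zero
  have := isPreconnected_Icc.constant hc (Set.right_mem_Icc.2 zero_le_one)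
    (Set.left_mem_Icc.2 zero_le_one)
  simpa using this

theorem countable_bad {v : Fin (2 + (2 + r)) → ℤ} {p : Fin (2 + r) → ℂ} (h : Gen C v p)
    (d : Fin (2 + r) → ℂ) :
    {ζ : ℂ | ∃ w, bil (MM C) w w = -2 ∧ ¬(w = v ∨ w = -v) ∧ wq C w (p + ζ • d) = 0}.Countable := by
  have : {ζ : ℂ | ∃ w, bil (MM C) w w = -2 ∧ ¬(w = v ∨ w = -v) ∧ wq C w (p + ζ • d) = 0} ⊆
      ⋃ w : Fin (2 + (2 + r)) → ℤ, {ζ : ℂ | wq C w p ≠ 0 ∧ wq C w (p + ζ • d) = 0} := by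
    rintro ζ ⟨w, h1, h2, h3⟩
    exact Set.mem_iUnion.2 ⟨w, fun h0 => h2 (h.only w h1 h0), h3⟩
  refine (Set.countable_iUnion fun w => ?_).mono this
  by_cases hw : wq C w p = 0
  · simp [hw]
  · obtain ⟨a, b, l, rfl⟩ := exists_hv w
    set P : Polynomial ℂ := Polynomial.C (wq C (hv a b l) p) + Polynomial.C (bil (SM C) (intC l) d -
      a * (bil (SM C) p d + bil (SM C) d p) / 2) * Polynomial.X +
      Polynomial.C (-(a * bil (SM C) d d / 2)) * Polynomial.X ^ 2 with hP
    have key : ∀ ζ : ℂ, wq C (hv a b l) (p + ζ • d) = P.eval ζ := by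
      intro ζ
      simp only [hP, wq_hv, bil_add_left, bil_add_right, bil_smul_left, bil_smul_right,
        Polynomial.eval_add, Polynomial.eval_mul, Polynomial.eval_C, Polynomial.eval_X,
        Polynomial.eval_pow]
      ring
    have hP0 : P ≠ 0 := by
      intro h0
      have := key 0
      rw [h0] at this
      exact hw (by simpa using this)
    refine ((Polynomial.finite_setOfPred_isRoot hP0).subset ?_).countable
    rintro ζ ⟨-, h3⟩
    exact (key ζ).symm.trans h3

theorem lineOrd_eq (hC : PD C) (hf : DifferentiableOn ℂ f (Tube C))
    (hz : ReflZeros C f) {b : ℤ} {α : Fin (2 + r) → ℤ} (hα : bil (SM C) α α = -2)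
    {p p' : Fin (2 + r) → ℂ} (h : Gen C (hv 0 b α) p) (h' : Gen C (hv 0 b α) p') :
    lineOrd f p' α = lineOrd f p α := by
  set d := p' - p
  set B := {ζ : ℂ | ∃ w, bil (MM C) w w = -2 ∧ ¬(w = hv 0 b α ∨ w = -hv 0 b α) ∧
    wq C w (p + ζ • d) = 0}
  have hB : B.Countable := countable_bad h d
  have hmid : p + ((1 / 2 : ℝ) : ℂ) • d ∈ Tube C := by
    have := (convex_tube hC).add_smul_sub_mem h.mem h'.mem (t := (1 / 2 : ℝ)) (by norm_num)
    have e : ((1 / 2 : ℝ) : ℂ) • d = (1 / 2 : ℝ) • (p' - p) := by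
      ext i; simp [d]
    rwa [e]
  have hy : ∀ᶠ y : ℝ in nhds 0, p + (1 / 2 + Complex.I * y : ℂ) • d ∈ Tube C := by
    have hc : Continuous fun y : ℝ => p + (1 / 2 + Complex.I * y : ℂ) • d := by fun_prop
    refine hc.continuousAt.eventually (isOpen_tube.mem_nhds ?_)
    simpa using hmid
  obtain ⟨δ, hδ, hb⟩ := Metric.eventually_nhds_iff_ball.1 hy
  have hcount : ((fun ζ : ℂ => ζ.im / (2 * ζ.re)) '' B ∪
      (fun ζ : ℂ => ζ.im / (2 * (1 - ζ.re))) '' B).Countable :=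
    (hB.image _).union (hB.image _)
  obtain ⟨y, hy1, hy2⟩ : ∃ y ∈ Set.Ioo 0 δ, y ∉ ((fun ζ : ℂ => ζ.im / (2 * ζ.re)) '' B ∪
      (fun ζ : ℂ => ζ.im / (2 * (1 - ζ.re))) '' B) := by
    by_contra hcon
    push Not at hcon
    exact (Cardinal.Real.Ioo_countable_iff.not.2 (by linarith)) (hcount.mono hcon)
  simp only [Set.mem_union, Set.mem_image, not_or, not_exists, not_and] at hy2
  have hyT := hb y (by simp [abs_of_pos hy1.1, hy1.2])
  have hlin : ∀ ζ : ℂ, wq C (hv 0 b α) (p + ζ • d) = 0 := by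
    intro ζ
    have e1 := h.zero
    have e2 := h'.zero
    rw [wq_hv] at e1 e2 ⊢
    simp only [d, bil_add_right, bil_smul_right, bil_sub_right, Int.cast_zero, zero_mul, zero_div,
      sub_zero] at e1 e2 ⊢
    linear_combination (1 - ζ) * e1 + ζ * e2
  have hgen : ∀ ζ : ℂ, p + ζ • d ∈ Tube C → ζ ∉ B → Gen C (hv 0 b α) (p + ζ • d) := by
    intro ζ h1 h2
    refine ⟨h1, hlin ζ, fun w hw hw0 => ?_⟩
    by_contra hcon
    exact h2 ⟨w, hw, hcon, hw0⟩
  set m : ℂ := 1 / 2 + Complex.I * y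
  have mre : m.re = 1 / 2 := by simp [m]
  have mim : m.im = y := by simp [m]
  have s1 : lineOrd f (p + m • d) α = lineOrd f p α := by
    refine lineOrd_segment (b := b) hC hf hz hα fun t ht => ?_
    rcases eq_or_lt_of_le ht.1 with rfl | htp
    · simpa using h
    · rw [smul_smul]
      refine hgen _ ?_ fun hB' => hy2.1 _ hB' ?_
      · have := (convex_tube hC).add_smul_sub_mem h.mem hyT ht
        have e : ((t : ℂ) * m) • d = t • (p + m • d - p) := by
          ext i; simp [mul_assoc]
        rwa [e]
      · simp only [Complex.mul_re, Complex.mul_im, Complex.ofReal_re, Complex.ofReal_im, mre, mim]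
        have := htp.ne'
        rw [div_eq_iff (by simp; positivity)]
        ring
  have s2 : lineOrd f (p' + (m - 1) • d) α = lineOrd f p' α := by
    refine lineOrd_segment (b := b) hC hf hz hα fun t ht => ?_
    rcases eq_or_lt_of_le ht.1 with rfl | htp
    · simpa using h'
    · have e0 : p' + (t : ℂ) • (m - 1) • d = p + (1 + t * (m - 1)) • d := by
        ext i; simp [d]; ring
      rw [e0]
      refine hgen _ ?_ fun hB' => hy2.2 _ hB' ?_
      · rw [← e0]
        have := (convex_tube hC).add_smul_sub_mem h'.mem hyT ht
        have e : (t : ℂ) • (m - 1) • d = t • (p + m • d - p') := by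
          ext i; simp [d]; ring_nf; simp
        rwa [e]
      · simp only [Complex.mul_re, Complex.mul_im, Complex.ofReal_re, Complex.ofReal_im, mre, mim,
          Complex.add_re, Complex.add_im, Complex.sub_re, Complex.sub_im, Complex.one_re,
          Complex.one_im]
        have := htp.ne'
        rw [div_eq_iff (fun h0 => htp.ne' (by linear_combination h0))]
        ring
  have e : p' + (m - 1) • d = p + m • d := by ext i; simp [d]; ring
  rw [← s2, e, s1]

end Order

end Refl

open Matrix
namespace Refl

section Strip

open Filter Topology

/-- The points of the plane outside the half-integers. -/
def nonHalf : Set ℂ := {s | ∀ n : ℤ, s ≠ n / 2}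

theorem dense_nonHalf : Dense nonHalf := by
  have h : (Set.range fun n : ℤ => (n / 2 : ℂ)).Countable := Set.countable_range _
  have e : nonHalf = (Set.range fun n : ℤ => (n / 2 : ℂ))ᶜ := by
    ext s; simp [nonHalf, eq_comm]
  rw [e]; exact h.dense_compl ℝ

theorem nonHalf_of_im {s : ℂ} (h : s.im ≠ 0) : s ∈ nonHalf := by
  rintro n rfl
  apply h
  have : ((n : ℂ) / 2) = ((n / 2 : ℝ) : ℂ) := by push_cast; rfl
  rw [this, Complex.ofReal_im]

/-- `e(s) = exp(2πis)`. -/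
noncomputable def cexp1 (s : ℂ) : ℂ := Complex.exp (2 * Real.pi * Complex.I * s)

theorem continuous_cexp1 : Continuous cexp1 := by unfold cexp1; fun_prop

theorem cexp1_add (s t : ℂ) : cexp1 (s + t) = cexp1 s * cexp1 t := by
  rw [cexp1, cexp1, cexp1, ← Complex.exp_add]; ring_nf

theorem cexp1_int (n : ℤ) : cexp1 n = 1 := by
  rw [cexp1, show 2 * Real.pi * Complex.I * (n : ℂ) = n * (2 * Real.pi * Complex.I) by ring]
  exact Complex.exp_int_mul_two_pi_mul_I n

theorem cexp1_half : cexp1 (1 / 2) = -1 := by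
  rw [cexp1, show 2 * Real.pi * Complex.I * (1 / 2) = Real.pi * Complex.I by ring]
  exact Complex.exp_pi_mul_I

theorem cexp1_eq_one {s : ℂ} (h : cexp1 s = 1) : ∃ n : ℤ, s = n := by
  obtain ⟨n, hn⟩ := Complex.exp_eq_one_iff.1 h
  refine ⟨n, ?_⟩
  have : (2 * Real.pi * Complex.I : ℂ) ≠ 0 := Complex.two_pi_I_ne_zero
  apply mul_left_cancel₀ this
  rw [hn]; ring

/-- The function `(e(s) - 1)^m (e(s) + 1)^n`. -/
noncomputable def halfPoly (m n : ℕ) (s : ℂ) : ℂ := (cexp1 s - 1) ^ m * (cexp1 s + 1) ^ n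

theorem halfPoly_add_half (m n : ℕ) (s : ℂ) :
    halfPoly m n (s + 1 / 2) = (-1) ^ (m + n) * halfPoly n m s := by
  rw [halfPoly, halfPoly, cexp1_add, cexp1_half, show cexp1 s * -1 - 1 = -1 * (cexp1 s + 1) by ring,
    show cexp1 s * -1 + 1 = -1 * (cexp1 s - 1) by ring, mul_pow, mul_pow]
  ring

theorem halfPoly_add_int (m n : ℕ) (s : ℂ) (k : ℤ) : halfPoly m n (s + k) = halfPoly m n s := by
  rw [halfPoly, halfPoly, cexp1_add, cexp1_int, mul_one]

theorem halfPoly_ne_zero (m n : ℕ) {s : ℂ} (h : s ∈ nonHalf) : halfPoly m n s ≠ 0 := by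
  refine mul_ne_zero (pow_ne_zero _ fun h0 => ?_) (pow_ne_zero _ fun h0 => ?_)
  · obtain ⟨k, hk⟩ := cexp1_eq_one (sub_eq_zero.1 h0)
    exact h (2 * k) (by rw [hk]; push_cast; ring)
  · have : cexp1 (s + 1 / 2) = 1 := by
      rw [cexp1_add, cexp1_half]; linear_combination -h0
    obtain ⟨k, hk⟩ := cexp1_eq_one this
    exact h (2 * k - 1) (by rw [eq_sub_of_add_eq hk]; push_cast; ring)

theorem continuous_halfPoly (m n : ℕ) : Continuous (halfPoly m n) :=
  ((continuous_cexp1.sub continuous_const).pow m).mul ((continuous_cexp1.add continuous_const).pow n)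

theorem tendsto_div_halfPoly {g : ℂ → ℂ} (hg : AnalyticAt ℂ g 0)
    (hnt : analyticOrderAt g 0 ≠ ⊤) (n : ℕ) :
    ∃ L : ℂ, L ≠ 0 ∧
      Tendsto (fun s => g s / halfPoly (analyticOrderNatAt g 0) n s) (𝓝[≠] 0) (𝓝 L) := by
  obtain ⟨u, hu, hu0, hev⟩ := (hg.analyticOrderAt_ne_top).1 hnt
  set m := analyticOrderNatAt g 0
  simp only [sub_zero, smul_eq_mul] at hev
  have hd : HasDerivAt cexp1 (2 * Real.pi * Complex.I) 0 := by
    have h1 : HasDerivAt (fun s : ℂ => 2 * Real.pi * Complex.I * s)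
        (2 * Real.pi * Complex.I) 0 := by
      simpa using (hasDerivAt_id (0 : ℂ)).const_mul (2 * Real.pi * Complex.I)
    have h2 := h1.cexp
    rw [mul_zero, Complex.exp_zero, one_mul] at h2
    exact h2
  have hs := hd.tendsto_slope_zero
  have e0 : cexp1 0 = 1 := by simpa using cexp1_int 0
  refine ⟨u 0 / ((2 * Real.pi * Complex.I) ^ m * (1 + 1) ^ n), ?_, ?_⟩
  · refine div_ne_zero hu0 (mul_ne_zero (pow_ne_zero _ Complex.two_pi_I_ne_zero)
      (pow_ne_zero _ (by norm_num)))
  · have h1 : Tendsto (fun s => u s / ((s⁻¹ • (cexp1 (0 + s) - cexp1 0)) ^ m * (cexp1 s + 1) ^ n))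
        (𝓝[≠] 0) (𝓝 (u 0 / ((2 * Real.pi * Complex.I) ^ m * (1 + 1) ^ n))) := by
      refine Tendsto.div (hu.continuousAt.tendsto.mono_left nhdsWithin_le_nhds)
        ((hs.pow m).mul ?_) ?_
      · have : Tendsto (fun s => (cexp1 s + 1) ^ n) (𝓝 0) (𝓝 ((cexp1 0 + 1) ^ n)) :=
          ((continuous_cexp1.add continuous_const).pow n).tendsto 0
        rw [e0] at this
        exact this.mono_left nhdsWithin_le_nhds
      · exact mul_ne_zero (pow_ne_zero _ Complex.two_pi_I_ne_zero) (pow_ne_zero _ (by norm_num))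
    refine h1.congr' ?_
    filter_upwards [hev.filter_mono nhdsWithin_le_nhds, self_mem_nhdsWithin] with s h2 h3
    have h3' : s ≠ 0 := h3
    rw [h2, halfPoly, zero_add, e0, smul_eq_mul, mul_pow, inv_pow]
    field_simp

theorem tendsto_punctured_of_zero {F G : ℂ → ℂ} {a L : ℂ} (hG : Tendsto G (𝓝[≠] 0) (𝓝 L))
    (h : ∀ᶠ s in 𝓝 0, F (a + s) = G s) : Tendsto F (𝓝[≠] a) (𝓝 L) := by
  have h0 : Tendsto (fun t : ℂ => t - a) (𝓝 a) (𝓝 0) := by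
    simpa using (continuous_id.sub continuous_const).tendsto (f := fun t : ℂ => t - a) a
  have h1 : Tendsto (fun t : ℂ => t - a) (𝓝[≠] a) (𝓝[≠] 0) :=
    tendsto_nhdsWithin_of_tendsto_nhds_of_eventually_within _ (h0.mono_left nhdsWithin_le_nhds)
      (by filter_upwards [self_mem_nhdsWithin] with t ht using sub_ne_zero.2 ht)
  refine (hG.comp h1).congr' ?_
  filter_upwards [(h0.eventually h).filter_mono nhdsWithin_le_nhds] with t ht
  rw [Function.comp_apply, ← ht, add_sub_cancel]

theorem analyticOrderAt_ne_top_of_zeros {g : ℂ → ℂ} {ε : ℝ} (hε : 0 < ε)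
    (h0 : ∀ s : ℂ, ‖s‖ < ε → g s = 0 → s ∉ nonHalf) : analyticOrderAt g 0 ≠ ⊤ := by
  rw [ne_eq, analyticOrderAt_eq_top]
  intro hev
  obtain ⟨s, hs, h1, h2⟩ := (dense_nonHalf.inter_nhds_nonempty
    (hev.and (Metric.ball_mem_nhds 0 hε)))
  exact h0 s (by simpa using h2) h1 hs

theorem wind_cexp1_sub {ε : ℝ} (hε : 1 < ε) (c : ℂ) (hc : ‖c‖ = 1) :
    wind (fun t => (ε : ℂ) * cexp1 t - c) = 1 := by
  have h := wind_homotopy (fun σ t => (ε : ℂ) * cexp1 t - σ * c) ?_ ?_ ?_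
  · have h2 := wind_circle (show 0 < ε by linarith) 1
    simp only [pow_one, Nat.cast_one] at h2
    simp only [Complex.ofReal_zero, zero_mul, sub_zero, Complex.ofReal_one, one_mul] at h
    rw [← h]; exact h2
  · have := continuous_cexp1
    fun_prop
  · intro σ hσ t h0
    have := congrArg norm (sub_eq_zero.1 h0)
    rw [norm_mul, norm_mul, hc, Complex.norm_real, Complex.norm_real, cexp1, Complex.norm_exp,
      Real.norm_of_nonneg hσ.1, Real.norm_of_nonneg (by linarith)] at this
    simp at this
    linarith [hσ.2]
  · intro σ _
    have h1 := cexp1_int 1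
    have h2 := cexp1_int 0
    push_cast at h1 h2 ⊢
    rw [h1, h2]

theorem wind_cexp1_sub_lt {ε : ℝ} (hε0 : 0 ≤ ε) (hε : ε < 1) (c : ℂ) (hc : ‖c‖ = 1) :
    wind (fun t => (ε : ℂ) * cexp1 t - c) = 0 := by
  have h := wind_homotopy (fun σ t => (σ : ℂ) * (ε * cexp1 t) - c) ?_ ?_ ?_
  · simp only [Complex.ofReal_zero, zero_mul, zero_sub, Complex.ofReal_one, one_mul] at h
    rw [← h]
    exact wind_const _ (neg_ne_zero.2 (by rintro rfl; simp at hc))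
  · have := continuous_cexp1
    fun_prop
  · intro σ hσ t h0
    have := congrArg norm (sub_eq_zero.1 h0)
    rw [norm_mul, norm_mul, hc, Complex.norm_real, Complex.norm_real, cexp1, Complex.norm_exp,
      Real.norm_of_nonneg hσ.1, Real.norm_of_nonneg hε0] at this
    simp at this
    nlinarith [hσ.1, hσ.2]
  · intro σ _
    have h1 := cexp1_int 1
    have h2 := cexp1_int 0
    push_cast at h1 h2 ⊢
    rw [h1, h2]

theorem wind_pow {u : ℝ → ℂ} (hu : Continuous u) (hu0 : ∀ t, u t ≠ 0) (hu1 : u 1 = u 0) (m : ℕ) :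
    wind (fun t => u t ^ m) = m * wind u := by
  induction m with
  | zero => simpa using wind_const 1 one_ne_zero
  | succ m ih =>
    simp only [pow_succ]
    have := wind_mul (u := fun t => u t ^ m) (hu.pow m) hu (fun t => pow_ne_zero _ (hu0 t)) hu0
      (by simp only [hu1]) hu1
    rw [this, ih]
    push_cast; ring

theorem wind_halfPoly (m n : ℕ) {y : ℝ} (hy : y ≠ 0) :
    wind (fun t => halfPoly m n (t + y * Complex.I)) = if y < 0 then (m + n : ℤ) else 0 := by
  have e : ∀ t : ℝ, cexp1 (t + y * Complex.I) = (Real.exp (-(2 * Real.pi * y)) : ℂ) * cexp1 t := by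
    intro t
    rw [cexp1_add, mul_comm, cexp1, Complex.ofReal_exp]
    congr 2
    push_cast
    linear_combination (2 * Real.pi * y : ℂ) * Complex.I_mul_I
  have hne := fun t : ℝ => nonHalf_of_im (s := (t + y * Complex.I)) (by simpa using hy)
  have h1 : ∀ t : ℝ, cexp1 (t + y * Complex.I) - 1 ≠ 0 := fun t => by
    simpa [halfPoly] using halfPoly_ne_zero 1 0 (hne t)
  have h2 : ∀ t : ℝ, cexp1 (t + y * Complex.I) + 1 ≠ 0 := fun t => by
    simpa [halfPoly] using halfPoly_ne_zero 0 1 (hne t)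
  have c1 : Continuous fun t : ℝ => cexp1 (t + y * Complex.I) := by
    have := continuous_cexp1; fun_prop
  have p1 : cexp1 ((1 : ℝ) + y * Complex.I) = cexp1 ((0 : ℝ) + y * Complex.I) := by
    rw [e, e]
    have h1 := cexp1_int 1
    have h2 := cexp1_int 0
    push_cast at h1 h2 ⊢
    rw [h1, h2]
  simp only [halfPoly]
  have wm := wind_mul (u := fun t : ℝ => (cexp1 (t + y * Complex.I) - 1) ^ m)
    (v := fun t : ℝ => (cexp1 (t + y * Complex.I) + 1) ^ n)
    ((c1.sub continuous_const).pow m) ((c1.add continuous_const).pow n)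
    (fun t => pow_ne_zero _ (h1 t)) (fun t => pow_ne_zero _ (h2 t)) (by simp only [p1])
    (by simp only [p1])
  have wp1 := wind_pow (u := fun t : ℝ => cexp1 (t + y * Complex.I) - 1)
    (c1.sub continuous_const) h1 (by simp only [p1]) m
  have wp2 := wind_pow (u := fun t : ℝ => cexp1 (t + y * Complex.I) + 1)
    (c1.add continuous_const) h2 (by simp only [p1]) n
  rw [wm, wp1, wp2]
  have e2 : ∀ t : ℝ, cexp1 (t + y * Complex.I) + 1 =
      (Real.exp (-(2 * Real.pi * y)) : ℂ) * cexp1 t - (-1) := by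
    intro t; rw [e]; ring
  rw [show (fun t : ℝ => cexp1 (t + y * Complex.I) + 1) = _ from funext e2]
  simp only [e]
  have hpi := Real.pi_pos
  split_ifs with h
  · have : 1 < Real.exp (-(2 * Real.pi * y)) := by
      rw [Real.one_lt_exp_iff]; nlinarith
    have w1 := wind_cexp1_sub this 1 (by simp)
    have w2 := wind_cexp1_sub this (-1) (by simp)
    rw [w1, w2]; ring
  · have hy' : 0 < y := lt_of_le_of_ne (not_lt.1 h) hy.symm
    have : Real.exp (-(2 * Real.pi * y)) < 1 := by
      rw [Real.exp_lt_one_iff]; nlinarith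
    have w1 := wind_cexp1_sub_lt (Real.exp_pos _).le this 1 (by simp)
    have w2 := wind_cexp1_sub_lt (Real.exp_pos _).le this (-1) (by simp)
    rw [w1, w2]; ring

/-- An even periodic function on a strip with zeros only at half-integers. -/
theorem two_wind_strip {g : ℂ → ℂ} {h : ℝ} (hh : 0 < h)
    (hg : ∀ s : ℂ, |s.im| ≤ h → AnalyticAt ℂ g s)
    (h1 : ∀ s : ℂ, |s.im| ≤ h → g (s + 1) = g s) (h2 : ∀ s : ℂ, |s.im| ≤ h → g (-s) = g s)
    (h0 : ∀ s : ℂ, |s.im| ≤ h → g s = 0 → s ∉ nonHalf) :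
    2 * wind (fun t => g (t + (-h : ℝ) * Complex.I)) =
      analyticOrderNatAt g 0 + analyticOrderNatAt (fun s => g (1 / 2 + s)) 0 := by
  set c0 := analyticOrderNatAt g 0
  set c1 := analyticOrderNatAt (fun s => g (1 / 2 + s)) 0
  have hper : ∀ (n : ℤ) (s : ℂ), |s.im| ≤ h → g (s + n) = g s := by
    intro n
    induction n using Int.induction_on with
    | zero => simp
    | succ i ih =>
      intro s hs
      rw [← ih s hs, ← h1 (s + (i : ℤ)) (by simpa using hs)]
      push_cast; ring_nf
    | pred i ih =>
      intro s hs
      rw [← ih s hs, ← h1 (s + (-i - 1 : ℤ)) (by simpa using hs)]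
      push_cast; ring_nf
  have hnorm : ∀ s : ℂ, ‖s‖ < h → |s.im| ≤ h := fun s hs => (Complex.abs_im_le_norm s).trans hs.le
  obtain ⟨L0, hL0, hT0⟩ := tendsto_div_halfPoly (hg 0 (by simpa using hh.le))
    (analyticOrderAt_ne_top_of_zeros hh fun s hs => h0 s (hnorm s hs)) c1
  have hg' : AnalyticAt ℂ (fun s => g (1 / 2 + s)) 0 := by
    refine AnalyticAt.comp (g := g) ?_ (by fun_prop)
    exact hg _ (by simpa using hh.le)
  obtain ⟨L1, hL1, hT1⟩ := tendsto_div_halfPoly hg'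
    (analyticOrderAt_ne_top_of_zeros hh fun s hs hs0 hmem => by
      refine h0 (1 / 2 + s) (by simpa using hnorm s hs) hs0 fun n hn => ?_
      exact hmem (n - 1) (by rw [eq_sub_of_add_eq' hn]; push_cast; ring)) c0
  set F : ℂ → ℂ := fun s => g s / halfPoly c0 c1 s with hF
  have hFint : ∀ (n : ℤ) (s : ℂ), |s.im| ≤ h → F (s + n) = F s := fun n s hs => by
    simp only [hF, halfPoly_add_int, hper n s hs]
  have hnear : ∀ᶠ s : ℂ in 𝓝 0, ‖s‖ < h := by
    filter_upwards [Metric.ball_mem_nhds (0 : ℂ) hh] with s hs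
    simpa using hs
  have hlim0 : ∀ n : ℤ, Tendsto F (𝓝[≠] (n : ℂ)) (𝓝 L0) := by
    intro n
    refine tendsto_punctured_of_zero hT0 (hnear.mono fun s hs => ?_)
    rw [add_comm, hFint n s (hnorm s hs)]
  have hlim1 : ∀ n : ℤ, Tendsto F (𝓝[≠] (n + 1 / 2 : ℂ)) (𝓝 (((-1) ^ (c0 + c1))⁻¹ * L1)) := by
    intro n
    refine tendsto_punctured_of_zero (hT1.const_mul _) (hnear.mono fun s hs => ?_)
    rw [show (n + 1 / 2 + s : ℂ) = (s + 1 / 2) + n by ring,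
      hFint n _ (by simpa using hnorm s hs)]
    simp only [hF, halfPoly_add_half]
    rw [add_comm s, div_mul_eq_div_div_swap, div_eq_inv_mul]
  have hcontF : ∀ s : ℂ, |s.im| ≤ h → s ∈ nonHalf → ContinuousAt F s := fun s hs hs' =>
    (hg s hs).continuousAt.div (continuous_halfPoly c0 c1).continuousAt (halfPoly_ne_zero _ _ hs')
  have hlim : ∀ s : ℂ, |s.im| ≤ h → ∃ L : ℂ, L ≠ 0 ∧ Tendsto F (𝓝[nonHalf] s) (𝓝 L) := by
    intro s hs
    by_cases hs' : s ∈ nonHalf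
    · exact ⟨F s, div_ne_zero (fun h => h0 s hs h hs') (halfPoly_ne_zero _ _ hs'),
        (hcontF s hs hs').tendsto.mono_left nhdsWithin_le_nhds⟩
    · have hle : 𝓝[nonHalf] s ≤ 𝓝[≠] s := nhdsWithin_mono _ fun t ht => by
        rintro rfl; exact hs' ht
      simp only [nonHalf, Set.mem_ofPred_eq, not_forall, not_not] at hs'
      obtain ⟨n, rfl⟩ := hs'
      rcases Int.even_or_odd' n with ⟨k, rfl | rfl⟩
      · refine ⟨L0, hL0, Tendsto.mono_left ?_ hle⟩
        have := hlim0 k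
        rwa [show ((2 * k : ℤ) / 2 : ℂ) = k by push_cast; ring]
      · refine ⟨((-1) ^ (c0 + c1))⁻¹ * L1, mul_ne_zero (inv_ne_zero (pow_ne_zero _ (by norm_num))) hL1,
          Tendsto.mono_left ?_ hle⟩
        have := hlim1 k
        rwa [show ((2 * k + 1 : ℤ) / 2 : ℂ) = k + 1 / 2 by push_cast; ring]
  set H := extendFrom nonHalf F
  have hHeq : ∀ {s L : ℂ}, Tendsto F (𝓝[nonHalf] s) (𝓝 L) → H s = L := fun hL =>
    extendFrom_eq (dense_nonHalf _) hL
  have hHc : ContinuousOn H {s : ℂ | |s.im| ≤ h} :=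
    continuousOn_extendFrom (fun s _ => dense_nonHalf s) fun s hs => by
      obtain ⟨L, -, hL⟩ := hlim s hs
      exact ⟨L, hL⟩
  have hH0 : ∀ s : ℂ, |s.im| ≤ h → H s ≠ 0 := by
    intro s hs
    obtain ⟨L, hL0, hL⟩ := hlim s hs
    rwa [hHeq hL]
  have hHF : ∀ s : ℂ, |s.im| ≤ h → s ∈ nonHalf → H s = F s := fun s hs hs' =>
    hHeq ((hcontF s hs hs').tendsto.mono_left nhdsWithin_le_nhds)
  have hline : ∀ σ ∈ Set.Icc (0 : ℝ) 1, |(1 - 2 * σ) * h| ≤ h := by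
    intro σ hσ
    rw [abs_le]
    constructor <;> nlinarith [hσ.1, hσ.2]
  have hwH : wind (fun t => H (t + (h : ℝ) * Complex.I)) =
      wind (fun t => H (t + (-h : ℝ) * Complex.I)) := by
    have hHint : ∀ n : ℤ, H n = L0 := fun n => hHeq ((hlim0 n).mono_left
      (nhdsWithin_mono _ fun t ht => by
        rintro rfl; exact ht (2 * n) (by push_cast; ring)))
    have hper : ∀ y : ℝ, |y| ≤ h → H ((1 : ℝ) + y * Complex.I) = H ((0 : ℝ) + y * Complex.I) := by
      intro y hy
      by_cases hy0 : y = 0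
      · have e1 := hHint 1
        have e0 := hHint 0
        push_cast at e1 e0
        simp [hy0, e1, e0]
      · have hn : ∀ t : ℝ, (t + y * Complex.I : ℂ) ∈ nonHalf := fun t =>
          nonHalf_of_im (by simpa using hy0)
        rw [hHF _ (by simpa using hy) (hn _), hHF _ (by simpa using hy) (hn _),
          ← hFint 1 ((0 : ℝ) + y * Complex.I) (by simpa using hy)]
        push_cast; ring_nf
    have := wind_homotopy (fun σ t => H (t + ((1 - 2 * σ) * h : ℝ) * Complex.I)) ?_ ?_ ?_
    · simpa [show (1 - 2 : ℝ) = -1 by norm_num] using this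
    · refine hHc.comp (Continuous.continuousOn (by fun_prop)) ?_
      rintro ⟨σ, t⟩ ⟨hσ, -⟩
      simpa using hline σ hσ
    · intro σ hσ t
      exact hH0 _ (by simpa using hline σ hσ)
    · intro σ hσ
      exact hper _ (hline σ hσ)
  have hfac : ∀ y : ℝ, y ≠ 0 → |y| ≤ h → wind (fun t => g (t + y * Complex.I)) =
      wind (fun t => H (t + y * Complex.I)) + if y < 0 then (c0 + c1 : ℤ) else 0 := by
    intro y hy hyh
    have him : ∀ t : ℝ, |((t : ℂ) + y * Complex.I).im| ≤ h := fun t => by simpa using hyh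
    have hnh : ∀ t : ℝ, ((t : ℂ) + y * Complex.I) ∈ nonHalf := fun t =>
      nonHalf_of_im (by simpa using hy)
    have hp1 : ∀ G : ℂ → ℂ, (∀ s : ℂ, |s.im| ≤ h → G (s + (1 : ℤ)) = G s) →
        G ((1 : ℝ) + y * Complex.I) = G ((0 : ℝ) + y * Complex.I) := by
      intro G hG
      rw [← hG _ (him 0)]; push_cast; ring_nf
    have hHF1 := hp1 F fun s hs => hFint 1 s hs
    rw [← wind_halfPoly c0 c1 hy, ← wind_mul]
    · congr 1
      funext t
      rw [hHF _ (him t) (hnh t)]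
      simp only [hF]
      rw [div_mul_cancel₀ _ (halfPoly_ne_zero _ _ (hnh t))]
    · exact hHc.comp_continuous (by fun_prop) him
    · have := continuous_halfPoly c0 c1
      fun_prop
    · exact fun t => hH0 _ (him t)
    · exact fun t => halfPoly_ne_zero _ _ (hnh t)
    · rw [hHF _ (him _) (hnh _), hHF _ (him _) (hnh _), hHF1]
    · exact hp1 _ fun s _ => halfPoly_add_int c0 c1 s 1
  have hgc : ∀ y : ℝ, |y| ≤ h → Continuous fun t : ℝ => g (t + y * Complex.I) := by
    intro y hy
    refine continuous_iff_continuousAt.2 fun t => ?_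
    exact ContinuousAt.comp (f := fun t : ℝ => (t : ℂ) + y * Complex.I)
      (hg _ (by simpa using hy)).continuousAt
      (Continuous.continuousAt (by fun_prop))
  have hsym := wind_neg (u := fun t : ℝ => g (t + h * Complex.I))
    (hgc h (by rw [abs_of_pos hh]))
    (fun t ht => h0 _ (by simp [abs_of_pos hh]) ht (nonHalf_of_im (by simpa using hh.ne')))
    (fun t => by
      rw [← h1 (t + h * Complex.I) (by simp [abs_of_pos hh])]
      push_cast; ring_nf)
  have hrefl : (fun t : ℝ => g ((-t : ℝ) + h * Complex.I)) =
      fun t : ℝ => g (t + (-h : ℝ) * Complex.I) := by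
    funext t
    rw [← h2 (t + (-h : ℝ) * Complex.I) (by simp [abs_of_pos hh])]
    push_cast; ring_nf
  rw [hrefl] at hsym
  have hm := hfac (-h) (by linarith) (by simp [abs_of_pos hh])
  have hp := hfac h hh.ne' (by simp [abs_of_pos hh])
  rw [if_pos (by linarith)] at hm
  rw [if_neg (by linarith)] at hp
  linarith

end Strip

end Refl

open Matrix
namespace Refl

section Rho

variable {r : ℕ} {C : Matrix (Fin r) (Fin r) ℤ} {k : ℤ} {f : (Fin (2 + r) → ℂ) → ℂ}

theorem roots_at (hC : PD C) {z : Fin (2 + r) → ℂ} {T : ℝ} {y : Fin r → ℝ}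
    (him : imv z = hv 1 T y) (hT : bil C y y + 2 < 2 * T) {v : Fin (2 + (2 + r)) → ℤ}
    (hv2 : bil (MM C) v v = -2) (h0 : wq C v z = 0) :
    ∃ b c : ℤ, ∃ μ : Fin r → ℤ, v = hv 0 b (hv 0 c μ) ∧ bil C μ μ = 2 ∧
      (c : ℝ) = bil C (intR μ) y := by
  obtain ⟨a, b, l, rfl⟩ := exists_hv v
  obtain ⟨e1, e2, -⟩ := wq_zero_data hC hv2 h0
  have hY : bil (SM C) (imv z) (imv z) = 2 * T - bil C y y := by rw [him, bil_S]; ring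
  have hY0 : 0 < bil (SM C) (imv z) (imv z) := by rw [hY]; linarith
  have hle : bil (SM C) (intR l - (a : ℝ) • rev z) (intR l - (a : ℝ) • rev z) ≤ 0 := by
    by_contra hcon
    have := negdef_orth hC hY0 e1 (not_le.1 hcon).le
    rw [this, bil_zero_left] at hcon
    exact hcon le_rfl
  have ha : a = 0 := by
    by_contra hne
    have h1 : (1 : ℝ) ≤ (a : ℝ) ^ 2 := by
      have : 0 < a ^ 2 := by positivity
      have : 1 ≤ a ^ 2 := by omega
      exact_mod_cast this
    rw [e2, hY] at hle
    nlinarith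
  subst ha
  simp only [Int.cast_zero, zero_smul, sub_zero, ne_eq, OfNat.ofNat_ne_zero, not_false_eq_true,
    zero_pow, zero_mul, add_zero] at e1 e2
  obtain ⟨l0, c, μ, rfl⟩ := exists_hv l
  rw [intR_hv, bil_S] at e2
  rw [intR_hv, him, bil_S] at e1
  have hn := hC.nonneg (intR μ - (l0 : ℝ) • y)
  simp only [bil_sub_left, bil_sub_right, bil_smul_left, bil_smul_right,
    bil_comm hC.symm y (intR μ)] at hn
  have hl0 : l0 = 0 := by
    by_contra hne
    have h1 : (1 : ℝ) ≤ (l0 : ℝ) ^ 2 := by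
      have : 0 < l0 ^ 2 := by positivity
      have : 1 ≤ l0 ^ 2 := by omega
      exact_mod_cast this
    have h2 : 0 ≤ 2 - (l0 : ℝ) ^ 2 * (2 * T - bil C y y) := by
      linear_combination hn + 2 * (l0 : ℝ) * e1 + (-1 : ℝ) * e2
    nlinarith [mul_nonneg (sub_nonneg.2 h1) (show 0 ≤ 2 * T - bil C y y by linarith)]
  subst hl0
  refine ⟨b, c, μ, rfl, ?_, ?_⟩
  · rw [bil_intR] at e2
    have : ((bil C μ μ : ℤ) : ℝ) = 2 := by
      simp only [Int.cast_zero, zero_mul, mul_zero, zero_add, zero_sub] at e2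
      linarith
    exact_mod_cast this
  · simp only [Int.cast_zero, zero_mul, zero_add, mul_one] at e1
    linarith

/-- Winding number of `f` along the loop `t ↦ iY + tλ`. -/
noncomputable def rho (f : (Fin (2 + r) → ℂ) → ℂ) (Y : Fin (2 + r) → ℝ) (l : Fin (2 + r) → ℤ) : ℤ :=
  wind fun t => f (Complex.I • cv Y + (t : ℂ) • intC l)

theorem mem_tube_of_im {z : Fin (2 + r) → ℂ} {T : ℝ} {y : Fin r → ℝ} (him : imv z = hv 1 T y)
    (hT : bil C y y + 2 < 2 * T) : z ∈ Tube C := by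
  rw [mem_tube, him]
  refine ⟨?_, ?_⟩
  · simp
  · rw [bil_S]; linarith

theorem rho_add (hC : PD C) (hd : ∀ i, C i i = 2) (i0 : Fin r) (hf : TForm C k f)
    {Y : Fin (2 + r) → ℝ} (hY : ∀ z, imv z = Y → z ∈ Tube C ∧ f z ≠ 0) (l m : Fin (2 + r) → ℤ) :
    rho f Y (l + m) = rho f Y l + rho f Y m := by
  have him : ∀ s t : ℝ, imv (Complex.I • cv Y + (s : ℂ) • intC l + (t : ℂ) • intC m) = Y := by
    intro s t
    rw [imv_add, imv_add, imv_smul_intC, imv_smul_intC]; simp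
  have := wind_diag (fun s t => f (Complex.I • cv Y + (s : ℂ) • intC l + (t : ℂ) • intC m)) ?_ ?_ ?_
    ?_
  · rw [rho, rho, rho]
    simp only [Complex.ofReal_zero, zero_smul, add_zero] at this
    rw [← this]
    congr 1; funext t
    rw [intC_add, smul_add, add_assoc]
  · refine continuous_iff_continuousAt.2 fun p => ?_
    refine ContinuousAt.comp (f := fun p : ℝ × ℝ => Complex.I • cv Y + (p.1 : ℂ) • intC l +
      (p.2 : ℂ) • intC m) ?_ (Continuous.continuousAt (by fun_prop))
    exact (hf.holo.differentiableAt (isOpen_tube.mem_nhds (hY _ (him _ _)).1)).continuousAt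
  · exact fun s t => (hY _ (him s t)).2
  · intro s
    simp only [Complex.ofReal_zero, zero_smul, add_zero, Complex.ofReal_one, one_smul]
    exact hf.trans hC hd i0 m (hY _ (by simpa using him s 0)).1
  · simp only [Complex.ofReal_zero, zero_smul, add_zero, Complex.ofReal_one, one_smul]
    exact hf.trans hC hd i0 l (hY _ (by simp)).1

theorem rho_zero {Y : Fin (2 + r) → ℝ} (hY : f (Complex.I • cv Y) ≠ 0) : rho f Y 0 = 0 := by
  rw [rho]
  simp only [intC_zero, smul_zero, add_zero]
  exact wind_const _ hY

theorem rho_nsmul (hC : PD C) (hd : ∀ i, C i i = 2) (i0 : Fin r) (hf : TForm C k f)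
    {Y : Fin (2 + r) → ℝ} (hY : ∀ z, imv z = Y → z ∈ Tube C ∧ f z ≠ 0) (n : ℕ)
    (l : Fin (2 + r) → ℤ) : rho f Y ((n : ℤ) • l) = n * rho f Y l := by
  induction n with
  | zero => simpa using rho_zero (hY _ (by simp)).2
  | succ n ih =>
    rw [Nat.cast_succ, add_smul, one_smul, rho_add hC hd i0 hf hY, ih]; ring

theorem rho_sum (hC : PD C) (hd : ∀ i, C i i = 2) (i0 : Fin r) (hf : TForm C k f)
    {Y : Fin (2 + r) → ℝ} (hY : ∀ z, imv z = Y → z ∈ Tube C ∧ f z ≠ 0) {ι : Type*}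
    (s : Finset ι) (l : ι → Fin (2 + r) → ℤ) : rho f Y (∑ i ∈ s, l i) = ∑ i ∈ s, rho f Y (l i) := by
  classical
  induction s using Finset.induction_on with
  | empty => simpa using rho_zero (hY _ (by simp)).2
  | insert i s hi ih => rw [Finset.sum_insert hi, Finset.sum_insert hi, rho_add hC hd i0 hf hY, ih]

theorem two_rho (hC : PD C) (hd : ∀ i, C i i = 2) (i0 : Fin r) (hf : TForm C k f)
    (hz : ReflZeros C f) {c : ℤ} {β : Fin r → ℤ} (hβ : bil C β β = 2) {y : Fin r → ℝ}
    (hy : bil C y y < 2) {h : ℝ} (hh : 0 < h) (hc : c - bil C (intR β) y = 2 * h)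
    (hwall : ∀ μ : Fin r → ℤ, bil C μ μ = 2 → ∀ c' : ℤ, ∀ τ ∈ Set.Icc 0 h,
      c' = bil C (intR μ) (y + τ • intR β) → τ = h ∧ ((μ = β ∧ c' = c) ∨ (μ = -β ∧ c' = -c))) :
    ∃ p0 p1, Gen C (hv 0 0 (hv 0 c β)) p0 ∧ Gen C (hv 0 1 (hv 0 c β)) p1 ∧
      2 * rho f (hv 1 2 y) (hv 0 c β) =
        lineOrd f p0 (hv 0 c β) + lineOrd f p1 (hv 0 c β) := by
  set α : Fin (2 + r) → ℤ := hv 0 c β with hα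
  have hα2 : bil (SM C) α α = -2 := by rw [hα, bil_S, hβ]; ring
  set Y0 : Fin (2 + r) → ℝ := hv 1 (2 + h * c) (y + h • intR β) with hY0
  have hvec : ∀ τ : ℝ, Y0 - (h - τ) • intR α = hv 1 (2 + τ * c) (y + τ • intR β) := by
    intro τ
    rw [hY0, hα, intR_hv, hv_smul, hv_sub, hv_inj]
    refine ⟨by simp, by ring, ?_⟩
    rw [sub_smul]; abel
  have hnorm : ∀ τ ∈ Set.Icc 0 h,
      bil C (y + τ • intR β) (y + τ • intR β) + 2 < 2 * (2 + τ * c) := by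
    intro τ hτ
    simp only [bil_add_left, bil_add_right, bil_smul_left, bil_smul_right, bil_intR, hβ,
      bil_comm hC.symm y (intR β)]
    push_cast
    have : bil C (intR β) y = c - 2 * h := by linarith
    rw [this]
    nlinarith [hτ.1, hτ.2, mul_nonneg hτ.1 (show 0 ≤ 2 * h - τ by linarith [hτ.2])]
  have hαY0 : bil (SM C) (intR α) Y0 = 0 := by
    rw [hα, hY0, intR_hv, bil_S, bil_add_right, bil_smul_right, bil_intR, hβ]
    push_cast
    linarith
  -- roots along the half-strip
  have hroot : ∀ τ ∈ Set.Icc 0 h, ∀ z, imv z = Y0 - (h - τ) • intR α → z ∈ Tube C ∧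
      ∀ v, bil (MM C) v v = -2 → wq C v z = 0 → τ = h ∧
        ∃ b : ℤ, v = hv 0 b α ∨ v = hv 0 b (-α) := by
    intro τ hτ z hz'
    rw [hvec] at hz'
    refine ⟨mem_tube_of_im hz' (hnorm τ hτ), fun v hv2 hv0 => ?_⟩
    obtain ⟨b, c', μ, rfl, hμ, hc'⟩ := roots_at hC hz' (hnorm τ hτ) hv2 hv0
    obtain ⟨h1, h2⟩ := hwall μ hμ c' τ hτ hc'
    refine ⟨h1, b, ?_⟩
    rcases h2 with ⟨rfl, rfl⟩ | ⟨rfl, rfl⟩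
    · exact Or.inl rfl
    · right; rw [hα, hv_neg, neg_zero]
  set z0 : Fin (2 + r) → ℂ := Complex.I • cv Y0
  have hz0 : imv z0 = Y0 := by simp [z0]
  have hgen : ∀ b : ℤ, Gen C (hv 0 b α) (z0 + ((b / 2 : ℝ) : ℂ) • intC α) := by
    intro b
    have him : imv (z0 + ((b / 2 : ℝ) : ℂ) • intC α) = Y0 - (h - h) • intR α := by
      rw [imv_add, imv_smul_intC, hz0]; simp
    have hαz : bil (SM C) (intC α) z0 = 0 := by
      rw [bil_smul_right, bil_intC_real, hαY0]; simp
    obtain ⟨h1, h2⟩ := hroot h ⟨hh.le, le_rfl⟩ _ him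
    have hw : ∀ b' : ℤ, wq C (hv 0 b' α) (z0 + ((b / 2 : ℝ) : ℂ) • intC α) = b' - b := by
      intro b'
      rw [wq_line b' hα2, wq_hv, hαz]; push_cast; ring
    refine ⟨h1, by rw [hw]; ring, fun w hw2 hw0 => ?_⟩
    obtain ⟨-, b', rfl | rfl⟩ := h2 w hw2 hw0
    · rw [hw, sub_eq_zero] at hw0
      left; rw [Int.cast_injective hw0]
    · have e : hv 0 b' (-α) = -hv 0 (-b') α := by
        rw [hv_neg (0 : ℤ) (-b') α, neg_zero, neg_neg]
      rw [e, wq_neg, hw, neg_eq_zero, sub_eq_zero] at hw0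
      right; rw [e, Int.cast_injective hw0]
  refine ⟨z0, z0 + ((1 / 2 : ℝ) : ℂ) • intC α, ?_, ?_, ?_⟩
  · simpa using hgen 0
  · simpa using hgen 1
  have hstripHalf : ∀ s : ℂ, s.im ≤ 0 → -h ≤ s.im → z0 + s • intC α ∈ Tube C ∧
      (f (z0 + s • intC α) = 0 → s ∉ nonHalf) := by
    intro s hs1 hs2
    have him : imv (z0 + s • intC α) = Y0 - (h - (s.im + h)) • intR α := by
      rw [imv_add, hz0, imv_smul_intC]
      rw [show h - (s.im + h) = -s.im by ring, neg_smul, sub_neg_eq_add]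
    obtain ⟨h1, h2⟩ := hroot (s.im + h) ⟨by linarith, by linarith⟩ _ him
    refine ⟨h1, fun hf0 hs => ?_⟩
    obtain ⟨v, hv2, hv0⟩ := hz _ h1 hf0
    obtain ⟨h3, b, hb⟩ := h2 v hv2 hv0
    have hαz : bil (SM C) (intC α) z0 = 0 := by
      rw [bil_smul_right, bil_intC_real, hαY0]; simp
    rcases hb with rfl | rfl
    · rw [wq_line b hα2, wq_hv, hαz] at hv0
      refine hs b ?_
      push_cast at hv0
      linear_combination -hv0 / 2
    · have e : hv 0 b (-α) = -hv 0 (-b) α := by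
        rw [hv_neg (0 : ℤ) (-b) α, neg_zero, neg_neg]
      rw [e, wq_neg, wq_line _ hα2, wq_hv, hαz] at hv0
      refine hs (-b) ?_
      push_cast at hv0 ⊢
      linear_combination hv0 / 2
  have hrefl : ∀ s : ℂ, s.im ≤ 0 → -h ≤ s.im → z0 + (-s) • intC α ∈ Tube C ∧
      f (z0 + (-s) • intC α) = f (z0 + s • intC α) := by
    intro s hs1 hs2
    have hT := (hstripHalf s hs1 hs2).1
    have hαz : bil (SM C) (intC α) (z0 + s • intC α) = -2 * s := by
      rw [bil_add_right, bil_smul_right, bil_smul_right, bil_intC, hα2, bil_intC_real, hαY0]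
      push_cast; ring
    have e : z0 + s • intC α + (-2 * s) • intC α = z0 + (-s) • intC α := by
      rw [add_assoc, ← add_smul]; congr 2; ring
    have h1 := tube_refl hC hT hα2 0
    have h2 := hf.refl α hα2 0 _ hT
    rw [hαz] at h1 h2
    simp only [Complex.ofReal_zero, Int.cast_zero, add_zero] at h1 h2
    rw [e] at h1 h2
    exact ⟨h1, h2⟩
  have hstrip : ∀ s : ℂ, |s.im| ≤ h → z0 + s • intC α ∈ Tube C ∧
      (f (z0 + s • intC α) = 0 → s ∉ nonHalf) := by
    intro s hs
    rw [abs_le] at hs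
    rcases le_total s.im 0 with h1 | h1
    · exact hstripHalf s h1 hs.1
    · have h2 := hrefl (-s) (by simpa using h1) (by simpa using hs.2)
      have h3 := hstripHalf (-s) (by simpa using h1) (by simpa using hs.2)
      rw [neg_neg] at h2
      refine ⟨h2.1, fun h0 hmem => ?_⟩
      refine h3.2 (h2.2 ▸ h0) fun n hn => hmem (-n) ?_
      rw [neg_eq_iff_eq_neg.1 hn]; push_cast; ring
  have key := two_wind_strip (g := fun s => f (z0 + s • intC α)) hh ?_ ?_ ?_ ?_
  · rw [rho, lineOrd, lineOrd]
    have e1 : (fun t : ℝ => f (z0 + ((t : ℂ) + (-h : ℝ) * Complex.I) • intC α)) =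
        fun t : ℝ => f (Complex.I • cv (hv 1 2 y) + (t : ℂ) • intC α) := by
      funext t
      have : hv 1 2 y = Y0 - h • intR α := by
        have := hvec 0
        simpa using this.symm
      rw [this]
      congr 1
      rw [cv_sub, cv_smul, cv_intR]
      ext i
      simp [z0]; ring
    have e2 : (fun s : ℂ => f (z0 + (1 / 2 + s) • intC α)) =
        fun s : ℂ => f (z0 + ((1 / 2 : ℝ) : ℂ) • intC α + s • intC α) := by
      funext s
      rw [add_assoc, ← add_smul]; push_cast; rfl
    rw [e1, e2] at key
    exact key
  · exact fun s hs => analyticAt_line isOpen_tube hf.holo _ _ (hstrip s hs).1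
  · intro s hs
    rw [add_smul, one_smul, ← add_assoc]
    exact hf.trans hC hd i0 α (hstrip s hs).1
  · intro s hs
    rw [abs_le] at hs
    rcases le_total s.im 0 with h1 | h1
    · exact (hrefl s h1 hs.1).2
    · have := (hrefl (-s) (by simpa using h1) (by simpa using hs.2)).2
      rw [neg_neg] at this
      exact this.symm
  · exact fun s hs => (hstrip s hs).2

end Rho

end Refl

open Matrix
namespace Refl

section Chamber

variable {r : ℕ} {C : Matrix (Fin r) (Fin r) ℤ} {k : ℤ} {f : (Fin (2 + r) → ℂ) → ℂ}

theorem PD.two_le (hC : PD C) {x : Fin r → ℤ} (hx : x ≠ 0) : 2 ≤ bil C x x := by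
  have h1 : intR x ≠ 0 := fun h => hx (funext fun i => by
    have := congrFun h i
    simpa [intR] using this)
  have h2 := hC.pos _ h1
  rw [bil_intR] at h2
  have h3 : 0 < bil C x x := by exact_mod_cast h2
  have := hC.even x
  omega

theorem bil_eq_sum (x y : Fin r → ℤ) : bil C x y = ∑ i, ∑ j, C i j * (x i * y j) := by
  rw [← Finset.univ_sum_single x, bil_sum_left]
  refine Finset.sum_congr rfl fun i _ => ?_
  have : (Pi.single i (x i) : Fin r → ℤ) = x i • Pi.single i 1 := by
    rw [← Pi.single_smul, smul_eq_mul, mul_one]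
  rw [Finset.univ_sum_single, this, bil_smul_left, bil_single_left, Finset.mul_sum]
  exact Finset.sum_congr rfl fun j _ => by simp; ring

theorem root_sign (hC : PD C) (hoff : ∀ i j, i ≠ j → C i j ≤ 0) {μ : Fin r → ℤ}
    (hμ : bil C μ μ = 2) : (∀ i, 0 ≤ μ i) ∨ ∀ i, μ i ≤ 0 := by
  set p : Fin r → ℤ := fun i => max (μ i) 0 with hp
  set n : Fin r → ℤ := fun i => max (-μ i) 0 with hn
  have hμp : μ = p - n := by
    funext i
    simp only [hp, hn, Pi.sub_apply]
    omega
  have hpn : bil C p n ≤ 0 := by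
    rw [bil_eq_sum]
    refine Finset.sum_nonpos fun i _ => Finset.sum_nonpos fun j _ => ?_
    by_cases hij : i = j
    · subst hij
      have : p i * n i = 0 := by
        rcases le_total (μ i) 0 with h | h
        · simp [hp, h]
        · simp [hn, h]
      rw [this, mul_zero]
    · exact mul_nonpos_of_nonpos_of_nonneg (hoff i j hij)
        (mul_nonneg (le_max_right _ _) (le_max_right _ _))
  by_cases hp0 : p = 0
  · right
    intro i
    have := congrFun hp0 i
    simpa [hp] using this
  by_cases hn0 : n = 0
  · left
    intro i
    have := congrFun hn0 i
    simpa [hn] using this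
  have h1 := hC.two_le hp0
  have h2 := hC.two_le hn0
  rw [hμp] at hμ
  simp only [bil_sub_left, bil_sub_right, bil_comm hC.symm n p] at hμ
  omega

theorem exists_small_dual (hC : PD C) : ∃ ε : ℝ, ∃ y : Fin r → ℝ, 0 < ε ∧
    (∀ μ : Fin r → ℤ, bil C (intR μ) y = ε * (∑ i, μ i : ℤ)) ∧ bil C y y < 1 / 2 := by
  choose c hc using hC.exists_dual
  set d := ∑ i, c i
  have hd : ∀ x : Fin r → ℝ, bil C x d = ∑ i, x i := by
    intro x
    rw [bil_sum_right]
    exact Finset.sum_congr rfl fun i _ => hc i x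
  have hN := hC.nonneg d
  set N := bil C d d with hNd
  refine ⟨1 / (2 * (1 + N)), (1 / (2 * (1 + N))) • d, by positivity, fun μ => ?_, ?_⟩
  · rw [bil_smul_right, hd]; simp [intR]
  · rw [bil_smul_left, bil_smul_right, ← hNd]
    have : 1 / (2 * (1 + N)) * (1 / (2 * (1 + N)) * N) = N / (4 * (1 + N) ^ 2) := by
      field_simp; ring
    rw [this, div_lt_div_iff₀ (by positivity) (by norm_num)]
    nlinarith

theorem root_pair_sq_le (hC : PD C) {μ : Fin r → ℤ} (hμ : bil C μ μ = 2) (w : Fin r → ℝ) :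
    bil C (intR μ) w ^ 2 ≤ 2 * bil C w w := by
  have h := hC.nonneg (w - (bil C (intR μ) w / 2) • intR μ)
  simp only [bil_sub_left, bil_sub_right, bil_smul_left, bil_smul_right, bil_intR, hμ,
    bil_comm hC.symm w (intR μ)] at h
  push_cast at h
  nlinarith

theorem root_pair_le (hC : PD C) {μ ν : Fin r → ℤ} (hμ : bil C μ μ = 2) (hν : bil C ν ν = 2)
    (hne : μ ≠ ν) : bil C μ ν ≤ 1 := by
  have h := hC.two_le (sub_ne_zero.2 hne)
  simp only [bil_sub_left, bil_sub_right, hμ, hν, bil_comm hC.symm ν μ] at h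
  omega

theorem sum_pos_of_root {μ : Fin r → ℤ} (hμ : bil C μ μ = 2) (h0 : ∀ i, 0 ≤ μ i) :
    1 ≤ ∑ i, μ i := by
  by_contra hcon
  have h1 : ∑ i, μ i = 0 := le_antisymm (by omega) (Finset.sum_nonneg fun i _ => h0 i)
  rw [Finset.sum_eq_zero_iff_of_nonneg fun i _ => h0 i] at h1
  have : μ = 0 := funext fun i => h1 i (Finset.mem_univ _)
  rw [this] at hμ
  simp at hμ

/-- Reduction of a statement about all roots to positive roots. -/
theorem wall_of_pos (hC : PD C) (hoff : ∀ i j, i ≠ j → C i j ≤ 0) {β : Fin r → ℤ} {c : ℤ}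
    {w : Fin r → ℝ} {P : Prop}
    (h : ∀ μ : Fin r → ℤ, bil C μ μ = 2 → (∀ i, 0 ≤ μ i) → ∀ c' : ℤ, c' = bil C (intR μ) w →
      P ∧ ((μ = β ∧ c' = c) ∨ (μ = -β ∧ c' = -c)))
    {μ : Fin r → ℤ} (hμ : bil C μ μ = 2) {c' : ℤ} (hc' : c' = bil C (intR μ) w) :
    P ∧ ((μ = β ∧ c' = c) ∨ (μ = -β ∧ c' = -c)) := by
  rcases root_sign hC hoff hμ with h0 | h0
  · exact h μ hμ h0 c' hc'
  · obtain ⟨hP, h1⟩ := h (-μ) (by simpa using hμ) (fun i => by simpa using h0 i) (-c') (by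
      rw [intR_neg, bil_neg_left, ← hc']; push_cast; rfl)
    refine ⟨hP, ?_⟩
    rcases h1 with ⟨h1, h2⟩ | ⟨h1, h2⟩
    · exact Or.inr ⟨by rw [← h1, neg_neg], by omega⟩
    · exact Or.inl ⟨neg_injective h1, by omega⟩

theorem int_eq_zero_of_sq_lt {c : ℤ} (h : (c : ℝ) ^ 2 < 1) : c = 0 := by
  have h1 : c ^ 2 < 1 := by exact_mod_cast h
  by_contra hne
  have : 0 < c ^ 2 := by positivity
  omega

theorem bil_nonneg_of_dominant {θ μ : Fin r → ℤ} (hθ : ∀ i, 0 ≤ bil C (Pi.single i 1) θ)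
    (hμ : ∀ i, 0 ≤ μ i) : 0 ≤ bil C μ θ := by
  rw [← Finset.univ_sum_single μ, bil_sum_left]
  refine Finset.sum_nonneg fun i _ => ?_
  have : (Pi.single i (μ i) : Fin r → ℤ) = μ i • Pi.single i 1 := by
    rw [← Pi.single_smul, smul_eq_mul, mul_one]
  rw [this, bil_smul_left]
  exact mul_nonneg (hμ i) (hθ i)

theorem exists_chamber (hC : PD C) (hd : ∀ i, C i i = 2) (hoff : ∀ i j, i ≠ j → C i j ≤ 0)
    (i0 : Fin r) (hf : TForm C k f) (hz : ReflZeros C f) :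
    ∃ Y : Fin (2 + r) → ℝ, (∀ z, imv z = Y → z ∈ Tube C ∧ f z ≠ 0) ∧
    ∀ α, ((∃ i, α = hv 0 0 (-Pi.single i 1)) ∨ ∃ θ, α = hv 0 1 θ ∧ bil C θ θ = 2 ∧
      (∀ i, 0 ≤ θ i) ∧ ∀ i, 0 ≤ bil C (Pi.single i 1) θ) →
    ∃ p0 p1, Gen C (hv 0 0 α) p0 ∧ Gen C (hv 0 1 α) p1 ∧
      2 * rho f Y α = lineOrd f p0 α + lineOrd f p1 α := by
  obtain ⟨ε, y, hε, hy, hyy⟩ := exists_small_dual hC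
  refine ⟨hv 1 2 y, fun z hzY => ?_, fun α hα => ?_⟩
  · have hT : bil C y y + 2 < 2 * 2 := by linarith
    refine ⟨mem_tube_of_im hzY hT, fun h0 => ?_⟩
    obtain ⟨v, hv2, hv0⟩ := hz z (mem_tube_of_im hzY hT) h0
    obtain ⟨b, c, μ, rfl, hμ, hc⟩ := roots_at hC hzY hT hv2 hv0
    have h1 := root_pair_sq_le hC hμ y
    have hc0 : c = 0 := int_eq_zero_of_sq_lt (by rw [hc]; linarith)
    rw [hy, hc0, Int.cast_zero, eq_comm, mul_eq_zero] at hc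
    have h2 : ∑ i, μ i = 0 := by
      rcases hc with h | h
      · exact absurd h hε.ne'
      · exact_mod_cast h
    rcases root_sign hC hoff hμ with h0 | h0
    · have := sum_pos_of_root hμ h0
      omega
    · have := sum_pos_of_root (μ := -μ) (C := C) (by simpa using hμ) (fun i => by simpa using h0 i)
      simp only [Pi.neg_apply, Finset.sum_neg_distrib] at this
      omega
  rcases hα with ⟨i, rfl⟩ | ⟨θ, rfl, hθ, hθ0, hθd⟩
  · have hs : bil C (Pi.single i (1 : ℤ)) (Pi.single i 1) = 2 := by rw [bil_single_int, hd]
    have hsy : bil C (intR (Pi.single i 1)) y = ε := by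
      rw [hy, Finset.sum_pi_single']; simp
    refine two_rho hC hd i0 hf hz (by simpa using hs) (by linarith) (h := ε / 2) (by linarith)
      (by rw [intR_neg, bil_neg_left, hsy]; push_cast; ring) fun μ hμ c' τ hτ hc' => ?_
    refine wall_of_pos hC hoff (fun μ hμ hμ0 c' hc' => ?_) hμ hc'
    have hn : bil C (y + τ • intR (-Pi.single i 1)) (y + τ • intR (-Pi.single i 1)) ≤
        bil C y y := by
      simp only [intR_neg, bil_add_left, bil_add_right, bil_smul_left, bil_smul_right,
        bil_neg_left, bil_neg_right, bil_intR, hs, bil_comm hC.symm y (intR _), hsy]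
      push_cast
      nlinarith [hτ.1, hτ.2]
    have hc0 : c' = 0 := int_eq_zero_of_sq_lt (by
      rw [hc']; linarith [root_pair_sq_le hC hμ (y + τ • intR (-Pi.single i 1))])
    rw [hc0, bil_add_right, hy, intR_neg, bil_smul_right, bil_neg_right, bil_intR] at hc'
    by_cases he : μ = Pi.single i 1
    · rw [he, hs, Finset.sum_pi_single'] at hc'
      simp only [Finset.mem_univ, if_true] at hc'
      push_cast at hc'
      exact ⟨by linarith, Or.inr ⟨by rw [he, neg_neg], by simp [hc0]⟩⟩
    · exfalso
      have h1 : (1 : ℝ) ≤ (∑ i, μ i : ℤ) := by exact_mod_cast sum_pos_of_root hμ hμ0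
      have h2 : ((bil C μ (Pi.single i 1) : ℤ) : ℝ) ≤ 1 := by
        exact_mod_cast root_pair_le hC hμ hs he
      push_cast at hc' h1
      nlinarith [hτ.1, hτ.2, mul_le_mul_of_nonneg_left h1 hε.le,
        mul_le_mul_of_nonneg_left h2 hτ.1]
  · have h1 := root_pair_sq_le hC hθ y
    have hs1 : (1 : ℝ) ≤ (∑ i, θ i : ℤ) := by exact_mod_cast sum_pos_of_root hθ hθ0
    set q := bil C (intR θ) y with hq
    have hq0 : 0 < q := by rw [hq, hy]; positivity
    have hq1 : q < 1 := by nlinarith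
    refine two_rho hC hd i0 hf hz hθ (by linarith) (h := (1 - q) / 2) (by linarith)
      (by rw [← hq]; push_cast; ring) fun μ hμ c' τ hτ hc' => ?_
    refine wall_of_pos hC hoff (fun μ hμ hμ0 c' hc' => ?_) hμ hc'
    have hμs : (1 : ℝ) ≤ (∑ i, μ i : ℤ) := by exact_mod_cast sum_pos_of_root hμ hμ0
    rw [bil_add_right, bil_smul_right, bil_intR] at hc'
    have hm0 : 0 < bil C (intR μ) y := by rw [hy]; positivity
    have hμθ := bil_nonneg_of_dominant hθd hμ0
    have hc1 : 1 ≤ c' := by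
      have : (0 : ℝ) < c' := by
        rw [hc']
        have : (0 : ℝ) ≤ bil C μ θ := by exact_mod_cast hμθ
        have := mul_nonneg hτ.1 this
        linarith
      have : 0 < c' := by exact_mod_cast this
      omega
    have hc1' : (1 : ℝ) ≤ c' := by exact_mod_cast hc1
    by_cases he : μ = θ
    · rw [he, hθ, ← hq] at hc'
      push_cast at hc'
      have h3 : (c' : ℝ) ≤ 1 := by linarith [hτ.2]
      have h4 : c' ≤ 1 := by exact_mod_cast h3
      exact ⟨by linarith [hτ.2], Or.inl ⟨he, by omega⟩⟩
    · exfalso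
      have h2 := root_pair_le hC hμ hθ he
      have hm1 : bil C (intR μ) y < 1 := by
        have := root_pair_sq_le hC hμ y
        nlinarith
      rcases (show bil C μ θ = 0 ∨ bil C μ θ = 1 by omega) with h3 | h3
      · rw [h3] at hc'
        push_cast at hc'
        linarith
      · have hr : bil C (θ - μ) (θ - μ) = 2 := by
          simp only [bil_sub_left, bil_sub_right, hθ, hμ, bil_comm hC.symm θ μ, h3]
          norm_num
        rcases root_sign hC hoff hr with h4 | h4
        · have h5 : bil C (intR μ) y ≤ q := by
            rw [hq, hy, hy]
            refine mul_le_mul_of_nonneg_left ?_ hε.le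
            have : ∑ i, μ i ≤ ∑ i, θ i := Finset.sum_le_sum fun i _ => by
              have := h4 i
              simp only [Pi.sub_apply] at this
              omega
            exact_mod_cast this
          rw [h3] at hc'
          push_cast at hc'
          linarith [hτ.2]
        · have h5 := bil_nonneg_of_dominant hθd (μ := μ - θ) fun i => by
            have := h4 i
            simp only [Pi.sub_apply] at this ⊢
            omega
          rw [bil_sub_left, h3, hθ] at h5
          omega

end Chamber

end Refl

open Matrix
namespace Refl

section Orders

variable {r : ℕ} {C : Matrix (Fin r) (Fin r) ℤ} {k : ℤ} {f : (Fin (2 + r) → ℂ) → ℂ}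

/-- The Eichler transvection attached to translation by `l`. -/
def tm (C : Matrix (Fin r) (Fin r) ℤ) (l : Fin (2 + r) → ℤ) (v : Fin (2 + (2 + r)) → ℤ) :
    Fin (2 + (2 + r)) → ℤ :=
  hv (hA v) (hB v + bil (SM C) (hX v) l - hA v * (bil (SM C) l l / 2)) (hX v - hA v • l)

theorem tm_hv (l : Fin (2 + r) → ℤ) (a b : ℤ) (m : Fin (2 + r) → ℤ) :
    tm C l (hv a b m) = hv a (b + bil (SM C) m l - a * (bil (SM C) l l / 2)) (m - a • l) := by
  simp [tm]

theorem PD.even_S (hC : PD C) (l : Fin (2 + r) → ℤ) : 2 * (bil (SM C) l l / 2) = bil (SM C) l l := by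
  refine Int.mul_ediv_cancel' ?_
  obtain ⟨a, b, x, rfl⟩ := exists_hv l
  rw [bil_S]
  obtain ⟨c, hc⟩ := hC.even x
  exact ⟨a * b - c, by rw [hc]; ring⟩

theorem norm_tm (hC : PD C) (l : Fin (2 + r) → ℤ) (v : Fin (2 + (2 + r)) → ℤ) :
    bil (MM C) (tm C l v) (tm C l v) = bil (MM C) v v := by
  obtain ⟨a, b, m, rfl⟩ := exists_hv v
  have h := hC.even_S l
  rw [tm_hv, bil_MM_hv, bil_MM_hv]
  simp only [bil_sub_left, bil_sub_right, bil_smul_left, bil_smul_right, bil_comm hC.symmS l m]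
  linear_combination (-(a : ℤ) ^ 2) * h

theorem tm_neg_tm (hC : PD C) (l : Fin (2 + r) → ℤ) (v : Fin (2 + (2 + r)) → ℤ) :
    tm C (-l) (tm C l v) = v := by
  obtain ⟨a, b, m, rfl⟩ := exists_hv v
  have h := hC.even_S l
  rw [tm_hv, tm_hv, hv_inj]
  refine ⟨rfl, ?_, ?_⟩
  · simp only [bil_sub_left, bil_neg_right, bil_neg_left, neg_neg, bil_smul_left]
    linear_combination (-(a : ℤ)) * h
  · rw [smul_neg, sub_neg_eq_add, sub_add_cancel]

theorem tm_neg_vec (l : Fin (2 + r) → ℤ) (v : Fin (2 + (2 + r)) → ℤ) :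
    tm C l (-v) = -tm C l v := by
  obtain ⟨a, b, m, rfl⟩ := exists_hv v
  rw [hv_neg, tm_hv, tm_hv, hv_neg, hv_inj]
  refine ⟨rfl, ?_, ?_⟩
  · rw [bil_neg_left]; ring
  · rw [neg_smul]; abel

theorem wq_add_intC (hC : PD C) (v : Fin (2 + (2 + r)) → ℤ) (l : Fin (2 + r) → ℤ)
    (z : Fin (2 + r) → ℂ) : wq C v (z + intC l) = wq C (tm C l v) z := by
  obtain ⟨a, b, m, rfl⟩ := exists_hv v
  have h : 2 * ((bil (SM C) l l / 2 : ℤ) : ℂ) = (bil (SM C) l l : ℤ) := by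
    exact_mod_cast hC.even_S l
  have e : intC (m - a • l) = intC m - (a : ℂ) • intC l := by
    rw [sub_eq_add_neg, intC_add, intC_neg, intC_smul, sub_eq_add_neg]
  rw [tm_hv, wq_hv, wq_hv, e]
  simp only [bil_add_right, bil_add_left, bil_intC, bil_sub_left, bil_smul_left,
    bil_comm hC.symmS z (intC l)]
  push_cast
  linear_combination (a : ℂ) / 2 * h

theorem Gen.trans (hC : PD C) {v : Fin (2 + (2 + r)) → ℤ} {l : Fin (2 + r) → ℤ}
    {p : Fin (2 + r) → ℂ} (h : Gen C (tm C l v) p) : Gen C v (p + intC l) := by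
  refine ⟨tube_add_intC h.mem l, by rw [wq_add_intC hC]; exact h.zero, fun w hw2 hw0 => ?_⟩
  rw [wq_add_intC hC] at hw0
  have := h.only _ (by rw [norm_tm hC, hw2]) hw0
  rcases this with h1 | h1
  · left
    rw [← tm_neg_tm hC l w, h1, tm_neg_tm hC]
  · right
    rw [← tm_neg_tm hC l w, h1, tm_neg_vec, tm_neg_tm hC]

theorem lineOrd_trans (hC : PD C) (hd : ∀ i, C i i = 2) (i0 : Fin r) (hf : TForm C k f)
    {p : Fin (2 + r) → ℂ} (hp : p ∈ Tube C) (l α : Fin (2 + r) → ℤ) :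
    lineOrd f (p + intC l) α = lineOrd f p α := by
  rw [lineOrd, lineOrd, analyticOrderNatAt, analyticOrderNatAt]
  congr 1
  refine analyticOrderAt_congr ?_
  have hc : ContinuousAt (fun s : ℂ => p + s • intC α) 0 :=
    Continuous.continuousAt (by fun_prop)
  filter_upwards [hc.eventually_mem (isOpen_tube.mem_nhds (by simpa using hp))] with s hs
  rw [add_right_comm]
  exact hf.trans hC hd i0 l hs

/-- Reflection of the lattice `S`. -/
def rfS (C : Matrix (Fin r) (Fin r) ℤ) (α β : Fin (2 + r) → ℤ) : Fin (2 + r) → ℤ :=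
  β + bil (SM C) α β • α

theorem rfS_neg (α β : Fin (2 + r) → ℤ) : rfS C α (-β) = -rfS C α β := by
  rw [rfS, rfS, bil_neg_right, neg_smul, neg_add]

theorem rfS_rfS {α : Fin (2 + r) → ℤ} (hα : bil (SM C) α α = -2) (β : Fin (2 + r) → ℤ) :
    rfS C α (rfS C α β) = β := by
  simp only [rfS, bil_add_right, bil_smul_right, hα]
  rw [add_assoc, ← add_smul]
  ring_nf

theorem norm_rfS (hC : PD C) {α : Fin (2 + r) → ℤ} (hα : bil (SM C) α α = -2)
    (β : Fin (2 + r) → ℤ) : bil (SM C) (rfS C α β) (rfS C α β) = bil (SM C) β β := by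
  simp only [rfS, bil_add_right, bil_smul_right, bil_add_left, bil_smul_left, hα,
    bil_comm hC.symmS β α]
  ring

theorem wq_refl (hC : PD C) {α : Fin (2 + r) → ℤ} (hα : bil (SM C) α α = -2) (a b : ℤ)
    (β : Fin (2 + r) → ℤ) (z : Fin (2 + r) → ℂ) :
    wq C (hv a b β) (z + bil (SM C) (intC α) z • intC α) = wq C (hv a b (rfS C α β)) z := by
  rw [wq_hv, wq_hv, rfS, intC_add, intC_smul]
  simp only [bil_add_right, bil_smul_right, bil_add_left, bil_smul_left, bil_intC, hα,
    bil_comm hC.symmS z (intC α), bil_comm hC.symmS β α]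
  ring

theorem Gen.refl (hC : PD C) {α : Fin (2 + r) → ℤ} (hα : bil (SM C) α α = -2) {a b : ℤ}
    {β : Fin (2 + r) → ℤ} {p : Fin (2 + r) → ℂ} (h : Gen C (hv a b (rfS C α β)) p) :
    Gen C (hv a b β) (p + bil (SM C) (intC α) p • intC α) := by
  have hT := tube_refl hC h.mem hα 0
  simp only [Complex.ofReal_zero, add_zero] at hT
  refine ⟨hT, by rw [wq_refl hC hα]; exact h.zero, fun w hw2 hw0 => ?_⟩
  obtain ⟨a', b', β', rfl⟩ := exists_hv w
  rw [wq_refl hC hα] at hw0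
  rcases h.only _ (by rw [bil_MM_hv, norm_rfS hC hα, ← hw2, bil_MM_hv]) hw0 with h1 | h1
  · left
    obtain ⟨h2, h3, h4⟩ := hv_inj.1 h1
    rw [h2, h3, ← rfS_rfS hα β', h4, rfS_rfS hα]
  · right
    rw [hv_neg] at h1
    obtain ⟨h2, h3, h4⟩ := hv_inj.1 h1
    rw [h2, h3, ← rfS_rfS hα β', h4, hv_neg, hv_inj]
    exact ⟨rfl, rfl, by rw [rfS_neg, rfS_rfS hα]⟩

theorem lineOrd_refl (hf : TForm C k f) {α : Fin (2 + r) → ℤ}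
    (hα : bil (SM C) α α = -2) {p : Fin (2 + r) → ℂ} (hp : p ∈ Tube C) (β : Fin (2 + r) → ℤ) :
    lineOrd f (p + bil (SM C) (intC α) p • intC α) (rfS C α β) = lineOrd f p β := by
  rw [lineOrd, lineOrd, analyticOrderNatAt, analyticOrderNatAt]
  congr 1
  refine analyticOrderAt_congr ?_
  have hc : ContinuousAt (fun s : ℂ => p + s • intC β) 0 :=
    Continuous.continuousAt (by fun_prop)
  filter_upwards [hc.eventually_mem (isOpen_tube.mem_nhds (by simpa using hp))] with s hs
  have := hf.refl α hα 0 _ hs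
  rw [← this]
  congr 1
  rw [rfS, intC_add, intC_smul, bil_add_right, bil_smul_right, bil_intC]
  push_cast
  module

/-- `f` vanishes to order `c` along all divisors of the vectors `(0, b, β)`. -/
def HasOrd (C : Matrix (Fin r) (Fin r) ℤ) (f : (Fin (2 + r) → ℂ) → ℂ) (β : Fin (2 + r) → ℤ)
    (c : ℕ) : Prop :=
  ∀ b p, Gen C (hv 0 b β) p → lineOrd f p β = c

theorem HasOrd.of_rfS (hC : PD C) (hf : TForm C k f) {α β : Fin (2 + r) → ℤ} {c : ℕ}
    (hα : bil (SM C) α α = -2) (h : HasOrd C f (rfS C α β) c) : HasOrd C f β c := by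
  intro b p hp
  rw [← rfS_rfS hα β] at hp
  rw [← lineOrd_refl hf hα hp.mem]
  exact h b _ (Gen.refl hC hα hp)

theorem HasOrd.step (hC : PD C) (hf : TForm C k f) {α β : Fin (2 + r) → ℤ} {c : ℕ}
    (hα : bil (SM C) α α = -2) (hβ : bil (SM C) β β = -2) (h1 : bil (SM C) α β = 1)
    (h : HasOrd C f α c) : HasOrd C f β c := by
  refine HasOrd.of_rfS hC hf hα (HasOrd.of_rfS hC hf hβ ?_)
  have : rfS C β (rfS C α β) = α := by
    rw [rfS, rfS, h1, one_smul, bil_add_right, hβ, bil_comm hC.symmS β α, h1]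
    module
  rwa [this]

theorem HasOrd.of_gen (hC : PD C) (hd : ∀ i, C i i = 2) (i0 : Fin r) (hf : TForm C k f)
    (hz : ReflZeros C f) {β l : Fin (2 + r) → ℤ} (hβ : bil (SM C) β β = -2) {b : ℤ}
    {p : Fin (2 + r) → ℂ} (hp : Gen C (hv 0 b β) p) {b' : ℤ} {p' : Fin (2 + r) → ℂ}
    (hp' : Gen C (hv 0 b' β) p') (hl : b + bil (SM C) β l = b') :
    lineOrd f p' β = lineOrd f p β := by
  have h1 : Gen C (tm C l (hv 0 b β)) p' := by
    rwa [tm_hv, zero_smul, sub_zero, zero_mul, sub_zero, hl]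
  rw [← lineOrd_trans hC hd i0 hf hp'.mem l β]
  exact lineOrd_eq hC hf.holo hz hβ hp (Gen.trans hC h1)

theorem exists_hasOrd (hC : PD C) (hd : ∀ i, C i i = 2) (i0 : Fin r) (hf : TForm C k f)
    (hz : ReflZeros C f) {β l : Fin (2 + r) → ℤ} (hβ : bil (SM C) β β = -2)
    (hl : bil (SM C) β l = 1) : ∃ c, HasOrd C f β c := by
  by_cases h : ∃ b p, Gen C (hv 0 b β) p
  · obtain ⟨b, p, hp⟩ := h
    refine ⟨lineOrd f p β, fun b' p' hp' => ?_⟩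
    exact HasOrd.of_gen hC hd i0 hf hz hβ hp hp' (l := (b' - b) • l)
      (by rw [bil_smul_right, hl]; ring)
  · push Not at h
    exact ⟨0, fun b p hp => absurd hp (h b p)⟩

theorem HasOrd.ne_zero (hC : PD C) (hf : TForm C k f) (hz : ReflZeros C f)
    {β : Fin (2 + r) → ℤ} (hβ : bil (SM C) β β = -2) (h : HasOrd C f β 0) {b : ℤ}
    {p : Fin (2 + r) → ℂ} (hp : Gen C (hv 0 b β) p) : f p ≠ 0 := by
  have h0 := h b p hp
  have han := analyticAt_line isOpen_tube hf.holo p (intC β) (s := 0) (by simpa using hp.mem)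
  have hc : ContinuousAt (fun s : ℂ => p + s • intC β) 0 :=
    Continuous.continuousAt (by fun_prop)
  have hlz := hp.local_zero hC hz
  have hev : ∀ᶠ s : ℂ in nhds 0, f (p + s • intC β) = 0 → s = 0 := by
    have := hc.tendsto
    rw [zero_smul, add_zero] at this
    filter_upwards [this.eventually hlz] with s hs hs0
    have := hs.2 hs0
    rw [wq_line b hβ, hp.zero] at this
    simpa using this
  have hntop : analyticOrderAt (fun s : ℂ => f (p + s • intC β)) 0 ≠ ⊤ := by
    rw [ne_eq, analyticOrderAt_eq_top]
    intro h1
    have h2 := h1.and hev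
    have h3 : ∀ᶠ s : ℂ in nhds 0, s = 0 := h2.mono fun s hs => hs.2 hs.1
    have h4 : ({0} : Set ℂ) ∈ nhds (0 : ℂ) := h3
    exact (isOpen_singleton_iff_nhds_eq_pure (0 : ℂ)).not.1 (not_isOpen_singleton 0)
      (le_antisymm (by rw [Filter.le_pure_iff]; exact h4) (pure_le_nhds 0))
  rw [lineOrd, analyticOrderNatAt, ENat.toNat_eq_zero] at h0
  have h1 := h0.resolve_right hntop
  rw [han.analyticOrderAt_eq_zero] at h1
  simpa using h1

end Orders

end Refl

open Matrix
namespace Refl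

section Vanishing

variable {r : ℕ} {C : Matrix (Fin r) (Fin r) ℤ} {k : ℤ} {f : (Fin (2 + r) → ℂ) → ℂ}

/-- A dominant positive root. -/
structure Dom (C : Matrix (Fin r) (Fin r) ℤ) (θ : Fin r → ℤ) : Prop where
  root : bil C θ θ = 2
  nonneg : ∀ i, 0 ≤ θ i
  dom : ∀ i, 0 ≤ bil C (Pi.single i 1) θ

/-- A dominant root whose support is linked to it through pairings `1` of roots. -/
structure Spread (C : Matrix (Fin r) (Fin r) ℤ) (θ : Fin r → ℤ) : Prop extends Dom C θ where
  spread : ∀ Q : Fin r → Prop, (∀ i, bil C (Pi.single i 1) θ = 1 → Q i) →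
    (∀ i j, Q i → C i j = -1 → Q j) → ∀ i, θ i ≠ 0 → Q i

theorem norm_neg_simple (hd : ∀ i, C i i = 2) (i : Fin r) :
    bil (SM C) (hv 0 0 (-Pi.single i (1 : ℤ))) (hv 0 0 (-Pi.single i 1)) = -2 := by
  rw [bil_S, bil_neg_left, bil_neg_right, neg_neg, bil_single_int, hd]; norm_num

theorem norm_base : bil (SM C) (hv (1 : ℤ) (-1) 0) (hv 1 (-1) 0) = -2 := by
  rw [bil_S]; simp

theorem norm_hv_root {θ : Fin r → ℤ} (hθ : bil C θ θ = 2) :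
    bil (SM C) (hv (0 : ℤ) 1 θ) (hv 0 1 θ) = -2 := by
  rw [bil_S, hθ]; norm_num

theorem Spread.hasOrd (hC : PD C) (hd : ∀ i, C i i = 2) (hf : TForm C k f) {θ : Fin r → ℤ}
    (hθ : Spread C θ) {c : ℕ} (h : HasOrd C f (hv 1 (-1) 0) c) :
    HasOrd C f (hv 0 1 θ) c ∧ ∀ i, θ i ≠ 0 → HasOrd C f (hv 0 0 (-Pi.single i 1)) c := by
  have h1 : HasOrd C f (hv 0 1 θ) c :=
    h.step hC hf norm_base (norm_hv_root hθ.root) (by rw [bil_S]; simp)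
  refine ⟨h1, hθ.spread (fun i => HasOrd C f (hv 0 0 (-Pi.single i 1)) c) (fun i hi => ?_)
    fun i j hi hij => ?_⟩
  · refine h1.step hC hf (norm_hv_root hθ.root) (norm_neg_simple hd i) ?_
    rw [bil_S, bil_neg_right, bil_comm hC.symm, hi]; norm_num
  · refine HasOrd.step hC hf (norm_neg_simple hd i) (norm_neg_simple hd j) ?_ hi
    rw [bil_S, bil_neg_right, bil_neg_left, bil_single_int, hij]; norm_num

/-- The winding number along the isotropic direction determines all boundary orders. -/
theorem rho_isotropic (hC : PD C) (hd : ∀ i, C i i = 2) (i0 : Fin r) (hf : TForm C k f)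
    {Y : Fin (2 + r) → ℝ} (hY : ∀ z, imv z = Y → z ∈ Tube C ∧ f z ≠ 0) {θ : Fin r → ℤ}
    (hθ : ∀ i, 0 ≤ θ i) :
    rho f Y (hv 0 1 0) = rho f Y (hv 0 1 θ) + ∑ i, θ i * rho f Y (hv 0 0 (-Pi.single i 1)) := by
  have e : (hv 0 1 0 : Fin (2 + r) → ℤ) =
      hv 0 1 θ + ∑ i, θ i • hv (0 : ℤ) 0 (-Pi.single i (1 : ℤ)) := by
    have : ∑ i, θ i • hv (0 : ℤ) 0 (-Pi.single i (1 : ℤ)) = hv 0 0 (-θ) := by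
      have h := hv_decomp 0 0 (-θ)
      rw [h]
      simp only [zero_smul, zero_add]
      refine Finset.sum_congr rfl fun i _ => ?_
      rw [hv_zsmul, hv_zsmul]
      simp
    rw [this, hv_add]; simp
  rw [e, rho_add hC hd i0 hf hY, rho_sum hC hd i0 hf hY]
  congr 1
  refine Finset.sum_congr rfl fun i _ => ?_
  obtain ⟨n, hn⟩ := Int.eq_ofNat_of_zero_le (hθ i)
  rw [hn]
  exact rho_nsmul hC hd i0 hf hY n _

theorem rho_isotropic_of_hasOrd (hC : PD C) (hd : ∀ i, C i i = 2) (i0 : Fin r)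
    (hf : TForm C k f) {Y : Fin (2 + r) → ℝ} (hY : ∀ z, imv z = Y → z ∈ Tube C ∧ f z ≠ 0)
    (hch : ∀ α, ((∃ i, α = hv 0 0 (-Pi.single i 1)) ∨ ∃ θ, α = hv 0 1 θ ∧ bil C θ θ = 2 ∧
      (∀ i, 0 ≤ θ i) ∧ ∀ i, 0 ≤ bil C (Pi.single i 1) θ) →
      ∃ p0 p1, Gen C (hv 0 0 α) p0 ∧ Gen C (hv 0 1 α) p1 ∧
        2 * rho f Y α = lineOrd f p0 α + lineOrd f p1 α)
    {θ : Fin r → ℤ} (hθ : Spread C θ) {c : ℕ} (h : HasOrd C f (hv 1 (-1) 0) c) :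
    rho f Y (hv 0 1 0) = c * (1 + ∑ i, θ i) := by
  obtain ⟨h1, h2⟩ := hθ.hasOrd hC hd hf h
  have key : ∀ α, ((∃ i, α = hv 0 0 (-Pi.single i 1)) ∨ ∃ θ, α = hv 0 1 θ ∧ bil C θ θ = 2 ∧
      (∀ i, 0 ≤ θ i) ∧ ∀ i, 0 ≤ bil C (Pi.single i 1) θ) → HasOrd C f α c → rho f Y α = c := by
    intro α hα hc
    obtain ⟨p0, p1, g0, g1, e⟩ := hch α hα
    rw [hc _ _ g0, hc _ _ g1] at e
    omega
  rw [rho_isotropic hC hd i0 hf hY hθ.nonneg,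
    key _ (Or.inr ⟨θ, rfl, hθ.root, hθ.nonneg, hθ.dom⟩) h1, mul_add, mul_one, Finset.mul_sum]
  congr 1
  refine Finset.sum_congr rfl fun i _ => ?_
  by_cases hi : θ i = 0
  · rw [hi, zero_mul, mul_zero]
  · rw [key _ (Or.inl ⟨i, rfl⟩) (h2 i hi), mul_comm]

theorem hasOrd_zero (hC : PD C) (hd : ∀ i, C i i = 2) (hoff : ∀ i j, i ≠ j → C i j ≤ 0)
    (i0 : Fin r) (hf : TForm C k f) (hz : ReflZeros C f) {θ θ' : Fin r → ℤ} (hθ : Spread C θ)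
    (hθ' : Spread C θ') (hne : ∑ i, θ i ≠ ∑ i, θ' i) : HasOrd C f (hv 1 (-1) 0) 0 := by
  obtain ⟨c, hc⟩ := exists_hasOrd hC hd i0 hf hz norm_base (l := hv 0 1 0)
    (by rw [bil_S]; simp)
  obtain ⟨Y, hY, hch⟩ := exists_chamber hC hd hoff i0 hf hz
  have h1 := rho_isotropic_of_hasOrd hC hd i0 hf hY hch hθ hc
  rw [rho_isotropic_of_hasOrd hC hd i0 hf hY hch hθ' hc] at h1
  have h2 : (c : ℤ) * (∑ i, θ i - ∑ i, θ' i) = 0 := by linear_combination -h1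
  rcases mul_eq_zero.1 h2 with h3 | h3
  · have : c = 0 := by exact_mod_cast h3
    rwa [this] at hc
  · exact absurd (sub_eq_zero.1 h3) hne

theorem hasOrd_simple (hC : PD C) (hd : ∀ i, C i i = 2) (hoff : ∀ i j, i ≠ j → C i j ≤ 0)
    (i0 : Fin r) (hf : TForm C k f) (hz : ReflZeros C f) (h0 : HasOrd C f (hv 1 (-1) 0) 0)
    {θ₁ θ : Fin r → ℤ} (hθ₁ : Spread C θ₁) (hθ : Dom C θ) {i : Fin r} (hi : θ i ≠ 0) :
    HasOrd C f (hv 0 0 (-Pi.single i 1)) 0 := by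
  obtain ⟨Y, hY, hch⟩ := exists_chamber hC hd hoff i0 hf hz
  have h1 := rho_isotropic_of_hasOrd hC hd i0 hf hY hch hθ₁ h0
  rw [Nat.cast_zero, zero_mul, rho_isotropic hC hd i0 hf hY hθ.nonneg] at h1
  have hn : ∀ i, 0 ≤ rho f Y (hv 0 0 (-Pi.single i 1)) := fun i => by
    obtain ⟨p0, p1, -, -, e⟩ := hch _ (Or.inl ⟨i, rfl⟩)
    omega
  have hnθ : 0 ≤ rho f Y (hv 0 1 θ) := by
    obtain ⟨p0, p1, -, -, e⟩ := hch _ (Or.inr ⟨θ, rfl, hθ.root, hθ.nonneg, hθ.dom⟩)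
    omega
  have hs : ∑ i, θ i * rho f Y (hv 0 0 (-Pi.single i 1)) = 0 :=
    le_antisymm (by omega) (Finset.sum_nonneg fun i _ => mul_nonneg (hθ.nonneg i) (hn i))
  rw [Finset.sum_eq_zero_iff_of_nonneg fun i _ => mul_nonneg (hθ.nonneg i) (hn i)] at hs
  have hρ : rho f Y (hv 0 0 (-Pi.single i 1)) = 0 :=
    (mul_eq_zero.1 (hs i (Finset.mem_univ _))).resolve_left hi
  obtain ⟨p0, p1, g0, g1, e⟩ := hch _ (Or.inl ⟨i, rfl⟩)
  rw [hρ] at e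
  intro b p hp
  have hpair : ∀ n : ℤ, bil (SM C) (hv 0 0 (-Pi.single i (1 : ℤ))) (n • hv 0 0 (Pi.single i 1)) =
      2 * n := by
    intro n
    rw [bil_smul_right, bil_S, bil_neg_left, bil_single_int, hd]; ring
  rcases Int.even_or_odd' b with ⟨n, hb | hb⟩
  · rw [HasOrd.of_gen hC hd i0 hf hz (norm_neg_simple hd i) g0 hp
      (l := n • hv 0 0 (Pi.single i 1)) (by rw [hpair, hb, zero_add])]
    omega
  · rw [HasOrd.of_gen hC hd i0 hf hz (norm_neg_simple hd i) g1 hp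
      (l := n • hv 0 0 (Pi.single i 1)) (by rw [hpair, hb, add_comm])]
    omega

end Vanishing

end Refl

open Matrix
namespace Refl

section Eichler

variable {r : ℕ} {C : Matrix (Fin r) (Fin r) ℤ} {k : ℤ} {f : (Fin (2 + r) → ℂ) → ℂ}

/-- The orbit of a vector under transvections, the swap of the first plane and negation. -/
inductive Orb (C : Matrix (Fin r) (Fin r) ℤ) (v : Fin (2 + (2 + r)) → ℤ) :
    (Fin (2 + (2 + r)) → ℤ) → Prop
  | base : Orb C v v
  | tm (l : Fin (2 + r) → ℤ) {w : Fin (2 + (2 + r)) → ℤ} (h : Orb C v w) : Orb C v (tm C l w)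
  | swap {a b : ℤ} {m : Fin (2 + r) → ℤ} (h : Orb C v (hv a b m)) : Orb C v (hv b a m)
  | neg {w : Fin (2 + (2 + r)) → ℤ} (h : Orb C v w) : Orb C v (-w)

theorem Orb.trans {u v w : Fin (2 + (2 + r)) → ℤ} (h : Orb C u v) (h' : Orb C v w) :
    Orb C u w := by
  induction h' with
  | base => exact h
  | tm l _ ih => exact ih.tm l
  | swap _ ih => exact ih.swap
  | neg _ ih => exact ih.neg

theorem Orb.symm (hC : PD C) {v w : Fin (2 + (2 + r)) → ℤ} (h : Orb C v w) : Orb C w v := by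
  induction h with
  | base => exact .base
  | @tm l w _ ih =>
    refine Orb.trans ?_ ih
    have := Orb.tm (-l) (Orb.base (C := C) (v := Refl.tm C l w))
    rwa [tm_neg_tm hC] at this
  | swap _ ih => exact Orb.trans (.swap .base) ih
  | @neg w _ ih =>
    have := Orb.neg (Orb.base (C := C) (v := -w))
    rw [neg_neg] at this
    exact this.trans ih

theorem Orb.norm (hC : PD C) {v w : Fin (2 + (2 + r)) → ℤ} (h : Orb C v w) :
    bil (MM C) w w = bil (MM C) v v := by
  induction h with
  | base => rfl
  | tm l _ ih => rw [norm_tm hC, ih]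
  | @swap a b m _ ih => rw [← ih, bil_MM_hv, bil_MM_hv]; ring
  | neg _ ih => simpa using ih

/-- All pairings of the vector with the lattice are even. -/
def EvenV (C : Matrix (Fin r) (Fin r) ℤ) (v : Fin (2 + (2 + r)) → ℤ) : Prop :=
  2 ∣ hA v ∧ 2 ∣ hB v ∧ ∀ x, 2 ∣ bil (SM C) (hX v) x

theorem Orb.evenV {v w : Fin (2 + (2 + r)) → ℤ} (h : Orb C v w) (hv : EvenV C v) :
    EvenV C w := by
  induction h with
  | base => exact hv
  | @tm l w _ ih =>
    obtain ⟨h1, h2, h3⟩ := ih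
    refine ⟨by simpa [Refl.tm] using h1, ?_, fun x => ?_⟩
    · simp only [Refl.tm, hB_hv]
      exact dvd_sub (dvd_add h2 (h3 l)) (h1.mul_right _)
    · simp only [Refl.tm, hX_hv, bil_sub_left, bil_smul_left]
      exact dvd_sub (h3 x) (h1.mul_right _)
  | swap _ ih =>
    obtain ⟨h1, h2, h3⟩ := ih
    simp only [hA_hv, hB_hv, hX_hv] at h1 h2 h3
    exact ⟨by simpa using h2, by simpa using h1, by simpa using h3⟩
  | @neg w _ ih =>
    obtain ⟨a, b, m, rfl⟩ := exists_hv w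
    obtain ⟨h1, h2, h3⟩ := ih
    simp only [hA_hv, hB_hv, hX_hv] at h1 h2 h3
    rw [hv_neg]
    exact ⟨by simpa using h1, by simpa using h2, by simpa using h3⟩

theorem exists_orb_minimal {v : Fin (2 + (2 + r)) → ℤ} (hv2 : bil (MM C) v v = -2) :
    ∃ w, Orb C v w ∧ hA w ≠ 0 ∧ ∀ w', Orb C v w' → hA w' ≠ 0 → |hA w| ≤ |hA w'| := by
  have hne : ∃ w, Orb C v w ∧ hA w ≠ 0 := by
    obtain ⟨a, b, m, rfl⟩ := exists_hv v
    by_cases ha : a = 0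
    · by_cases hb : b = 0
      · subst ha hb
        rw [bil_MM_hv] at hv2
        have h := (Orb.base (C := C) (v := hv 0 0 m)).tm m
        rw [tm_hv] at h
        refine ⟨_, h.swap, ?_⟩
        rw [hA_hv]
        simp only [mul_zero, zero_add] at hv2
        rw [hv2]; norm_num
      · exact ⟨_, (Orb.base (C := C) (v := hv a b m)).swap, by simpa using hb⟩
    · exact ⟨_, .base, by simpa using ha⟩
  classical
  have hex : ∃ n : ℕ, ∃ w, Orb C v w ∧ hA w ≠ 0 ∧ (hA w).natAbs = n := by
    obtain ⟨w, h1, h2⟩ := hne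
    exact ⟨_, w, h1, h2, rfl⟩
  obtain ⟨w, h1, h2, h3⟩ := Nat.find_spec hex
  refine ⟨w, h1, h2, fun w' h1' h2' => ?_⟩
  have := Nat.find_min' hex ⟨w', h1', h2', rfl⟩
  rw [Int.abs_eq_natAbs, Int.abs_eq_natAbs, h3]
  exact_mod_cast this

theorem exists_shift (a : ℤ) {ρ : ℤ} (hρ : 0 < ρ) : ∃ s, 0 < a + ρ * s ∧ a + ρ * s ≤ ρ := by
  refine ⟨-((a - 1) / ρ), ?_⟩
  have h1 := Int.mul_ediv_add_emod (a - 1) ρ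
  have h2 := Int.emod_nonneg (a - 1) hρ.ne'
  have h3 := Int.emod_lt_of_pos (a - 1) hρ
  rw [mul_neg]
  omega

theorem exists_reduced (hC : PD C) {v : Fin (2 + (2 + r)) → ℤ} (hv2 : bil (MM C) v v = -2) :
    ∃ a b : ℤ, ∃ μ : Fin r → ℤ, Orb C v (hv a b (hv 0 0 μ)) ∧ a ≠ 0 ∧ a ∣ b ∧
      ∀ ν, a ∣ bil C μ ν := by
  obtain ⟨w, hw, hw0, hmin⟩ := exists_orb_minimal hv2
  obtain ⟨a, b, m, rfl⟩ := exists_hv w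
  obtain ⟨l₁, l₂, μ, rfl⟩ := exists_hv m
  simp only [hA_hv] at hw0 hmin
  -- clear the second coordinate
  obtain ⟨b', h1⟩ : ∃ b', Orb C v (hv a b' (hv l₁ 0 μ)) := by
    have h := hw.tm (hv 0 (l₂ / a) 0)
    rw [tm_hv, hv_smul, hv_sub, mul_zero, sub_zero, smul_zero, sub_zero] at h
    have hr : l₂ - a * (l₂ / a) = l₂ % a := by
      have := Int.mul_ediv_add_emod l₂ a
      omega
    rw [hr] at h
    rcases (Int.emod_nonneg l₂ hw0).eq_or_lt with h0 | h0
    · rw [← h0] at h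
      exact ⟨_, h⟩
    · exfalso
      obtain ⟨s, hs1, hs2⟩ := exists_shift a h0
      have h' := h.swap.tm (hv s 0 0)
      rw [tm_hv] at h'
      have hm := hmin _ h'.swap
      simp only [hA_hv, bil_S, mul_zero, zero_mul, zero_add, add_zero, 
        bil_zero_right, sub_zero, Int.zero_ediv] at hm
      have := hm hs1.ne'
      rw [abs_of_pos hs1] at this
      have := Int.emod_lt_abs l₂ hw0
      omega
  obtain ⟨b', h1⟩ : ∃ b', Orb C v (hv a b' (hv 0 0 μ)) := by
    have h := h1.tm (hv (l₁ / a) 0 0)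
    rw [tm_hv, hv_smul, hv_sub, mul_zero, sub_zero, smul_zero, sub_zero] at h
    have hr : l₁ - a * (l₁ / a) = l₁ % a := by
      have := Int.mul_ediv_add_emod l₁ a
      omega
    rw [hr] at h
    rcases (Int.emod_nonneg l₁ hw0).eq_or_lt with h0 | h0
    · rw [← h0] at h
      exact ⟨_, h⟩
    · exfalso
      obtain ⟨s, hs1, hs2⟩ := exists_shift a h0
      have h' := h.swap.tm (hv 0 s 0)
      rw [tm_hv] at h'
      have hm := hmin _ h'.swap
      simp only [hA_hv, bil_S, mul_zero, zero_mul, add_zero,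
        bil_zero_right, sub_zero, Int.zero_ediv] at hm
      have := hm hs1.ne'
      rw [abs_of_pos hs1] at this
      have := Int.emod_lt_abs l₁ hw0
      omega
  have hdiv : ∀ ν, a ∣ b' - bil C μ ν := by
    intro ν
    obtain ⟨q, hq⟩ := hC.even ν
    by_contra hcon
    -- shift the last coordinate into the range of remainders
    set e := (b' - bil C μ ν) / a with he
    have h := h1.tm (hv (e + q) 1 ν)
    rw [tm_hv] at h
    have hm := hmin _ h.swap
    have e1 : bil (SM C) (hv (e + q) 1 ν) (hv (e + q) 1 ν) / 2 = e := by
      rw [bil_S, hq]; omega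
    rw [hA_hv, e1, bil_S] at hm
    have hr := Int.mul_ediv_add_emod (b' - bil C μ ν) a
    rw [← he] at hr
    have e2 : b' + (0 * 1 + 0 * (e + q) - bil C μ ν) - a * e = (b' - bil C μ ν) % a := by
      linear_combination -hr
    rw [e2] at hm
    have h0 : (b' - bil C μ ν) % a ≠ 0 := fun h0 => hcon (Int.dvd_of_emod_eq_zero h0)
    have h2 := hm h0
    rw [abs_of_nonneg (Int.emod_nonneg _ hw0)] at h2
    have := Int.emod_lt_abs (b' - bil C μ ν) hw0
    omega
  have hb : a ∣ b' := by simpa using hdiv 0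
  refine ⟨a, b', μ, h1, hw0, hb, fun ν => ?_⟩
  have := dvd_sub hb (hdiv ν)
  rwa [sub_sub_cancel] at this

theorem Orb.dvd_two {v : Fin (2 + (2 + r)) → ℤ} {a b : ℤ} {μ : Fin r → ℤ} (hC : PD C)
    (hv2 : bil (MM C) v v = -2) (h : Orb C v (hv a b (hv 0 0 μ))) (hμ : ∀ ν, a ∣ bil C μ ν) :
    a ∣ 2 := by
  have h1 := h.norm hC
  rw [hv2, bil_MM_hv, bil_S] at h1
  have e : (2 : ℤ) = bil C μ μ - a * (2 * b) := by linear_combination h1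
  rw [e]
  exact dvd_sub (hμ μ) (Dvd.intro _ rfl)

/-- A root with an odd pairing lies in the standard orbit. -/
theorem orb_of_not_evenV (hC : PD C) {v : Fin (2 + (2 + r)) → ℤ}
    (hv2 : bil (MM C) v v = -2) (hv' : ¬EvenV C v) : Orb C v (hv 1 (-1) 0) := by
  obtain ⟨a, b, μ, h, ha, hab, hμ⟩ := exists_reduced hC hv2
  have h2 := h.dvd_two hC hv2 hμ
  have hodd : ¬(2 : ℤ) ∣ a := by
    intro hd
    refine hv' ((h.symm hC).evenV ⟨by simpa using hd, by simpa using hd.trans hab, fun x => ?_⟩)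
    obtain ⟨x₁, x₂, ν, rfl⟩ := exists_hv x
    rw [hX_hv, bil_S]
    simpa using hd.trans (hμ ν)
  have key : ∀ b' μ', Orb C v (hv 1 b' (hv 0 0 μ')) → Orb C v (hv 1 (-1) 0) := by
    intro b' μ' h'
    have h3 := h'.tm (hv 0 0 μ')
    rw [tm_hv, one_smul, sub_self] at h3
    have h4 := h3.norm hC
    rw [hv2, bil_MM_hv, bil_zero_left] at h4
    convert h3 using 2
    linarith
  have h5 := Int.le_of_dvd (by norm_num) h2
  have h6 := Int.le_of_dvd (by norm_num) (neg_dvd.mpr h2)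
  obtain rfl | rfl : a = 1 ∨ a = -1 := by omega
  · exact key _ _ h
  · have := h.neg
    rw [hv_neg, hv_neg, neg_neg, neg_zero] at this
    exact key _ _ this

/-- The normal form of a root with only even pairings. -/
theorem orb_of_evenV (hC : PD C) {v : Fin (2 + (2 + r)) → ℤ}
    (hv2 : bil (MM C) v v = -2) (hv' : EvenV C v) :
    ∃ c μ, Orb C v (hv 2 (2 * c) (hv 0 0 μ)) ∧ (∀ ν, 2 ∣ bil C μ ν) ∧
      bil C μ μ = 8 * c + 2 := by
  obtain ⟨a, b, μ, h, ha, hab, hμ⟩ := exists_reduced hC hv2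
  have h2 := h.dvd_two hC hv2 hμ
  have hE : (2 : ℤ) ∣ a := by simpa using (h.evenV hv').1
  have key : ∀ b' μ', (∀ ν, 2 ∣ bil C μ' ν) → 2 ∣ b' → Orb C v (hv 2 b' (hv 0 0 μ')) →
      ∃ c μ, Orb C v (hv 2 (2 * c) (hv 0 0 μ)) ∧ (∀ ν, 2 ∣ bil C μ ν) ∧
        bil C μ μ = 8 * c + 2 := by
    rintro b' μ' hm ⟨c, rfl⟩ h'
    refine ⟨c, μ', h', hm, ?_⟩
    have h4 := h'.norm hC
    rw [hv2, bil_MM_hv, bil_S] at h4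
    linear_combination -h4
  have h5 := Int.le_of_dvd (by norm_num) h2
  have h6 := Int.le_of_dvd (by norm_num) (neg_dvd.mpr h2)
  obtain rfl | rfl : a = 2 ∨ a = -2 := by omega
  · exact key _ _ hμ hab h
  · have := h.neg
    rw [hv_neg, hv_neg, neg_neg, neg_zero] at this
    refine key _ _ (fun ν => ?_) ?_ this
    · rw [bil_neg_left, dvd_neg]
      exact hE.trans (hμ ν)
    · rw [dvd_neg]
      exact hE.trans hab

theorem orb_even_simple (hC : PD C) {v : Fin (2 + (2 + r)) → ℤ} (hv2 : bil (MM C) v v = -2)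
    {b : ℤ} {i : Fin r} (hi : C i i = 2) (ν : Fin r → ℤ)
    (h : Orb C v (hv 2 b (hv 0 0 (Pi.single i 1 + (2 : ℤ) • ν)))) :
    Orb C v (hv 0 (-2) (hv 0 0 (-Pi.single i 1))) := by
  have h3 := h.tm (hv 0 0 ν)
  rw [tm_hv, hv_smul, hv_sub, add_sub_cancel_right] at h3
  have h4 := h3.norm hC
  rw [hv2, bil_MM_hv] at h4
  simp only [mul_zero, sub_zero] at h3 h4
  rw [bil_S (r := r) 0 0 0 0 (Pi.single i 1) (Pi.single i 1), bil_single_int, hi] at h4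
  have h5 := h3
  rw [show b + bil (SM C) (hv 0 0 (Pi.single i 1 + (2 : ℤ) • ν)) (hv 0 0 ν) -
    2 * (bil (SM C) (hv 0 0 ν) (hv 0 0 ν) / 2) = 0 by linarith] at h5
  have h6 := h5.swap.neg
  rwa [hv_neg, hv_neg, neg_zero] at h6

end Eichler

end Refl

open Matrix
namespace Refl

section NonvanishingOnDivisors

variable {r : ℕ} {C : Matrix (Fin r) (Fin r) ℤ} {k : ℤ} {f : (Fin (2 + r) → ℂ) → ℂ}

/-- `f` has no zeros on the generic part of the divisor of `v`. -/
def NV (C : Matrix (Fin r) (Fin r) ℤ) (f : (Fin (2 + r) → ℂ) → ℂ) (v : Fin (2 + (2 + r)) → ℤ) :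
    Prop := ∀ p, Gen C v p → f p ≠ 0

theorem Gen.neg {v : Fin (2 + (2 + r)) → ℤ} {p : Fin (2 + r) → ℂ} (h : Gen C v p) :
    Gen C (-v) p := by
  refine ⟨h.mem, by rw [wq_neg, h.zero, neg_zero], fun w hw h0 => ?_⟩
  rcases h.only w hw h0 with h | h
  · exact Or.inr (by rw [h, neg_neg])
  · exact Or.inl h

theorem wq_inv (a b : ℤ) (m : Fin (2 + r) → ℤ) {z : Fin (2 + r) → ℂ}
    (hne : bil (SM C) z z ≠ 0) :
    wq C (hv a b m) ((-2 / bil (SM C) z z) • z) =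
      (-2 / bil (SM C) z z) * wq C (hv b a m) z := by
  simp only [wq_hv, bil_smul_left, bil_smul_right]
  field_simp
  ring

theorem Gen.inv (hC : PD C) {a b : ℤ} {m : Fin (2 + r) → ℤ} {p : Fin (2 + r) → ℂ}
    (h : Gen C (hv b a m) p) : Gen C (hv a b m) ((-2 / bil (SM C) p p) • p) := by
  have hne := bil_self_ne_zero hC h.mem
  refine ⟨tube_inv hC h.mem, by rw [wq_inv _ _ _ hne, h.zero, mul_zero], fun w hw h0 => ?_⟩
  obtain ⟨a', b', m', rfl⟩ := exists_hv w
  rw [wq_inv _ _ _ hne] at h0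
  have h1 := (mul_eq_zero.mp h0).resolve_left (div_ne_zero (by norm_num) hne)
  have h2 : bil (MM C) (hv b' a' m') (hv b' a' m') = -2 := by
    rw [← hw, bil_MM_hv, bil_MM_hv]; ring
  rcases h.only _ h2 h1 with h3 | h3
  · rw [hv_inj] at h3
    obtain ⟨rfl, rfl, rfl⟩ := h3
    exact Or.inl rfl
  · rw [hv_neg, hv_inj] at h3
    obtain ⟨rfl, rfl, rfl⟩ := h3
    exact Or.inr (by rw [hv_neg])

theorem NV.orb (hC : PD C) (hd : ∀ i, C i i = 2) (i0 : Fin r) (hf : TForm C k f)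
    {v w : Fin (2 + (2 + r)) → ℤ} (h : Orb C v w) (hv : NV C f v) : NV C f w := by
  induction h with
  | base => exact hv
  | tm l _ ih =>
    intro p hp h0
    exact ih _ (hp.trans hC) (by rw [hf.trans hC hd i0 l hp.mem, h0])
  | swap _ ih =>
    intro p hp h0
    exact ih _ (hp.inv hC) (by rw [hf.inv p hp.mem, h0, mul_zero])
  | neg _ ih =>
    intro p hp h0
    have := hp.neg
    rw [neg_neg] at this
    exact ih p this h0

theorem NV.orb_symm (hC : PD C) (hd : ∀ i, C i i = 2) (i0 : Fin r) (hf : TForm C k f)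
    {v w : Fin (2 + (2 + r)) → ℤ} (h : Orb C v w) (hw : NV C f w) : NV C f v :=
  hw.orb hC hd i0 hf (h.symm hC)

theorem HasOrd.nv (hC : PD C) (hf : TForm C k f) (hz : ReflZeros C f)
    {β : Fin (2 + r) → ℤ} (hβ : bil (SM C) β β = -2) (h : HasOrd C f β 0) (b : ℤ) :
    NV C f (hv 0 b β) := fun _ hp => h.ne_zero hC hf hz hβ hp

/-- Derivative of the divisor equation of `v` at `z`. -/
noncomputable def grad (v : Fin (2 + (2 + r)) → ℤ) (z : Fin (2 + r) → ℂ) : Fin (2 + r) → ℂ :=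
  intC (hX v) - ((hA v : ℤ) : ℂ) • z

theorem wq_add (hC : PD C) (v : Fin (2 + (2 + r)) → ℤ) (z d : Fin (2 + r) → ℂ) :
    wq C v (z + d) = wq C v z + bil (SM C) (grad v z) d - ((hA v : ℤ) : ℂ) * bil (SM C) d d / 2 := by
  obtain ⟨a, b, l, rfl⟩ := exists_hv v
  simp only [wq_hv, grad, hA_hv, hX_hv, bil_add_left, bil_add_right, bil_sub_left, bil_smul_left]
  rw [bil_comm hC.symmS d z]
  ring

theorem grad_dep (hC : PD C) {v w : Fin (2 + (2 + r)) → ℤ} {p : Fin (2 + r) → ℂ}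
    (hp : p ∈ Tube C) (h1 : wq C v p = 0) (h2 : wq C w p = 0) {c c' : ℂ}
    (h : c • grad v p + c' • grad w p = 0) : c • intC v + c' • intC w = 0 := by
  have hconj : ∀ u : Fin (2 + (2 + r)) → ℤ, wq C u p = 0 →
      bil (MM C) (intC u) (fun i => (starRingEnd ℂ) (psi C p i)) = 0 := by
    intro u hu
    have h3 := congrArg (starRingEnd ℂ) hu
    rw [wq, map_bil, map_zero] at h3
    simp only [intC, map_intCast] at h3
    exact h3
  have key : ∃ A : ℂ, c • intC v + c' • intC w = A • psi C p := by
    obtain ⟨a, b, l, rfl⟩ := exists_hv v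
    obtain ⟨a', b', l', rfl⟩ := exists_hv w
    rw [wq_hv] at h1 h2
    simp only [grad, hA_hv, hX_hv] at h
    have e : c • intC l + c' • intC l' = (c * a + c' * a') • p := by
      have : c • intC l + c' • intC l' - (c * a + c' * a') • p = 0 := by
        rw [← h]; module
      exact sub_eq_zero.mp this
    refine ⟨c * a + c' * a', ?_⟩
    have e' := congrArg (fun x => bil (SM C) x p) e
    simp only [bil_add_left, bil_smul_left] at e'
    rw [intC_hv, intC_hv, psi, hv_smul, hv_smul, hv_smul, hv_add, hv_inj]
    refine ⟨by ring, ?_, e⟩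
    linear_combination c * h1 + c' * h2 - e'
  obtain ⟨A, hA'⟩ := key
  have h4 : bil (MM C) (c • intC v + c' • intC w) (fun i => (starRingEnd ℂ) (psi C p i)) = 0 := by
    rw [bil_add_left, bil_smul_left, bil_smul_left, hconj v h1, hconj w h2]; ring
  rw [hA', bil_smul_left, bil_psi_conj hC] at h4
  have h5 : (0 : ℝ) < bil (SM C) (imv p) (imv p) := (mem_tube.mp hp).2
  have h6 : A = 0 := by
    refine (mul_eq_zero.mp h4).resolve_right ?_
    exact_mod_cast (by positivity : (2 * bil (SM C) (imv p) (imv p) : ℝ) ≠ 0)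
  rw [hA', h6, zero_smul]

theorem intC_injective {n : ℕ} {v w : Fin n → ℤ} (h : intC v = intC w) : v = w := by
  funext i
  have : ((v i : ℤ) : ℂ) = ((w i : ℤ) : ℂ) := congrFun h i
  exact_mod_cast this

theorem grad_ne_zero (hC : PD C) {v : Fin (2 + (2 + r)) → ℤ} {p : Fin (2 + r) → ℂ}
    (hp : p ∈ Tube C) (hv2 : bil (MM C) v v = -2) (h1 : wq C v p = 0) : grad v p ≠ 0 := by
  intro h
  have h2 := grad_dep hC hp h1 h1 (c := 1) (c' := 0) (by rw [h]; simp)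
  rw [one_smul, zero_smul, add_zero, ← intC_zero] at h2
  rw [intC_injective h2, bil_zero_left] at hv2
  norm_num at hv2

theorem grad_pair (hC : PD C) {v w : Fin (2 + (2 + r)) → ℤ} {p : Fin (2 + r) → ℂ}
    (hp : p ∈ Tube C) (hv2 : bil (MM C) v v = -2) (hw2 : bil (MM C) w w = -2)
    (h1 : wq C v p = 0) (h2 : wq C w p = 0) {c c' : ℂ} (hc' : c' ≠ 0)
    (h : c • grad v p + c' • grad w p = 0) : w = v ∨ w = -v := by
  have h3 := grad_dep hC hp h1 h2 h
  have h4 : intC w = (-c / c') • intC v := by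
    have : c' • intC w = (-c) • intC v := by
      rw [neg_smul]; exact eq_neg_of_add_eq_zero_right h3
    rw [div_eq_inv_mul, mul_smul, ← this, smul_smul, inv_mul_cancel₀ hc', one_smul]
  have h5 : ((bil (MM C) w w : ℤ) : ℂ) = (-c / c') ^ 2 * ((bil (MM C) v v : ℤ) : ℂ) := by
    rw [← bil_intC, ← bil_intC, h4, bil_smul_left, bil_smul_right]; ring
  rw [hv2, hw2] at h5
  push_cast at h5
  have h6 : (-c / c') ^ 2 = 1 := by linear_combination h5 / 2
  rcases sq_eq_one_iff.mp h6 with h7 | h7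
  · rw [h7, one_smul] at h4
    exact Or.inl (intC_injective h4)
  · rw [h7, neg_one_smul, ← intC_neg] at h4
    exact Or.inr (intC_injective h4)

theorem exists_avoid (hC : PD C) {ι : Type*} [Finite ι] (m : ι → Fin (2 + r) → ℂ)
    (hm : ∀ i, m i ≠ 0) : ∃ u, ∀ i, bil (SM C) (m i) u ≠ 0 := by
  let L : ι → Module.Dual ℂ (Fin (2 + r) → ℂ) := fun i =>
    IsLinearMap.mk' (fun u => bil (SM C) (m i) u)
      ⟨fun x y => bil_add_right _ _ _ _, fun c x => bil_smul_right _ _ _ _⟩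
  refine Module.Dual.exists_forall_ne_zero_of_forall_exists L fun i => ?_
  by_contra hcon
  push Not at hcon
  apply hm i
  funext j
  obtain ⟨c, hc⟩ := hC.exists_dual_S j
  have h1 : bil (SM C) (m i) (cv c) = 0 := hcon (cv c)
  rw [bil_comm hC.symmS] at h1
  have hre := congrArg Complex.re h1
  have him := congrArg Complex.im h1
  rw [re_bil_cv, bil_comm hC.symmS, hc] at hre
  rw [im_bil_cv, bil_comm hC.symmS, hc] at him
  exact Complex.ext hre him

theorem eventually_not_both (hC : PD C) {v w : Fin (2 + (2 + r)) → ℤ} {p x y : Fin (2 + r) → ℂ}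
    (h1 : wq C v p = 0) (h2 : wq C w p = 0)
    (hxy : bil (SM C) (grad v p) x * bil (SM C) (grad w p) y -
      bil (SM C) (grad w p) x * bil (SM C) (grad v p) y ≠ 0) :
    ∀ᶠ q : ℂ × ℂ in nhds (0, 0), wq C v (p + (q.1 • x + q.2 • y)) = 0 →
      wq C w (p + (q.1 • x + q.2 • y)) = 0 → q.1 = 0 ∧ q.2 = 0 := by
  set Lx := bil (SM C) (grad v p) x
  set Ly := bil (SM C) (grad v p) y
  set Mx := bil (SM C) (grad w p) x
  set My := bil (SM C) (grad w p) y
  set a : ℂ := ((hA v : ℤ) : ℂ)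
  set b : ℂ := ((hA w : ℤ) : ℂ)
  let α : ℂ × ℂ → ℂ := fun q => (q.1 * bil (SM C) x x + 2 * q.2 * bil (SM C) x y) / 2
  let β : ℂ × ℂ → ℂ := fun q => q.2 * bil (SM C) y y / 2
  let D : ℂ × ℂ → ℂ := fun q => (Lx - a * α q) * (My - b * β q) - (Mx - b * α q) * (Ly - a * β q)
  have hD : Continuous D := by fun_prop
  have hD0 : D (0, 0) ≠ 0 := by simpa [D, α, β] using hxy
  filter_upwards [hD.continuousAt.eventually_ne hD0] with q hq e1 e2
  rw [wq_add hC, h1] at e1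
  rw [wq_add hC, h2] at e2
  simp only [bil_add_left, bil_add_right, bil_smul_left, bil_smul_right,
    bil_comm hC.symmS y x] at e1 e2
  constructor
  · refine (mul_eq_zero.mp (?_ : D q * q.1 = 0)).resolve_left hq
    simp only [D, α, β]
    linear_combination (My - b * β q) * e1 - (Ly - a * β q) * e2
  · refine (mul_eq_zero.mp (?_ : D q * q.2 = 0)).resolve_left hq
    simp only [D, α, β]
    linear_combination (Lx - a * α q) * e2 - (Mx - b * α q) * e1

theorem eventually_only_zero (hC : PD C) {v : Fin (2 + (2 + r)) → ℤ} {p x : Fin (2 + r) → ℂ}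
    (h1 : wq C v p = 0) (hx : bil (SM C) (grad v p) x ≠ 0) :
    ∀ᶠ s : ℂ in nhds 0, wq C v (p + s • x) = 0 → s = 0 := by
  let D : ℂ → ℂ := fun s => bil (SM C) (grad v p) x -
    ((hA v : ℤ) : ℂ) * (s * bil (SM C) x x) / 2
  have hD : Continuous D := by fun_prop
  have hD0 : D 0 ≠ 0 := by simpa [D] using hx
  filter_upwards [hD.continuousAt.eventually_ne hD0] with s hs e1
  rw [wq_add hC, h1] at e1
  simp only [bil_smul_left, bil_smul_right] at e1
  refine (mul_eq_zero.mp (?_ : D s * s = 0)).resolve_left hs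
  simp only [D]
  linear_combination e1

/-- Near a point only the root divisors through that point occur. -/
theorem exists_local_roots (hC : PD C) {p : Fin (2 + r) → ℂ} (hp : p ∈ Tube C) :
    ∃ F : Set (Fin (2 + (2 + r)) → ℤ), F.Finite ∧
      (∀ v ∈ F, bil (MM C) v v = -2 ∧ wq C v p = 0) ∧
      ∀ᶠ z in nhds p, ∀ v, bil (MM C) v v = -2 → wq C v z = 0 → v ∈ F := by
  obtain ⟨F, hF, h⟩ := locally_finite_roots hC hp
  refine ⟨{v ∈ F | bil (MM C) v v = -2 ∧ wq C v p = 0}, hF.subset fun v hv => hv.1,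
    fun v hv => hv.2, ?_⟩
  have h2 : ∀ᶠ z in nhds p, ∀ v ∈ F, wq C v p ≠ 0 → wq C v z ≠ 0 := by
    rw [hF.eventually_all]
    intro v _
    by_cases h0 : wq C v p = 0
    · exact Filter.Eventually.of_forall fun _ h => absurd h0 h
    · exact ((continuous_wq v).continuousAt.eventually_ne h0).mono fun _ h _ => h
  filter_upwards [h, h2] with z hz hz2 v hv2 h0
  refine ⟨hz v hv2 h0, hv2, ?_⟩
  by_contra hcon
  exact hz2 v (hz v hv2 h0) hcon h0

/-- A form with zeros on root divisors only and not vanishing generically on any of them has no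
zeros. -/
theorem ne_zero_of_nv (hC : PD C) (hf : DifferentiableOn ℂ f (Tube C)) (hz : ReflZeros C f)
    (hnv : ∀ v, bil (MM C) v v = -2 → NV C f v) {p : Fin (2 + r) → ℂ} (hp : p ∈ Tube C) :
    f p ≠ 0 := by
  intro hfp
  obtain ⟨F, hF, hF0, hloc⟩ := exists_local_roots hC hp
  have : Finite F := hF
  obtain ⟨x, hx⟩ := exists_avoid hC (fun v : F => grad (v : Fin (2 + (2 + r)) → ℤ) p)
    fun v => grad_ne_zero hC hp (hF0 v v.2).1 (hF0 v v.2).2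
  obtain ⟨y, hy⟩ := exists_avoid hC
    (fun q : {q : F × F // ¬((q.2 : Fin (2 + (2 + r)) → ℤ) = q.1 ∨
        (q.2 : Fin (2 + (2 + r)) → ℤ) = -q.1)} =>
      (-bil (SM C) (grad (q.1.2 : Fin (2 + (2 + r)) → ℤ) p) x) •
          grad (q.1.1 : Fin (2 + (2 + r)) → ℤ) p +
        bil (SM C) (grad (q.1.1 : Fin (2 + (2 + r)) → ℤ) p) x •
          grad (q.1.2 : Fin (2 + (2 + r)) → ℤ) p)
    (fun q h => q.2 (grad_pair hC hp (hF0 _ q.1.1.2).1 (hF0 _ q.1.2.2).1 (hF0 _ q.1.1.2).2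
      (hF0 _ q.1.2.2).2 (hx q.1.1) h))
  let g : ℂ × ℂ → Fin (2 + r) → ℂ := fun q => p + (q.1 • x + q.2 • y)
  have hg : Continuous g := by fun_prop
  have hg0 : g (0, 0) = p := by simp [g]
  have hev : ∀ᶠ q in nhds ((0 : ℂ), (0 : ℂ)), (g q ∈ Tube C) ∧
      (∀ v, bil (MM C) v v = -2 → wq C v (g q) = 0 → v ∈ F) ∧
      (∀ v w : F, ¬((w : Fin (2 + (2 + r)) → ℤ) = v ∨ (w : Fin (2 + (2 + r)) → ℤ) = -v) →
        wq C v (g q) = 0 → wq C w (g q) = 0 → q.1 = 0 ∧ q.2 = 0) := by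
    have hgt : Filter.Tendsto g (nhds (0, 0)) (nhds p) := by
      have := hg.tendsto (0, 0)
      rwa [hg0] at this
    refine (hgt.eventually (isOpen_tube.mem_nhds hp)).and
      ((hgt.eventually hloc).and ?_)
    rw [Filter.eventually_all]
    intro v
    rw [Filter.eventually_all]
    intro w
    by_cases hvw : (w : Fin (2 + (2 + r)) → ℤ) = v ∨ (w : Fin (2 + (2 + r)) → ℤ) = -v
    · exact Filter.Eventually.of_forall fun _ h => absurd hvw h
    · refine (eventually_not_both hC (x := x) (y := y) (hF0 v v.2).2 (hF0 w w.2).2 ?_).mono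
        fun q h _ => h
      have := hy ⟨(v, w), hvw⟩
      simp only [bil_add_left, bil_smul_left] at this
      intro h0
      exact this (by linear_combination h0)
  have hev1 : ∀ᶠ s : ℂ in nhds 0, ∀ v : F, wq C v (p + s • x) = 0 → s = 0 := by
    rw [Filter.eventually_all]
    exact fun v => eventually_only_zero hC (hF0 v v.2).2 (hx v)
  obtain ⟨ε₁, hε₁, h1⟩ := Metric.eventually_nhds_iff.mp hev
  obtain ⟨ε₂, hε₂, h2⟩ := Metric.eventually_nhds_iff.mp hev1
  set ε := min ε₁ ε₂ / 2 with hεdef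
  have hε : 0 < ε := by positivity
  have hlt1 : ε < ε₁ := by
    have := min_le_left ε₁ ε₂
    have := lt_min hε₁ hε₂
    rw [hεdef]; linarith
  have hlt2 : ε < ε₂ := by
    have := min_le_right ε₁ ε₂
    have := lt_min hε₁ hε₂
    rw [hεdef]; linarith
  have hin : ∀ s t : ℂ, ‖s‖ ≤ ε → ‖t‖ ≤ ε → dist (s, t) ((0 : ℂ), (0 : ℂ)) < ε₁ := by
    intro s t hs ht
    rw [Prod.dist_eq, dist_zero_right, dist_zero_right]
    exact (max_le hs ht).trans_lt hlt1
  have hcirc : ∀ s : ℂ, ‖s‖ = ε → f (g (s, 0)) ≠ 0 := by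
    intro s hs h0
    obtain ⟨a1, a2, -⟩ := h1 (hin s 0 hs.le (by simpa using hε.le))
    obtain ⟨v, hv2, hv0⟩ := hz _ a1 h0
    have := h2 (y := s) (by rw [dist_zero_right, hs]; exact hlt2) ⟨v, a2 v hv2 hv0⟩
      (by simpa [g] using hv0)
    rw [this, norm_zero] at hs
    exact hε.ne hs
  have hdisc : ∀ s t : ℂ, ‖s‖ ≤ ε → ‖t‖ ≤ ε → t ≠ 0 → f (g (s, t)) ≠ 0 := by
    intro s t hs ht ht0 h0
    obtain ⟨a1, a2, a3⟩ := h1 (hin s t hs ht)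
    obtain ⟨v, hv2, hv0⟩ := hz _ a1 h0
    refine hnv v hv2 _ ⟨a1, hv0, fun w hw2 hw0 => ?_⟩ h0
    by_contra hcon
    exact ht0 (a3 ⟨v, a2 v hv2 hv0⟩ ⟨w, a2 w hw2 hw0⟩ hcon hv0 hw0).2
  -- the values on the circle stay away from zero
  have hsph : IsCompact (Metric.sphere (0 : ℂ) ε) := isCompact_sphere _ _
  have hne : (Metric.sphere (0 : ℂ) ε).Nonempty := NormedSpace.sphere_nonempty.mpr hε.le
  have hfc : ∀ s t : ℂ, ‖s‖ ≤ ε → ‖t‖ ≤ ε → ContinuousAt (fun q => ‖f (g q)‖) (s, t) := by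
    intro s t hs ht
    exact (((hf.differentiableAt (isOpen_tube.mem_nhds (h1 (hin s t hs ht)).1)).continuousAt).comp
      (f := g) hg.continuousAt).norm
  have hcont : ContinuousOn (fun s : ℂ => ‖f (g (s, 0))‖) (Metric.sphere 0 ε) := by
    intro s hs
    have hs' : ‖s‖ = ε := by simpa using hs
    have h3 := hfc s 0 hs'.le (by simpa using hε.le)
    exact (ContinuousAt.comp (f := fun s : ℂ => (s, (0 : ℂ))) h3
      (by fun_prop)).continuousWithinAt
  obtain ⟨s₀, hs₀, hmin⟩ := hsph.exists_isMinOn hne hcont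
  set δ := ‖f (g (s₀, 0))‖ with hδdef
  have hδ : 0 < δ := norm_pos_iff.mpr (hcirc s₀ (by simpa using hs₀))
  have e1 : ∀ᶠ t : ℂ in nhds 0, ∀ s ∈ Metric.sphere (0 : ℂ) ε, δ / 2 < ‖f (g (s, t))‖ := by
    refine hsph.eventually_forall_of_forall_eventually fun s hs => ?_
    have hs' : ‖s‖ = ε := by simpa using hs
    have h3 := hfc s 0 hs'.le (by simpa using hε.le)
    have h4 : δ / 2 < ‖f (g (s, 0))‖ := by
      have : δ ≤ ‖f (g (s, 0))‖ := hmin hs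
      linarith
    have h5 := h3.eventually (lt_mem_nhds h4)
    exact (continuous_swap.tendsto ((0 : ℂ), s)).eventually h5
  have e2 : ∀ᶠ t : ℂ in nhds 0, ‖f (g (0, t))‖ < δ / 2 := by
    have h3 := hfc 0 0 (by simpa using hε.le) (by simpa using hε.le)
    have h4 : ‖f (g (0, 0))‖ < δ / 2 := by rw [hg0, hfp, norm_zero]; positivity
    exact ((Continuous.tendsto (by fun_prop : Continuous fun t : ℂ => ((0 : ℂ), t)) 0).eventually
      (h3.eventually (gt_mem_nhds h4)))
  have e3 : ∀ᶠ t : ℂ in nhds 0, ‖t‖ ≤ ε := by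
    filter_upwards [Metric.closedBall_mem_nhds (0 : ℂ) hε] with t ht
    simpa using ht
  obtain ⟨t, ⟨⟨ht1, ht2⟩, ht3⟩, ht0⟩ :=
    (((e1.and e2).and e3).filter_mono nhdsWithin_le_nhds |>.and
      (self_mem_nhdsWithin : {(0 : ℂ)}ᶜ ∈ nhdsWithin 0 {(0 : ℂ)}ᶜ)).exists
  have hd : DiffContOnCl ℂ (fun s : ℂ => (f (g (s, t)))⁻¹) (Metric.ball 0 ε) := by
    refine DifferentiableOn.diffContOnCl fun s hs => ?_
    rw [closure_ball _ hε.ne'] at hs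
    have hs' : ‖s‖ ≤ ε := by simpa using hs
    refine DifferentiableWithinAt.inv ?_ (hdisc s t hs' ht3 ht0)
    have h3 := hf.differentiableAt (isOpen_tube.mem_nhds (h1 (hin s t hs' ht3)).1)
    refine (DifferentiableAt.comp (f := fun s : ℂ => g (s, t)) s h3 ?_).differentiableWithinAt
    simp only [g]
    fun_prop
  have hmax := Complex.norm_le_of_forall_mem_frontier_norm_le (C := (δ / 2)⁻¹)
    Metric.isBounded_ball hd (fun s hs => ?_) (subset_closure (Metric.mem_ball_self hε))
  · rw [norm_inv] at hmax
    have h3 : 0 < ‖f (g (0, t))‖ :=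
      norm_pos_iff.mpr (hdisc 0 t (by simpa using hε.le) ht3 ht0)
    have := (inv_le_inv₀ h3 (by positivity)).mp hmax
    linarith
  · rw [frontier_ball _ hε.ne'] at hs
    rw [norm_inv]
    exact inv_anti₀ (by positivity) (ht1 s hs).le

theorem zeroFree_of_nv (hC : PD C)
    (h : ∀ (k : ℤ) (f : (Fin (2 + r) → ℂ) → ℂ), TForm C k f → ReflZeros C f →
      ∀ v, bil (MM C) v v = -2 → NV C f v) : ZeroFree C :=
  fun k f hf hz _ hp => ne_zero_of_nv hC hf.holo hz (h k f hf hz) hp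

end NonvanishingOnDivisors

end Refl

open Matrix
namespace Refl

section Criterion

variable {r r' : ℕ} {C : Matrix (Fin r) (Fin r) ℤ} {C' : Matrix (Fin r') (Fin r') ℤ} {k : ℤ}
  {f : (Fin (2 + r) → ℂ) → ℂ}

theorem HasOrd.of_nv {β : Fin (2 + r) → ℤ} (h : ∀ b, NV C f (hv 0 b β)) : HasOrd C f β 0 := by
  intro b p hp
  have h0 := h b p hp
  rw [lineOrd, analyticOrderNatAt]
  by_cases ha : AnalyticAt ℂ (fun s : ℂ => f (p + s • intC β)) 0
  · rw [ha.analyticOrderAt_eq_zero.mpr (by simpa using h0)]; rfl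
  · rw [analyticOrderAt_of_not_analyticAt ha]; rfl

theorem bil_M_std : bil (MM C) (hv 0 0 (hv 1 (-1) 0)) (hv 0 0 (hv 1 (-1) 0)) = (-2 : ℤ) := by
  rw [bil_MM_hv, bil_S]; simp

theorem nv_of_not_evenV (hC : PD C) (hd : ∀ i, C i i = 2) (i0 : Fin r) (hf : TForm C k f)
    (hz : ReflZeros C f) (h : HasOrd C f (hv 1 (-1) 0) 0) {v : Fin (2 + (2 + r)) → ℤ}
    (hv2 : bil (MM C) v v = -2) (hE : ¬EvenV C v) : NV C f v := by
  have h1 : NV C f (hv 0 0 (hv 1 (-1) 0)) := h.nv hC hf hz (by rw [bil_S]; simp) 0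
  have h2 : Orb C (hv 0 0 (hv 1 (-1) 0)) (hv 1 (-1) 0) :=
    orb_of_not_evenV hC bil_M_std fun hE => by
      have := hE.2.2 (hv 1 0 0)
      rw [hX_hv, bil_S] at this
      simp at this
  exact NV.orb_symm hC hd i0 hf (orb_of_not_evenV hC hv2 hE) (h1.orb hC hd i0 hf h2)

/-- Every form with zeros on mirrors of roots has order zero along a standard odd root. -/
def OddOrd (C : Matrix (Fin r) (Fin r) ℤ) : Prop :=
  ∀ k f, TForm C k f → ReflZeros C f → HasOrd C f (hv 1 (-1) 0) 0

theorem nv_of_even_simple (hC : PD C) (hd : ∀ i, C i i = 2) (hoff : ∀ i j, i ≠ j → C i j ≤ 0)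
    (i0 : Fin r) (hf : TForm C k f) (hz : ReflZeros C f) (h0 : HasOrd C f (hv 1 (-1) 0) 0)
    {θ₁ θ : Fin r → ℤ} (hθ₁ : Spread C θ₁) {v : Fin (2 + (2 + r)) → ℤ}
    (hv2 : bil (MM C) v v = -2) {b : ℤ} {i : Fin r} {ν : Fin r → ℤ}
    (hθ : Dom C θ) (hi : θ i ≠ 0)
    (h : Orb C v (hv 2 b (hv 0 0 (Pi.single i 1 + (2 : ℤ) • ν)))) : NV C f v := by
  refine NV.orb_symm hC hd i0 hf (orb_even_simple hC hv2 (hd i) ν h) ?_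
  have hroot : bil (SM C) (hv 0 0 (-Pi.single i 1)) (hv 0 0 (-Pi.single i 1)) = (-2 : ℤ) := by
    rw [bil_S, bil_neg_left, bil_neg_right, bil_single, hd]; simp
  exact (hasOrd_simple hC hd hoff i0 hf hz h0 hθ₁ hθ hi).nv hC hf hz hroot _

theorem zeroFree_of_classes (hC : PD C) (hd : ∀ i, C i i = 2) (i0 : Fin r) (hO : OddOrd C)
    (hE : ∀ k f, TForm C k f → ReflZeros C f → ∀ v, bil (MM C) v v = -2 → ∀ c μ,
      Orb C v (hv 2 (2 * c) (hv 0 0 μ)) → (∀ ν, 2 ∣ bil C μ ν) → bil C μ μ = 8 * c + 2 →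
      NV C f v) : ZeroFree C :=
  zeroFree_of_nv hC fun k f hf hz v hv2 => by
    by_cases he : EvenV C v
    · obtain ⟨c, μ, h1, h2, h3⟩ := orb_of_evenV hC hv2 he
      exact hE k f hf hz v hv2 c μ h1 h2 h3
    · exact nv_of_not_evenV hC hd i0 hf hz (hO k f hf hz) hv2 he

theorem oddOrd_of_spread (hC : PD C) (hd : ∀ i, C i i = 2) (hoff : ∀ i j, i ≠ j → C i j ≤ 0)
    (i0 : Fin r) {θ θ' : Fin r → ℤ} (hθ : Spread C θ) (hθ' : Spread C θ')
    (hne : ∑ i, θ i ≠ ∑ i, θ' i) : OddOrd C :=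
  fun _ _ hf hz => hasOrd_zero hC hd hoff i0 hf hz hθ hθ' hne

/-- Lattice isometries between the hyperbolic lattices that preserve the positive cones. -/
structure ConeIso (C : Matrix (Fin r) (Fin r) ℤ) (C' : Matrix (Fin r') (Fin r') ℤ)
    (Q : Matrix (Fin (2 + r)) (Fin (2 + r')) ℤ) (Q' : Matrix (Fin (2 + r')) (Fin (2 + r)) ℤ) :
    Prop where
  form : Qᵀ * SM C * Q = SM C'
  right : Q * Q' = 1
  left : Q' * Q = 1
  pos : 0 < hA (actR Q (hv (1 : ℤ) 1 0))

section

variable {Q : Matrix (Fin (2 + r)) (Fin (2 + r')) ℤ} {Q' : Matrix (Fin (2 + r')) (Fin (2 + r)) ℤ}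

theorem ConeIso.bil_eq (h : ConeIso C C' Q Q') {R : Type*} [CommRing R] (x y : Fin (2 + r') → R) :
    bil (SM C) (actR Q x) (actR Q y) = bil (SM C') x y := by rw [bil_act, h.form]

theorem ConeIso.act_inv (h : ConeIso C C' Q Q') {R : Type*} [CommRing R] (x : Fin (2 + r) → R) :
    actR Q (actR Q' x) = x := by rw [← actR_mul, h.right, actR_one]

theorem ConeIso.inv_act (h : ConeIso C C' Q Q') {R : Type*} [CommRing R] (x : Fin (2 + r') → R) :
    actR Q' (actR Q x) = x := by rw [← actR_mul, h.left, actR_one]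

theorem intC_act (Q : Matrix (Fin (2 + r)) (Fin (2 + r')) ℤ) (x : Fin (2 + r') → ℤ) :
    intC (actR Q x) = actR Q (intC x) := actR_map (Int.castRingHom ℂ) Q x

theorem imv_act (Q : Matrix (Fin (2 + r)) (Fin (2 + r')) ℤ) (z : Fin (2 + r') → ℂ) :
    imv (actR Q z) = actR Q (imv z) := by
  ext i
  simp [imv, actR]

theorem ConeIso.base (h : ConeIso C C' Q Q') : actR Q (hv (1 : ℝ) 1 0) ∈ PosCone C := by
  refine ⟨?_, ?_⟩
  · have h1 := h.pos
    have h2 : hA (actR Q (hv (1 : ℝ) 1 0)) = ((hA (actR Q (hv (1 : ℤ) 1 0)) : ℤ) : ℝ) := by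
      have := actR_map (Int.castRingHom ℝ) Q (hv (1 : ℤ) 1 0)
      have e := map_hv (Int.castRingHom ℝ) 1 1 (0 : Fin r' → ℤ)
      rw [e] at this
      simp only [map_one, Pi.zero_apply, map_zero] at this
      change hA (actR Q (hv (1 : ℝ) 1 fun _ => 0)) = _
      rw [← this]; rfl
    rw [h2]; exact_mod_cast h1
  · rw [h.bil_eq]; exact (base_mem C').2

theorem ConeIso.mem (h : ConeIso C C' Q Q') (hC : PD C) (hC' : PD C') {z : Fin (2 + r') → ℂ}
    (hz : z ∈ Tube C') : actR Q z ∈ Tube C := by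
  rw [mem_tube] at hz ⊢
  rw [imv_act]
  refine mem_posCone_of_pair hC h.base ?_ ?_
  · rw [h.bil_eq]; exact hz.2
  · rw [h.bil_eq]; exact posCone_pair hC' hz (base_mem C')

theorem ConeIso.mem_inv (h : ConeIso C C' Q Q') (hC : PD C) (hC' : PD C') {z : Fin (2 + r) → ℂ}
    (hz : z ∈ Tube C) : actR Q' z ∈ Tube C' := by
  rw [mem_tube] at hz ⊢
  rw [imv_act]
  refine mem_posCone_of_pair hC' (base_mem C') ?_ ?_
  · rw [← h.bil_eq, h.act_inv]; exact hz.2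
  · rw [← h.bil_eq, h.act_inv]; exact posCone_pair hC hz h.base

theorem ConeIso.wq_eq (h : ConeIso C C' Q Q') (a b : ℤ) (l : Fin (2 + r') → ℤ)
    (z : Fin (2 + r') → ℂ) : wq C (hv a b (actR Q l)) (actR Q z) = wq C' (hv a b l) z := by
  rw [wq_hv, wq_hv, intC_act, h.bil_eq, h.bil_eq]

theorem ConeIso.tform (h : ConeIso C C' Q Q') (hC : PD C) (hC' : PD C') (hf : TForm C k f) :
    TForm C' k fun z => f (actR Q z) where
  holo := by
    refine hf.holo.comp (Differentiable.differentiableOn ?_) fun z hz => h.mem hC hC' hz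
    unfold actR
    fun_prop
  refl α hα b z hz := by
    have := hf.refl (actR Q α) (by rw [h.bil_eq, hα]) b _ (h.mem hC hC' hz)
    rw [intC_act, h.bil_eq] at this
    simp only [actR_add, actR_smul]
    exact this
  refl4 u hu hu2 z hz := by
    have := hf.refl4 (actR Q u) (by rw [h.bil_eq, hu])
      (fun x => by rw [← h.act_inv x, h.bil_eq]; exact hu2 _) _ (h.mem hC hC' hz)
    rw [intC_act, h.bil_eq] at this
    simp only [actR_add, actR_smul]
    exact this
  inv z hz := by
    have := hf.inv _ (h.mem hC hC' hz)
    rw [h.bil_eq] at this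
    simp only [actR_smul]
    exact this

theorem ConeIso.reflZeros (h : ConeIso C C' Q Q') (hC : PD C) (hC' : PD C') (hz : ReflZeros C f) :
    ReflZeros C' fun z => f (actR Q z) := by
  intro z hzT h0
  obtain ⟨v, hv2, hv0⟩ := hz _ (h.mem hC hC' hzT) h0
  obtain ⟨a, b, l, rfl⟩ := exists_hv v
  refine ⟨hv a b (actR Q' l), ?_, ?_⟩
  · rw [← hv2, bil_MM_hv, bil_MM_hv, ← h.bil_eq, h.act_inv]
  · rw [← h.wq_eq, h.act_inv]; exact hv0

theorem ConeIso.nv (h : ConeIso C C' Q Q') (hC : PD C) (hC' : PD C') {a b : ℤ}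
    {l : Fin (2 + r') → ℤ} (hn : NV C' (fun z => f (actR Q z)) (hv a b l)) :
    NV C f (hv a b (actR Q l)) := by
  intro p hp
  have := hn (actR Q' p) ⟨h.mem_inv hC hC' hp.mem, ?_, ?_⟩
  · simpa only [h.act_inv] using this
  · rw [← h.wq_eq, h.act_inv]; exact hp.zero
  · intro w hw2 hw0
    obtain ⟨a', b', m, rfl⟩ := exists_hv w
    rw [← h.wq_eq, h.act_inv] at hw0
    have e := hp.only _ (by
      rw [← hw2, bil_MM_hv, bil_MM_hv, h.bil_eq]) hw0
    rw [hv_neg, hv_inj, hv_inj] at e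
    rw [hv_neg, hv_inj, hv_inj]
    refine e.imp (fun e => ⟨e.1, e.2.1, ?_⟩) fun e => ⟨e.1, e.2.1, ?_⟩
    · rw [← h.inv_act m, e.2.2, h.inv_act]
    · rw [← h.inv_act m, e.2.2, show -actR Q l = actR Q (-l) by
        rw [← neg_one_smul ℤ l, actR_smul, neg_one_smul], h.inv_act]

theorem ConeIso.oddOrd (h : ConeIso C C' Q Q') (hC : PD C) (hC' : PD C')
    (hd' : ∀ i, C' i i = 2) (i0 : Fin r') (hO : OddOrd C') : OddOrd C := by
  intro k f hf hz
  refine HasOrd.of_nv fun b => ?_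
  have hf' := h.tform hC hC' hf
  have hz' := h.reflZeros hC hC' hz
  have := h.nv (f := f) (a := 0) (b := b) (l := actR Q' (hv 1 (-1) 0)) hC hC' ?_
  · rwa [h.act_inv] at this
  · refine nv_of_not_evenV hC' hd' i0 hf' hz' (hO _ _ hf' hz') ?_ fun hE => ?_
    · rw [bil_MM_hv, ← h.bil_eq, h.act_inv, bil_S]; simp
    · have := hE.2.2 (actR Q' (hv 1 0 0))
      rw [hX_hv, ← h.bil_eq, h.act_inv, h.act_inv, bil_S] at this
      simp at this

end

end Criterion

end Refl

open Matrix
namespace Refl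

section DirectSums

variable {m n r : ℕ} {A : Matrix (Fin m) (Fin m) ℤ} {B : Matrix (Fin n) (Fin n) ℤ}
  {C : Matrix (Fin r) (Fin r) ℤ}

@[simp] theorem dsum_ll (i j : Fin m) : dsum A B (Fin.castAdd n i) (Fin.castAdd n j) = A i j := by
  simp [dsum]

@[simp] theorem dsum_rr (i j : Fin n) : dsum A B (Fin.natAdd m i) (Fin.natAdd m j) = B i j := by
  simp [dsum]

@[simp] theorem dsum_lr (i : Fin m) (j : Fin n) :
    dsum A B (Fin.castAdd n i) (Fin.natAdd m j) = 0 := by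
  simp [dsum]

@[simp] theorem dsum_rl (i : Fin n) (j : Fin m) :
    dsum A B (Fin.natAdd m i) (Fin.castAdd n j) = 0 := by
  simp [dsum]

theorem exists_append (x : Fin (m + n) → ℤ) : ∃ y z, x = Fin.append y z :=
  ⟨fun i => x (Fin.castAdd n i), fun i => x (Fin.natAdd m i), Fin.append_castAdd_natAdd.symm⟩

theorem single_castAdd (i : Fin m) :
    Pi.single (Fin.castAdd n i) (1 : ℤ) = Fin.append (Pi.single i 1) 0 := by
  ext j
  induction j using Fin.addCases with
  | left j => simp [Pi.single_apply]
  | right j =>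
    have : Fin.natAdd m j ≠ Fin.castAdd n i := by simp [Fin.ext_iff]; omega
    simp [this]

theorem single_natAdd (i : Fin n) :
    Pi.single (Fin.natAdd m i) (1 : ℤ) = Fin.append 0 (Pi.single i 1) := by
  ext j
  induction j using Fin.addCases with
  | left j =>
    have : Fin.castAdd n j ≠ Fin.natAdd m i := by simp [Fin.ext_iff]; omega
    simp [this]
  | right j => simp [Pi.single_apply]

theorem append_add_two_smul (x y : Fin m → ℤ) (x' y' : Fin n → ℤ) :
    Fin.append x x' + (2 : ℤ) • Fin.append y y' =
      Fin.append (x + (2 : ℤ) • y) (x' + (2 : ℤ) • y') := by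
  ext j
  induction j using Fin.addCases with
  | left j => simp
  | right j => simp

/-- Gram matrices of simply laced root bases, with a strictly dominant vector. -/
structure Cartan (C : Matrix (Fin r) (Fin r) ℤ) : Prop where
  symm : ∀ i j, C i j = C j i
  diag : ∀ i, C i i = 2
  off : ∀ i j, i ≠ j → C i j ≤ 0
  dom : ∃ ρ : Fin r → ℤ, (∀ i, 0 < ρ i) ∧ ∀ i, 0 < ∑ j, C i j * ρ j

theorem Cartan.of_pairs (hs : ∀ p : Fin r × Fin r, C p.1 p.2 = C p.2 p.1)
    (hd : ∀ i, C i i = 2) (ho : ∀ p : Fin r × Fin r, p.1 ≠ p.2 → C p.1 p.2 ≤ 0) (ρ : Fin r → ℤ)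
    (h1 : ∀ i, 0 < ρ i) (h2 : ∀ i, 0 < ∑ j, C i j * ρ j) : Cartan C :=
  ⟨fun i j => hs (i, j), hd, fun i j => ho (i, j), ρ, h1, h2⟩

theorem Cartan.dsum (hA : Cartan A) (hB : Cartan B) : Cartan (dsum A B) where
  symm i j := by
    induction i using Fin.addCases <;> induction j using Fin.addCases <;>
      simp [hA.symm, hB.symm]
  diag i := by induction i using Fin.addCases <;> simp [hA.diag, hB.diag]
  off i j hij := by
    induction i using Fin.addCases <;> induction j using Fin.addCases <;> simp
    · exact hA.off _ _ fun h => hij (by rw [h])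
    · exact hB.off _ _ fun h => hij (by rw [h])
  dom := by
    obtain ⟨ρ, h1, h2⟩ := hA.dom
    obtain ⟨ρ', h1', h2'⟩ := hB.dom
    refine ⟨Fin.append ρ ρ', fun i => ?_, fun i => ?_⟩
    · induction i using Fin.addCases <;> simp [h1, h1']
    · rw [Fin.sum_univ_add]
      induction i using Fin.addCases <;> simp [h2, h2']

theorem even_of_diag (hs : ∀ i j, C i j = C j i) (hd : ∀ i, C i i = 2) (x : Fin r → ℤ) :
    2 ∣ bil C x x := by
  have e : C = (Matrix.of fun i j => if i < j then C i j else if i = j then 1 else 0) +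
      (Matrix.of fun i j => if i < j then C i j else if i = j then 1 else 0)ᵀ := by
    ext i j
    simp only [Matrix.add_apply, Matrix.transpose_apply, Matrix.of_apply]
    rcases lt_trichotomy i j with h | rfl | h
    · simp [h, h.ne', h.not_gt]
    · simp [hd]
    · simp [h, h.ne', h.not_gt, hs i j]
  set T : Matrix (Fin r) (Fin r) ℤ :=
    Matrix.of fun i j => if i < j then C i j else if i = j then 1 else 0
  refine ⟨bil T x x, ?_⟩
  have h1 : bil Tᵀ x x = bil T x x := by
    unfold bil
    rw [Finset.sum_comm]
    refine Finset.sum_congr rfl fun i _ => Finset.sum_congr rfl fun j _ => ?_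
    rw [Matrix.transpose_apply]; ring
  have h2 : bil C x x = bil T x x + bil Tᵀ x x := by
    rw [e]
    unfold bil
    simp only [Matrix.add_apply, Int.cast_id, add_mul, Finset.sum_add_distrib]
  rw [h2, h1, two_mul]

theorem Cartan.pos (hC : Cartan C) {x : Fin r → ℝ} (hx : x ≠ 0) : 0 < bil C x x := by
  obtain ⟨ρ, h1, h2⟩ := hC.dom
  have hρ : ∀ i, (0 : ℝ) < ρ i := fun i => by exact_mod_cast h1 i
  set t : Fin r → ℝ := fun i => x i / ρ i with ht
  have hxt : ∀ i, x i = ρ i * t i := fun i => by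
    rw [ht]; field_simp [(hρ i).ne']
  have key : ∑ i, ∑ j, ((C i j : ℝ) * ρ i * ρ j) * ((t i ^ 2 + t j ^ 2) / 2) ≤ bil C x x := by
    unfold bil
    refine Finset.sum_le_sum fun i _ => Finset.sum_le_sum fun j _ => ?_
    rw [hxt i, hxt j]
    by_cases h : i = j
    · subst h; apply le_of_eq; ring
    · have h3 : (C i j : ℝ) ≤ 0 := by exact_mod_cast hC.off i j h
      have h4 : 0 ≤ (ρ i : ℝ) * ρ j * (t i - t j) ^ 2 := by
        have := hρ i; have := hρ j; positivity
      nlinarith [mul_nonneg (neg_nonneg.mpr h3) h4]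
  refine lt_of_lt_of_le ?_ key
  have e : ∑ i, ∑ j, ((C i j : ℝ) * ρ i * ρ j) * ((t i ^ 2 + t j ^ 2) / 2) =
      ∑ i, (∑ j, (C i j : ℝ) * ρ j) * (ρ i * t i ^ 2) := by
    have e1 : ∑ i, ∑ j, ((C i j : ℝ) * ρ i * ρ j) * (t j ^ 2 / 2) =
        ∑ i, ∑ j, ((C i j : ℝ) * ρ i * ρ j) * (t i ^ 2 / 2) := by
      rw [Finset.sum_comm]
      refine Finset.sum_congr rfl fun i _ => Finset.sum_congr rfl fun j _ => ?_
      rw [hC.symm j i]; ring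
    simp only [add_div, mul_add, Finset.sum_add_distrib]
    rw [e1, ← Finset.sum_add_distrib]
    refine Finset.sum_congr rfl fun i _ => ?_
    rw [← Finset.sum_add_distrib, Finset.sum_mul]
    exact Finset.sum_congr rfl fun j _ => by ring
  rw [e]
  have hs : ∀ i, (0 : ℝ) < ∑ j, (C i j : ℝ) * ρ j := fun i => by exact_mod_cast h2 i
  obtain ⟨i, hi⟩ : ∃ i, x i ≠ 0 := by
    by_contra! h
    exact hx (funext h)
  refine Finset.sum_pos' (fun i _ => ?_) ⟨i, Finset.mem_univ i, ?_⟩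
  · have := hs i; have := hρ i; positivity
  · have h3 := hs i; have h4 := hρ i
    have : t i ≠ 0 := fun h => hi (by rw [hxt, h, mul_zero])
    positivity

theorem Cartan.pd (hC : Cartan C) : PD C where
  symm := Matrix.ext fun i j => hC.symm j i
  even := even_of_diag hC.symm hC.diag
  pos _ hx := hC.pos hx

theorem Dom.left {θ : Fin m → ℤ} (h : Dom A θ) : Dom (dsum A B) (Fin.append θ 0) where
  root := by rw [bil_dsum, bil_zero_left, h.root, add_zero]
  nonneg i := by induction i using Fin.addCases <;> simp [h.nonneg]
  dom i := by
    induction i using Fin.addCases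
    · rw [single_castAdd, bil_dsum, bil_zero_left, add_zero]; exact h.dom _
    · rw [single_natAdd, bil_dsum, bil_zero_left, bil_zero_right, add_zero]

theorem Dom.right {θ : Fin n → ℤ} (h : Dom B θ) : Dom (dsum A B) (Fin.append 0 θ) where
  root := by rw [bil_dsum, bil_zero_left, h.root, zero_add]
  nonneg i := by induction i using Fin.addCases <;> simp [h.nonneg]
  dom i := by
    induction i using Fin.addCases
    · rw [single_castAdd, bil_dsum, bil_zero_left, bil_zero_right, add_zero]
    · rw [single_natAdd, bil_dsum, bil_zero_left, zero_add]; exact h.dom _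

theorem Spread.left {θ : Fin m → ℤ} (h : Spread A θ) : Spread (dsum A B) (Fin.append θ 0) where
  toDom := h.toDom.left
  spread Q h1 h2 i hi := by
    induction i using Fin.addCases with
    | left i =>
      rw [Fin.append_left] at hi
      refine h.spread (fun i => Q (Fin.castAdd n i)) (fun i hi => h1 _ ?_)
        (fun i j hi hij => h2 _ _ hi ?_) i hi
      · rw [single_castAdd, bil_dsum, bil_zero_left, add_zero, hi]
      · rw [dsum_ll, hij]
    | right i => simp at hi

theorem Spread.right {θ : Fin n → ℤ} (h : Spread B θ) : Spread (dsum A B) (Fin.append 0 θ) where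
  toDom := h.toDom.right
  spread Q h1 h2 i hi := by
    induction i using Fin.addCases with
    | right i =>
      rw [Fin.append_right] at hi
      refine h.spread (fun i => Q (Fin.natAdd m i)) (fun i hi => h1 _ ?_)
        (fun i j hi hij => h2 _ _ hi ?_) i hi
      · rw [single_natAdd, bil_dsum, bil_zero_left, zero_add, hi]
      · rw [dsum_rr, hij]
    | left i => simp at hi

/-- `μ` pairs evenly with the lattice. -/
def Par (C : Matrix (Fin r) (Fin r) ℤ) (μ : Fin r → ℤ) : Prop := ∀ ν, 2 ∣ bil C μ ν

theorem Par.split {μ : Fin m → ℤ} {μ' : Fin n → ℤ} (h : Par (dsum A B) (Fin.append μ μ')) :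
    Par A μ ∧ Par B μ' := by
  refine ⟨fun ν => ?_, fun ν => ?_⟩
  · have := h (Fin.append ν 0)
    rwa [bil_dsum, bil_zero_right, add_zero] at this
  · have := h (Fin.append 0 ν)
    rwa [bil_dsum, bil_zero_right, zero_add] at this

theorem Par.reduce (hC : Cartan C) {μ : Fin r → ℤ} (h : Par C μ) :
    ∃ ε : Fin r → Fin 2, ∃ ν : Fin r → ℤ, μ = (fun i => ((ε i : ℕ) : ℤ)) + (2 : ℤ) • ν ∧
      (∀ i, (∑ j, C i j * ((ε j : ℕ) : ℤ)) % 2 = 0) ∧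
      bil C μ μ % 8 = (∑ i, ∑ j, C i j * ((ε i : ℕ) : ℤ) * ((ε j : ℕ) : ℤ)) % 8 := by
  refine ⟨fun i => ⟨(μ i % 2).toNat, by have := Int.emod_lt_of_pos (μ i) two_pos; omega⟩,
    fun i => μ i / 2, ?_, ?_, ?_⟩
  · ext i
    have := Int.emod_nonneg (μ i) two_ne_zero
    simp only [Pi.add_apply, Pi.smul_apply, smul_eq_mul, Int.toNat_of_nonneg this]
    omega
  all_goals
    have hn : ∀ i, (((μ i % 2).toNat : ℕ) : ℤ) = μ i % 2 := fun i =>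
      Int.toNat_of_nonneg (Int.emod_nonneg (μ i) two_ne_zero)
    have hμ : μ = (fun i => μ i % 2) + (2 : ℤ) • fun i => μ i / 2 := by
      ext i; simp only [Pi.add_apply, Pi.smul_apply, smul_eq_mul]; omega
    have hp : Par C fun i => μ i % 2 := fun ν => by
      have := h ν
      rw [hμ, bil_add_left, bil_smul_left] at this
      omega
    simp only [hn]
  · intro i
    have := hp (Pi.single i 1)
    rw [bil_comm hC.pd.symm, bil_single_left] at this
    simp only [Int.cast_id] at this
    omega
  · have h1 := hp fun i => μ i / 2
    have h2 := hC.pd.even fun i => μ i / 2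
    have h3 : bil C μ μ = bil C (fun i => μ i % 2) (fun i => μ i % 2) +
        4 * bil C (fun i => μ i % 2) (fun i => μ i / 2) +
        4 * bil C (fun i => μ i / 2) (fun i => μ i / 2) := by
      conv_lhs => rw [hμ]
      simp only [bil_add_left, bil_add_right, bil_smul_left, bil_smul_right]
      rw [bil_comm hC.pd.symm (fun i => μ i / 2) (fun i => μ i % 2)]
      ring
    have h4 : bil C (fun i => μ i % 2) (fun i => μ i % 2) =
        ∑ i, ∑ j, C i j * (μ i % 2) * (μ j % 2) := by
      unfold bil; simp only [Int.cast_id]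
    rw [h3, ← h4]
    omega

end DirectSums

end Refl

open Matrix
namespace Refl

section Components

theorem cartan_A1 : Cartan (gramA 1) :=
  .of_pairs (by decide +kernel) (by decide +kernel) (by decide +kernel) ![1]
    (by decide +kernel) (by decide +kernel)

theorem dom_A1 : Dom (gramA 1) ![1] where
  root := by decide +kernel
  nonneg := by decide +kernel
  dom := by decide +kernel

theorem cartan_A2 : Cartan (gramA 2) :=
  .of_pairs (by decide +kernel) (by decide +kernel) (by decide +kernel) ![2, 2]
    (by decide +kernel) (by decide +kernel)

theorem spread_A2 : Spread (gramA 2) ![1, 1] where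
  root := by decide +kernel
  nonneg := by decide +kernel
  dom := by decide +kernel
  spread Q h1 h2 i _ := by
    have q0 := h1 0 (by decide +kernel)
    have q1 := h1 1 (by decide +kernel)
    fin_cases i <;> assumption

theorem cartan_A3 : Cartan (gramA 3) :=
  .of_pairs (by decide +kernel) (by decide +kernel) (by decide +kernel) ![3, 4, 3]
    (by decide +kernel) (by decide +kernel)

theorem spread_A3 : Spread (gramA 3) ![1, 1, 1] where
  root := by decide +kernel
  nonneg := by decide +kernel
  dom := by decide +kernel
  spread Q h1 h2 i _ := by
    have q0 := h1 0 (by decide +kernel)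
    have q2 := h1 2 (by decide +kernel)
    have q1 := h2 0 1 q0 (by decide +kernel)
    fin_cases i <;> assumption

theorem cartan_A4 : Cartan (gramA 4) :=
  .of_pairs (by decide +kernel) (by decide +kernel) (by decide +kernel) ![4, 6, 6, 4]
    (by decide +kernel) (by decide +kernel)

theorem spread_A4 : Spread (gramA 4) ![1, 1, 1, 1] where
  root := by decide +kernel
  nonneg := by decide +kernel
  dom := by decide +kernel
  spread Q h1 h2 i _ := by
    have q0 := h1 0 (by decide +kernel)
    have q3 := h1 3 (by decide +kernel)
    have q1 := h2 0 1 q0 (by decide +kernel)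
    have q2 := h2 3 2 q3 (by decide +kernel)
    fin_cases i <;> assumption

theorem cartan_D4 : Cartan (gramD 4) :=
  .of_pairs (by decide +kernel) (by decide +kernel) (by decide +kernel) ![6, 10, 6, 6]
    (by decide +kernel) (by decide +kernel)

theorem spread_D4 : Spread (gramD 4) ![1, 2, 1, 1] where
  root := by decide +kernel
  nonneg := by decide +kernel
  dom := by decide +kernel
  spread Q h1 h2 i _ := by
    have q1 := h1 1 (by decide +kernel)
    have q0 := h2 1 0 q1 (by decide +kernel)
    have q2 := h2 1 2 q1 (by decide +kernel)
    have q3 := h2 1 3 q1 (by decide +kernel)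
    fin_cases i <;> assumption

theorem cartan_D5 : Cartan (gramD 5) :=
  .of_pairs (by decide +kernel) (by decide +kernel) (by decide +kernel) ![8, 14, 18, 10, 10]
    (by decide +kernel) (by decide +kernel)

theorem spread_D5 : Spread (gramD 5) ![1, 2, 2, 1, 1] where
  root := by decide +kernel
  nonneg := by decide +kernel
  dom := by decide +kernel
  spread Q h1 h2 i _ := by
    have q1 := h1 1 (by decide +kernel)
    have q0 := h2 1 0 q1 (by decide +kernel)
    have q2 := h2 1 2 q1 (by decide +kernel)
    have q3 := h2 2 3 q2 (by decide +kernel)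
    have q4 := h2 2 4 q2 (by decide +kernel)
    fin_cases i <;> assumption

theorem cartan_D6 : Cartan (gramD 6) :=
  .of_pairs (by decide +kernel) (by decide +kernel) (by decide +kernel) ![10, 18, 24, 28, 15, 15]
    (by decide +kernel) (by decide +kernel)

theorem spread_D6 : Spread (gramD 6) ![1, 2, 2, 2, 1, 1] where
  root := by decide +kernel
  nonneg := by decide +kernel
  dom := by decide +kernel
  spread Q h1 h2 i _ := by
    have q1 := h1 1 (by decide +kernel)
    have q0 := h2 1 0 q1 (by decide +kernel)
    have q2 := h2 1 2 q1 (by decide +kernel)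
    have q3 := h2 2 3 q2 (by decide +kernel)
    have q4 := h2 3 4 q3 (by decide +kernel)
    have q5 := h2 3 5 q3 (by decide +kernel)
    fin_cases i <;> assumption

theorem cartan_D8 : Cartan (gramD 8) :=
  .of_pairs (by decide +kernel) (by decide +kernel) (by decide +kernel) ![14, 26, 36, 44, 50, 54, 28, 28]
    (by decide +kernel) (by decide +kernel)

theorem spread_D8 : Spread (gramD 8) ![1, 2, 2, 2, 2, 2, 1, 1] where
  root := by decide +kernel
  nonneg := by decide +kernel
  dom := by decide +kernel
  spread Q h1 h2 i _ := by
    have q1 := h1 1 (by decide +kernel)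
    have q0 := h2 1 0 q1 (by decide +kernel)
    have q2 := h2 1 2 q1 (by decide +kernel)
    have q3 := h2 2 3 q2 (by decide +kernel)
    have q4 := h2 3 4 q3 (by decide +kernel)
    have q5 := h2 4 5 q4 (by decide +kernel)
    have q6 := h2 5 6 q5 (by decide +kernel)
    have q7 := h2 5 7 q5 (by decide +kernel)
    fin_cases i <;> assumption

theorem cartan_E6 : Cartan gramE6 :=
  .of_pairs (by decide +kernel) (by decide +kernel) (by decide +kernel) ![16, 30, 42, 30, 16, 22]
    (by decide +kernel) (by decide +kernel)

theorem spread_E6 : Spread gramE6 ![1, 2, 3, 2, 1, 2] where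
  root := by decide +kernel
  nonneg := by decide +kernel
  dom := by decide +kernel
  spread Q h1 h2 i _ := by
    have q5 := h1 5 (by decide +kernel)
    have q2 := h2 5 2 q5 (by decide +kernel)
    have q1 := h2 2 1 q2 (by decide +kernel)
    have q3 := h2 2 3 q2 (by decide +kernel)
    have q0 := h2 1 0 q1 (by decide +kernel)
    have q4 := h2 3 4 q3 (by decide +kernel)
    fin_cases i <;> assumption

theorem cartan_E7 : Cartan gramE7 :=
  .of_pairs (by decide +kernel) (by decide +kernel) (by decide +kernel) ![34, 66, 96, 75, 52, 27, 49]
    (by decide +kernel) (by decide +kernel)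

theorem spread_E7 : Spread gramE7 ![2, 3, 4, 3, 2, 1, 2] where
  root := by decide +kernel
  nonneg := by decide +kernel
  dom := by decide +kernel
  spread Q h1 h2 i _ := by
    have q0 := h1 0 (by decide +kernel)
    have q1 := h2 0 1 q0 (by decide +kernel)
    have q2 := h2 1 2 q1 (by decide +kernel)
    have q3 := h2 2 3 q2 (by decide +kernel)
    have q6 := h2 2 6 q2 (by decide +kernel)
    have q4 := h2 3 4 q3 (by decide +kernel)
    have q5 := h2 4 5 q4 (by decide +kernel)
    fin_cases i <;> assumption

theorem cartan_E8 : Cartan gramE8 :=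
  .of_pairs (by decide +kernel) (by decide +kernel) (by decide +kernel) ![92, 182, 270, 220, 168, 114, 58, 136]
    (by decide +kernel) (by decide +kernel)

theorem spread_E8 : Spread gramE8 ![2, 4, 6, 5, 4, 3, 2, 3] where
  root := by decide +kernel
  nonneg := by decide +kernel
  dom := by decide +kernel
  spread Q h1 h2 i _ := by
    have q6 := h1 6 (by decide +kernel)
    have q5 := h2 6 5 q6 (by decide +kernel)
    have q4 := h2 5 4 q5 (by decide +kernel)
    have q3 := h2 4 3 q4 (by decide +kernel)
    have q2 := h2 3 2 q3 (by decide +kernel)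
    have q1 := h2 2 1 q2 (by decide +kernel)
    have q7 := h2 2 7 q2 (by decide +kernel)
    have q0 := h2 1 0 q1 (by decide +kernel)
    fin_cases i <;> assumption

end Components

end Refl

open Matrix
namespace Refl

section Isometries

/-- An isometry from `U ⊕ (E₇ ⊕ D₄)(-1)` onto `U ⊕ (E₈ ⊕ 3A₁)(-1)`. -/
def isoE7D4 : Matrix (Fin 13) (Fin 13) ℤ :=
  !![2, 2, 0, 0, 0, 0, 0, 2, 0, -2, 1, 0, 0;
    2, 2, 0, 0, 0, 0, 0, 2, 0, -1, 0, 1, 1;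
    2, 2, 1, 0, 0, 0, 0, 2, 0, 0, 0, 0, 0;
    4, 4, 0, 1, 0, 0, 0, 4, 0, 0, 0, 0, 0;
    6, 6, 0, 0, 1, 0, 0, 6, 0, 0, 0, 0, 0;
    5, 5, 0, 0, 0, 1, 0, 5, 0, 0, 0, 0, 0;
    4, 4, 0, 0, 0, 0, 1, 4, 0, 0, 0, 0, 0;
    3, 3, 0, 0, 0, 0, 0, 4, 0, 0, 0, 0, 0;
    2, 1, 0, 0, 0, 0, 0, 2, 0, 0, 0, 0, 0;
    3, 3, 0, 0, 0, 0, 0, 3, 1, 0, 0, 0, 0;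
    1, 1, 0, 0, 0, 0, 0, 1, 0, -1, 0, 1, 0;
    1, 1, 0, 0, 0, 0, 0, 1, 0, -1, 0, 0, 1;
    1, 1, 0, 0, 0, 0, 0, 1, 0, -1, 1, 0, 0]

/-- The inverse of `isoE7D4`. -/
def isoE7D4Inv : Matrix (Fin 13) (Fin 13) ℤ :=
  !![2, 2, 0, 0, 0, 0, 0, -1, 1, 0, -2, -2, -2;
    2, 2, 0, 0, 0, 0, 0, 0, -1, 0, -2, -2, -2;
    -2, -2, 1, 0, 0, 0, 0, 0, 0, 0, 2, 2, 2;
    -4, -4, 0, 1, 0, 0, 0, 0, 0, 0, 4, 4, 4;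
    -6, -6, 0, 0, 1, 0, 0, 0, 0, 0, 6, 6, 6;
    -5, -5, 0, 0, 0, 1, 0, 0, 0, 0, 5, 5, 5;
    -4, -4, 0, 0, 0, 0, 1, 0, 0, 0, 4, 4, 4;
    -3, -3, 0, 0, 0, 0, 0, 1, 0, 0, 3, 3, 3;
    -3, -3, 0, 0, 0, 0, 0, 0, 0, 1, 3, 3, 3;
    0, 1, 0, 0, 0, 0, 0, 0, 0, 0, -1, -1, 0;
    -1, 0, 0, 0, 0, 0, 0, 0, 0, 0, 0, 0, 2;
    -1, 0, 0, 0, 0, 0, 0, 0, 0, 0, 1, 0, 1;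
    -1, 0, 0, 0, 0, 0, 0, 0, 0, 0, 0, 1, 1]

theorem coneIso_E7D4 : ConeIso (dsum gramE8 (dsum (gramA 1) (dsum (gramA 1) (gramA 1)))) (dsum gramE7 (gramD 4)) isoE7D4 isoE7D4Inv where
  form := by decide +kernel
  right := by decide +kernel
  left := by decide +kernel
  pos := by decide +kernel

/-- An isometry from `U ⊕ (D₄ ⊕ D₆)(-1)` onto `U ⊕ (D₈ ⊕ 2A₁)(-1)`. -/
def isoD4D6 : Matrix (Fin 12) (Fin 12) ℤ :=
  !![2, 2, -2, 0, 0, 0, -2, 0, 2, -1, 0, 0;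
    2, 2, -2, 0, 0, 0, -1, 0, 2, -2, 1, 1;
    1, 1, -1, 0, 0, 0, -1, 0, 1, 0, 0, 0;
    2, 2, -2, 0, 0, 0, -2, 1, 2, -1, 0, 0;
    3, 3, -3, 0, 0, 0, -2, 0, 4, -2, 0, 0;
    4, 3, -4, 0, 0, 0, -2, 0, 4, -2, 0, 0;
    4, 2, -3, 0, 0, 0, -2, 0, 4, -2, 0, 0;
    4, 2, -4, 1, 0, 0, -2, 0, 4, -2, 0, 0;
    2, 1, -2, 0, 1, 0, -1, 0, 2, -1, 0, 0;
    2, 1, -2, 0, 0, 1, -1, 0, 2, -1, 0, 0;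
    1, 1, -1, 0, 0, 0, -1, 0, 1, -1, 1, 0;
    1, 1, -1, 0, 0, 0, -1, 0, 1, -1, 0, 1]

/-- The inverse of `isoD4D6`. -/
def isoD4D6Inv : Matrix (Fin 12) (Fin 12) ℤ :=
  !![2, 2, 0, 0, -1, -1, 1, 0, 0, 0, -2, -2;
    2, 2, 0, 0, 0, -1, 0, 0, 0, 0, -2, -2;
    2, 2, 0, 0, 0, -2, 1, 0, 0, 0, -2, -2;
    2, 2, 0, 0, 0, -2, 0, 1, 0, 0, -2, -2;
    1, 1, 0, 0, 0, -1, 0, 0, 1, 0, -1, -1;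
    1, 1, 0, 0, 0, -1, 0, 0, 0, 1, -1, -1;
    0, 1, 0, 0, 0, 0, 0, 0, 0, 0, -1, -1;
    -1, 0, 0, 1, 0, 0, 0, 0, 0, 0, 0, 0;
    -2, -1, 1, 0, 1, 0, 0, 0, 0, 0, 1, 1;
    -1, 0, 2, 0, 0, 0, 0, 0, 0, 0, 0, 0;
    -1, 0, 1, 0, 0, 0, 0, 0, 0, 0, 1, 0;
    -1, 0, 1, 0, 0, 0, 0, 0, 0, 0, 0, 1]

theorem coneIso_D4D6 : ConeIso (dsum (gramD 8) (dsum (gramA 1) (gramA 1))) (dsum (gramD 4) (gramD 6)) isoD4D6 isoD4D6Inv where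
  form := by decide +kernel
  right := by decide +kernel
  left := by decide +kernel
  pos := by decide +kernel

/-- The reflection of `U ⊕ (D₈ ⊕ 2A₁)(-1)` in a `(-4)`-vector given by a spinor class. -/
def isoSpin : Matrix (Fin 12) (Fin 12) ℤ :=
  !![3, 2, 0, 0, 0, 0, 0, 0, 0, -2, -2, -2;
    2, 3, 0, 0, 0, 0, 0, 0, 0, -2, -2, -2;
    1, 1, 1, 0, 0, 0, 0, 0, 0, -1, -1, -1;
    2, 2, 0, 1, 0, 0, 0, 0, 0, -2, -2, -2;
    3, 3, 0, 0, 1, 0, 0, 0, 0, -3, -3, -3;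
    4, 4, 0, 0, 0, 1, 0, 0, 0, -4, -4, -4;
    5, 5, 0, 0, 0, 0, 1, 0, 0, -5, -5, -5;
    6, 6, 0, 0, 0, 0, 0, 1, 0, -6, -6, -6;
    3, 3, 0, 0, 0, 0, 0, 0, 1, -3, -3, -3;
    4, 4, 0, 0, 0, 0, 0, 0, 0, -3, -4, -4;
    1, 1, 0, 0, 0, 0, 0, 0, 0, -1, 0, -1;
    1, 1, 0, 0, 0, 0, 0, 0, 0, -1, -1, 0]

theorem coneIso_Spin : ConeIso (dsum (gramD 8) (dsum (gramA 1) (gramA 1))) (dsum (gramD 8) (dsum (gramA 1) (gramA 1))) isoSpin isoSpin where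
  form := by decide +kernel
  right := by decide +kernel
  left := by decide +kernel
  pos := by decide +kernel

/-- The reflection of `U ⊕ (D₈ ⊕ 2A₁)(-1)` in a `(-4)`-vector given by the other spinor class. -/
def isoCospin : Matrix (Fin 12) (Fin 12) ℤ :=
  !![3, 2, 0, 0, 0, 0, 0, 0, -2, 0, -2, -2;
    2, 3, 0, 0, 0, 0, 0, 0, -2, 0, -2, -2;
    1, 1, 1, 0, 0, 0, 0, 0, -1, 0, -1, -1;
    2, 2, 0, 1, 0, 0, 0, 0, -2, 0, -2, -2;
    3, 3, 0, 0, 1, 0, 0, 0, -3, 0, -3, -3;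
    4, 4, 0, 0, 0, 1, 0, 0, -4, 0, -4, -4;
    5, 5, 0, 0, 0, 0, 1, 0, -5, 0, -5, -5;
    6, 6, 0, 0, 0, 0, 0, 1, -6, 0, -6, -6;
    4, 4, 0, 0, 0, 0, 0, 0, -3, 0, -4, -4;
    3, 3, 0, 0, 0, 0, 0, 0, -3, 1, -3, -3;
    1, 1, 0, 0, 0, 0, 0, 0, -1, 0, 0, -1;
    1, 1, 0, 0, 0, 0, 0, 0, -1, 0, -1, 0]

theorem coneIso_Cospin : ConeIso (dsum (gramD 8) (dsum (gramA 1) (gramA 1))) (dsum (gramD 8) (dsum (gramA 1) (gramA 1))) isoCospin isoCospin where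
  form := by decide +kernel
  right := by decide +kernel
  left := by decide +kernel
  pos := by decide +kernel

end Isometries

end Refl

open Matrix
namespace Refl

section Conclusions

variable {m n r : ℕ} {C K : Matrix (Fin r) (Fin r) ℤ}

theorem dsum_mul (A A' : Matrix (Fin m) (Fin m) ℤ) (B B' : Matrix (Fin n) (Fin n) ℤ) :
    dsum A B * dsum A' B' = dsum (A * A') (B * B') := by
  simp only [dsum, Matrix.reindex_apply, Matrix.submatrix_mul_equiv, Matrix.fromBlocks_multiply]
  simp

theorem dsum_transpose (A : Matrix (Fin m) (Fin m) ℤ) (B : Matrix (Fin n) (Fin n) ℤ) :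
    (dsum A B)ᵀ = dsum Aᵀ Bᵀ := by
  simp [dsum, Matrix.transpose_submatrix, Matrix.fromBlocks_transpose]

theorem dsum_smul_one (d : ℤ) :
    dsum (d • (1 : Matrix (Fin m) (Fin m) ℤ)) (d • (1 : Matrix (Fin n) (Fin n) ℤ)) = d • 1 := by
  ext i j
  induction i using Fin.addCases with
  | left i => induction j using Fin.addCases with
    | left j => simp only [dsum_ll, Matrix.smul_apply, Matrix.one_apply, Fin.castAdd_inj]
    | right j =>
      have : Fin.castAdd n i ≠ Fin.natAdd m j := by simp [Fin.ext_iff]; omega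
      simp [this]
  | right i => induction j using Fin.addCases with
    | left j =>
      have : Fin.natAdd m i ≠ Fin.castAdd n j := by simp [Fin.ext_iff]; omega
      simp [this]
    | right j => simp only [dsum_rr, Matrix.smul_apply, Matrix.one_apply, Fin.natAdd_inj]

/-- The lattice of `K` embeds into that of `C` with finite index. -/
def Embeds (K C : Matrix (Fin r) (Fin r) ℤ) : Prop :=
  ∃ E E' : Matrix (Fin r) (Fin r) ℤ, ∃ d : ℤ, 0 < d ∧ Eᵀ * C * E = K ∧ E * E' = d • 1 ∧
    E' * E = d • 1

theorem Embeds.refl (C : Matrix (Fin r) (Fin r) ℤ) : Embeds C C :=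
  ⟨1, 1, 1, one_pos, by simp, by simp, by simp⟩

theorem Embeds.dsum {A A' : Matrix (Fin m) (Fin m) ℤ} {B B' : Matrix (Fin n) (Fin n) ℤ}
    (h : Embeds A A') (h' : Embeds B B') : Embeds (dsum A B) (dsum A' B') := by
  obtain ⟨E, E', d, hd, h1, h2, h3⟩ := h
  obtain ⟨F, F', e, he, h1', h2', h3'⟩ := h'
  refine ⟨Refl.dsum E F, Refl.dsum (e • E') (d • F'), d * e, mul_pos hd he, ?_, ?_, ?_⟩
  · rw [dsum_transpose, dsum_mul, dsum_mul, h1, h1']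
  · rw [dsum_mul, Matrix.mul_smul, Matrix.mul_smul, h2, h2', smul_smul, smul_smul, mul_comm e,
      dsum_smul_one]
  · rw [dsum_mul, Matrix.smul_mul, Matrix.smul_mul, h3, h3', smul_smul, smul_smul, mul_comm e,
      dsum_smul_one]

theorem not_reflective_of_embeds (hC : Cartan C) (i0 : Fin r) (hZ : ZeroFree C)
    (h : Embeds K C) {q : ℕ} (hq : 0 < q) :
    ¬Is2Reflective (dsum ((q : ℤ) • U) (dsum U (-K))) := by
  obtain ⟨E, E', d, hd, h1, h2, h3⟩ := h
  exact not_reflective_of_embedding hC.pd hZ (nonvanishingWeight hC.pd hC.diag i0)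
    (weightZeroConst hC.pd hC.diag i0) hd h1 h2 h3 (by exact_mod_cast hq)

/-- Reduction modulo two of the condition `Par`. -/
abbrev ParMod (C : Matrix (Fin r) (Fin r) ℤ) (ε : Fin r → Fin 2) : Prop :=
  ∀ i, (∑ j, C i j * ((ε j : ℕ) : ℤ)) % 2 = 0

/-- The norm modulo eight. -/
abbrev normMod (C : Matrix (Fin r) (Fin r) ℤ) (ε : Fin r → Fin 2) : ℤ :=
  (∑ i, ∑ j, C i j * ((ε i : ℕ) : ℤ) * ((ε j : ℕ) : ℤ)) % 8

theorem zeroFree_of_no_even (hC : Cartan C) (i0 : Fin r) (hO : OddOrd C)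
    (h : ∀ μ, Par C μ → bil C μ μ % 8 ≠ 2) : ZeroFree C :=
  zeroFree_of_classes hC.pd hC.diag i0 hO fun _ _ _ _ _ _ _ μ _ h2 h3 =>
    absurd (show bil C μ μ % 8 = 2 by omega) (h μ h2)

theorem Par.norm_mod (hC : Cartan C) {μ : Fin r → ℤ} (h : Par C μ) {P : ℤ → Prop}
    (hP : ∀ ε, ParMod C ε → P (normMod C ε)) : P (bil C μ μ % 8) := by
  obtain ⟨ε, ν, -, h1, h2⟩ := h.reduce hC
  rw [h2]; exact hP ε h1

theorem par_A1 (μ : Fin 1 → ℤ) : bil (gramA 1) μ μ = 2 * (μ 0 * μ 0) := by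
  simp [bil, gramA]; ring

theorem norm_E8 {μ : Fin 8 → ℤ} (h : Par gramE8 μ) : bil gramE8 μ μ % 8 = 0 :=
  h.norm_mod cartan_E8 (P := fun x => x = 0) (by decide +kernel)

theorem norm_E6 {μ : Fin 6 → ℤ} (h : Par gramE6 μ) : bil gramE6 μ μ % 8 = 0 :=
  h.norm_mod cartan_E6 (P := fun x => x = 0) (by decide +kernel)

theorem norm_A2 {μ : Fin 2 → ℤ} (h : Par (gramA 2) μ) : bil (gramA 2) μ μ % 8 = 0 :=
  h.norm_mod cartan_A2 (P := fun x => x = 0) (by decide +kernel)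

theorem norm_A4 {μ : Fin 4 → ℤ} (h : Par (gramA 4) μ) : bil (gramA 4) μ μ % 8 = 0 :=
  h.norm_mod cartan_A4 (P := fun x => x = 0) (by decide +kernel)

theorem norm_A3 {μ : Fin 3 → ℤ} (h : Par (gramA 3) μ) : bil (gramA 3) μ μ % 4 = 0 := by
  have := h.norm_mod cartan_A3 (P := fun x => x % 4 = 0) (by decide +kernel)
  omega

theorem norm_D4 {μ : Fin 4 → ℤ} (h : Par (gramD 4) μ) : bil (gramD 4) μ μ % 4 = 0 := by
  have := h.norm_mod cartan_D4 (P := fun x => x % 4 = 0) (by decide +kernel)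
  omega

theorem norm_D5 {μ : Fin 5 → ℤ} (h : Par (gramD 5) μ) : bil (gramD 5) μ μ % 4 = 0 := by
  have := h.norm_mod cartan_D5 (P := fun x => x % 4 = 0) (by decide +kernel)
  omega

theorem norm_D8 {μ : Fin 8 → ℤ} (h : Par (gramD 8) μ) : bil (gramD 8) μ μ % 4 = 0 := by
  have := h.norm_mod cartan_D8 (P := fun x => x % 4 = 0) (by decide +kernel)
  omega

theorem norm_D6 {μ : Fin 6 → ℤ} (h : Par (gramD 6) μ) : bil (gramD 6) μ μ % 8 ≠ 2 :=
  h.norm_mod cartan_D6 (P := fun x => x ≠ 2) (by decide +kernel)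

theorem norm_E7 {μ : Fin 7 → ℤ} (h : Par gramE7 μ) : bil gramE7 μ μ % 8 ≠ 2 :=
  h.norm_mod cartan_E7 (P := fun x => x ≠ 2) (by decide +kernel)

theorem zero_lift : (fun i => (((0 : Fin r → Fin 2) i : ℕ) : ℤ)) = 0 := by
  ext i; simp

theorem Par.eq_two_smul (hC : Cartan C) {μ : Fin r → ℤ} (h : Par C μ)
    (h8 : bil C μ μ % 8 = 0) (hdec : ∀ ε, ParMod C ε → normMod C ε = 0 → ε = 0) :
    ∃ ν : Fin r → ℤ, μ = (2 : ℤ) • ν := by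
  obtain ⟨ε, ν, h0, h1, h2⟩ := h.reduce hC
  have := hdec ε h1 (h2.symm.trans h8)
  subst this
  rw [zero_lift, zero_add] at h0
  exact ⟨ν, h0⟩

theorem half_E8 {μ : Fin 8 → ℤ} (h : Par gramE8 μ) : ∃ ν : Fin 8 → ℤ, μ = (2 : ℤ) • ν :=
  h.eq_two_smul cartan_E8 (norm_E8 h) (by decide +kernel)

theorem half_D4 {μ : Fin 4 → ℤ} (h : Par (gramD 4) μ) (h8 : bil (gramD 4) μ μ % 8 = 0) :
    ∃ ν : Fin 4 → ℤ, μ = (2 : ℤ) • ν :=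
  h.eq_two_smul cartan_D4 h8 (by decide +kernel)

/-- Twice a spinor weight of `D₈`, in the basis of simple roots. -/
def spin : Fin 8 → ℤ := ![1, 2, 3, 4, 5, 6, 3, 4]

/-- Twice the other spinor weight. -/
def cospin : Fin 8 → ℤ := ![1, 2, 3, 4, 5, 6, 4, 3]

theorem half_D8 {μ : Fin 8 → ℤ} (h : Par (gramD 8) μ) (h8 : bil (gramD 8) μ μ % 8 = 0) :
    ∃ ν : Fin 8 → ℤ, μ = (2 : ℤ) • ν ∨ μ = spin + (2 : ℤ) • ν ∨ μ = cospin + (2 : ℤ) • ν := by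
  obtain ⟨ε, ν, h0, h1, h2⟩ := h.reduce cartan_D8
  have hdec : ∀ ε, ParMod (gramD 8) ε → normMod (gramD 8) ε = 0 →
      ε = 0 ∨ ε = ![1, 0, 1, 0, 1, 0, 1, 0] ∨ ε = ![1, 0, 1, 0, 1, 0, 0, 1] := by
    decide +kernel
  rcases hdec ε h1 (h2.symm.trans h8) with rfl | rfl | rfl
  · rw [zero_lift, zero_add] at h0
    exact ⟨ν, Or.inl h0⟩
  · refine ⟨ν - ![0, 1, 1, 2, 2, 3, 1, 2], Or.inr (Or.inl ?_)⟩
    rw [h0, show (fun i => (((![1, 0, 1, 0, 1, 0, 1, 0] : Fin 8 → Fin 2) i : ℕ) : ℤ)) =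
      spin - (2 : ℤ) • ![0, 1, 1, 2, 2, 3, 1, 2] by decide +kernel]
    module
  · refine ⟨ν - ![0, 1, 1, 2, 2, 3, 2, 1], Or.inr (Or.inr ?_)⟩
    rw [h0, show (fun i => (((![1, 0, 1, 0, 1, 0, 0, 1] : Fin 8 → Fin 2) i : ℕ) : ℤ)) =
      cospin - (2 : ℤ) • ![0, 1, 1, 2, 2, 3, 2, 1] by decide +kernel]
    module

theorem even_A1 {x : Fin 1 → ℤ} (h : x 0 % 2 = 0) : x = (2 : ℤ) • fun i => x i / 2 := by
  ext i
  rw [Subsingleton.elim i 0, Pi.smul_apply, smul_eq_mul]; omega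

theorem odd_A1 {x : Fin 1 → ℤ} (h : x 0 % 2 = 1) :
    x = Pi.single 0 1 + (2 : ℤ) • fun i => x i / 2 := by
  ext i
  rw [Subsingleton.elim i 0, Pi.add_apply, Pi.smul_apply, smul_eq_mul, Pi.single_eq_same]; omega

theorem sq_mod (x : ℤ) : x % 2 = 0 ∧ 2 * (x * x) % 8 = 0 ∨ x % 2 = 1 ∧ 2 * (x * x) % 8 = 2 := by
  rcases Int.even_or_odd' x with ⟨y, rfl | rfl⟩
  · refine Or.inl ⟨by omega, ?_⟩
    rw [show 2 * (2 * y * (2 * y)) = 8 * (y * y) by ring]; omega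
  · refine Or.inr ⟨by omega, ?_⟩
    rw [show 2 * ((2 * y + 1) * (2 * y + 1)) = 8 * (y * y + y) + 2 by ring]; omega

end Conclusions

end Refl

open Matrix
namespace Refl

section Cases

theorem embeds_D8_E8 :
    Embeds (gramD 8) gramE8 :=
  ⟨!![-2, 0, 0, 0, 0, 0, 0, 0;
    -4, 0, 0, 0, 0, 0, 1, 0;
    -6, 0, 0, 0, 0, 1, 0, 0;
    -5, 0, 0, 0, 1, 0, 0, 0;
    -4, 0, 0, 1, 0, 0, 0, 0;
    -3, 0, 1, 0, 0, 0, 0, 0;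
    -2, 1, 0, 0, 0, 0, 0, 0;
    -3, 0, 0, 0, 0, 0, 0, 1],
   !![-1, 0, 0, 0, 0, 0, 0, 0;
    -2, 0, 0, 0, 0, 0, 2, 0;
    -3, 0, 0, 0, 0, 2, 0, 0;
    -4, 0, 0, 0, 2, 0, 0, 0;
    -5, 0, 0, 2, 0, 0, 0, 0;
    -6, 0, 2, 0, 0, 0, 0, 0;
    -4, 2, 0, 0, 0, 0, 0, 0;
    -3, 0, 0, 0, 0, 0, 0, 2],
   2, by decide, by decide +kernel, by decide +kernel, by decide +kernel⟩

theorem embeds_4A1_D4 :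
    Embeds (dsum (gramA 1) (dsum (gramA 1) (dsum (gramA 1) (gramA 1)))) (gramD 4) :=
  ⟨!![1, 0, 0, 1;
    0, 0, 0, 2;
    0, 1, 0, 1;
    0, 0, 1, 1],
   !![2, -1, 0, 0;
    0, -1, 2, 0;
    0, -1, 0, 2;
    0, 1, 0, 0],
   2, by decide, by decide +kernel, by decide +kernel, by decide +kernel⟩

theorem embeds_2D4_D8 :
    Embeds (r := 10) (dsum (gramD 4) (dsum (gramD 4) (dsum (gramA 1) (gramA 1)))) (dsum (gramD 8) (dsum (gramA 1) (gramA 1))) :=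
  ⟨!![1, 0, 0, 0, 0, 0, 0, 0, 0, 0;
    0, 1, 0, 0, 0, 0, 0, 0, 0, 0;
    0, 0, 1, 1, 0, 0, 0, 0, 0, 0;
    0, 0, 0, 2, 0, 0, 0, 0, 0, 0;
    0, 0, 0, 2, 1, 0, 0, 0, 0, 0;
    0, 0, 0, 2, 0, 1, 0, 0, 0, 0;
    0, 0, 0, 1, 0, 0, 1, 0, 0, 0;
    0, 0, 0, 1, 0, 0, 0, 1, 0, 0;
    0, 0, 0, 0, 0, 0, 0, 0, 1, 0;
    0, 0, 0, 0, 0, 0, 0, 0, 0, 1],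
   !![2, 0, 0, 0, 0, 0, 0, 0, 0, 0;
    0, 2, 0, 0, 0, 0, 0, 0, 0, 0;
    0, 0, 2, -1, 0, 0, 0, 0, 0, 0;
    0, 0, 0, 1, 0, 0, 0, 0, 0, 0;
    0, 0, 0, -2, 2, 0, 0, 0, 0, 0;
    0, 0, 0, -2, 0, 2, 0, 0, 0, 0;
    0, 0, 0, -1, 0, 0, 2, 0, 0, 0;
    0, 0, 0, -1, 0, 0, 0, 2, 0, 0;
    0, 0, 0, 0, 0, 0, 0, 0, 2, 0;
    0, 0, 0, 0, 0, 0, 0, 0, 0, 2],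
   2, by decide, by decide +kernel, by decide +kernel, by decide +kernel⟩

variable {r : ℕ} {C : Matrix (Fin r) (Fin r) ℤ} {k : ℤ} {f : (Fin (2 + r) → ℂ) → ℂ}

theorem Cartan.oddOrd (hC : Cartan C) (i0 : Fin r) {θ θ' : Fin r → ℤ} (hθ : Spread C θ)
    (hθ' : Spread C θ') (hne : ∑ i, θ i ≠ ∑ i, θ' i) : OddOrd C :=
  oddOrd_of_spread hC.pd hC.diag hC.off i0 hθ hθ' hne

theorem Cartan.nv (hC : Cartan C) (i0 : Fin r) (hO : OddOrd C) (hf : TForm C k f)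
    (hz : ReflZeros C f) {θ₁ θ : Fin r → ℤ} (hθ₁ : Spread C θ₁) (hθ : Dom C θ) {i : Fin r}
    (hi : θ i ≠ 0) {v : Fin (2 + (2 + r)) → ℤ} (hv2 : bil (MM C) v v = -2) {b : ℤ}
    {μ ν : Fin r → ℤ} (h : Orb C v (hv 2 b (hv 0 0 μ))) (hμ : μ = Pi.single i 1 + (2 : ℤ) • ν) :
    NV C f v := by
  subst hμ
  exact nv_of_even_simple hC.pd hC.diag hC.off i0 hf hz (hO _ _ hf hz) hθ₁ hv2 hθ hi h

theorem Orb.reduce_even (hC : Cartan C) {v : Fin (2 + (2 + r)) → ℤ} {c : ℤ}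
    {μ₀ ν : Fin r → ℤ} (h : Orb C v (hv 2 (2 * c) (hv 0 0 (μ₀ + (2 : ℤ) • ν))))
    (hμ : bil C (μ₀ + (2 : ℤ) • ν) (μ₀ + (2 : ℤ) • ν) = 8 * c + 2) (hμ₀ : bil C μ₀ μ₀ = 10) :
    Orb C v (hv 0 2 (hv 2 2 μ₀)) := by
  have hs : bil C ν μ₀ = bil C μ₀ ν := bil_comm hC.pd.symm _ _
  have h1 := h.tm (hv 0 0 ν)
  have e1 := hC.pd.even_S (hv 0 0 ν)
  rw [tm_hv, e1] at h1
  simp only [bil_S, bil_add_left, bil_add_right, bil_smul_left, bil_smul_right] at h1 hμ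
  have e2 : hv (0 : ℤ) 0 (μ₀ + (2 : ℤ) • ν) - (2 : ℤ) • hv 0 0 ν = hv 0 0 μ₀ := by
    rw [hv_smul, hv_sub]; simp
  rw [e2, show 2 * c + (0 * 0 + 0 * 0 - (bil C μ₀ ν + 2 * bil C ν ν)) -
    (0 * 0 + 0 * 0 - bil C ν ν) = 2 by linarith] at h1
  have h2 := h1.tm (hv (-1) (-1) 0)
  have e3 := hC.pd.even_S (hv (-1) (-1) 0)
  have e4 : hv (0 : ℤ) 0 μ₀ - (2 : ℤ) • hv (-1) (-1) 0 = hv 2 2 μ₀ := by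
    rw [hv_smul, hv_sub]; simp
  rw [tm_hv, e3, e4, bil_S, bil_S] at h2
  simpa using h2.swap

theorem Cartan.nv_of_reflection (hC : Cartan C) (i0 : Fin r) (hO : OddOrd C) (hf : TForm C k f)
    (hz : ReflZeros C f) {Q : Matrix (Fin (2 + r)) (Fin (2 + r)) ℤ} (hQ : ConeIso C C Q Q)
    {θ₁ θ : Fin r → ℤ} (hθ₁ : Spread C θ₁) (hθ : Dom C θ) {i : Fin r} (hi : θ i ≠ 0)
    {v : Fin (2 + (2 + r)) → ℤ} {c : ℤ} {μ₀ ν : Fin r → ℤ}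
    (h : Orb C v (hv 2 (2 * c) (hv 0 0 (μ₀ + (2 : ℤ) • ν))))
    (hμ : bil C (μ₀ + (2 : ℤ) • ν) (μ₀ + (2 : ℤ) • ν) = 8 * c + 2) (hμ₀ : bil C μ₀ μ₀ = 10)
    (hact : actR Q (hv 0 0 (-Pi.single i 1)) = hv (2 : ℤ) 2 μ₀) : NV C f v := by
  refine NV.orb_symm hC.pd hC.diag i0 hf (h.reduce_even hC hμ hμ₀) ?_
  rw [← hact]
  have hf' := hQ.tform hC.pd hC.pd hf
  have hz' := hQ.reflZeros hC.pd hC.pd hz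
  refine hQ.nv hC.pd hC.pd (HasOrd.nv hC.pd hf' hz' ?_ (hasOrd_simple hC.pd hC.diag hC.off i0 hf'
    hz' (hO _ _ hf' hz') hθ₁ hθ hi) 2)
  rw [bil_S, bil_neg_left, bil_neg_right, bil_single, hC.diag]; simp


theorem cartan_E8D4A1 : Cartan (dsum gramE8 (dsum (gramD 4) (gramA 1))) :=
  cartan_E8.dsum (cartan_D4.dsum cartan_A1)

theorem zeroFree_E8D4A1 : ZeroFree (dsum gramE8 (dsum (gramD 4) (gramA 1))) := by
  have hC := cartan_E8D4A1
  have hO : OddOrd (dsum gramE8 (dsum (gramD 4) (gramA 1))) :=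
    hC.oddOrd 0 spread_E8.left spread_D4.left.right (by decide +kernel)
  refine zeroFree_of_classes hC.pd hC.diag 0 hO fun k f hf hz v hv2 c μ ho hp hμ => ?_
  obtain ⟨α, μ', rfl⟩ := exists_append μ
  obtain ⟨β, x, rfl⟩ := exists_append μ'
  obtain ⟨hα, hp'⟩ := Par.split hp
  obtain ⟨hβ, -⟩ := hp'.split
  rw [bil_dsum, bil_dsum, par_A1] at hμ
  have h1 := norm_E8 hα
  have h2 := norm_D4 hβ
  have h3 := sq_mod (x 0)
  obtain ⟨α', rfl⟩ := half_E8 hα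
  obtain ⟨β', rfl⟩ := half_D4 hβ (by omega)
  have hx := odd_A1 (x := x) (by omega)
  refine hC.nv 0 hO hf hz spread_E8.left dom_A1.right.right (i := Fin.natAdd 8 (Fin.natAdd 4 0))
    (by decide) hv2 ho (ν := Fin.append α' (Fin.append β' fun i => x i / 2)) ?_
  rw [single_natAdd, single_natAdd, append_add_two_smul, append_add_two_smul, ← hx, zero_add,
    zero_add]

theorem append_two_smul {m n : ℕ} (y : Fin m → ℤ) (y' : Fin n → ℤ) :
    (2 : ℤ) • Fin.append y y' = Fin.append ((2 : ℤ) • y) ((2 : ℤ) • y') := by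
  ext j
  induction j using Fin.addCases <;> simp

theorem cartan_E83A1 : Cartan (dsum gramE8 (dsum (gramA 1) (dsum (gramA 1) (gramA 1)))) :=
  cartan_E8.dsum (cartan_A1.dsum (cartan_A1.dsum cartan_A1))

theorem zeroFree_E83A1 :
    ZeroFree (dsum gramE8 (dsum (gramA 1) (dsum (gramA 1) (gramA 1)))) := by
  have hC := cartan_E83A1
  have hC' := cartan_E7.dsum cartan_D4
  have hO : OddOrd (dsum gramE8 (dsum (gramA 1) (dsum (gramA 1) (gramA 1)))) :=
    coneIso_E7D4.oddOrd hC.pd hC'.pd hC'.diag 0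
      (hC'.oddOrd 0 spread_E7.left spread_D4.right (by decide +kernel))
  refine zeroFree_of_classes hC.pd hC.diag 0 hO fun k f hf hz v hv2 c μ ho hp hμ => ?_
  obtain ⟨α, μ', rfl⟩ := exists_append μ
  obtain ⟨x, μ'', rfl⟩ := exists_append μ'
  obtain ⟨y, z, rfl⟩ := exists_append μ''
  obtain ⟨hα, -⟩ := Par.split hp
  rw [bil_dsum, bil_dsum, bil_dsum, par_A1, par_A1, par_A1] at hμ
  have h0 := norm_E8 hα
  obtain ⟨α', rfl⟩ := half_E8 hα
  have key : x 0 % 2 = 1 ∧ y 0 % 2 = 0 ∧ z 0 % 2 = 0 ∨ x 0 % 2 = 0 ∧ y 0 % 2 = 1 ∧ z 0 % 2 = 0 ∨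
      x 0 % 2 = 0 ∧ y 0 % 2 = 0 ∧ z 0 % 2 = 1 := by
    have h1 := sq_mod (x 0)
    have h2 := sq_mod (y 0)
    have h3 := sq_mod (z 0)
    omega
  rcases key with ⟨hx, hy, hz'⟩ | ⟨hx, hy, hz'⟩ | ⟨hx, hy, hz'⟩
  · refine hC.nv 0 hO hf hz spread_E8.left dom_A1.left.right (i := Fin.natAdd 8 (Fin.castAdd 2 0))
      (by decide) hv2 ho (ν := Fin.append α' (Fin.append (fun i => x i / 2)
        (Fin.append (fun i => y i / 2) fun i => z i / 2))) ?_
    rw [single_natAdd, single_castAdd, append_add_two_smul, append_add_two_smul, ← odd_A1 hx,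
      zero_add, zero_add, append_two_smul, ← even_A1 hy, ← even_A1 hz']
  · refine hC.nv 0 hO hf hz spread_E8.left dom_A1.left.right.right
      (i := Fin.natAdd 8 (Fin.natAdd 1 (Fin.castAdd 1 0)))
      (by decide) hv2 ho (ν := Fin.append α' (Fin.append (fun i => x i / 2)
        (Fin.append (fun i => y i / 2) fun i => z i / 2))) ?_
    rw [single_natAdd, single_natAdd, single_castAdd, append_add_two_smul, append_add_two_smul,
      append_add_two_smul, ← odd_A1 hy, zero_add, zero_add, zero_add, ← even_A1 hx, ← even_A1 hz']
  · refine hC.nv 0 hO hf hz spread_E8.left dom_A1.right.right.right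
      (i := Fin.natAdd 8 (Fin.natAdd 1 (Fin.natAdd 1 0)))
      (by decide) hv2 ho (ν := Fin.append α' (Fin.append (fun i => x i / 2)
        (Fin.append (fun i => y i / 2) fun i => z i / 2))) ?_
    rw [single_natAdd, single_natAdd, single_natAdd, append_add_two_smul, append_add_two_smul,
      append_add_two_smul, ← odd_A1 hz', zero_add, zero_add, zero_add, ← even_A1 hx, ← even_A1 hy]

theorem cartan_D82A1 : Cartan (dsum (gramD 8) (dsum (gramA 1) (gramA 1))) :=
  cartan_D8.dsum (cartan_A1.dsum cartan_A1)

theorem act_isoSpin_left :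
    actR isoSpin (hv (0 : ℤ) 0 (-Pi.single (Fin.natAdd 8 (Fin.natAdd 1 (0 : Fin 1))) 1)) =
    hv (2 : ℤ) 2 (Fin.append spin (Fin.append (Pi.single (0 : Fin 1) 1) (0 : Fin 1 → ℤ))) := by
  decide +kernel

theorem act_isoSpin_right :
    actR isoSpin (hv (0 : ℤ) 0 (-Pi.single (Fin.natAdd 8 (Fin.castAdd 1 (0 : Fin 1))) 1)) =
    hv (2 : ℤ) 2 (Fin.append spin (Fin.append (0 : Fin 1 → ℤ) (Pi.single (0 : Fin 1) 1))) := by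
  decide +kernel

theorem act_isoCospin_left :
    actR isoCospin (hv (0 : ℤ) 0 (-Pi.single (Fin.natAdd 8 (Fin.natAdd 1 (0 : Fin 1))) 1)) =
    hv (2 : ℤ) 2 (Fin.append cospin (Fin.append (Pi.single (0 : Fin 1) 1) (0 : Fin 1 → ℤ))) := by
  decide +kernel

theorem act_isoCospin_right :
    actR isoCospin (hv (0 : ℤ) 0 (-Pi.single (Fin.natAdd 8 (Fin.castAdd 1 (0 : Fin 1))) 1)) =
    hv (2 : ℤ) 2 (Fin.append cospin (Fin.append (0 : Fin 1 → ℤ) (Pi.single (0 : Fin 1) 1))) := by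
  decide +kernel

theorem append_decomp_left {α α₀ ν : Fin 8 → ℤ} {x y : Fin 1 → ℤ} (hα : α = α₀ + (2 : ℤ) • ν)
    (hx : x 0 % 2 = 1) (hy : y 0 % 2 = 0) :
    Fin.append α (Fin.append x y) = Fin.append α₀ (Fin.append (Pi.single 0 1) 0) +
      (2 : ℤ) • Fin.append ν (Fin.append (fun i => x i / 2) fun i => y i / 2) := by
  rw [append_add_two_smul, append_add_two_smul, ← odd_A1 hx, zero_add, ← even_A1 hy, hα]

theorem append_decomp_right {α α₀ ν : Fin 8 → ℤ} {x y : Fin 1 → ℤ} (hα : α = α₀ + (2 : ℤ) • ν)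
    (hx : x 0 % 2 = 0) (hy : y 0 % 2 = 1) :
    Fin.append α (Fin.append x y) = Fin.append α₀ (Fin.append 0 (Pi.single 0 1)) +
      (2 : ℤ) • Fin.append ν (Fin.append (fun i => x i / 2) fun i => y i / 2) := by
  rw [append_add_two_smul, append_add_two_smul, ← odd_A1 hy, zero_add, ← even_A1 hx, hα]

theorem zeroFree_D82A1 : ZeroFree (dsum (gramD 8) (dsum (gramA 1) (gramA 1))) := by
  have hC := cartan_D82A1
  have hC' := cartan_D4.dsum cartan_D6
  have hO : OddOrd (dsum (gramD 8) (dsum (gramA 1) (gramA 1))) :=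
    coneIso_D4D6.oddOrd hC.pd hC'.pd hC'.diag 0
      (hC'.oddOrd 0 spread_D4.left spread_D6.right (by decide +kernel))
  refine zeroFree_of_classes hC.pd hC.diag 0 hO fun k f hf hz v hv2 c μ ho hp hμ => ?_
  obtain ⟨α, μ', rfl⟩ := exists_append μ
  obtain ⟨x, y, rfl⟩ := exists_append μ'
  obtain ⟨hα, -⟩ := Par.split hp
  have hμ' := hμ
  rw [bil_dsum, bil_dsum, par_A1, par_A1] at hμ'
  have h0 := norm_D8 hα
  have h1 := sq_mod (x 0)
  have h2 := sq_mod (y 0)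
  obtain ⟨ν, hν⟩ := half_D8 hα (by omega)
  have key : x 0 % 2 = 1 ∧ y 0 % 2 = 0 ∨ x 0 % 2 = 0 ∧ y 0 % 2 = 1 := by omega
  rcases key with ⟨hx, hy⟩ | ⟨hx, hy⟩ <;> rcases hν with h | h | h
  · refine hC.nv 0 hO hf hz spread_D8.left dom_A1.left.right (i := Fin.natAdd 8 (Fin.castAdd 1 0))
      (by decide) hv2 ho ?_ (ν := Fin.append ν (Fin.append (fun i => x i / 2) fun i => y i / 2))
    rw [single_natAdd, single_castAdd]
    exact append_decomp_left (by rw [h, zero_add]) hx hy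
  · rw [append_decomp_left h hx hy] at ho hμ
    exact hC.nv_of_reflection 0 hO hf hz coneIso_Spin spread_D8.left dom_A1.right.right
      (by decide) ho hμ (by decide +kernel) act_isoSpin_left
  · rw [append_decomp_left h hx hy] at ho hμ
    exact hC.nv_of_reflection 0 hO hf hz coneIso_Cospin spread_D8.left dom_A1.right.right
      (by decide) ho hμ (by decide +kernel) act_isoCospin_left
  · refine hC.nv 0 hO hf hz spread_D8.left dom_A1.right.right (i := Fin.natAdd 8 (Fin.natAdd 1 0))
      (by decide) hv2 ho ?_ (ν := Fin.append ν (Fin.append (fun i => x i / 2) fun i => y i / 2))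
    rw [single_natAdd, single_natAdd]
    exact append_decomp_right (by rw [h, zero_add]) hx hy
  · rw [append_decomp_right h hx hy] at ho hμ
    exact hC.nv_of_reflection 0 hO hf hz coneIso_Spin spread_D8.left dom_A1.left.right
      (by decide) ho hμ (by decide +kernel) act_isoSpin_right
  · rw [append_decomp_right h hx hy] at ho hμ
    exact hC.nv_of_reflection 0 hO hf hz coneIso_Cospin spread_D8.left dom_A1.left.right
      (by decide) ho hμ (by decide +kernel) act_isoCospin_right

theorem zeroFree_dsum {m n : ℕ} {A : Matrix (Fin m) (Fin m) ℤ} {B : Matrix (Fin n) (Fin n) ℤ}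
    (hA : Cartan A) (hB : Cartan B) (i0 : Fin (m + n)) {θ : Fin m → ℤ} {θ' : Fin n → ℤ}
    (hθ : Spread A θ) (hθ' : Spread B θ') (hne : ∑ i, θ i ≠ ∑ i, θ' i)
    (hnorm : ∀ μ ν, Par A μ → Par B ν → (bil A μ μ + bil B ν ν) % 8 ≠ 2) :
    ZeroFree (dsum A B) := by
  refine zeroFree_of_no_even (hA.dsum hB) i0 ((hA.dsum hB).oddOrd i0 hθ.left hθ'.right ?_)
    fun μ hp => ?_
  · simpa [Fin.sum_univ_add] using hne
  · obtain ⟨α, β, rfl⟩ := exists_append μ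
    rw [bil_dsum]
    exact hnorm α β hp.split.1 hp.split.2

theorem zeroFree_E8E7 : ZeroFree (dsum gramE8 gramE7) :=
  zeroFree_dsum cartan_E8 cartan_E7 0 spread_E8 spread_E7 (by decide +kernel) fun μ ν h h' => by
    have := norm_E8 h
    have := norm_E7 h'
    omega

theorem zeroFree_E8D6 : ZeroFree (dsum gramE8 (gramD 6)) :=
  zeroFree_dsum cartan_E8 cartan_D6 0 spread_E8 spread_D6 (by decide +kernel) fun μ ν h h' => by
    have := norm_E8 h
    have := norm_D6 h'
    omega

theorem zeroFree_E8D4 : ZeroFree (dsum gramE8 (gramD 4)) :=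
  zeroFree_dsum cartan_E8 cartan_D4 0 spread_E8 spread_D4 (by decide +kernel) fun μ ν h h' => by
    have := norm_E8 h
    have := norm_D4 h'
    omega

theorem zeroFree_E8A3 : ZeroFree (dsum gramE8 (gramA 3)) :=
  zeroFree_dsum cartan_E8 cartan_A3 0 spread_E8 spread_A3 (by decide +kernel) fun μ ν h h' => by
    have := norm_E8 h
    have := norm_A3 h'
    omega

theorem zeroFree_E8A2 : ZeroFree (dsum gramE8 (gramA 2)) :=
  zeroFree_dsum cartan_E8 cartan_A2 0 spread_E8 spread_A2 (by decide +kernel) fun μ ν h h' => by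
    have := norm_E8 h
    have := norm_A2 h'
    omega

theorem zeroFree_E6A2 : ZeroFree (dsum gramE6 (gramA 2)) :=
  zeroFree_dsum cartan_E6 cartan_A2 0 spread_E6 spread_A2 (by decide +kernel) fun μ ν h h' => by
    have := norm_E6 h
    have := norm_A2 h'
    omega

theorem zeroFree_D4A3 : ZeroFree (dsum (gramD 4) (gramA 3)) :=
  zeroFree_dsum cartan_D4 cartan_A3 0 spread_D4 spread_A3 (by decide +kernel) fun μ ν h h' => by
    have := norm_D4 h
    have := norm_A3 h'
    omega

theorem zeroFree_D5A2 : ZeroFree (dsum (gramD 5) (gramA 2)) :=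
  zeroFree_dsum cartan_D5 cartan_A2 0 spread_D5 spread_A2 (by decide +kernel) fun μ ν h h' => by
    have := norm_D5 h
    have := norm_A2 h'
    omega

theorem zeroFree_D4A2 : ZeroFree (dsum (gramD 4) (gramA 2)) :=
  zeroFree_dsum cartan_D4 cartan_A2 0 spread_D4 spread_A2 (by decide +kernel) fun μ ν h h' => by
    have := norm_D4 h
    have := norm_A2 h'
    omega

theorem zeroFree_A4A2 : ZeroFree (dsum (gramA 4) (gramA 2)) :=
  zeroFree_dsum cartan_A4 cartan_A2 0 spread_A4 spread_A2 (by decide +kernel) fun μ ν h h' => by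
    have := norm_A4 h
    have := norm_A2 h'
    omega

theorem zeroFree_A3A2 : ZeroFree (dsum (gramA 3) (gramA 2)) :=
  zeroFree_dsum cartan_A3 cartan_A2 0 spread_A3 spread_A2 (by decide +kernel) fun μ ν h h' => by
    have := norm_A3 h
    have := norm_A2 h'
    omega

end Cases

end Refl

namespace Refl

/-- For each of the 18 listed lattices K and S = U ⊕ K(−1), the lattice
U(m) ⊕ S is not 2-reflective for every positive integer m (no automorphic correction). -/
theorem no_automorphic_correction :
    ∀ m : ℕ, 0 < m →
      ¬ Is2Reflective (dsum ((m : ℤ) • U) (dsum U (-(dsum gramE8 gramE7)))) ∧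
      ¬ Is2Reflective (dsum ((m : ℤ) • U) (dsum U (-(dsum gramE8 (gramD 6))))) ∧
      ¬ Is2Reflective (dsum ((m : ℤ) • U) (dsum U (-(dsum gramE8 (dsum (gramD 4) (gramA 1)))))) ∧
      ¬ Is2Reflective (dsum ((m : ℤ) • U) (dsum U (-(dsum gramE8 (gramD 4))))) ∧
      ¬ Is2Reflective (dsum ((m : ℤ) • U) (dsum U (-(dsum (gramD 8) (gramD 4))))) ∧
      ¬ Is2Reflective (dsum ((m : ℤ) • U) (dsum U (-(dsum gramE8 (dsum (gramA 1) (dsum (gramA 1) (dsum (gramA 1) (gramA 1)))))))) ∧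
      ¬ Is2Reflective (dsum ((m : ℤ) • U) (dsum U (-(dsum gramE8 (dsum (gramA 1) (dsum (gramA 1) (gramA 1))))))) ∧
      ¬ Is2Reflective (dsum ((m : ℤ) • U) (dsum U (-(dsum (gramD 8) (dsum (gramA 1) (dsum (gramA 1) (gramA 1))))))) ∧
      ¬ Is2Reflective (dsum ((m : ℤ) • U) (dsum U (-(dsum gramE8 (gramA 3))))) ∧
      ¬ Is2Reflective (dsum ((m : ℤ) • U) (dsum U (-(dsum (gramD 8) (dsum (gramA 1) (gramA 1)))))) ∧
      ¬ Is2Reflective (dsum ((m : ℤ) • U) (dsum U (-(dsum (gramD 4) (dsum (gramD 4) (dsum (gramA 1) (gramA 1))))))) ∧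
      ¬ Is2Reflective (dsum ((m : ℤ) • U) (dsum U (-(dsum gramE8 (gramA 2))))) ∧
      ¬ Is2Reflective (dsum ((m : ℤ) • U) (dsum U (-(dsum gramE6 (gramA 2))))) ∧
      ¬ Is2Reflective (dsum ((m : ℤ) • U) (dsum U (-(dsum (gramD 4) (gramA 3))))) ∧
      ¬ Is2Reflective (dsum ((m : ℤ) • U) (dsum U (-(dsum (gramD 5) (gramA 2))))) ∧
      ¬ Is2Reflective (dsum ((m : ℤ) • U) (dsum U (-(dsum (gramD 4) (gramA 2))))) ∧
      ¬ Is2Reflective (dsum ((m : ℤ) • U) (dsum U (-(dsum (gramA 4) (gramA 2))))) ∧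
      ¬ Is2Reflective (dsum ((m : ℤ) • U) (dsum U (-(dsum (gramA 3) (gramA 2))))) := by
  intro m hm
  refine ⟨?_, ?_, ?_, ?_, ?_, ?_, ?_, ?_, ?_, ?_, ?_, ?_, ?_, ?_, ?_, ?_, ?_, ?_⟩
  · exact not_reflective_of_embeds (cartan_E8.dsum cartan_E7) 0 zeroFree_E8E7 (.refl _) hm
  · exact not_reflective_of_embeds (cartan_E8.dsum cartan_D6) 0 zeroFree_E8D6 (.refl _) hm
  · exact not_reflective_of_embeds cartan_E8D4A1 0 zeroFree_E8D4A1 (.refl _) hm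
  · exact not_reflective_of_embeds (cartan_E8.dsum cartan_D4) 0 zeroFree_E8D4 (.refl _) hm
  · exact not_reflective_of_embeds (cartan_E8.dsum cartan_D4) 0 zeroFree_E8D4 (embeds_D8_E8.dsum (.refl _)) hm
  · exact not_reflective_of_embeds (cartan_E8.dsum cartan_D4) 0 zeroFree_E8D4 (.dsum (.refl _) embeds_4A1_D4) hm
  · exact not_reflective_of_embeds cartan_E83A1 0 zeroFree_E83A1 (.refl _) hm
  · exact not_reflective_of_embeds cartan_E83A1 0 zeroFree_E83A1 (embeds_D8_E8.dsum (.refl _)) hm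
  · exact not_reflective_of_embeds (cartan_E8.dsum cartan_A3) 0 zeroFree_E8A3 (.refl _) hm
  · exact not_reflective_of_embeds cartan_D82A1 0 zeroFree_D82A1 (.refl _) hm
  · exact not_reflective_of_embeds cartan_D82A1 0 zeroFree_D82A1 embeds_2D4_D8 hm
  · exact not_reflective_of_embeds (cartan_E8.dsum cartan_A2) 0 zeroFree_E8A2 (.refl _) hm
  · exact not_reflective_of_embeds (cartan_E6.dsum cartan_A2) 0 zeroFree_E6A2 (.refl _) hm
  · exact not_reflective_of_embeds (cartan_D4.dsum cartan_A3) 0 zeroFree_D4A3 (.refl _) hm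
  · exact not_reflective_of_embeds (cartan_D5.dsum cartan_A2) 0 zeroFree_D5A2 (.refl _) hm
  · exact not_reflective_of_embeds (cartan_D4.dsum cartan_A2) 0 zeroFree_D4A2 (.refl _) hm
  · exact not_reflective_of_embeds (cartan_A4.dsum cartan_A2) 0 zeroFree_A4A2 (.refl _) hm
  · exact not_reflective_of_embeds (cartan_A3.dsum cartan_A2) 0 zeroFree_A3A2 (.refl _) hm

end Refl
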